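/- Let $C$ be a smooth non-hyperelliptic complex projective curve of genus $3$ with canonical bundle $\omega_C$, embedded in $\mathbb P^5=\mathbb PH^0(\omega_C^{\otimes 2})^*$ by $|\omega_C^{\otimes 2}|$ (here $\mathbb PW$ is the space of lines of $W$), and let $V\subset\mathbb P^5$ be the Veronese surface through $C$, that is, the image of $\mathbb PH^0(\omega_C)^*$ under $[\varphi]\mapsto[\psi]$ with $\psi(st)=\varphi(s)\varphi(t)$ for $s,t\in H^0(\omega_C)$. Let $E$ be a stable, globally generated vector bundle of rank two on $C$ with $\det E\cong\omega_C^{\otimes 2}$, and let $F=\overline E$ be its dual span, i.e. the dual of the kernel of the evaluation map $H^0(E)\otimes\mathcal O_C\to E$. Assume that $\iota([E])=[E_o]$, where $\iota([E])=[\overline E]$ and $E_o=\omega_C\oplus\omega_C$; i.e. $F$ is semistable and S-equivalent to $\omega_C\oplus\omega_C$. For $x\in C$ let $R_x=\mathbb PE_x^*\subset\mathbb PH^0(E)^*$, and let $R=\bigcup_{x\in C}R_x$ be the tautological scroll of $E$. Let $G=\gamma([E])\subset\mathbb P^5$ be the Plücker quadric of lines of $\mathbb PH^0(E)^*$, i.e.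 the zero locus of the pull-back of the quadratic form $\beta\mapsto\beta\wedge\beta$ on $\wedge^2H^0(E)^*$ by the transpose of the determinant map $\wedge^2H^0(E)\to H^0(\omega_C^{\otimes 2})$. Then: 1. $F$ fits in an exact sequence $0\to\omega_C\to F\to\omega_C\to0$. 2. $h^0(E)=4$, so that $\mathbb PH^0(E)^*=\mathbb P^3$; the quadric $G$ has rank six and contains $V$; $V$ is a Veronese surface containing $C$, and each $x\in C\subset G$ parametrizes the line $R_x$. 3. There is a rational normal cubic $\Gamma\subset\mathbb P^3$ such that the points of $V\subset G$ parametrize, bijectively, the bisecant lines of $\Gamma$ (tangent lines included). 4. For each $o\in\Gamma$ the generators of the cone over $\Gamma$ with vertex $o$ are parametrized by a smooth conic $B\subset V$. The intersection divisor $b_o=B\cdot C$ is a canonical divisor of $C$ (of degree four). It parametrizes, with multiplicity, the four lines of $R$ through $o$: the points of its support are the $x\in C$ with $o\in R_x$, and $b_o=p_*n^*o$, where $n:\mathbb P(E)\to\mathbb P^3$ is the tautological map and $p:\mathbb P(E)\to C$ the projection. 5. The surface $R$ has multiplicity four at every point of $\Gamma$. -/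

import Mathlib

/-!
A smooth complex projective curve `C` is given by its function field `K`: the points of `C` are
the places of `K`, the local ring at a point is the valuation ring of the place, and the
non-empty open sets are the complements of finite sets of points.
An algebraic vector bundle on `C` is given by its generic fibre `V` (a finite dimensional vector
space over `K`) together with its stalks, which form a family of lattices in `V`.
-/

open scoped TensorProduct LinearAlgebra.Projectivization

noncomputable section

namespace OcticScroll

/-! ### The curve -/

/-- `K` is the function field of a smooth projective curve over `ℂ`: a finitely generated field
extension of `ℂ` of transcendence degree one. -/
structure IsCurveFunctionField (K : Type*) [Field K] [Algebra ℂ K] : Prop where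
  fg : (⊤ : IntermediateField ℂ K).FG
  trdeg_eq_one : Algebra.trdeg ℂ K = 1

/-- A point of the smooth projective curve with function field `K`, given by its local ring:
a valuation ring of `K` which contains `ℂ` and is not the whole of `K`. -/
structure Point (K : Type*) [Field K] [Algebra ℂ K] where
  /-- the local ring at the point -/
  O : ValuationSubring K
  algebraMap_mem : ∀ c : ℂ, algebraMap ℂ K c ∈ O
  ne_top : O ≠ ⊤

/-- The curve is hyperelliptic (for genus at least two): it has a morphism of degree two to the
projective line, that is, `K` has degree two over `ℂ(f)` for some non-constant `f`. -/
def IsHyperelliptic (K : Type*) [Field K] [Algebra ℂ K] : Prop :=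
  ∃ f : K, Transcendental ℂ f ∧ Module.finrank (IntermediateField.adjoin ℂ {f}) K = 2

/-! ### Vector bundles -/

/-- The length of the `R`-module `M / (M ∩ N)`, for two submodules `M`, `N` of one module. -/
def colength {R V : Type*} [Ring R] [AddCommGroup V] [Module R V] (M N : Submodule R V) : ℕ∞ :=
  Module.length R (M ⧸ N.submoduleOf M)

/-- A subsheaf of `𝒪_C`-modules, given by its stalks, of the constant sheaf `V`. -/
structure Family (K : Type*) [Field K] [Algebra ℂ K] (V : Type*) [AddCommGroup V]
    [Module K V] where
  /-- the stalk at a point -/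
  stalk : ∀ P : Point K, Submodule P.O V

namespace Family

variable {K : Type*} [Field K] [Algebra ℂ K]
variable {V : Type*} [AddCommGroup V] [Module K V]
variable {W : Type*} [AddCommGroup W] [Module K W]
variable {X : Type*} [AddCommGroup X] [Module K X]

/-- The family consists of the stalks of a vector bundle of rank `r` with generic fibre `V`: each
stalk is a lattice in `V`, and all but finitely many stalks are generated by one and the same
basis of `V`. -/
structure IsVectorBundle (E : Family K V) (r : ℕ) : Prop where
  fg : ∀ P, (E.stalk P).FG
  span_eq_top : ∀ P, Submodule.span K (E.stalk P : Set V) = ⊤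
  generic : ∃ b : Module.Basis (Fin r) K V,
    {P : Point K | E.stalk P ≠ Submodule.span P.O (Set.range b)}.Finite

/-- An isomorphism of vector bundles. -/
structure Iso (E : Family K V) (F : Family K W) where
  /-- the isomorphism of the generic fibres -/
  toEquiv : V ≃ₗ[K] W
  mem_iff : ∀ (P : Point K) (v : V), toEquiv v ∈ F.stalk P ↔ v ∈ E.stalk P

/-- There is an exact sequence of vector bundles `0 → L → E → M → 0`. -/
def IsExtension (L : Family K W) (E : Family K V) (M : Family K X) : Prop :=
  ∃ (i : W →ₗ[K] V) (p : V →ₗ[K] X),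
    Function.Injective i ∧ Function.Exact i p ∧ Function.Surjective p ∧
    ∀ P : Point K, L.stalk P = (E.stalk P).comap (i.restrictScalars P.O) ∧
      M.stalk P = (E.stalk P).map (p.restrictScalars P.O)

/-- The subbundle of `E` with generic fibre `U`. -/
def sub (E : Family K V) (U : Submodule K V) : Family K U where
  stalk P := (E.stalk P).comap (U.subtype.restrictScalars P.O)

/-- The quotient of `E` by its subbundle with generic fibre `U`. -/
def quot (E : Family K V) (U : Submodule K V) : Family K (V ⧸ U) where
  stalk P := (E.stalk P).map (U.mkQ.restrictScalars P.O)

/-- The direct sum `E ⊕ F`. -/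
def directSum (E : Family K V) (F : Family K W) : Family K (V × W) where
  stalk P := (E.stalk P).prod (F.stalk P)

/-- The tensor product `E ⊗ F`. -/
def tensor (E : Family K V) (F : Family K W) : Family K (V ⊗[K] W) where
  stalk P := Submodule.span P.O {x | ∃ v ∈ E.stalk P, ∃ w ∈ F.stalk P, x = v ⊗ₜ[K] w}

/-- The determinant `⋀² E` of a bundle of rank two. -/
def det (E : Family K V) : Family K (⋀[K]^2 V) where
  stalk P := Submodule.span P.O
    {x | ∃ v ∈ E.stalk P, ∃ w ∈ E.stalk P, x = exteriorPower.ιMulti K 2 ![v, w]}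

/-- The dual bundle `E* = Hom(E, 𝒪_C)`. -/
def dual (E : Family K V) : Family K (Module.Dual K V) where
  stalk P :=
    { carrier := {φ | ∀ v ∈ E.stalk P, φ v ∈ P.O}
      add_mem' := fun ha hb v hv => P.O.add_mem _ _ (ha v hv) (hb v hv)
      zero_mem' := fun _ _ => P.O.zero_mem
      smul_mem' := fun c _ ha v hv => P.O.mul_mem _ _ c.2 (ha v hv) }

/-- The trivial bundle `H ⊗ 𝒪_C`, for a complex vector space `H`. -/
def trivial (K : Type*) [Field K] [Algebra ℂ K] (H : Type*) [AddCommGroup H] [Module ℂ H] :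
    Family K (K ⊗[ℂ] H) where
  stalk P := Submodule.span P.O (Set.range fun h : H => (1 : K) ⊗ₜ[ℂ] h)

/-! ### Degree, stability, S-equivalence -/

/-- The order at `P` of a non-zero rational section `s` of a line bundle `L`. -/
def ord (L : Family K V) (s : V) (P : Point K) : ℤ :=
  ((colength (L.stalk P) (Submodule.span P.O {s})).toNat : ℤ) -
    ((colength (Submodule.span P.O {s}) (L.stalk P)).toNat : ℤ)

open scoped Classical in
/-- The degree of a line bundle `L`: the degree of the divisor of a non-zero rational section. -/
def lineDegree (L : Family K V) : ℤ :=
  if h : ∃ s : V, s ≠ 0 then ∑ᶠ P : Point K, L.ord h.choose P else 0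

/-- The degree of a bundle of rank two. -/
def degree (E : Family K V) : ℤ := E.det.lineDegree

/-- A bundle `E` of rank two is stable: `deg L < deg E / 2` for each line subbundle `L`. -/
def IsStable (E : Family K V) : Prop :=
  ∀ ℓ : Submodule K V, Module.finrank K ℓ = 1 → 2 * (E.sub ℓ).lineDegree < E.degree

/-- A bundle `E` of rank two is semistable: `deg L ≤ deg E / 2` for each line subbundle `L`. -/
def IsSemistable (E : Family K V) : Prop :=
  ∀ ℓ : Submodule K V, Module.finrank K ℓ = 1 → 2 * (E.sub ℓ).lineDegree ≤ E.degree

/-- The line subbundle with generic fibre `ℓ` defines a Jordan-Hölder filtration of the strictly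
semistable bundle `E` of rank two. -/
def IsJordanHolder (E : Family K V) (ℓ : Submodule K V) : Prop :=
  Module.finrank K ℓ = 1 ∧ 2 * (E.sub ℓ).lineDegree = E.degree

/-- S-equivalence of semistable bundles of rank two, i.e. equality `[E] = [F]` of their points in
the moduli space: the graded bundles of Jordan-Hölder filtrations of `E` and `F` are isomorphic. -/
def SEquiv (E : Family K V) (F : Family K W) : Prop :=
  E.IsSemistable ∧ F.IsSemistable ∧
    ((E.IsStable ∧ F.IsStable ∧ Nonempty (E.Iso F)) ∨
      ∃ (ℓ : Submodule K V) (m : Submodule K W), E.IsJordanHolder ℓ ∧ F.IsJordanHolder m ∧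
        Nonempty (((E.sub ℓ).directSum (E.quot ℓ)).Iso ((F.sub m).directSum (F.quot m))))

/-! ### Global sections -/

variable [Module ℂ V] [IsScalarTower ℂ K V]

/-- The complex vector space `H⁰(E)` of global sections. -/
def H0 (E : Family K V) : Submodule ℂ V where
  carrier := {v | ∀ P, v ∈ E.stalk P}
  add_mem' ha hb P := add_mem (ha P) (hb P)
  zero_mem' P := zero_mem _
  smul_mem' c v hv P := by
    have h := (E.stalk P).smul_mem ⟨algebraMap ℂ K c, P.algebraMap_mem c⟩ (hv P)
    rwa [← algebraMap_smul K c v]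

/-- `E` is globally generated. -/
def IsGloballyGenerated (E : Family K V) : Prop :=
  ∀ P : Point K, Submodule.span P.O (E.H0 : Set V) = E.stalk P

/-- The dual span `Ē` of `E`: the dual of the kernel of the evaluation `H⁰(E) ⊗ 𝒪_C → E`. -/
def dualSpan (E : Family K V) :
    Family K (Module.Dual K (LinearMap.ker (LinearMap.liftBaseChange K E.H0.subtype))) :=
  ((trivial K E.H0).sub (LinearMap.ker (LinearMap.liftBaseChange K E.H0.subtype))).dual

/-- The image of the dual `E_x*` of the fibre in `H⁰(E)*` under the transpose of the evaluation
`H⁰(E) → E_x`: the linear forms on `H⁰(E)` which vanish on the sections vanishing at `x`.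
If `E` has rank two, its projectivization is the line `R_x` of the scroll; if `E` is a line bundle
it is the image of `x` under the map defined by `|E|`. -/
def fibreDual (E : Family K V) (x : Point K) : Submodule ℂ (Module.Dual ℂ E.H0) where
  carrier := {φ | ∀ s : E.H0, (s : V) ∈ IsLocalRing.maximalIdeal x.O • E.stalk x → φ s = 0}
  add_mem' ha hb s hs := by simp [ha s hs, hb s hs]
  zero_mem' _ _ := rfl
  smul_mem' c φ hφ s hs := by simp [hφ s hs]

/-- The tautological scroll `R = ⋃ R_x` in `ℙH⁰(E)*`. -/
def scroll (E : Family K V) : Set (ℙ ℂ (Module.Dual ℂ E.H0)) :=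
  {z | ∃ x : Point K, z.submodule ≤ E.fibreDual x}

/-- The multiplicity at `x` of the divisor `p_* n^* o` on `C`, where `o = [φ]` is a point of
`ℙH⁰(E)*`, `n : ℙ(E) → ℙH⁰(E)*` is the tautological map and `p : ℙ(E) → C` the projection: the
scheme `n⁻¹(o)` is `ℙ(𝒬)`, for the cokernel `𝒬` of the evaluation `ker φ ⊗ 𝒪_C → E`. -/
def rulingMult (E : Family K V) (φ : Module.Dual ℂ E.H0) (x : Point K) : ℕ∞ :=
  colength (E.stalk x)
    (Submodule.span x.O (((LinearMap.ker φ).map E.H0.subtype : Submodule ℂ V) : Set V))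

/-- The ideal in the local ring at `x` of the intersection of `C`, mapped to `ℙH⁰(L)*` by the
complete linear system of the line bundle `L`, with a subset `Z`. It is generated by the
homogeneous forms on `H⁰(L)*` vanishing on `Z`, restricted to `C`, in terms of a generator `e` of
the stalk of `L`. The variables of the forms are the elements of `H⁰(L)`. -/
def interIdeal (L : Family K V) (Z : Set (ℙ ℂ (Module.Dual ℂ L.H0))) (x : Point K) :
    Ideal x.O :=
  Ideal.span {g | ∃ (e : V) (c : L.H0 → K) (d : ℕ) (F : MvPolynomial L.H0 ℂ),
    L.stalk x = Submodule.span x.O {e} ∧ (∀ s : L.H0, (s : V) = c s • e) ∧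
    F.IsHomogeneous d ∧ (∀ z ∈ Z, MvPolynomial.eval (fun s => z.rep s) F = 0) ∧
    (g : K) = MvPolynomial.aeval c F}

/-- The multiplicity at `x` of the intersection of `C` and `Z` in `ℙH⁰(L)*`. -/
def interMult (L : Family K V) (Z : Set (ℙ ℂ (Module.Dual ℂ L.H0))) (x : Point K) : ℕ∞ :=
  Module.length x.O (x.O ⧸ L.interIdeal Z x)

end Family

/-! ### The canonical bundle -/

/-- The canonical bundle `ω_C`: its stalk at `P` is generated by the differentials of the functions
that are regular at `P`. -/
def omega (K : Type*) [Field K] [Algebra ℂ K] : Family K (Ω[K⁄ℂ]) where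
  stalk P := Submodule.span P.O {η | ∃ f ∈ P.O, η = KaehlerDifferential.D ℂ K f}

/-- The bundle `ω_C ⊗ ω_C`. -/
def omega2 (K : Type*) [Field K] [Algebra ℂ K] : Family K (Ω[K⁄ℂ] ⊗[K] Ω[K⁄ℂ]) :=
  (omega K).tensor (omega K)

/-- The genus `h⁰(ω_C)` of the curve. -/
def genus (K : Type*) [Field K] [Algebra ℂ K] : ℕ := Module.finrank ℂ (omega K).H0

/-- The effective divisor `D` is canonical: it is the divisor of a non-zero section of `ω_C`. -/
def IsCanonicalDivisor {K : Type*} [Field K] [Algebra ℂ K] (D : Point K →₀ ℕ) : Prop :=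
  ∃ s ∈ (omega K).H0, s ≠ 0 ∧
    ∀ P : Point K, colength ((omega K).stalk P) (Submodule.span P.O {s}) = (D P : ℕ∞)

/-- The product of two sections of `ω_C`. -/
def mulSection {K : Type*} [Field K] [Algebra ℂ K] (s t : (omega K).H0) : (omega2 K).H0 :=
  ⟨(s : Ω[K⁄ℂ]) ⊗ₜ[K] (t : Ω[K⁄ℂ]),
    fun P => Submodule.subset_span ⟨s, s.2 P, t, t.2 P, rfl⟩⟩

/-! ### Projective geometry -/

/-- `Z` is a Veronese surface in a five-dimensional projective space. -/
def IsVeroneseSurface {M : Type*} [AddCommGroup M] [Module ℂ M] (Z : Set (ℙ ℂ M)) : Prop :=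
  ∃ w : Module.Basis (Sym2 (Fin 3)) ℂ M, Z = {z | ∃ a : Fin 3 → ℂ, a ≠ 0 ∧
    z.submodule = Submodule.span ℂ {∑ p : Sym2 (Fin 3), (p.map a).mul • w p}}

/-- `Z` is a smooth plane conic in a projective space. -/
def IsConic {M : Type*} [AddCommGroup M] [Module ℂ M] (Z : Set (ℙ ℂ M)) : Prop :=
  ∃ w : Fin 3 → M, LinearIndependent ℂ w ∧ Z = {z | ∃ a : Fin 2 → ℂ, a ≠ 0 ∧
    z.submodule = Submodule.span ℂ {a 0 ^ 2 • w 0 + (a 0 * a 1) • w 1 + a 1 ^ 2 • w 2}}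

section Cubic

variable {M : Type*} [AddCommGroup M] [Module ℂ M] (w : Module.Basis (Fin 4) ℂ M)

/-- The parametrization of the rational normal cubic defined by the basis `w`. -/
def cubicPoint (a : Fin 2 → ℂ) : M :=
  a 0 ^ 3 • w 0 + (a 0 ^ 2 * a 1) • w 1 + (a 0 * a 1 ^ 2) • w 2 + a 1 ^ 3 • w 3

/-- The rational normal cubic in a three-dimensional projective space defined by the basis `w`. -/
def ratNormalCubic : Set (ℙ ℂ M) :=
  {z | ∃ a : Fin 2 → ℂ, a ≠ 0 ∧ z.submodule = Submodule.span ℂ {cubicPoint w a}}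

/-- The tangent line of the rational normal cubic at the point with parameter `a`, spanned by the
two partial derivatives of the parametrization. -/
def cubicTangent (a : Fin 2 → ℂ) : Submodule ℂ M :=
  Submodule.span ℂ
    {(3 * a 0 ^ 2) • w 0 + (2 * a 0 * a 1) • w 1 + a 1 ^ 2 • w 2,
      a 0 ^ 2 • w 1 + (2 * a 0 * a 1) • w 2 + (3 * a 1 ^ 2) • w 3}

/-- The line `ℓ` is a generator of the cone over the rational normal cubic with vertex its point
`o`: it joins `o` to another point of the curve, or is the tangent line at `o`. -/
def IsConeGenerator (o : ℙ ℂ M) (ℓ : Submodule ℂ M) : Prop :=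
  ∃ a : Fin 2 → ℂ, a ≠ 0 ∧ o.submodule = Submodule.span ℂ {cubicPoint w a} ∧
    ((∃ b : Fin 2 → ℂ, LinearIndependent ℂ ![a, b] ∧
      ℓ = Submodule.span ℂ {cubicPoint w a, cubicPoint w b}) ∨ ℓ = cubicTangent w a)

/-- The line `ℓ` is bisecant to the rational normal cubic: it joins two points of the curve, or it
is a tangent line. -/
def IsBisecant (ℓ : Submodule ℂ M) : Prop :=
  ∃ o ∈ ratNormalCubic w, IsConeGenerator w o ℓ

/-- The subset `Z` of a three-dimensional projective space is a surface, and `m` is its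
multiplicity at the point `o = [v]`: the homogeneous ideal of `Z` has one generator `F`, and the lowest
non-zero homogeneous part of the expansion of `F` at `v` has degree `m`.
Coordinates are taken with respect to the basis `w`. -/
def HasMultiplicity (Z : Set (ℙ ℂ M)) (o : ℙ ℂ M) (m : ℕ) : Prop :=
  ∃ F : MvPolynomial (Fin 4) ℂ,
    MvPolynomial.vanishingIdeal ℂ {x : Fin 4 → ℂ |
      ∃ h : w.equivFun.symm x ≠ 0, Projectivization.mk ℂ (w.equivFun.symm x) h ∈ Z} =
        Ideal.span {F} ∧
    (∀ i < m, MvPolynomial.homogeneousComponent i (MvPolynomial.bind₁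
      (fun j => MvPolynomial.X j + MvPolynomial.C (w.equivFun o.rep j)) F) = 0) ∧
    MvPolynomial.homogeneousComponent m (MvPolynomial.bind₁
      (fun j => MvPolynomial.X j + MvPolynomial.C (w.equivFun o.rep j)) F) ≠ 0

end Cubic

/-- The rank of a quadratic form. -/
def quadricRank {M : Type*} [AddCommGroup M] [Module ℂ M] (q : QuadraticForm ℂ M) : ℕ :=
  Module.finrank ℂ (LinearMap.range q.polarBilin)

/-- The Veronese surface through the bicanonical curve: the image of `ℙH⁰(ω_C)*` in `ℙH⁰(ω_C²)*`
under `[φ] ↦ [ψ]` with `ψ(s t) = φ(s) φ(t)` for all sections `s`, `t` of `ω_C`. -/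
def veronese (K : Type*) [Field K] [Algebra ℂ K] :
    Set (ℙ ℂ (Module.Dual ℂ (omega2 K).H0)) :=
  {z | ∃ φ : Module.Dual ℂ (omega K).H0, φ ≠ 0 ∧
    ∀ s t : (omega K).H0, z.rep (mulSection s t) = φ s * φ t}

/-! ### The Plücker quadric -/

section Pluecker

variable {K : Type*} [Field K] [Algebra ℂ K]
variable {V : Type*} [AddCommGroup V] [Module K V] [Module ℂ V] [IsScalarTower ℂ K V]
variable {E : Family K V}

/-- The wedge product of two vectors, as a bilinear map. -/
def wedge (K V : Type*) [Field K] [AddCommGroup V] [Module K V] :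
    V →ₗ[K] V →ₗ[K] ⋀[K]^2 V :=
  LinearMap.mk₂ K (fun v w => exteriorPower.ιMulti K 2 ![v, w])
    (fun a b c => AlternatingMap.map_vecCons_add _ ![c] a b)
    (fun r a c => AlternatingMap.map_vecCons_smul _ ![c] r a)
    (fun a b c => by
      have h := (exteriorPower.ιMulti K 2 (M := V)).map_update_add ![a, b] 1 b c
      have e : ∀ x : V, Function.update ![a, b] 1 x = ![a, x] := fun x => by
        ext i; fin_cases i <;> simp
      rwa [e, e, e] at h)
    (fun r a c => by
      have h := (exteriorPower.ιMulti K 2 (M := V)).map_update_smul ![a, c] 1 r c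
      have e : ∀ x : V, Function.update ![a, c] 1 x = ![a, x] := fun x => by
        ext i; fin_cases i <;> simp
      rwa [e, e] at h)

/-- The determinant map `H⁰(E) × H⁰(E) → H⁰(ω_C²)`, for an isomorphism `δ : det E ≅ ω_C²`. -/
def detMap (δ : E.det.Iso (omega2 K)) : E.H0 →ₗ[ℂ] E.H0 →ₗ[ℂ] (omega2 K).H0 :=
  LinearMap.mk₂ ℂ
    (fun s t => ⟨δ.toEquiv (wedge K V s t), fun P => (δ.mem_iff P _).2
      (Submodule.subset_span ⟨s, s.2 P, t, t.2 P, rfl⟩)⟩)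
    (fun a b c => by ext; simp)
    (fun r a c => by
      ext
      simp only [Submodule.coe_smul]
      rw [← algebraMap_smul K r (a : V), map_smul, LinearMap.smul_apply, map_smul,
        algebraMap_smul])
    (fun a b c => by ext; simp)
    (fun r a c => by
      ext
      simp only [Submodule.coe_smul]
      rw [← algebraMap_smul K r (c : V), map_smul, map_smul, algebraMap_smul])

/-- The linear form `ψ ↦ ψ(det(s, t))` on `H⁰(ω_C²)*`. -/
def pluckerCoord (δ : E.det.Iso (omega2 K)) (s t : E.H0) :
    Module.Dual ℂ (omega2 K).H0 →ₗ[ℂ] ℂ :=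
  Module.Dual.eval ℂ (omega2 K).H0 (detMap δ s t)

/-- The equation of the Plücker quadric `G` in `ℙH⁰(ω_C²)*`: the pull-back, by the transpose
`H⁰(ω_C²)* → ⋀² H⁰(E)*` of the determinant map, of the quadratic form `β ↦ β ∧ β` with values in
`⋀⁴ H⁰(E)*` (divided by two, in the coordinates given by a basis `b` of `H⁰(E)`). -/
def pluckerQuadric (δ : E.det.Iso (omega2 K)) (b : Module.Basis (Fin 4) ℂ E.H0) :
    QuadraticForm ℂ (Module.Dual ℂ (omega2 K).H0) :=
  QuadraticMap.linMulLin (pluckerCoord δ (b 0) (b 1)) (pluckerCoord δ (b 2) (b 3)) -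
    QuadraticMap.linMulLin (pluckerCoord δ (b 0) (b 2)) (pluckerCoord δ (b 1) (b 3)) +
    QuadraticMap.linMulLin (pluckerCoord δ (b 0) (b 3)) (pluckerCoord δ (b 1) (b 2))

/-- The line of `ℙH⁰(E)*` parametrized by a point `z = [ψ]` of the Plücker quadric: if the
alternating form `(s, t) ↦ ψ(det(s, t))` on `H⁰(E)` is `φ₁ ∧ φ₂`, it is the span of `φ₁`, `φ₂`. -/
def lineOf (δ : E.det.Iso (omega2 K)) (z : ℙ ℂ (Module.Dual ℂ (omega2 K).H0)) :
    Submodule ℂ (Module.Dual ℂ E.H0) :=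
  LinearMap.range ((detMap δ).compr₂ z.rep)

end Pluecker

end OcticScroll

end

open OcticScroll

open scoped Polynomial nonZeroDivisors
open IsDedekindDomain

noncomputable section

set_option linter.unusedSectionVars false

namespace OcticScroll

/-! ### Affine charts of the curve -/

section Field

variable {K : Type*} [Field K] [Algebra ℂ K]

theorem transcendental_of_forall_ne {x : K} (h : ∀ c : ℂ, algebraMap ℂ K c ≠ x) :
    Transcendental ℂ x := by
  intro hx
  have := (IntermediateField.isAlgebraic_adjoin_simple hx.isIntegral)
  have h2 := IntermediateField.eq_bot_of_isAlgClosed_of_isAlgebraic (IntermediateField.adjoin ℂ {x})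
  have h3 : x ∈ (⊥ : IntermediateField ℂ K) := h2 ▸ IntermediateField.mem_adjoin_simple_self ℂ x
  obtain ⟨c, hc⟩ := IntermediateField.mem_bot.1 h3
  exact h c hc

theorem finiteDimensional_adjoin (hK : IsCurveFunctionField K) {x : K} (hx : Transcendental ℂ x) :
    FiniteDimensional (IntermediateField.adjoin ℂ {x}) K := by
  have h1 : AlgebraicIndependent ℂ (fun _ : Fin 1 => x) := by
    rw [algebraicIndependent_unique_type_iff]; exact hx
  have h2 := (h1.isTranscendenceBasis_of_lift_trdeg_le_of_finite (by simp [hK.trdeg_eq_one])).isAlgebraic_field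
  rw [Set.range_const] at h2
  obtain ⟨s, hs⟩ := hK.fg
  have h3 : IntermediateField.adjoin (IntermediateField.adjoin ℂ {x}) (s : Set K) = ⊤ := by
    rw [← IntermediateField.restrictScalars_eq_top_iff (K := ℂ), eq_top_iff, ← hs, IntermediateField.adjoin_le_iff]
    exact IntermediateField.subset_adjoin _ _
  have := IntermediateField.finiteDimensional_adjoin (K := IntermediateField.adjoin ℂ {x}) (S := (s : Set K)) (L := K)
    (fun a _ => Algebra.IsIntegral.isIntegral a)
  rw [h3] at this
  exact IntermediateField.topEquiv.toLinearEquiv.finiteDimensional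

end Field

section Chart

variable {K : Type*} [Field K] [Algebra ℂ K] [Algebra ℂ[X] K] [IsScalarTower ℂ ℂ[X] K]

variable (K) in
/-- The ring of functions of the affine chart. -/
abbrev ChartRing : Type _ := integralClosure ℂ[X] K

theorem charZero_of_isFractionRing (k : Type*) [Field k] [Algebra ℂ[X] k] [IsFractionRing ℂ[X] k] :
    CharZero k :=
  charZero_of_injective_algebraMap (R := ℂ[X]) (IsFractionRing.injective ℂ[X] k)

variable (K) in
theorem chart_isDedekind (k : Type*) [Field k] [Algebra ℂ[X] k] [IsFractionRing ℂ[X] k] [Algebra k K]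
    [IsScalarTower ℂ[X] k K] [FiniteDimensional k K] : IsDedekindDomain (ChartRing K) := by
  have := charZero_of_isFractionRing k
  exact integralClosure.isDedekindDomain ℂ[X] k K

variable (K) in
theorem chart_isFractionRing (k : Type*) [Field k] [Algebra ℂ[X] k] [IsFractionRing ℂ[X] k] [Algebra k K]
    [IsScalarTower ℂ[X] k K] [FiniteDimensional k K] : IsFractionRing (ChartRing K) K :=
  integralClosure.isFractionRing_of_finite_extension k K

variable (K) in
theorem chart_finite (k : Type*) [Field k] [Algebra ℂ[X] k] [IsFractionRing ℂ[X] k] [Algebra k K]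
    [IsScalarTower ℂ[X] k K] [FiniteDimensional k K] : Module.Finite ℂ[X] (ChartRing K) := by
  have := charZero_of_isFractionRing k
  exact IsIntegralClosure.finite ℂ[X] k K _

theorem Point.integral_mem {P : Point K} (hx : algebraMap ℂ[X] K Polynomial.X ∈ P.O) {z : K}
    (hz : IsIntegral ℂ[X] z) : z ∈ P.O := by
  have h0 : ∀ p : ℂ[X], algebraMap ℂ[X] K p ∈ P.O := by
    intro p
    induction p using Polynomial.induction_on' with
    | add p q hp hq => rw [map_add]; exact add_mem hp hq
    | monomial n a =>
      rw [← Polynomial.C_mul_X_pow_eq_monomial, map_mul, map_pow]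
      refine mul_mem ?_ (pow_mem hx n)
      rw [← Polynomial.algebraMap_eq, ← IsScalarTower.algebraMap_apply]
      exact P.algebraMap_mem a
  let f : ℂ[X] →+* P.O := (algebraMap ℂ[X] K).codRestrict P.O.toSubring h0
  have h1 : IsIntegral P.O z := by
    obtain ⟨p, hp, hp2⟩ := hz
    refine ⟨p.map f, hp.map f, ?_⟩
    rw [Polynomial.eval₂_map]
    exact hp2
  obtain ⟨y, hy⟩ := IsIntegrallyClosed.isIntegral_iff.1 h1
  rw [← hy]; exact y.2

variable [IsDedekindDomain (ChartRing K)] [IsFractionRing (ChartRing K) K]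

theorem Point.exists_heightOneSpectrum (P : Point K) (hx : algebraMap ℂ[X] K Polynomial.X ∈ P.O) :
    ∃ v : HeightOneSpectrum (ChartRing K), ∀ z : K, z ∈ P.O ↔ v.valuation K z ≤ 1 := by
  let i : ChartRing K →+* P.O :=
    (algebraMap (ChartRing K) K).codRestrict P.O.toSubring fun z => Point.integral_mem hx z.2
  have hi : ∀ a, ((i a : P.O) : K) = algebraMap (ChartRing K) K a := fun a => rfl
  have hne : (IsLocalRing.maximalIdeal P.O).comap i ≠ ⊥ := by
    intro h
    apply P.ne_top
    rw [eq_top_iff]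
    rintro z -
    obtain ⟨a, b, hb, rfl⟩ := IsFractionRing.div_surjective (A := ChartRing K) z
    have hb0 : b ≠ 0 := nonZeroDivisors.ne_zero hb
    have hu : IsUnit (i b) := by
      by_contra hcon
      have : b ∈ (IsLocalRing.maximalIdeal P.O).comap i := hcon
      rw [h] at this
      exact hb0 this
    obtain ⟨c, hc⟩ := hu.exists_right_inv
    have : algebraMap (ChartRing K) K a / algebraMap (ChartRing K) K b = ((i a * c : P.O) : K) := by
      have h1 : algebraMap (ChartRing K) K b * (c : K) = 1 := by
        rw [← hi]; exact_mod_cast congrArg Subtype.val hc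
      have h2 : algebraMap (ChartRing K) K b ≠ 0 := left_ne_zero_of_mul_eq_one h1
      rw [div_eq_iff h2]
      push_cast
      rw [hi, mul_assoc, mul_comm (c : K), h1, mul_one]
    rw [this]; exact (i a * c).2
  let v : HeightOneSpectrum (ChartRing K) := ⟨_, Ideal.comap_isPrime i _, hne⟩
  have key : (v.valuation K).valuationSubring ≤ P.O := by
    intro z hz
    obtain ⟨a, b, hab⟩ := HeightOneSpectrum.exists_primeCompl_mul_eq_of_integer v z hz
    have hu : IsUnit (i b) := by
      by_contra hcon
      exact b.2 hcon
    obtain ⟨c, hc⟩ := hu.exists_right_inv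
    have h1 : algebraMap (ChartRing K) K b * (c : K) = 1 := by
      rw [← hi]; exact_mod_cast congrArg Subtype.val hc
    have : z = ((i a * c : P.O) : K) := by
      push_cast
      rw [hi, ← hab, mul_assoc, h1, mul_one]
    rw [this]; exact (i a * c).2
  rw [← HeightOneSpectrum.valuationSubringAtPrime_eq_valuationSubring] at key
  refine ⟨v, fun z => ?_⟩
  rw [← ValuationSubring.eq_of_le_of_ne_top _ key P.ne_top,
    HeightOneSpectrum.valuationSubringAtPrime_eq_valuationSubring]
  rfl

theorem exists_point_of_heightOneSpectrum (v : HeightOneSpectrum (ChartRing K)) :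
    ∃ P : Point K, algebraMap ℂ[X] K Polynomial.X ∈ P.O ∧ ∀ z : K, z ∈ P.O ↔ v.valuation K z ≤ 1 := by
  have h0 : ∀ p : ℂ[X], v.valuation K (algebraMap ℂ[X] K p) ≤ 1 := fun p => by
    rw [IsScalarTower.algebraMap_apply ℂ[X] (ChartRing K) K]
    exact v.valuation_le_one _
  refine ⟨⟨(v.valuation K).valuationSubring, fun c => ?_, fun h => ?_⟩, ?_, fun z => Iff.rfl⟩
  · rw [IsScalarTower.algebraMap_apply ℂ ℂ[X] K]
    exact h0 _
  · obtain ⟨z, hz⟩ := v.valuation_surjective K (WithZero.exp 1)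
    have : z ∈ (v.valuation K).valuationSubring := by rw [h]; trivial
    rw [Valuation.mem_valuationSubring_iff, hz] at this
    exact absurd this (by rw [← WithZero.exp_zero, WithZero.exp_le_exp]; decide)
  · exact h0 _

end Chart

section Setup

variable {K : Type*} [Field K] [Algebra ℂ K]

theorem chart_induction (hK : IsCurveFunctionField K) {x : K} (hx : Transcendental ℂ x)
    {motive : Prop}
    (h : ∀ [Algebra ℂ[X] K] [IsScalarTower ℂ ℂ[X] K]
      [Algebra ℂ[X] (IntermediateField.adjoin ℂ {x})]
      [IsFractionRing ℂ[X] (IntermediateField.adjoin ℂ {x})]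
      [IsScalarTower ℂ[X] (IntermediateField.adjoin ℂ {x}) K]
      [FiniteDimensional (IntermediateField.adjoin ℂ {x}) K]
      [IsDedekindDomain (ChartRing K)] [IsFractionRing (ChartRing K) K]
      [Module.Finite ℂ[X] (ChartRing K)],
      (∀ p : ℂ[X], algebraMap ℂ[X] K p = Polynomial.aeval x p) → motive) : motive := by
  let : Algebra ℂ[X] K := (Polynomial.aeval (R := ℂ) x).toAlgebra
  have : IsScalarTower ℂ ℂ[X] K := .of_algebraMap_eq fun c => by
    change _ = Polynomial.aeval x (Polynomial.C c); simp
  let : Algebra ℂ[X] (IntermediateField.adjoin ℂ {x}) :=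
    (Polynomial.aeval (R := ℂ) (IntermediateField.AdjoinSimple.gen ℂ x)).toAlgebra
  have hmap : ∀ p : ℂ[X], ((algebraMap ℂ[X] (IntermediateField.adjoin ℂ {x}) p :
      IntermediateField.adjoin ℂ {x}) : K) = Polynomial.aeval x p := fun p => by
    change ((Polynomial.aeval (IntermediateField.AdjoinSimple.gen ℂ x) p :
      IntermediateField.adjoin ℂ {x}) : K) = _
    rw [← IntermediateField.aeval_coe]
    simp
  have : IsScalarTower ℂ[X] (IntermediateField.adjoin ℂ {x}) K := .of_algebraMap_eq fun p =>
    (hmap p).symm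
  have : FaithfulSMul ℂ[X] (IntermediateField.adjoin ℂ {x}) := by
    rw [faithfulSMul_iff_algebraMap_injective]
    intro p q hpq
    have := congrArg (fun a : IntermediateField.adjoin ℂ {x} => (a : K)) hpq
    simp only [hmap] at this
    exact transcendental_iff_injective.1 hx this
  have : IsFractionRing ℂ[X] (IntermediateField.adjoin ℂ {x}) := .of_field _ _ fun z => by
    obtain ⟨r, s, hrs⟩ := IntermediateField.mem_adjoin_simple_iff ℂ (z : K) |>.1 z.2
    refine ⟨r, s, Subtype.ext ?_⟩
    rw [hrs]
    push_cast
    rw [hmap, hmap]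
  have := finiteDimensional_adjoin hK hx
  have := chart_isDedekind K (IntermediateField.adjoin ℂ {x})
  have := chart_isFractionRing K (IntermediateField.adjoin ℂ {x})
  have := chart_finite K (IntermediateField.adjoin ℂ {x})
  exact h fun p => rfl

variable [hK : Fact (IsCurveFunctionField K)]

theorem Point.exists_transcendental (P : Point K) :
    ∃ x : K, Transcendental ℂ x ∧ x ∈ P.O ∧ x⁻¹ ∉ P.O := by
  obtain ⟨z, hz⟩ : ∃ z, z ∉ P.O := by
    by_contra hcon
    push Not at hcon
    exact P.ne_top (eq_top_iff.2 fun z _ => hcon z)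
  refine ⟨z⁻¹, transcendental_of_forall_ne fun c hc => hz ?_, ?_, by rwa [inv_inv]⟩
  · rw [← inv_inv z, ← hc, ← map_inv₀]; exact P.algebraMap_mem _
  · exact (P.O.mem_or_inv_mem z).resolve_left hz

instance (P : Point K) : IsDiscreteValuationRing P.O := by
  obtain ⟨x, hx, hxO, -⟩ := P.exists_transcendental
  refine chart_induction hK.out hx ?_
  intro _ _ _ _ _ _ _ _ _ hmap
  obtain ⟨v, hv⟩ := P.exists_heightOneSpectrum (by rw [hmap]; simpa using hxO)
  have : P.O = v.valuationSubringAtPrime K := by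
    rw [HeightOneSpectrum.valuationSubringAtPrime_eq_valuationSubring]
    ext z; exact hv z
  rw [this]
  exact IsLocalization.AtPrime.isDiscreteValuationRing_of_dedekind_domain (ChartRing K) v.ne_bot _

/-- The discrete valuation of a point. -/
def Point.val (P : Point K) : Valuation K (WithZero (Multiplicative ℤ)) :=
  (IsDiscreteValuationRing.maximalIdeal P.O).valuation K

/-- The order of a function at a point (zero for the zero function). -/
def Point.ord (P : Point K) (z : K) : ℤ := -(P.val z).log

theorem Point.val_surjective (P : Point K) : Function.Surjective P.val :=
  HeightOneSpectrum.valuation_surjective _ _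

theorem Point.val_le_one_iff (P : Point K) (z : K) : P.val z ≤ 1 ↔ z ∈ P.O := by
  constructor
  · intro h
    obtain ⟨y, hy⟩ := HeightOneSpectrum.mem_integers_of_valuation_le_one (R := P.O) K z (fun v => by
      have : v = IsDiscreteValuationRing.maximalIdeal P.O :=
        HeightOneSpectrum.ext (IsLocalRing.eq_maximalIdeal v.isMaximal)
      rw [this]; exact h)
    rw [← hy]; exact y.2
  · intro h
    exact HeightOneSpectrum.valuation_le_one _ (⟨z, h⟩ : P.O)

theorem valuation_eq_of_forall_le_one_iff {v w : Valuation K (WithZero (Multiplicative ℤ))}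
    (hv : Function.Surjective v) (hw : Function.Surjective w) (h : ∀ z, v z ≤ 1 ↔ w z ≤ 1) :
    v = w := by
  have he : v.IsEquiv w := Valuation.isEquiv_of_val_le_one fun {z} => h z
  obtain ⟨π, hπ⟩ := hv (WithZero.exp (-1))
  obtain ⟨ρ, hρ⟩ := hw (WithZero.exp (-1))
  have key : ∀ a : WithZero (Multiplicative ℤ), a < 1 → a ≤ WithZero.exp (-1) := by
    intro a ha
    rcases eq_or_ne a 0 with rfl | h0
    · exact zero_le
    · rw [← WithZero.exp_log h0, WithZero.exp_le_exp]
      rw [← WithZero.exp_log h0, ← WithZero.exp_zero, WithZero.exp_lt_exp] at ha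
      omega
  have hlt : WithZero.exp (-1 : ℤ) < (1 : WithZero (Multiplicative ℤ)) := by
    rw [← WithZero.exp_zero, WithZero.exp_lt_exp]; decide
  have hwπ : w π = WithZero.exp (-1) := by
    apply le_antisymm
    · apply key
      rw [← he.lt_one_iff_lt_one, hπ]; exact hlt
    · rw [← hρ, ← he, hπ]
      apply key
      rw [he.lt_one_iff_lt_one, hρ]; exact hlt
  ext z
  rcases eq_or_ne z 0 with rfl | hz
  · simp
  have h0 : v z ≠ 0 := (Valuation.ne_zero_iff _).2 hz
  have h1 : v z = v (π ^ (-(v z).log)) := by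
    rw [map_zpow₀, hπ, ← WithZero.exp_zsmul]
    simp [WithZero.exp_log h0]
  rw [h1, (he.eq_iff).1 h1, map_zpow₀, map_zpow₀, hπ, hwπ]

theorem Point.val_eq {P : Point K} {v : Valuation K (WithZero (Multiplicative ℤ))}
    (hv : Function.Surjective v) (h : ∀ z, z ∈ P.O ↔ v z ≤ 1) : P.val = v :=
  valuation_eq_of_forall_le_one_iff P.val_surjective hv fun z => by rw [P.val_le_one_iff, h]

namespace Point

variable (P : Point K)

theorem val_eq_exp {z : K} (hz : z ≠ 0) : P.val z = WithZero.exp (-P.ord z) := by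
  rw [ord, neg_neg, WithZero.exp_log ((Valuation.ne_zero_iff _).2 hz)]

theorem ord_eq_of_val {z : K} {n : ℤ} (h : P.val z = WithZero.exp (-n)) : P.ord z = n := by
  rw [ord, h, WithZero.log_exp, neg_neg]

@[simp] theorem ord_zero : P.ord 0 = 0 := by simp [ord]
@[simp] theorem ord_one : P.ord 1 = 0 := by simp [ord]

theorem ord_mul {z w : K} (hz : z ≠ 0) (hw : w ≠ 0) : P.ord (z * w) = P.ord z + P.ord w := by
  apply ord_eq_of_val
  rw [map_mul, P.val_eq_exp hz, P.val_eq_exp hw, ← WithZero.exp_add, neg_add]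

@[simp] theorem ord_inv (z : K) : P.ord z⁻¹ = -P.ord z := by
  rw [ord, ord, map_inv₀, WithZero.log_inv]

theorem ord_div {z w : K} (hz : z ≠ 0) (hw : w ≠ 0) : P.ord (z / w) = P.ord z - P.ord w := by
  rw [div_eq_mul_inv, P.ord_mul hz (inv_ne_zero hw), ord_inv, sub_eq_add_neg]

@[simp] theorem ord_pow (z : K) (n : ℕ) : P.ord (z ^ n) = n * P.ord z := by
  rw [ord, ord, map_pow, WithZero.log_pow]; simp

@[simp] theorem ord_zpow (z : K) (n : ℤ) : P.ord (z ^ n) = n * P.ord z := by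
  rw [ord, ord, map_zpow₀, WithZero.log_zpow]; simp

@[simp] theorem ord_neg (z : K) : P.ord (-z) = P.ord z := by
  rw [ord, ord, Valuation.map_neg]

theorem mem_O_iff {z : K} (hz : z ≠ 0) : z ∈ P.O ↔ 0 ≤ P.ord z := by
  rw [← P.val_le_one_iff, P.val_eq_exp hz, ← WithZero.exp_zero, WithZero.exp_le_exp]; omega

/-- The functions of order at least `n` at `P`. -/
def fil (n : ℤ) : Submodule P.O K where
  carrier := {z | P.val z ≤ WithZero.exp (-n)}
  add_mem' ha hb := (P.val.map_add _ _).trans (max_le ha hb)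
  zero_mem' := by simp
  smul_mem' c z hz := by
    change P.val ((c : K) * z) ≤ _
    rw [map_mul]
    exact (mul_le_of_le_one_left zero_le ((P.val_le_one_iff _).2 c.2)).trans hz

theorem mem_fil_iff_val {n : ℤ} {z : K} : z ∈ P.fil n ↔ P.val z ≤ WithZero.exp (-n) := Iff.rfl

theorem mem_fil {n : ℤ} {z : K} (hz : z ≠ 0) : z ∈ P.fil n ↔ n ≤ P.ord z := by
  rw [mem_fil_iff_val, P.val_eq_exp hz, WithZero.exp_le_exp]; omega

theorem mem_fil' {n : ℤ} {z : K} : z ∈ P.fil n ↔ z = 0 ∨ n ≤ P.ord z := by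
  rcases eq_or_ne z 0 with rfl | hz
  · simp
  · rw [P.mem_fil hz]; simp [hz]

@[simp] theorem mem_fil_zero {z : K} : z ∈ P.fil 0 ↔ z ∈ P.O := by
  rw [mem_fil_iff_val, ← P.val_le_one_iff]; simp

theorem mul_mem_fil {m n : ℤ} {z w : K} (hz : z ∈ P.fil m) (hw : w ∈ P.fil n) :
    z * w ∈ P.fil (m + n) := by
  rw [mem_fil_iff_val, map_mul, neg_add, WithZero.exp_add]
  exact mul_le_mul' hz hw

theorem fil_anti {m n : ℤ} (h : m ≤ n) : P.fil n ≤ P.fil m := fun z hz =>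
  (P.mem_fil_iff_val.1 hz).trans (by rw [WithZero.exp_le_exp]; omega)

theorem mul_mem_fil_iff {m : ℤ} {z w : K} (hw : w ≠ 0) :
    z * w ∈ P.fil m ↔ z ∈ P.fil (m - P.ord w) := by
  rcases eq_or_ne z 0 with rfl | hz
  · simp
  · rw [P.mem_fil hz, P.mem_fil (mul_ne_zero hz hw), P.ord_mul hz hw]; omega

theorem exists_ord_eq (n : ℤ) : ∃ t : K, t ≠ 0 ∧ P.ord t = n := by
  obtain ⟨t, ht⟩ := P.val_surjective (WithZero.exp (-n))
  refine ⟨t, ?_, P.ord_eq_of_val ht⟩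
  rintro rfl
  rw [map_zero] at ht
  exact WithZero.exp_ne_zero ht.symm

@[simp] theorem ord_algebraMap (c : ℂ) : P.ord (algebraMap ℂ K c) = 0 := by
  rcases eq_or_ne c 0 with rfl | hc
  · simp
  have h0 : algebraMap ℂ K c ≠ 0 := by simpa
  have h1 := (P.mem_O_iff h0).1 (P.algebraMap_mem c)
  have h2 := (P.mem_O_iff (inv_ne_zero h0)).1 (by rw [← map_inv₀]; exact P.algebraMap_mem _)
  rw [ord_inv] at h2
  omega

theorem smul_mem_fil {n : ℤ} (c : ℂ) {z : K} (hz : z ∈ P.fil n) : c • z ∈ P.fil n := by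
  rw [Algebra.smul_def]
  exact (P.fil n).smul_mem ⟨_, P.algebraMap_mem c⟩ hz

theorem mem_maximalIdeal {z : P.O} : z ∈ IsLocalRing.maximalIdeal P.O ↔ (z : K) ∈ P.fil 1 := by
  have h1 : z ∈ IsLocalRing.maximalIdeal P.O ↔ P.val z < 1 :=
    (HeightOneSpectrum.valuation_lt_one_iff_mem (K := K)
      (IsDiscreteValuationRing.maximalIdeal P.O) z).symm
  rw [h1]
  rcases eq_or_ne (z : K) 0 with h | h
  · rw [h]; simp
  · rw [P.mem_fil h, P.val_eq_exp h, ← WithZero.exp_zero, WithZero.exp_lt_exp]; omega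

theorem exists_residue {z : K} (hz : z ∈ P.O) : ∃ c : ℂ, z - algebraMap ℂ K c ∈ P.fil 1 := by
  by_cases hc : ∃ c : ℂ, algebraMap ℂ K c = z
  · obtain ⟨c, rfl⟩ := hc
    exact ⟨c, by simp⟩
  push Not at hc
  refine chart_induction hK.out (transcendental_of_forall_ne hc) ?_
  intro _ _ _ _ _ _ _ _ _ hmap
  obtain ⟨v, hv⟩ := P.exists_heightOneSpectrum (by rw [hmap]; simpa using hz)
  have hval := Point.val_eq (v.valuation_surjective K) hv
  have : v.asIdeal.comap (algebraMap ℂ[X] (ChartRing K)) ≠ ⊥ :=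
    Ideal.comap_ne_bot_of_integral_mem (Submodule.ne_bot_iff _ |>.1 v.ne_bot).choose_spec.2
      (Submodule.ne_bot_iff _ |>.1 v.ne_bot).choose_spec.1 (Algebra.IsIntegral.isIntegral _)
  obtain ⟨p, hp, hp0⟩ := Submodule.ne_bot_iff _ |>.1 this
  have hprime : (v.asIdeal.comap (algebraMap ℂ[X] (ChartRing K))).IsPrime := Ideal.comap_isPrime _ _
  rw [IsAlgClosed.splits p |>.eq_prod_roots] at hp
  obtain hp | hp := hprime.mem_or_mem hp
  · exact absurd (Ideal.eq_top_of_isUnit_mem _ hp ((Polynomial.isUnit_C).2 (by simpa using hp0))) hprime.ne_top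
  · rw [hprime.multiset_prod_mem_iff_exists_mem] at hp
    obtain ⟨q, hq, hq2⟩ := hp
    obtain ⟨a, -, rfl⟩ := Multiset.mem_map.1 hq
    refine ⟨a, ?_⟩
    have h3 : v.valuation K (algebraMap ℂ[X] K (Polynomial.X - Polynomial.C a)) < 1 := by
      rw [IsScalarTower.algebraMap_apply ℂ[X] (ChartRing K) K, HeightOneSpectrum.valuation_lt_one_iff_mem]
      exact hq2
    rw [hmap] at h3
    simp only [map_sub, Polynomial.aeval_X, Polynomial.aeval_C] at h3
    rw [mem_fil_iff_val, hval]
    rcases eq_or_ne (z - algebraMap ℂ K a) 0 with h | h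
    · rw [h]; simp
    · rw [← hval, P.val_eq_exp h, WithZero.exp_le_exp]
      rw [← hval, P.val_eq_exp h, ← WithZero.exp_zero, WithZero.exp_lt_exp] at h3
      omega

theorem exists_sub_smul_mem_fil {z w : K} (hw : w ≠ 0) (hz : z ∈ P.fil (P.ord w)) :
    ∃ c : ℂ, z - c • w ∈ P.fil (P.ord w + 1) := by
  have h1 : z / w ∈ P.O := by
    rw [← P.mem_fil_zero, div_eq_mul_inv, P.mul_mem_fil_iff (inv_ne_zero hw)]; simpa using hz
  obtain ⟨c, hc⟩ := P.exists_residue h1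
  refine ⟨c, ?_⟩
  have : z - c • w = (z / w - algebraMap ℂ K c) * w := by
    rw [Algebra.smul_def]; field_simp
  rw [this, P.mul_mem_fil_iff hw]
  simpa using hc

end Point

end Setup

section ChartPoints

variable {K : Type*} [Field K] [Algebra ℂ K] [hK : Fact (IsCurveFunctionField K)]

theorem Point.ext' {P Q : Point K} (h : P.O = Q.O) : P = Q := by
  cases P; cases Q; simp_all

variable [Algebra ℂ[X] K] [IsScalarTower ℂ ℂ[X] K]
  [IsDedekindDomain (ChartRing K)] [IsFractionRing (ChartRing K) K]

variable (K) in
/-- The points of a chart are the maximal ideals of its ring of functions. -/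
def chartEquiv :
    {P : Point K // algebraMap ℂ[X] K Polynomial.X ∈ P.O} ≃ HeightOneSpectrum (ChartRing K) where
  toFun P := (P.1.exists_heightOneSpectrum P.2).choose
  invFun v := ⟨(exists_point_of_heightOneSpectrum v).choose,
    (exists_point_of_heightOneSpectrum v).choose_spec.1⟩
  left_inv P := by
    refine Subtype.ext (Point.ext' ?_)
    ext z
    rw [(exists_point_of_heightOneSpectrum _).choose_spec.2,
      ← (P.1.exists_heightOneSpectrum P.2).choose_spec]
  right_inv v := by
    refine HeightOneSpectrum.eq_of_valuation_isEquiv_valuation (K := K)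
      (Valuation.isEquiv_of_val_le_one fun {z} => ?_)
    rw [← (Point.exists_heightOneSpectrum (exists_point_of_heightOneSpectrum v).choose
      (exists_point_of_heightOneSpectrum v).choose_spec.1).choose_spec,
      (exists_point_of_heightOneSpectrum v).choose_spec.2]

theorem chartEquiv_valuation (P : {P : Point K // algebraMap ℂ[X] K Polynomial.X ∈ P.O}) :
    (chartEquiv K P).valuation K = P.1.val :=
  (Point.val_eq (HeightOneSpectrum.valuation_surjective _ _)
    (P.1.exists_heightOneSpectrum P.2).choose_spec).symm

theorem chartEquiv_symm_val (v : HeightOneSpectrum (ChartRing K)) :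
    ((chartEquiv K).symm v).1.val = v.valuation K := by
  rw [← chartEquiv_valuation, Equiv.apply_symm_apply]

theorem mem_asIdeal_iff (v : HeightOneSpectrum (ChartRing K)) (b : ChartRing K) :
    b ∈ v.asIdeal ↔ (b : K) ∈ ((chartEquiv K).symm v).1.fil 1 := by
  have h1 : b ∈ v.asIdeal ↔ ((chartEquiv K).symm v).1.val b < 1 := by
    rw [chartEquiv_symm_val]; exact (v.valuation_lt_one_iff_mem b).symm
  rw [h1]
  rcases eq_or_ne (b : K) 0 with h | h
  · rw [h]; simp
  · rw [Point.mem_fil _ h, Point.val_eq_exp _ h, ← WithZero.exp_zero, WithZero.exp_lt_exp]; omega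

theorem finite_ord_ne_zero_chart {z : K} (hz : z ≠ 0) :
    {P : Point K | algebraMap ℂ[X] K Polynomial.X ∈ P.O ∧ P.ord z ≠ 0}.Finite := by
  have aux : ∀ b : ChartRing K, b ≠ 0 →
      {P : Point K | algebraMap ℂ[X] K Polynomial.X ∈ P.O ∧ P.ord (b : K) ≠ 0}.Finite := by
    intro b hb
    have h1 := Ideal.finite_factors (I := Ideal.span {b}) (by simpa using hb)
    refine (h1.image fun v => ((chartEquiv K).symm v).1).subset ?_
    rintro P ⟨hP, hP2⟩
    refine ⟨chartEquiv K ⟨P, hP⟩, ?_, by simp⟩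
    rw [Set.mem_ofPred_eq, Ideal.dvd_span_singleton, mem_asIdeal_iff, Equiv.symm_apply_apply,
      Point.mem_fil _ (by simpa using hb)]
    have := (P.mem_O_iff (z := (b : K)) (by simpa using hb)).1 (Point.integral_mem hP b.2)
    change 1 ≤ P.ord (b : K)
    omega
  obtain ⟨a, b, hb, rfl⟩ := IsFractionRing.div_surjective (A := ChartRing K) z
  have hb0 : b ≠ 0 := nonZeroDivisors.ne_zero hb
  have ha0 : a ≠ 0 := by rintro rfl; simp at hz
  refine ((aux a ha0).union (aux b hb0)).subset ?_
  rintro P ⟨hP, hP2⟩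
  by_contra hcon
  simp only [Set.mem_union, Set.mem_ofPred_eq, not_or, not_and, not_not] at hcon
  apply hP2
  rw [P.ord_div (by simpa using ha0) (by simpa using hb0)]
  erw [hcon.1 hP, hcon.2 hP]
  rfl

theorem inertiaDeg_eq_one [Module.Finite ℂ[X] (ChartRing K)] (v : HeightOneSpectrum (ChartRing K))
    (p : Ideal ℂ[X]) [p.IsMaximal] [v.asIdeal.LiesOver p] : v.asIdeal.inertiaDeg ℂ[X] = 1 := by
  rw [Ideal.inertiaDeg_eq_of_isMaximal p]
  refine finrank_eq_one (1 : ChartRing K ⧸ v.asIdeal) one_ne_zero fun w => ?_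
  obtain ⟨b, rfl⟩ := Ideal.Quotient.mk_surjective w
  let P := ((chartEquiv K).symm v)
  obtain ⟨c, hc⟩ := P.1.exists_residue (Point.integral_mem P.2 b.2)
  refine ⟨Ideal.Quotient.mk p (Polynomial.C c), ?_⟩
  rw [Algebra.smul_def, mul_one]
  change Ideal.Quotient.mk v.asIdeal (algebraMap ℂ[X] (ChartRing K) (Polynomial.C c)) = _
  rw [eq_comm, Ideal.Quotient.eq, mem_asIdeal_iff]
  convert hc using 1
  push_cast
  rw [IsScalarTower.algebraMap_apply ℂ ℂ[X] K]
  rfl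

theorem ramificationIdx_eq_ord (k : Type*) [Field k] [Algebra ℂ[X] k] [IsFractionRing ℂ[X] k]
    [Algebra k K] [IsScalarTower ℂ[X] k K] [FiniteDimensional k K]
    (P : {P : Point K // algebraMap ℂ[X] K Polynomial.X ∈ P.O}) {p : Ideal ℂ[X]}
    [p.IsMaximal] {π : ℂ[X]} (hp : p = Ideal.span {π}) (hπ : π ≠ 0)
    [(chartEquiv K P).asIdeal.LiesOver p] :
    ((chartEquiv K P).asIdeal.ramificationIdx ℂ[X] : ℤ) = P.1.ord (algebraMap ℂ[X] K π) := by
  have hinj : Function.Injective (algebraMap ℂ[X] (ChartRing K)) := by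
    have : Function.Injective (algebraMap ℂ[X] K) := by
      rw [IsScalarTower.algebraMap_eq ℂ[X] k K]
      exact (algebraMap k K).injective.comp (IsFractionRing.injective ℂ[X] k)
    rw [IsScalarTower.algebraMap_eq ℂ[X] (ChartRing K) K] at this
    exact Function.Injective.of_comp (f := algebraMap (ChartRing K) K) this
  have hne : algebraMap ℂ[X] (ChartRing K) π ≠ 0 := by
    rw [Ne, map_eq_zero_iff _ hinj]; exact hπ
  have hm : p.map (algebraMap ℂ[X] (ChartRing K)) = Ideal.span {algebraMap ℂ[X] (ChartRing K) π} := by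
    rw [hp, Ideal.map_span, Set.image_singleton]
  have : FaithfulSMul ℂ[X] (ChartRing K) := (faithfulSMul_iff_algebraMap_injective _ _).2 hinj
  rw [Ideal.IsDedekindDomain.ramificationIdx_eq_multiplicity p _ (by rw [hm]; simpa using hne), hm]
  symm
  apply Point.ord_eq_of_val
  have hπK : algebraMap ℂ[X] K π = algebraMap (ChartRing K) K (algebraMap ℂ[X] (ChartRing K) π) :=
    IsScalarTower.algebraMap_apply ℂ[X] (ChartRing K) K π
  rw [← chartEquiv_valuation, hπK, HeightOneSpectrum.valuation_of_algebraMap, HeightOneSpectrum.intValuation_eq_exp_neg_multiplicity _ hne]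

theorem finsum_zeros_chart (k : Type*) [Field k] [Algebra ℂ[X] k] [IsFractionRing ℂ[X] k]
    [Algebra k K] [IsScalarTower ℂ[X] k K] [FiniteDimensional k K]
    [Module.Finite ℂ[X] (ChartRing K)] :
    ∑ᶠ P : Point K, max (P.ord (algebraMap ℂ[X] K Polynomial.X)) 0 = Module.finrank k K := by
  set x := algebraMap ℂ[X] K Polynomial.X with hx
  let p : Ideal ℂ[X] := Ideal.span {Polynomial.X}
  have hpm : p.IsMaximal := PrincipalIdealRing.isMaximal_of_irreducible Polynomial.irreducible_X
  have hinjK : Function.Injective (algebraMap ℂ[X] K) := by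
    rw [IsScalarTower.algebraMap_eq ℂ[X] k K]
    exact (algebraMap k K).injective.comp (IsFractionRing.injective ℂ[X] k)
  have hx0 : x ≠ 0 := by rw [hx, Ne, map_eq_zero_iff _ hinjK]; exact Polynomial.X_ne_zero
  have hT : Module.IsTorsionFree ℂ[X] K := by
    rw [Module.isTorsionFree_iff_algebraMap_injective]; exact hinjK
  have hch := charZero_of_isFractionRing k
  have hfree : Module.Free ℂ[X] (ChartRing K) := IsIntegralClosure.module_free ℂ[X] k K _
  have hrank : Module.finrank ℂ[X] (ChartRing K) = Module.finrank k K := IsIntegralClosure.rank ℂ[X] k K _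
  have : Fintype (p.primesOver (ChartRing K)) := (Algebra.QuasiFinite.finite_primesOver p).fintype
  rw [← hrank, ← Ideal.sum_ramification_inertia_eq_finrank p]
  let S : Set (Point K) := {P | 0 < P.ord x}
  have hSO : ∀ P ∈ S, x ∈ P.O := fun P hP => (P.mem_O_iff hx0).2 (le_of_lt hP)
  have hover : ∀ P (hP : P ∈ S), (chartEquiv K ⟨P, hSO P hP⟩).asIdeal.LiesOver p := by
    intro P hP
    constructor
    refine hpm.eq_of_le (Ideal.comap_ne_top _ (chartEquiv K ⟨P, hSO P hP⟩).isPrime.ne_top) ?_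
    rw [Ideal.span_le, Set.singleton_subset_iff]
    rw [SetLike.mem_coe, Ideal.mem_comap, mem_asIdeal_iff, Equiv.symm_apply_apply]
    change x ∈ P.fil 1
    rw [P.mem_fil hx0]
    exact hP
  let e : S ≃ p.primesOver (ChartRing K) := {
    toFun := fun P => ⟨(chartEquiv K ⟨P.1, hSO P.1 P.2⟩).asIdeal,
      (chartEquiv K ⟨P, hSO P.1 P.2⟩).isPrime, hover P.1 P.2⟩
    invFun := fun q => ⟨((chartEquiv K).symm ⟨q.1, q.2.1, by
        have := q.2.2
        exact Ideal.ne_bot_of_liesOver_of_ne_bot (p := p) (by simp [p]) q.1⟩).1, by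
      rw [Set.mem_ofPred_eq]
      have h1 : algebraMap ℂ[X] (ChartRing K) Polynomial.X ∈ q.1 := by
        have := q.2.2.over
        have h2 : Polynomial.X ∈ p := Ideal.mem_span_singleton_self _
        rw [this] at h2
        exact h2
      have h3 := (mem_asIdeal_iff ⟨q.1, q.2.1, by
        have := q.2.2
        exact Ideal.ne_bot_of_liesOver_of_ne_bot (p := p) (by simp [p]) q.1⟩ _).1 h1
      change x ∈ _ at h3
      rw [Point.mem_fil _ hx0] at h3
      omega⟩
    left_inv := fun P => by
      have h := congrArg Subtype.val ((chartEquiv K).symm_apply_apply ⟨P.1, hSO P.1 P.2⟩)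
      exact Subtype.ext h
    right_inv := fun q => Subtype.ext (by simp) }
  have h1 : ∑ᶠ P : Point K, max (P.ord x) 0 = ∑ᶠ P ∈ S, max (P.ord x) 0 := by
    rw [← finsum_mem_univ]
    refine finsum_mem_inter_support_eq' _ _ _ fun P hP => ?_
    simp only [Set.mem_univ, true_iff]
    change 0 < P.ord x
    by_contra hcon
    exact hP (max_eq_right (by omega))
  rw [h1, ← finsum_set_coe_eq_finsum_mem, ← finsum_comp_equiv e.symm, finsum_eq_sum_of_fintype]
  push_cast
  refine Finset.sum_congr rfl fun q _ => ?_
  obtain ⟨P, rfl⟩ := e.surjective q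
  rw [Equiv.symm_apply_apply]
  have := hover P.1 P.2
  change _ = (((chartEquiv K ⟨P.1, hSO P.1 P.2⟩).asIdeal.ramificationIdx ℂ[X] : ℕ) : ℤ) *
    (((chartEquiv K ⟨P.1, hSO P.1 P.2⟩).asIdeal.inertiaDeg ℂ[X] : ℕ) : ℤ)
  rw [inertiaDeg_eq_one _ p, ramificationIdx_eq_ord k ⟨P.1, hSO P.1 P.2⟩ (p := p) rfl Polynomial.X_ne_zero,
    max_eq_left (le_of_lt P.2)]
  simp [hx]

end ChartPoints

section Degree

variable {K : Type*} [Field K] [Algebra ℂ K] [hK : Fact (IsCurveFunctionField K)]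

theorem finsum_zeros {x : K} (hx : Transcendental ℂ x) :
    ∑ᶠ P : Point K, max (P.ord x) 0 = Module.finrank (IntermediateField.adjoin ℂ {x}) K := by
  refine chart_induction hK.out hx ?_
  intro _ _ _ _ _ _ _ _ _ hmap
  rw [← finsum_zeros_chart, hmap]
  simp

theorem ne_zero_of_transcendental {x : K} (hx : Transcendental ℂ x) : x ≠ 0 := by
  rintro rfl; exact hx isAlgebraic_zero

theorem Transcendental.inv' {x : K} (hx : Transcendental ℂ x) : Transcendental ℂ x⁻¹ := fun h =>
  hx (by simpa using h.inv)

theorem finite_ord_ne_zero (z : K) : {P : Point K | P.ord z ≠ 0}.Finite := by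
  by_cases hc : ∃ c : ℂ, algebraMap ℂ K c = z
  · obtain ⟨c, rfl⟩ := hc
    simp
  push Not at hc
  have hz := transcendental_of_forall_ne hc
  have aux : ∀ x : K, Transcendental ℂ x → {P : Point K | x ∈ P.O ∧ P.ord x ≠ 0}.Finite := by
    intro x hx
    refine chart_induction hK.out hx ?_
    intro _ _ _ _ _ _ _ _ _ hmap
    have := finite_ord_ne_zero_chart (ne_zero_of_transcendental hx)
    simpa [hmap] using this
  refine ((aux z hz).union (aux z⁻¹ (Transcendental.inv' hz))).subset ?_
  intro P hP
  rcases P.O.mem_or_inv_mem z with h | h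
  · exact Or.inl ⟨h, hP⟩
  · exact Or.inr ⟨h, by simpa using hP⟩

/-- The divisor of a function. -/
def divf (z : K) : Point K →₀ ℤ := Finsupp.ofSupportFinite (fun P => P.ord z) (finite_ord_ne_zero z)

@[simp] theorem divf_apply (z : K) (P : Point K) : divf z P = P.ord z := rfl

/-- The degree of a divisor. -/
def deg (D : Point K →₀ ℤ) : ℤ := D.sum fun _ n => n

theorem deg_add (D D' : Point K →₀ ℤ) : deg (D + D') = deg D + deg D' :=
  Finsupp.sum_add_index' (fun _ => rfl) fun _ _ _ => rfl

theorem deg_neg (D : Point K →₀ ℤ) : deg (-D) = -deg D := by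
  have := deg_add D (-D)
  rw [add_neg_cancel] at this
  simp only [deg, Finsupp.sum_zero_index] at this ⊢
  omega

theorem deg_sub (D D' : Point K →₀ ℤ) : deg (D - D') = deg D - deg D' := by
  rw [sub_eq_add_neg, deg_add, deg_neg]; ring

@[simp] theorem deg_zero : deg (0 : Point K →₀ ℤ) = 0 := Finsupp.sum_zero_index

@[simp] theorem deg_single (P : Point K) (n : ℤ) : deg (Finsupp.single P n) = n :=
  Finsupp.sum_single_index rfl

theorem deg_eq_finsum (D : Point K →₀ ℤ) : deg D = ∑ᶠ P, D P := by
  rw [finsum_eq_sum_of_support_subset (s := D.support)]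
  · rfl
  · intro P hP; simpa using hP

theorem deg_nonneg {D : Point K →₀ ℤ} (h : 0 ≤ D) : 0 ≤ deg D :=
  Finset.sum_nonneg fun P _ => h P

theorem deg_mono {D D' : Point K →₀ ℤ} (h : D ≤ D') : deg D ≤ deg D' := by
  have := deg_nonneg (sub_nonneg.2 h)
  rw [deg_sub] at this
  omega

theorem eq_of_le_of_deg_eq {D D' : Point K →₀ ℤ} (h : D ≤ D') (hd : deg D = deg D') : D = D' := by
  have h1 : deg (D' - D) = 0 := by rw [deg_sub]; omega
  have h2 : ∀ P ∈ (D' - D).support, (D' - D) P = 0 :=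
    (Finset.sum_eq_zero_iff_of_nonneg fun P _ => sub_nonneg.2 h P).1 h1
  ext P
  by_cases hP : P ∈ (D' - D).support
  · have := h2 P hP
    simp only [Finsupp.coe_sub, Pi.sub_apply] at this
    omega
  · rw [Finsupp.notMem_support_iff] at hP
    simp only [Finsupp.coe_sub, Pi.sub_apply] at hP
    omega

theorem deg_divf (z : K) : deg (divf z) = 0 := by
  by_cases hc : ∃ c : ℂ, algebraMap ℂ K c = z
  · obtain ⟨c, rfl⟩ := hc
    have : divf (algebraMap ℂ K c) = 0 := by ext P; simp
    rw [this, deg_zero]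
  push Not at hc
  have hz := transcendental_of_forall_ne hc
  have h1 := finsum_zeros hz
  have h2 := finsum_zeros (Transcendental.inv' hz)
  have hk : IntermediateField.adjoin ℂ {z⁻¹} = IntermediateField.adjoin ℂ {z} := by
    apply le_antisymm
    · rw [IntermediateField.adjoin_le_iff, Set.singleton_subset_iff]
      exact inv_mem (IntermediateField.mem_adjoin_simple_self ℂ z)
    · rw [IntermediateField.adjoin_le_iff, Set.singleton_subset_iff]
      simpa using inv_mem (IntermediateField.mem_adjoin_simple_self ℂ z⁻¹)
  rw [hk, ← h1] at h2
  have hf : ∀ w : K, (Function.support fun P : Point K => max (P.ord w) 0).Finite := fun w =>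
    (finite_ord_ne_zero w).subset fun P hP hcon => hP (by simp [hcon])
  rw [deg_eq_finsum, finsum_congr (g := fun P => max (P.ord z) 0 - max (P.ord z⁻¹) 0), finsum_sub_distrib (hf _) (hf _), h2, sub_self]
  intro P
  simp only [divf_apply, Point.ord_inv]
  omega

/-- A function without poles is constant. -/
theorem exists_const_of_forall_mem {z : K} (hz : ∀ P : Point K, z ∈ P.O) :
    ∃ c : ℂ, algebraMap ℂ K c = z := by
  by_contra hc
  push Not at hc
  have ht := transcendental_of_forall_ne hc
  have h0 := ne_zero_of_transcendental ht
  have h1 := finsum_zeros (Transcendental.inv' ht)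
  have := finiteDimensional_adjoin hK.out (Transcendental.inv' ht)
  have h2 : 0 < Module.finrank (IntermediateField.adjoin ℂ {z⁻¹}) K := Module.finrank_pos
  have h3 : ∑ᶠ P : Point K, max (P.ord z⁻¹) 0 = 0 := by
    rw [finsum_congr (g := fun _ => 0), finsum_zero]
    intro P
    have := (P.mem_O_iff h0).1 (hz P)
    rw [Point.ord_inv]; omega
  omega

end Degree

/-! ### Differentials -/

section Kaehler

variable {K : Type*} [Field K] [Algebra ℂ K] [hK : Fact (IsCurveFunctionField K)]

/-- The module structure of the differentials over a local ring, by restriction of scalars. -/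
instance instModuleOmega (P : Point K) : Module P.O (Ω[K⁄ℂ]) := Subsemiring.instModuleSubtypeMem P.O

/-- The universal derivation. -/
local notation "d" => KaehlerDifferential.D ℂ K

theorem exists_D_eq_smul {x : K} (hx : Transcendental ℂ x) (z : K) : ∃ f : K, d z = f • d x := by
  have hfin := finiteDimensional_adjoin hK.out hx
  have h1 : ∀ z : IntermediateField.adjoin ℂ {x}, d (z : K) ∈ Submodule.span K {d x} := by
    intro z
    obtain ⟨r, s, hrs⟩ := IntermediateField.mem_adjoin_simple_iff ℂ (z : K) |>.1 z.2
    rw [hrs, Derivation.leibniz_div, Derivation.map_aeval, Derivation.map_aeval]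
    refine Submodule.smul_mem _ _ (Submodule.sub_mem _ ?_ ?_)
    all_goals exact Submodule.smul_mem _ _ (Submodule.smul_mem _ _ (Submodule.mem_span_singleton_self _))
  have h2 : ∀ p : Polynomial (IntermediateField.adjoin ℂ {x}),
      d (Polynomial.aeval z p) - Polynomial.aeval z (Polynomial.derivative p) • d z ∈
        Submodule.span K {d x} := by
    intro p
    induction p using Polynomial.induction_on' with
    | add p q hp hq =>
      simp only [map_add, add_smul]
      convert Submodule.add_mem _ hp hq using 1
      abel
    | monomial n a =>
      rw [Polynomial.aeval_monomial, Polynomial.derivative_monomial, Polynomial.aeval_monomial,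
        Derivation.leibniz, Derivation.leibniz_pow]
      have : algebraMap (IntermediateField.adjoin ℂ {x}) K a • n • z ^ (n - 1) • d z + z ^ n • d (algebraMap (IntermediateField.adjoin ℂ {x}) K a) - (algebraMap (IntermediateField.adjoin ℂ {x}) K (a * n) * z ^ (n-1)) • d z = z ^ n • d (a : K) := by
        rw [map_mul, map_natCast, ← Nat.cast_smul_eq_nsmul K, smul_smul, smul_smul]
        simp [mul_assoc]
      rw [this]
      exact Submodule.smul_mem _ _ (h1 a)
  have h3 := h2 (minpoly (IntermediateField.adjoin ℂ {x}) z)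
  rw [minpoly.aeval, map_zero, zero_sub] at h3
  have h4 : Polynomial.aeval z (Polynomial.derivative (minpoly (IntermediateField.adjoin ℂ {x}) z)) ≠ 0 :=
    (Algebra.IsSeparable.isSeparable _ z : IsSeparable _ z).aeval_derivative_ne_zero (minpoly.aeval _ _)
  obtain ⟨f, hf⟩ := Submodule.mem_span_singleton.1 h3
  refine ⟨-(Polynomial.aeval z (Polynomial.derivative (minpoly (IntermediateField.adjoin ℂ {x}) z)))⁻¹ * f, ?_⟩
  rw [mul_smul, hf, neg_smul, smul_neg, neg_neg, smul_smul, inv_mul_cancel₀ h4, one_smul]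

theorem exists_eq_smul_D {x : K} (hx : Transcendental ℂ x) (η : Ω[K⁄ℂ]) : ∃ f : K, η = f • d x := by
  have : η ∈ Submodule.span K (Set.range (d)) := by
    rw [KaehlerDifferential.span_range_derivation]; trivial
  induction this using Submodule.span_induction with
  | mem η h => obtain ⟨z, rfl⟩ := h; exact exists_D_eq_smul hx z
  | zero => exact ⟨0, by simp⟩
  | add a b _ _ ha hb =>
    obtain ⟨f, rfl⟩ := ha
    obtain ⟨g, rfl⟩ := hb
    exact ⟨f + g, by rw [add_smul]⟩
  | smul c a _ ha =>
    obtain ⟨f, rfl⟩ := ha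
    exact ⟨c * f, by rw [mul_smul]⟩

theorem D_ne_zero [Nontrivial (Ω[K⁄ℂ])] {x : K} (hx : Transcendental ℂ x) : d x ≠ 0 := by
  intro h
  obtain ⟨η, hη⟩ := exists_ne (0 : Ω[K⁄ℂ])
  obtain ⟨f, rfl⟩ := exists_eq_smul_D hx η
  simp [h] at hη

theorem Point.transcendental_of_ord_ne_zero {P : Point K} {t : K} (ht : P.ord t ≠ 0) :
    Transcendental ℂ t :=
  transcendental_of_forall_ne fun c hc => ht (by rw [← hc]; simp)

/-- The stalks of `ω` on a chart are generated by finitely many differentials. -/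
theorem omega_stalk_chart {x : K} (hx : Transcendental ℂ x) : ∃ s : Finset K,
    ∀ P : Point K, x ∈ P.O → (∀ a ∈ s, a ∈ P.O) ∧
      (omega K).stalk P = Submodule.span P.O (insert (d x) ((fun a => d a) '' (s : Set K))) := by
  classical
  refine chart_induction hK.out hx ?_
  intro _ _ _ _ _ _ _ _ hfin hmap
  obtain ⟨s, hs⟩ := hfin.fg_top
  refine ⟨s.image (fun b : ChartRing K => (b : K)), fun P hP => ?_⟩
  have hX : algebraMap ℂ[X] K Polynomial.X ∈ P.O := by rw [hmap]; simpa using hP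
  have hB : ∀ b : ChartRing K, (b : K) ∈ P.O := fun b => Point.integral_mem hX b.2
  have hs' : ∀ a ∈ s.image (fun b : ChartRing K => (b : K)), a ∈ P.O := by
    intro a ha
    obtain ⟨b, -, rfl⟩ := Finset.mem_image.1 ha
    exact hB b
  refine ⟨hs', le_antisymm ?_ ?_⟩
  · set N := Submodule.span P.O (insert (d x) ((fun a => d a) '' (s.image (fun b : ChartRing K => (b : K)) : Set K)))
    have hsm : ∀ (f : K) (hf : f ∈ P.O) (η : Ω[K⁄ℂ]), η ∈ N → f • η ∈ N := fun f hf η hη =>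
      N.smul_mem (⟨f, hf⟩ : P.O) hη
    have hdx : d x ∈ N := Submodule.subset_span (Set.mem_insert _ _)
    have hpO : ∀ p : ℂ[X], Polynomial.aeval x p ∈ P.O := fun p => by
      rw [← hmap, IsScalarTower.algebraMap_apply ℂ[X] (ChartRing K) K]
      exact hB _
    have hpoly : ∀ p : ℂ[X], d (Polynomial.aeval x p) ∈ N := fun p => by
      rw [Derivation.map_aeval]; exact hsm _ (hpO _) _ hdx
    have hdB : ∀ b : ChartRing K, d (b : K) ∈ N := by
      intro b
      have : b ∈ Submodule.span ℂ[X] (s : Set (ChartRing K)) := by rw [hs]; trivial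
      induction this using Submodule.span_induction with
      | mem b hb =>
        refine Submodule.subset_span (Set.mem_insert_of_mem _ ⟨b, ?_, rfl⟩)
        simp only [Finset.coe_image]
        exact ⟨b, hb, rfl⟩
      | zero => simp
      | add a b _ _ ha hb => push_cast; rw [map_add]; exact N.add_mem ha hb
      | smul p b _ hb =>
        have : ((p • b : ChartRing K) : K) = Polynomial.aeval x p * b := by
          rw [Algebra.smul_def, ← hmap]; rfl
        rw [this, Derivation.leibniz]
        exact N.add_mem (hsm _ (hpO p) _ hb) (hsm _ (hB b) _ (hpoly p))
    refine Submodule.span_le.2 ?_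
    rintro _ ⟨f, hf, rfl⟩
    obtain ⟨v, hv⟩ := P.exists_heightOneSpectrum hX
    obtain ⟨a, b, hab⟩ := v.exists_primeCompl_mul_eq_of_integer f ((hv f).1 hf)
    have hb1 : v.valuation K ((b : ChartRing K) : K) = 1 := (HeightOneSpectrum.valuation_eq_one_iff_notMem v).2 b.2
    have hb0 : ((b : ChartRing K) : K) ≠ 0 := by
      intro h
      rw [h, map_zero] at hb1
      exact zero_ne_one hb1
    have hbinv : ((b : ChartRing K) : K)⁻¹ ∈ P.O := (hv _).2 (by rw [map_inv₀, hb1, inv_one])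
    have h5 : f * ((b : ChartRing K) : K) = (a : K) := hab
    have h6 := congrArg (d) h5
    rw [Derivation.leibniz] at h6
    have h7 : d f = ((b : ChartRing K) : K)⁻¹ • (d (a : K) - f • d ((b : ChartRing K) : K)) := by
      rw [← h6, add_sub_cancel_left, smul_smul, inv_mul_cancel₀ hb0, one_smul]
    rw [SetLike.mem_coe, h7]
    exact hsm _ hbinv _ (N.sub_mem (hdB a) (hsm _ hf _ (hdB b)))
  · refine Submodule.span_le.2 ?_
    rintro η (rfl | ⟨a, ha, rfl⟩)
    · exact Submodule.subset_span ⟨x, hP, rfl⟩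
    · exact Submodule.subset_span ⟨a, hs' a ha, rfl⟩

theorem omega_stalk_eq (P : Point K) {t : K} (ht : P.ord t = 1) :
    (omega K).stalk P = Submodule.span P.O {d t} := by
  have ht0 : t ≠ 0 := by rintro rfl; simp at ht
  have htO : t ∈ P.O := (P.mem_O_iff ht0).2 (by omega)
  apply le_antisymm
  · refine Submodule.le_of_le_smul_of_le_jacobson_bot (I := IsLocalRing.maximalIdeal P.O) ?_
      (IsLocalRing.maximalIdeal_le_jacobson _) ?_
    · obtain ⟨x, hx, hxO, -⟩ := P.exists_transcendental
      obtain ⟨s, hs⟩ := omega_stalk_chart hx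
      rw [(hs P hxO).2]
      exact Submodule.fg_span (Set.Finite.insert _ (s.finite_toSet.image _))
    · refine Submodule.span_le.2 ?_
      rintro _ ⟨f, hf, rfl⟩
      obtain ⟨c, hc⟩ := P.exists_residue hf
      have hg : (f - algebraMap ℂ K c) / t ∈ P.O := by
        rw [← P.mem_fil_zero, div_eq_mul_inv, P.mul_mem_fil_iff (inv_ne_zero ht0)]
        simpa [ht] using hc
      set g := (f - algebraMap ℂ K c) / t with hgdef
      have h1 : f = algebraMap ℂ K c + t * g := by rw [hgdef]; field_simp; ring
      have h2 : d f = g • d t + t • d g := by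
        conv_lhs => rw [h1]
        rw [map_add, Derivation.map_algebraMap, zero_add, Derivation.leibniz, add_comm]
      rw [SetLike.mem_coe, h2]
      refine Submodule.add_mem_sup ?_ ?_
      · exact Submodule.smul_mem _ (⟨g, hg⟩ : P.O) (Submodule.mem_span_singleton_self _)
      · exact Submodule.smul_mem_smul (r := (⟨t, htO⟩ : P.O))
          (P.mem_maximalIdeal.2 ((P.mem_fil ht0).2 ht.ge)) (Submodule.subset_span ⟨g, hg, rfl⟩)
  · rw [Submodule.span_singleton_le_iff_mem]
    exact Submodule.subset_span ⟨t, htO, rfl⟩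

end Kaehler

/-! ### Line bundles and divisors -/

section LineBundle

variable {K : Type*} [Field K] [Algebra ℂ K] [hK : Fact (IsCurveFunctionField K)]
variable {V : Type*} [AddCommGroup V] [Module K V]

/-- `L` is a line bundle, and `D` is the divisor of its non-zero rational section `s`. -/
structure HasDiv (L : Family K V) (s : V) (D : Point K →₀ ℤ) : Prop where
  ne_zero : s ≠ 0
  exists_smul : ∀ v : V, ∃ f : K, v = f • s
  mem_iff : ∀ (P : Point K) (f : K), f • s ∈ L.stalk P ↔ f ∈ P.fil (-D P)

local notation "d" => KaehlerDifferential.D ℂ K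

theorem mem_span_O_singleton {P : Point K} {s : V} (hs : s ≠ 0) {f : K} {n : ℤ} {h : K}
    (hh : h ≠ 0) (hn : P.ord h = n) : f • s ∈ Submodule.span P.O {h • s} ↔ f ∈ P.fil n := by
  rw [Submodule.mem_span_singleton]
  constructor
  · rintro ⟨c, hc⟩
    have h1 : (c : K) * h = f := by
      have : ((c : K) * h) • s = f • s := by rw [mul_smul]; exact hc
      exact smul_left_injective K hs this
    rw [← h1, P.mul_mem_fil_iff hh, hn, sub_self, P.mem_fil_zero]
    exact c.2
  · intro hf
    have : f / h ∈ P.O := by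
      rw [← P.mem_fil_zero, div_eq_mul_inv, P.mul_mem_fil_iff (inv_ne_zero hh)]
      simpa [hn] using hf
    refine ⟨⟨f / h, this⟩, ?_⟩
    change (f / h) • h • s = f • s
    rw [smul_smul, div_mul_cancel₀ _ hh]

theorem ord_D {P : Point K} {t z h : K} [Nontrivial (Ω[K⁄ℂ])] (ht : P.ord t = 1)
    (hz : P.ord z ≠ 0) (h1 : d z = h • d t) : h ≠ 0 ∧ P.ord h = P.ord z - 1 := by
  have ht0 : t ≠ 0 := by rintro rfl; simp at ht
  have hz0 : z ≠ 0 := by rintro rfl; simp at hz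
  have hdt := D_ne_zero (P.transcendental_of_ord_ne_zero (t := t) (by omega))
  set n := P.ord z
  let u := z * (t ^ n)⁻¹
  have htn : t ^ n ≠ 0 := zpow_ne_zero _ ht0
  have hu0 : u ≠ 0 := mul_ne_zero hz0 (inv_ne_zero htn)
  have hu : P.ord u = 0 := by
    rw [P.ord_mul hz0 (inv_ne_zero htn), P.ord_inv, P.ord_zpow, ht]; simp [n]
  have huO : u ∈ P.O := (P.mem_O_iff hu0).2 hu.ge
  obtain ⟨g, hg⟩ : ∃ g : P.O, (g : K) • d t = d u := by
    have : d u ∈ (omega K).stalk P := Submodule.subset_span ⟨u, huO, rfl⟩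
    rw [omega_stalk_eq P ht] at this
    exact Submodule.mem_span_singleton.1 this
  have hz1 : z = u * t ^ n := by simp [u, htn]
  have h2 : d z = (u * (n * t ^ (n - 1)) + t ^ n * g) • d t := by
    conv_lhs => rw [hz1]
    rw [Derivation.leibniz, Derivation.leibniz_zpow, ← hg, smul_smul, ← Int.cast_smul_eq_zsmul K, smul_smul, smul_smul, add_smul, mul_assoc]
  have h3 : h = u * (n * t ^ (n - 1)) + t ^ n * g :=
    smul_left_injective K hdt (h1.symm.trans h2)
  have hnK : (n : K) ≠ 0 := by
    have : CharZero K := charZero_of_injective_algebraMap (algebraMap ℂ K).injective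
    exact_mod_cast hz
  have hordn : P.ord (n : K) = 0 := by
    have : (n : K) = algebraMap ℂ K n := by simp
    rw [this, P.ord_algebraMap]
  have hA0 : u * (n * t ^ (n - 1)) ≠ 0 := mul_ne_zero hu0 (mul_ne_zero hnK (zpow_ne_zero _ ht0))
  have hA : P.ord (u * (n * t ^ (n - 1))) = n - 1 := by
    rw [P.ord_mul hu0 (mul_ne_zero hnK (zpow_ne_zero _ ht0)), P.ord_mul hnK (zpow_ne_zero _ ht0),
      hu, hordn, P.ord_zpow, ht]; ring
  have hB : t ^ n * g ∈ P.fil n := by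
    rw [mul_comm, P.mul_mem_fil_iff htn, P.ord_zpow, ht]; simp
  have hmem : h ∈ P.fil (n - 1) := by
    rw [h3]; exact add_mem ((P.mem_fil hA0).2 hA.ge) (P.fil_anti (by omega) hB)
  have hnot : h ∉ P.fil n := by
    intro hcon
    have : u * (n * t ^ (n - 1)) ∈ P.fil n := by
      have := sub_mem hcon hB
      rwa [h3, add_sub_cancel_right] at this
    rw [P.mem_fil hA0] at this
    omega
  have hh0 : h ≠ 0 := by rintro rfl; exact hnot (zero_mem _)
  refine ⟨hh0, ?_⟩
  rw [P.mem_fil hh0] at hmem hnot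
  omega

theorem exists_hasDiv_omega [Nontrivial (Ω[K⁄ℂ])] {x : K} (hx : Transcendental ℂ x) :
    ∃ κ : Point K →₀ ℤ, HasDiv (omega K) (d x) κ ∧
      ∀ (P : Point K) (c : ℂ), 0 < P.ord (x - algebraMap ℂ K c) →
        κ P = P.ord (x - algebraMap ℂ K c) - 1 := by
  have hdx := D_ne_zero hx
  have hloc : ∀ P : Point K, ∃ h : K, h ≠ 0 ∧ ∃ t, P.ord t = 1 ∧ d x = h • d t ∧
      (omega K).stalk P = Submodule.span P.O {h⁻¹ • d x} := by
    intro P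
    obtain ⟨t, ht0, ht⟩ := P.exists_ord_eq 1
    obtain ⟨h, hh⟩ := exists_eq_smul_D (P.transcendental_of_ord_ne_zero (t := t) (by omega)) (d x)
    have hh0 : h ≠ 0 := by rintro rfl; simp [hdx] at hh
    refine ⟨h, hh0, t, ht, hh, ?_⟩
    rw [omega_stalk_eq P ht, hh, smul_smul, inv_mul_cancel₀ hh0, one_smul]
  choose h hh0 t ht htx hst using hloc
  have hmem : ∀ P f, f • d x ∈ (omega K).stalk P ↔ f ∈ P.fil (-P.ord (h P)) := by
    intro P f
    rw [hst]
    exact mem_span_O_singleton hdx (inv_ne_zero (hh0 P)) (by simp)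
  have hfin : {P : Point K | P.ord (h P) ≠ 0}.Finite := by
    obtain ⟨s, hs⟩ := omega_stalk_chart hx
    choose g hg using fun a : K => exists_D_eq_smul hx a
    have hbad : (⋃ a ∈ s, {P : Point K | P.ord (g a) ≠ 0}).Finite :=
      Set.Finite.biUnion s.finite_toSet fun a _ => finite_ord_ne_zero (g a)
    refine ((finite_ord_ne_zero x).union hbad).subset ?_
    intro P hP
    by_contra hcon
    simp only [Set.mem_union, Set.mem_iUnion, not_or, not_exists, Set.mem_ofPred_eq, not_not] at hcon
    apply hP
    have hxO : x ∈ P.O := (P.mem_O_iff (ne_zero_of_transcendental hx)).2 hcon.1.ge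
    have h1 : (omega K).stalk P = Submodule.span P.O {(1 : K) • d x} := by
      rw [one_smul, (hs P hxO).2]
      apply le_antisymm
      · refine Submodule.span_le.2 ?_
        rintro η (rfl | ⟨a, ha, rfl⟩)
        · exact Submodule.mem_span_singleton_self _
        · have hgO : g a ∈ P.O := by
            rw [← P.mem_fil_zero, P.mem_fil']
            exact Or.inr (hcon.2 a ha).ge
          change d a ∈ _
          rw [hg a]
          exact Submodule.smul_mem _ (⟨g a, hgO⟩ : P.O) (Submodule.mem_span_singleton_self _)
      · exact Submodule.span_mono (by simp)
    have h2 : ∀ f : K, f ∈ P.fil 0 ↔ f ∈ P.fil (-P.ord (h P)) := fun f => by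
      rw [← hmem, h1]
      exact (mem_span_O_singleton hdx one_ne_zero (by simp)).symm
    obtain ⟨a, ha0, ha⟩ := P.exists_ord_eq (-P.ord (h P))
    have h3 := h2 1
    have h4 := h2 a
    rw [P.mem_fil one_ne_zero, P.mem_fil one_ne_zero, P.ord_one] at h3
    rw [P.mem_fil ha0, P.mem_fil ha0, ha] at h4
    omega
  refine ⟨Finsupp.ofSupportFinite (fun P => P.ord (h P)) hfin, ⟨hdx, exists_eq_smul_D hx, fun P f => hmem P f⟩, ?_⟩
  intro P c hc
  have h1 : d (x - algebraMap ℂ K c) = h P • d (t P) := by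
    rw [map_sub, Derivation.map_algebraMap, sub_zero, htx P]
  exact (ord_D (ht P) (by omega) h1).2

end LineBundle

/-! ### Fractional ideals and valuations -/

section Dedekind

variable {R : Type*} [CommRing R] [IsDedekindDomain R] {K : Type*} [Field K] [Algebra R K]
  [IsFractionRing R K]

theorem fractionalIdeal_le_iff_count {I J : FractionalIdeal R⁰ K} (hI : I ≠ 0) (hJ : J ≠ 0) :
    I ≤ J ↔ ∀ v : HeightOneSpectrum R,
      FractionalIdeal.count K v J ≤ FractionalIdeal.count K v I := by
  refine ⟨fun h v => FractionalIdeal.count_mono K v hI h, fun h => ?_⟩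
  have hH : I * J⁻¹ ≠ 0 := mul_ne_zero hI (inv_ne_zero hJ)
  have h1 : I * J⁻¹ ≤ 1 := by
    rw [← FractionalIdeal.finprod_heightOneSpectrum_factorization' K hH]
    refine finprod_induction (p := fun H : FractionalIdeal R⁰ K => H ≤ 1) le_rfl
      (fun a b ha hb => mul_le_one' ha hb) fun v => ?_
    have h2 : 0 ≤ FractionalIdeal.count K v (I * J⁻¹) := by
      rw [FractionalIdeal.count_mul K v hI (inv_ne_zero hJ), FractionalIdeal.count_inv]
      have := h v
      omega
    obtain ⟨n, hn⟩ := Int.eq_ofNat_of_zero_le h2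
    rw [hn, zpow_natCast, ← FractionalIdeal.coeIdeal_pow]
    exact FractionalIdeal.coeIdeal_le_one
  calc I = I * J⁻¹ * J := by rw [mul_assoc, inv_mul_cancel₀ hJ, mul_one]
    _ ≤ 1 * J := mul_le_mul_left h1 J
    _ = J := one_mul J

theorem count_spanSingleton (v : HeightOneSpectrum R) {z : K} (hz : z ≠ 0) :
    v.valuation K z = WithZero.exp (-FractionalIdeal.count K v (FractionalIdeal.spanSingleton R⁰ z)) := by
  have aux : ∀ a : R, a ≠ 0 → v.valuation K (algebraMap R K a) = WithZero.exp
      (-FractionalIdeal.count K v (FractionalIdeal.spanSingleton R⁰ (algebraMap R K a))) := by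
    intro a ha
    rw [← FractionalIdeal.coeIdeal_span_singleton, FractionalIdeal.count_coe _ _ (by simpa using ha),
      HeightOneSpectrum.valuation_of_algebraMap, HeightOneSpectrum.intValuation_if_neg _ ha]
  obtain ⟨a, b, hb, rfl⟩ := IsFractionRing.div_surjective (A := R) z
  have hb0 : b ≠ 0 := nonZeroDivisors.ne_zero hb
  have ha0 : a ≠ 0 := by rintro rfl; simp at hz
  have hbK : algebraMap R K b ≠ 0 := by simpa using hb0
  have haK : algebraMap R K a ≠ 0 := by simpa using ha0
  rw [map_div₀, aux a ha0, aux b hb0, div_eq_mul_inv, div_eq_mul_inv, ← FractionalIdeal.spanSingleton_mul_spanSingleton,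
    FractionalIdeal.count_mul _ _ (FractionalIdeal.spanSingleton_ne_zero_iff.2 haK)
      (FractionalIdeal.spanSingleton_ne_zero_iff.2 (inv_ne_zero hbK)),
    ← FractionalIdeal.spanSingleton_inv, FractionalIdeal.count_inv, ← WithZero.exp_neg, ← WithZero.exp_add]
  congr 1
  ring

theorem mem_fractionalIdeal_iff {I : FractionalIdeal R⁰ K} (hI : I ≠ 0) {z : K} :
    z ∈ I ↔ ∀ v : HeightOneSpectrum R,
      v.valuation K z ≤ WithZero.exp (-FractionalIdeal.count K v I) := by
  rcases eq_or_ne z 0 with rfl | hz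
  · simp [FractionalIdeal.zero_mem]
  rw [← FractionalIdeal.spanSingleton_le_iff_mem, fractionalIdeal_le_iff_count (FractionalIdeal.spanSingleton_ne_zero_iff.2 hz) hI]
  refine forall_congr' fun v => ?_
  rw [count_spanSingleton v hz, WithZero.exp_le_exp]
  omega

theorem count_coeIdeal_eq {J : Ideal R} (hJ : J ≠ ⊥) (v : HeightOneSpectrum R) {n : ℕ}
    (h1 : v.asIdeal ^ n ∣ J) (h2 : ¬ v.asIdeal ^ (n + 1) ∣ J) :
    FractionalIdeal.count K v (J : FractionalIdeal R⁰ K) = n := by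
  classical
  have hJ0 : (J : FractionalIdeal R⁰ K) ≠ 0 := by simpa using hJ
  have hv : ∀ m : ℕ, ((v.asIdeal ^ m : Ideal R) : FractionalIdeal R⁰ K) ≠ 0 := fun m => by
    simpa using pow_ne_zero m v.ne_bot
  have hc : ∀ (w : HeightOneSpectrum R) (m : ℕ),
      FractionalIdeal.count K w ((v.asIdeal ^ m : Ideal R) : FractionalIdeal R⁰ K) =
        m * (if v = w then 1 else 0) := by
    intro w m
    rw [FractionalIdeal.coeIdeal_pow, FractionalIdeal.count_pow, FractionalIdeal.count_maximal]
  have h3 : (n : ℤ) ≤ FractionalIdeal.count K v (J : FractionalIdeal R⁰ K) := by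
    have := FractionalIdeal.count_mono K v hJ0
      ((FractionalIdeal.coeIdeal_le_coeIdeal K).2 (Ideal.dvd_iff_le.1 h1))
    rw [hc] at this
    simpa using this
  have h4 : FractionalIdeal.count K v (J : FractionalIdeal R⁰ K) < (n + 1 : ℕ) := by
    by_contra hcon
    push Not at hcon
    apply h2
    rw [Ideal.dvd_iff_le, ← FractionalIdeal.coeIdeal_le_coeIdeal K, fractionalIdeal_le_iff_count hJ0 (hv _)]
    intro w
    rw [hc]
    split_ifs with hvw
    · subst hvw; simpa using hcon
    · simpa using FractionalIdeal.count_coe_nonneg K w J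
  push_cast at h4
  omega

end Dedekind

section Different

attribute [local instance] FractionRing.liftAlgebra

variable {A B : Type*} [CommRing A] [CommRing B] [Algebra A B] [IsDedekindDomain A]
  [IsDedekindDomain B] [Module.IsTorsionFree A B] [Module.Finite A B]

/-- In residue characteristic zero the exponent of the different is at most `e - 1`. -/
theorem not_pow_dvd_differentIdeal [Algebra.IsSeparable (FractionRing A) (FractionRing B)]
    {p : Ideal A} [p.IsMaximal] [CharZero (A ⧸ p)] (P Q : Ideal B) (e : ℕ) (hne : P ^ e ≠ ⊤)
    (hPQ : IsCoprime (P ^ e) Q) (hP : P ^ e * Q = Ideal.map (algebraMap A B) p) :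
    ¬ P ^ e ∣ differentIdeal A B := by
  let : Field (A ⧸ p) := Ideal.Quotient.field p
  let : Algebra (A ⧸ p) (B ⧸ Q) := Ideal.Quotient.algebraQuotientOfLEComap (by
      rw [← Ideal.map_le_iff_le_comap, ← hP]
      exact Ideal.mul_le_right)
  let : Algebra (A ⧸ p) (B ⧸ P ^ e) := Ideal.Quotient.algebraQuotientOfLEComap (by
      rw [← Ideal.map_le_iff_le_comap, ← hP]
      exact Ideal.mul_le_left)
  have : IsScalarTower A (A ⧸ p) (B ⧸ Q) := .of_algebraMap_eq' rfl
  have : Module.Finite (A ⧸ p) (B ⧸ Q) :=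
    Module.Finite.of_restrictScalars_finite A (A ⧸ p) (B ⧸ Q)
  have : IsScalarTower A (A ⧸ p) (B ⧸ P ^ e) := .of_algebraMap_eq' rfl
  have : Module.Finite (A ⧸ p) (B ⧸ P ^ e) :=
    Module.Finite.of_restrictScalars_finite A (A ⧸ p) (B ⧸ P ^ e)
  let f : (B ⧸ p.map (algebraMap A B)) ≃ₐ[A ⧸ p] ((B ⧸ P ^ e) × B ⧸ Q) :=
    { __ := (Ideal.quotEquivOfEq hP.symm).trans (Ideal.quotientMulEquivQuotientProd (P ^ e) Q hPQ),
      commutes' := Quotient.ind fun _ ↦ rfl }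
  obtain ⟨y, hy⟩ := Ideal.Quotient.mk_surjective (f.symm (1, 0))
  refine not_dvd_differentIdeal_of_intTrace_not_mem A (P ^ e) Q hP y ?_ ?_
  · have := congrArg (fun z => (f z).2) hy
    simp only [AlgEquiv.apply_symm_apply] at this
    simpa [f, Ideal.Quotient.eq_zero_iff_mem] using this
  · have : Nontrivial (B ⧸ P ^ e) := Ideal.Quotient.nontrivial_iff.2 hne
    rw [← Ideal.Quotient.eq_zero_iff_mem, ← Algebra.trace_quotient_eq_of_isDedekindDomain,
      hy, Algebra.trace_eq_of_algEquiv, Algebra.trace_prod_apply, map_zero, add_zero,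
      ← map_one (algebraMap (A ⧸ p) _), Algebra.trace_algebraMap, nsmul_eq_mul, mul_one,
      Nat.cast_eq_zero]
    exact Module.finrank_pos.ne'

end Different

/-! ### Trace duality on a chart -/

section ChartDual

attribute [local instance] FractionRing.liftAlgebra FractionRing.isScalarTower_liftAlgebra

variable {K : Type*} [Field K] [Algebra ℂ K] [hK : Fact (IsCurveFunctionField K)]
variable [Algebra ℂ[X] K] [IsScalarTower ℂ ℂ[X] K]
  [IsDedekindDomain (ChartRing K)] [IsFractionRing (ChartRing K) K]

/-- The functions on the chart with poles bounded by a divisor. -/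
def chartIdeal (D : Point K →₀ ℤ) : FractionalIdeal (ChartRing K)⁰ K :=
  ∏ᶠ v : HeightOneSpectrum (ChartRing K),
    (v.asIdeal : FractionalIdeal (ChartRing K)⁰ K) ^ (-D ((chartEquiv K).symm v).1)

theorem chartIdeal_ne_zero (D : Point K →₀ ℤ) : chartIdeal D ≠ 0 :=
  finprod_induction (p := fun H : FractionalIdeal (ChartRing K)⁰ K => H ≠ 0) one_ne_zero
    (fun _ _ ha hb => mul_ne_zero ha hb)
    fun v => zpow_ne_zero _ (FractionalIdeal.coeIdeal_ne_zero.2 v.ne_bot)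

theorem count_chartIdeal (D : Point K →₀ ℤ) (v : HeightOneSpectrum (ChartRing K)) :
    FractionalIdeal.count K v (chartIdeal D) = -D ((chartEquiv K).symm v).1 := by
  refine FractionalIdeal.count_finprod K v (fun v => -D ((chartEquiv K).symm v).1) ?_
  rw [Filter.eventually_cofinite]
  have h1 : Set.InjOn (fun v => ((chartEquiv K).symm v).1)
      ((fun v => ((chartEquiv K).symm v).1) ⁻¹' (D.support : Set (Point K))) := fun v _ w _ h =>
    (chartEquiv K).symm.injective (Subtype.ext h)
  refine (Set.Finite.preimage h1 D.support.finite_toSet).subset fun v hv => ?_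
  simpa using hv

theorem mem_chartIdeal {D : Point K →₀ ℤ} {z : K} :
    z ∈ chartIdeal D ↔ ∀ P : Point K, algebraMap ℂ[X] K Polynomial.X ∈ P.O → z ∈ P.fil (-D P) := by
  rw [mem_fractionalIdeal_iff (chartIdeal_ne_zero D)]
  constructor
  · intro h P hP
    have := h (chartEquiv K ⟨P, hP⟩)
    rwa [count_chartIdeal, Equiv.symm_apply_apply, chartEquiv_valuation] at this
  · intro h v
    rw [count_chartIdeal, ← chartEquiv_symm_val]
    exact h _ ((chartEquiv K).symm v).2

theorem count_differentIdeal (k : Type*) [Field k] [Algebra ℂ[X] k] [IsFractionRing ℂ[X] k]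
    [Algebra k K] [IsScalarTower ℂ[X] k K] [FiniteDimensional k K]
    [Module.Finite ℂ[X] (ChartRing K)] [Module.IsTorsionFree ℂ[X] (ChartRing K)]
    (P : {P : Point K // algebraMap ℂ[X] K Polynomial.X ∈ P.O}) {c : ℂ}
    (hc : 0 < P.1.ord (algebraMap ℂ[X] K (Polynomial.X - Polynomial.C c))) :
    FractionalIdeal.count K (chartEquiv K P) (differentIdeal ℂ[X] (ChartRing K) :
      FractionalIdeal (ChartRing K)⁰ K) =
      P.1.ord (algebraMap ℂ[X] K (Polynomial.X - Polynomial.C c)) - 1 := by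
  have hinjK : Function.Injective (algebraMap ℂ[X] K) := by
    rw [IsScalarTower.algebraMap_eq ℂ[X] k K]
    exact (algebraMap k K).injective.comp (IsFractionRing.injective ℂ[X] k)
  have hinj : Function.Injective (algebraMap ℂ[X] (ChartRing K)) := by
    rw [IsScalarTower.algebraMap_eq ℂ[X] (ChartRing K) K] at hinjK
    exact Function.Injective.of_comp (f := algebraMap (ChartRing K) K) hinjK
  have : FaithfulSMul ℂ[X] (ChartRing K) := (faithfulSMul_iff_algebraMap_injective _ _).2 hinj
  have hch := charZero_of_isFractionRing (FractionRing ℂ[X])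
  have : FiniteDimensional (FractionRing ℂ[X]) (FractionRing (ChartRing K)) := by
    have : IsLocalization (Algebra.algebraMapSubmonoid (ChartRing K) ℂ[X]⁰) (FractionRing (ChartRing K)) :=
      IsIntegralClosure.isLocalization _ (FractionRing ℂ[X]) _ _
    exact .of_isLocalization ℂ[X] (ChartRing K) ℂ[X]⁰
  set v := chartEquiv K P with hv
  set p : Ideal ℂ[X] := Ideal.span {Polynomial.X - Polynomial.C c} with hp
  have hpm : p.IsMaximal :=
    PrincipalIdealRing.isMaximal_of_irreducible (Polynomial.irreducible_X_sub_C c)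
  have hπ0 : (Polynomial.X - Polynomial.C c) ≠ (0 : ℂ[X]) := Polynomial.X_sub_C_ne_zero c
  have hp0 : p ≠ ⊥ := by simpa [hp] using hπ0
  have hover : v.asIdeal.LiesOver p := by
    constructor
    refine hpm.eq_of_le (Ideal.comap_ne_top _ v.isPrime.ne_top) ?_
    rw [Ideal.span_le, Set.singleton_subset_iff, SetLike.mem_coe, Ideal.mem_comap, mem_asIdeal_iff,
      hv, Equiv.symm_apply_apply]
    change algebraMap ℂ[X] K _ ∈ P.1.fil 1
    rw [P.1.mem_fil (by rw [Ne, map_eq_zero_iff _ hinjK]; exact hπ0)]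
    exact hc
  have hmap0 : p.map (algebraMap ℂ[X] (ChartRing K)) ≠ ⊥ := by
    rw [Ne, Ideal.map_eq_bot_iff_of_injective hinj]; exact hp0
  have hram := ramificationIdx_eq_ord k P (p := p) hp hπ0
  rw [← hv, Ideal.IsDedekindDomain.ramificationIdx_eq_multiplicity p _ hmap0] at hram
  set e := multiplicity v.asIdeal (p.map (algebraMap ℂ[X] (ChartRing K))) with he
  obtain ⟨m, hm⟩ : ∃ m, e = m + 1 := ⟨e - 1, by omega⟩
  have hdvd : v.asIdeal ^ e ∣ p.map (algebraMap ℂ[X] (ChartRing K)) := pow_multiplicity_dvd _ _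
  have hndvd : ¬ v.asIdeal ^ (e + 1) ∣ p.map (algebraMap ℂ[X] (ChartRing K)) := by
    have hfin : FiniteMultiplicity v.asIdeal (p.map (algebraMap ℂ[X] (ChartRing K))) :=
      FiniteMultiplicity.of_prime_left (Ideal.prime_of_isPrime v.ne_bot v.isPrime) hmap0
    exact hfin.not_pow_dvd_of_multiplicity_lt (Nat.lt_succ_self _)
  obtain ⟨Q, hQ⟩ := hdvd
  have hcop : IsCoprime (v.asIdeal ^ e) Q := by
    refine IsCoprime.pow_left ?_
    rw [Ideal.isCoprime_iff_sup_eq]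
    refine v.isMaximal.1.2 _ (lt_of_le_of_ne le_sup_left fun h => hndvd ?_)
    rw [hQ, pow_succ]
    exact mul_dvd_mul_left _ (Ideal.dvd_iff_le.2 (h ▸ le_sup_right))
  have : CharZero (ℂ[X] ⧸ p) :=
    charZero_of_injective_algebraMap (R := ℂ) (algebraMap ℂ (ℂ[X] ⧸ p)).injective
  have h1 : v.asIdeal ^ m ∣ differentIdeal ℂ[X] (ChartRing K) := by
    have := pow_sub_one_dvd_differentIdeal ℂ[X] v.asIdeal e hp0 ⟨Q, hQ⟩
    rwa [hm] at this
  have h2 : ¬ v.asIdeal ^ (m + 1) ∣ differentIdeal ℂ[X] (ChartRing K) := by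
    rw [← hm]
    refine not_pow_dvd_differentIdeal (p := p) v.asIdeal Q e ?_ hcop hQ.symm
    intro h
    exact v.isPrime.ne_top (top_le_iff.1 (h ▸ Ideal.pow_le_self (by omega)))
  rw [count_coeIdeal_eq differentIdeal_ne_bot v h1 h2]
  omega

theorem forall_trace_mem_iff (k : Type*) [Field k] [Algebra ℂ[X] k] [IsFractionRing ℂ[X] k]
    [Algebra k K] [IsScalarTower ℂ[X] k K] [FiniteDimensional k K]
    [Module.Finite ℂ[X] (ChartRing K)] {κ : Point K →₀ ℤ}
    (hκ : ∀ (P : Point K) (c : ℂ),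
      0 < P.ord (algebraMap ℂ[X] K (Polynomial.X - Polynomial.C c)) →
        κ P = P.ord (algebraMap ℂ[X] K (Polynomial.X - Polynomial.C c)) - 1)
    (D : Point K →₀ ℤ) (y : K) :
    (∀ z ∈ chartIdeal D, Algebra.trace k K (y * z) ∈ (algebraMap ℂ[X] k).range) ↔
      ∀ P : Point K, algebraMap ℂ[X] K Polynomial.X ∈ P.O → y ∈ P.fil (D P - κ P) := by
  have hch := charZero_of_isFractionRing k
  have hinjK : Function.Injective (algebraMap ℂ[X] K) := by
    rw [IsScalarTower.algebraMap_eq ℂ[X] k K]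
    exact (algebraMap k K).injective.comp (IsFractionRing.injective ℂ[X] k)
  have hinj : Function.Injective (algebraMap ℂ[X] (ChartRing K)) := by
    rw [IsScalarTower.algebraMap_eq ℂ[X] (ChartRing K) K] at hinjK
    exact Function.Injective.of_comp (f := algebraMap (ChartRing K) K) hinjK
  have hT : Module.IsTorsionFree ℂ[X] (ChartRing K) := by
    rw [Module.isTorsionFree_iff_algebraMap_injective]; exact hinj
  have h1 : (∀ z ∈ chartIdeal D, Algebra.trace k K (y * z) ∈ (algebraMap ℂ[X] k).range) ↔
      y ∈ FractionalIdeal.dual ℂ[X] k (chartIdeal D) := by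
    rw [FractionalIdeal.mem_dual (chartIdeal_ne_zero D)]
    rfl
  have hd1 : FractionalIdeal.dual ℂ[X] k (1 : FractionalIdeal (ChartRing K)⁰ K) ≠ 0 :=
    FractionalIdeal.dual_ne_zero ℂ[X] k one_ne_zero
  rw [h1, mem_fractionalIdeal_iff (FractionalIdeal.dual_ne_zero ℂ[X] k (chartIdeal_ne_zero D))]
  have h2 : ∀ P (hP : algebraMap ℂ[X] K Polynomial.X ∈ P.O),
      -FractionalIdeal.count K (chartEquiv K ⟨P, hP⟩) (FractionalIdeal.dual ℂ[X] k (chartIdeal D)) =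
        -(D P - κ P) := by
    intro P hP
    obtain ⟨c, hc⟩ := P.exists_residue hP
    have hc' : 0 < P.ord (algebraMap ℂ[X] K (Polynomial.X - Polynomial.C c)) := by
      have h3 : algebraMap ℂ[X] K (Polynomial.X - Polynomial.C c) =
          algebraMap ℂ[X] K Polynomial.X - algebraMap ℂ K c := by
        rw [map_sub, IsScalarTower.algebraMap_apply ℂ ℂ[X] K]; rfl
      rw [← h3, P.mem_fil (by
        rw [Ne, map_eq_zero_iff _ hinjK]; exact Polynomial.X_sub_C_ne_zero c)] at hc
      omega
    have h4 := count_differentIdeal k ⟨P, hP⟩ hc'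
    rw [coeIdeal_differentIdeal ℂ[X] k, FractionalIdeal.count_inv] at h4
    rw [FractionalIdeal.dual_eq_mul_inv, FractionalIdeal.count_mul _ _ hd1
      (inv_ne_zero (chartIdeal_ne_zero D)), FractionalIdeal.count_inv, count_chartIdeal,
      Equiv.symm_apply_apply, hκ P c hc']
    dsimp only at h4 ⊢
    omega
  constructor
  · intro h P hP
    have := h (chartEquiv K ⟨P, hP⟩)
    rwa [h2 P hP, chartEquiv_valuation] at this
  · intro h v
    obtain ⟨⟨P, hP⟩, rfl⟩ := (chartEquiv K).surjective v
    rw [h2 P hP, chartEquiv_valuation]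
    exact h P hP

end ChartDual

section RRSpace

variable {K : Type*} [Field K] [Algebra ℂ K] [hK : Fact (IsCurveFunctionField K)]

/-- The functions with poles bounded by `D` at the points of the set `S`. -/
def boundedOn (S : Set (Point K)) (D : Point K →₀ ℤ) : Submodule ℂ K where
  carrier := {z | ∀ P ∈ S, z ∈ P.fil (-D P)}
  add_mem' ha hb P hP := add_mem (ha P hP) (hb P hP)
  zero_mem' _ _ := zero_mem _
  smul_mem' c _ hz P hP := P.smul_mem_fil c (hz P hP)

theorem mem_boundedOn {S : Set (Point K)} {D : Point K →₀ ℤ} {z : K} :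
    z ∈ boundedOn S D ↔ ∀ P ∈ S, z ∈ P.fil (-D P) := Iff.rfl

/-- The points of the chart on which `x` is regular. -/
def chart (x : K) : Set (Point K) := {P | x ∈ P.O}

theorem mem_chart {x : K} {P : Point K} : P ∈ chart x ↔ x ∈ P.O := Iff.rfl

theorem mem_chart_or_inv (x : K) (P : Point K) : P ∈ chart x ∨ P ∈ chart x⁻¹ := P.O.mem_or_inv_mem x

/-- The Riemann–Roch space `H⁰(𝒪(D))`. -/
def rrSpace (D : Point K →₀ ℤ) : Submodule ℂ K := boundedOn Set.univ D

theorem mem_rrSpace {D : Point K →₀ ℤ} {z : K} :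
    z ∈ rrSpace D ↔ ∀ P : Point K, z ∈ P.fil (-D P) := by
  simp [rrSpace, mem_boundedOn]

theorem mem_rrSpace_iff {x : K} {D : Point K →₀ ℤ} {z : K} :
    z ∈ rrSpace D ↔ z ∈ boundedOn (chart x) D ∧ z ∈ boundedOn (chart x⁻¹) D := by
  rw [mem_rrSpace]
  refine ⟨fun h => ⟨fun P _ => h P, fun P _ => h P⟩, fun h P => ?_⟩
  rcases mem_chart_or_inv x P with hP | hP
  · exact h.1 P hP
  · exact h.2 P hP

theorem boundedOn_mono {S : Set (Point K)} {D D' : Point K →₀ ℤ} (h : D ≤ D') :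
    boundedOn S D ≤ boundedOn S D' := fun z hz P hP =>
  P.fil_anti (by have := h P; omega) (hz P hP)

theorem trace_mem_chart_iff {x : K} (hx : Transcendental ℂ x) {k : IntermediateField ℂ K}
    (hk : k = IntermediateField.adjoin ℂ {x}) {κ : Point K →₀ ℤ}
    (hκ : ∀ (P : Point K) (c : ℂ), 0 < P.ord (x - algebraMap ℂ K c) →
      κ P = P.ord (x - algebraMap ℂ K c) - 1) (D : Point K →₀ ℤ) (y : K) :
    (∀ z ∈ boundedOn (chart x) D, ∃ p : ℂ[X],
      (Algebra.trace k K (y * z) : K) = Polynomial.aeval x p) ↔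
      ∀ P ∈ chart x, y ∈ P.fil (D P - κ P) := by
  subst hk
  refine chart_induction hK.out hx ?_
  intro _ _ _ _ _ _ _ _ _ hmap
  have hX : algebraMap ℂ[X] K Polynomial.X = x := by rw [hmap]; simp
  have hXc : ∀ c : ℂ, algebraMap ℂ[X] K (Polynomial.X - Polynomial.C c) = x - algebraMap ℂ K c := by
    intro c; rw [hmap]; simp
  have h := forall_trace_mem_iff (IntermediateField.adjoin ℂ {x}) (κ := κ)
    (fun P c => by rw [hXc]; exact hκ P c) D y
  rw [hX] at h
  change _ ↔ ∀ P : Point K, x ∈ P.O → y ∈ P.fil (D P - κ P)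
  rw [← h]
  have hz : ∀ z, z ∈ chartIdeal D ↔ z ∈ boundedOn (chart x) D := fun z => by
    rw [mem_chartIdeal, hX]; rfl
  refine forall_congr' fun z => ?_
  rw [hz]
  refine forall_congr' fun _ => ?_
  rw [RingHom.mem_range]
  refine exists_congr fun p => ?_
  rw [← hmap, IsScalarTower.algebraMap_apply ℂ[X] (IntermediateField.adjoin ℂ {x}) K, eq_comm]
  exact Subtype.ext_iff.symm

theorem exists_mem_boundedOn_add_single {x : K} (hx : Transcendental ℂ x) (D : Point K →₀ ℤ)
    {P : Point K} (hP : P ∈ chart x) :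
    ∃ g ∈ boundedOn (chart x) (D + Finsupp.single P 1), g ∉ boundedOn (chart x) D := by
  refine chart_induction hK.out hx ?_
  intro _ _ _ _ _ _ _ _ _ hmap
  have hX : algebraMap ℂ[X] K Polynomial.X = x := by rw [hmap]; simp
  have hz : ∀ (D : Point K →₀ ℤ) z, z ∈ chartIdeal D ↔ z ∈ boundedOn (chart x) D := fun D z => by
    rw [mem_chartIdeal, hX]; rfl
  by_contra! hcon
  have hle : chartIdeal (D + Finsupp.single P 1) ≤ chartIdeal D := fun z hz' =>
    (hz D z).2 (hcon z ((hz _ z).1 hz'))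
  have := FractionalIdeal.count_mono K (chartEquiv K ⟨P, by rw [hX]; exact hP⟩) (chartIdeal_ne_zero _) hle
  rw [count_chartIdeal, count_chartIdeal, Equiv.symm_apply_apply] at this
  simp at this

theorem exists_basis_boundedOn {x : K} (hx : Transcendental ℂ x) {k : IntermediateField ℂ K}
    (hk : k = IntermediateField.adjoin ℂ {x}) (D : Point K →₀ ℤ) :
    ∃ (n : ℕ) (v : Module.Basis (Fin n) k K), ∀ z, z ∈ boundedOn (chart x) D ↔
      ∃ p : Fin n → ℂ[X], z = ∑ i, Polynomial.aeval x (p i) * v i := by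
  subst hk
  refine chart_induction hK.out hx ?_
  intro _ _ _ _ _ _ _ _ hfin hmap
  have hX : algebraMap ℂ[X] K Polynomial.X = x := by rw [hmap]; simp
  have hz : ∀ z, z ∈ chartIdeal D ↔ z ∈ boundedOn (chart x) D := fun z => by
    rw [mem_chartIdeal, hX]; rfl
  have hinjK : Function.Injective (algebraMap ℂ[X] K) := by
    rw [IsScalarTower.algebraMap_eq ℂ[X] (IntermediateField.adjoin ℂ {x}) K]
    exact (algebraMap (IntermediateField.adjoin ℂ {x}) K).injective.comp (IsFractionRing.injective ℂ[X] _)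
  have hT : Module.IsTorsionFree ℂ[X] K := by
    rw [Module.isTorsionFree_iff_algebraMap_injective]; exact hinjK
  let I := chartIdeal D
  let M : Submodule ℂ[X] K := (I : Submodule (ChartRing K) K).restrictScalars ℂ[X]
  have : Module.Finite (ChartRing K) (I : Submodule (ChartRing K) K) := by
    have := FractionalIdeal.isNoetherian I
    infer_instance
  have hMfin : Module.Finite ℂ[X] M := by
    have : Module.Finite ℂ[X] (I : Submodule (ChartRing K) K) := Module.Finite.trans (ChartRing K) _
    exact this
  have hMfree : Module.Free ℂ[X] M := inferInstance
  let b := Module.finBasis ℂ[X] M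
  have hli : LinearIndependent ℂ[X] (fun i => (b i : K)) :=
    b.linearIndependent.map' M.subtype (Submodule.ker_subtype M)
  have hlik : LinearIndependent (IntermediateField.adjoin ℂ {x}) (fun i => (b i : K)) :=
    (LinearIndependent.iff_fractionRing (R := ℂ[X]) (K := IntermediateField.adjoin ℂ {x})).1 hli
  have hspanM : ∀ z ∈ M, ∃ p : Fin (Module.finrank ℂ[X] M) → ℂ[X], z = ∑ i, Polynomial.aeval x (p i) * (b i : K) := by
    intro z hzM
    refine ⟨fun i => b.repr ⟨z, hzM⟩ i, ?_⟩
    have := congrArg (fun m : M => (m : K)) (b.sum_repr ⟨z, hzM⟩)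
    simp only at this
    refine this.symm.trans ?_
    rw [AddSubmonoidClass.coe_finsetSum]
    refine Finset.sum_congr rfl fun i _ => ?_
    rw [Submodule.coe_smul, Algebra.smul_def, hmap]
  have hspan : ⊤ ≤ Submodule.span (IntermediateField.adjoin ℂ {x}) (Set.range fun i => (b i : K)) := by
    rintro z -
    have hMspan : ∀ m ∈ M, m ∈ Submodule.span (IntermediateField.adjoin ℂ {x}) (Set.range fun i => (b i : K)) := by
      intro m hm
      obtain ⟨p, rfl⟩ := hspanM m hm
      refine Submodule.sum_mem _ fun i _ => ?_
      rw [← hmap, IsScalarTower.algebraMap_apply ℂ[X] (IntermediateField.adjoin ℂ {x}) K, ← Algebra.smul_def]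
      exact Submodule.smul_mem _ _ (Submodule.subset_span ⟨i, rfl⟩)
    obtain ⟨m, hm, hm0⟩ : ∃ m ∈ I, m ≠ 0 := by
      by_contra! hcon
      exact chartIdeal_ne_zero D ((FractionalIdeal.eq_zero_iff).2 hcon)
    have halg : IsAlgebraic ℂ[X] (z / m) := by
      have : Algebra.IsAlgebraic ℂ[X] K :=
        (IsFractionRing.comap_isAlgebraic_iff (A := ℂ[X]) (K := IntermediateField.adjoin ℂ {x}) (C := K)).2 inferInstance
      exact Algebra.IsAlgebraic.isAlgebraic _
    obtain ⟨q, hq0, hq⟩ := halg.exists_integral_multiple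
    have h1 : algebraMap ℂ[X] K q * z ∈ M := by
      have : algebraMap ℂ[X] K q * z = (⟨q • (z / m), hq⟩ : ChartRing K) • m := by
        rw [Algebra.smul_def]
        change _ = (q • (z / m)) * m
        rw [Algebra.smul_def, mul_assoc, div_mul_cancel₀ _ hm0]
      rw [this]
      exact (I : Submodule (ChartRing K) K).smul_mem _ hm
    have h2 := hMspan _ h1
    have hqk : algebraMap ℂ[X] (IntermediateField.adjoin ℂ {x}) q ≠ 0 := by
      rw [Ne, map_eq_zero_iff _ (IsFractionRing.injective ℂ[X] _)]; exact hq0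
    have h3 : z = (algebraMap ℂ[X] (IntermediateField.adjoin ℂ {x}) q)⁻¹ • (algebraMap ℂ[X] K q * z) := by
      rw [IsScalarTower.algebraMap_apply ℂ[X] (IntermediateField.adjoin ℂ {x}) K, ← Algebra.smul_def,
        smul_smul, inv_mul_cancel₀ hqk, one_smul]
    rw [h3]
    exact Submodule.smul_mem _ _ h2
  refine ⟨_, Module.Basis.mk hlik hspan, fun z => ?_⟩
  simp only [Module.Basis.mk_apply]
  rw [← hz]
  constructor
  · exact fun h => hspanM z h
  · rintro ⟨p, rfl⟩
    change _ ∈ M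
    refine Submodule.sum_mem _ fun i _ => ?_
    rw [← hmap, ← Algebra.smul_def]
    exact M.smul_mem _ (b i).2

end RRSpace

section LineBundleDiv

variable {K : Type*} [Field K] [Algebra ℂ K] [hK : Fact (IsCurveFunctionField K)]
variable {V : Type*} [AddCommGroup V] [Module K V] {L : Family K V} {s : V} {D : Point K →₀ ℤ}

theorem HasDiv.smul (h : HasDiv L s D) {f : K} (hf : f ≠ 0) : HasDiv L (f • s) (D + divf f) where
  ne_zero := smul_ne_zero hf h.ne_zero
  exists_smul v := by
    obtain ⟨g, rfl⟩ := h.exists_smul v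
    exact ⟨g / f, by rw [smul_smul, div_mul_cancel₀ _ hf]⟩
  mem_iff P g := by
    rw [smul_smul, h.mem_iff, P.mul_mem_fil_iff hf, Finsupp.add_apply, divf_apply]
    congr! 1
    ring_nf

theorem Point.fil_injective (P : Point K) {m n : ℤ} (h : ∀ f : K, f ∈ P.fil m ↔ f ∈ P.fil n) :
    m = n := by
  obtain ⟨a, ha0, ha⟩ := P.exists_ord_eq m
  obtain ⟨b, hb0, hb⟩ := P.exists_ord_eq n
  have h1 := h a
  have h2 := h b
  rw [P.mem_fil ha0, P.mem_fil ha0] at h1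
  rw [P.mem_fil hb0, P.mem_fil hb0] at h2
  omega

theorem HasDiv.unique (h : HasDiv L s D) {D' : Point K →₀ ℤ} (h' : HasDiv L s D') : D = D' := by
  ext P
  have := P.fil_injective (m := -D P) (n := -D' P) fun f => by rw [← h.mem_iff, h'.mem_iff]
  omega

end LineBundleDiv

section Jump

variable {K : Type*} [Field K] [Algebra ℂ K] [hK : Fact (IsCurveFunctionField K)]

theorem adjoin_inv (x : K) :
    IntermediateField.adjoin ℂ {x⁻¹} = IntermediateField.adjoin ℂ {x} := by
  apply le_antisymm <;> rw [IntermediateField.adjoin_simple_le_iff]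
  · exact inv_mem (IntermediateField.mem_adjoin_simple_self ℂ x)
  · rw [← inv_inv x]
    simpa using inv_mem (IntermediateField.mem_adjoin_simple_self ℂ x⁻¹)

theorem aeval_inv_mul_pow {x : K} (hx : x ≠ 0) (q : ℂ[X]) {N : ℕ} (hq : q.natDegree ≤ N) :
    Polynomial.aeval x⁻¹ q * x ^ N = Polynomial.aeval x (q.reflect N) := by
  have : Invertible x := invertibleOfNonzero hx
  have h := Polynomial.eval₂_reflect_mul_pow (algebraMap ℂ K) x N (q.reflect N)
    ((Polynomial.natDegree_reflect_le (p := q) (N := N)).trans (by simp [hq]))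
  rw [Polynomial.reflect_reflect, invOf_eq_inv] at h
  exact h

theorem eq_zero_of_mul_aeval_eq {x : K} (hx : Transcendental ℂ x) {p q : ℂ[X]}
    (h : x * Polynomial.aeval x p = Polynomial.aeval x⁻¹ q) : p = 0 := by
  have hinj := transcendental_iff_injective.1 hx
  have h1 := aeval_inv_mul_pow (ne_zero_of_transcendental hx) q le_rfl
  rw [← h] at h1
  have h2 : Polynomial.X ^ (q.natDegree + 1) * p = q.reflect q.natDegree := by
    apply hinj
    rw [← h1]; simp; ring
  by_contra hp
  have h3 := congrArg Polynomial.natDegree h2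
  rw [Polynomial.natDegree_X_pow_mul _ hp] at h3
  have h4 := Polynomial.natDegree_reflect_le (p := q) (N := q.natDegree)
  simp only [max_self] at h4
  omega

theorem D_inv (x : K) : KaehlerDifferential.D ℂ K x⁻¹ =
    (-(x ^ 2)⁻¹) • KaehlerDifferential.D ℂ K x := by
  rw [Derivation.leibniz_inv, neg_smul, inv_pow, neg_smul]

theorem divf_mul {f g : K} (hf : f ≠ 0) (hg : g ≠ 0) : divf (f * g) = divf f + divf g := by
  ext P; simp [divf_apply, P.ord_mul hf hg]

theorem mem_rrSpace_sub_iff [Nontrivial (Ω[K⁄ℂ])] {x : K} (hx : Transcendental ℂ x)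
    {k : IntermediateField ℂ K} (hk : k = IntermediateField.adjoin ℂ {x})
    {κ : Point K →₀ ℤ} (hκ : HasDiv (omega K) (KaehlerDifferential.D ℂ K x) κ)
    (D : Point K →₀ ℤ) (y : K) : y ∈ rrSpace (κ - D) ↔
      (∀ z ∈ boundedOn (chart x) D, ∃ p : ℂ[X],
        (Algebra.trace k K (y * z) : K) = Polynomial.aeval x p) ∧
      (∀ z ∈ boundedOn (chart x⁻¹) D, ∃ p : ℂ[X],
        x ^ 2 * (Algebra.trace k K (y * z) : K) = Polynomial.aeval x⁻¹ p) := by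
  have hx0 := ne_zero_of_transcendental hx
  obtain ⟨κ₁, h1, h1'⟩ := exists_hasDiv_omega hx
  obtain rfl := hκ.unique h1
  obtain ⟨κ₂, h2, h2'⟩ := exists_hasDiv_omega (OcticScroll.Transcendental.inv' hx)
  rw [D_inv x] at h2
  have hne : -(x ^ 2)⁻¹ ≠ 0 := by simp [hx0]
  have hκ₂ : ∀ P : Point K, κ₂ P = κ P - 2 * P.ord x := by
    intro P
    rw [h2.unique (hκ.smul hne)]
    simp only [Finsupp.add_apply, divf_apply, P.ord_neg, P.ord_inv, P.ord_pow]
    ring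
  rw [trace_mem_chart_iff hx hk h1' D y, mem_rrSpace_iff (x := x)]
  have h3 := trace_mem_chart_iff (OcticScroll.Transcendental.inv' hx) (hk.trans (adjoin_inv x).symm) h2' D (x ^ 2 * y)
  have h4 : ∀ z, ((Algebra.trace k K (x ^ 2 * y * z) : k) : K) = x ^ 2 * (Algebra.trace k K (y * z) : k) := by
    intro z
    have hxk : x ^ 2 ∈ k := by rw [hk]; exact pow_mem (IntermediateField.mem_adjoin_simple_self ℂ x) 2
    have : x ^ 2 * y * z = (⟨x ^ 2, hxk⟩ : k) • (y * z) := by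
      rw [Algebra.smul_def, mul_assoc]; rfl
    rw [this, map_smul]; rfl
  simp only [h4] at h3
  rw [h3]
  refine and_congr ?_ ?_
  · rw [mem_boundedOn]
    refine forall₂_congr fun P _ => ?_
    rw [Finsupp.sub_apply, neg_sub]
  · rw [mem_boundedOn]
    refine forall₂_congr fun P _ => ?_
    rw [Finsupp.sub_apply, neg_sub, mul_comm, P.mul_mem_fil_iff (pow_ne_zero 2 hx0), hκ₂, P.ord_pow]
    congr! 1
    push_cast; ring_nf

theorem boundedOn_add_single_of_notMem {S : Set (Point K)} {D : Point K →₀ ℤ} {P : Point K}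
    (hP : P ∉ S) : boundedOn S (D + Finsupp.single P 1) = boundedOn S D := by
  ext z
  refine forall₂_congr fun Q hQ => ?_
  have : P ≠ Q := by rintro rfl; exact hP hQ
  simp [this]

theorem mul_mem_boundedOn {S : Set (Point K)} {D : Point K →₀ ℤ} {P : Point K} {x z : K}
    (hS : ∀ Q ∈ S, x ∈ Q.O) (hxP : x ∈ P.fil 1)
    (hz : z ∈ boundedOn S (D + Finsupp.single P 1)) : x * z ∈ boundedOn S D := by
  intro Q hQ
  by_cases h : P = Q
  · subst h
    have := P.mul_mem_fil hxP (hz P hQ)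
    simpa using this
  · have := Q.mul_mem_fil (Q.mem_fil_zero.2 (hS Q hQ)) (hz Q hQ)
    simpa [Finsupp.single_apply, h] using this

theorem mem_rrSpace_of_mem_add_single [Nontrivial (Ω[K⁄ℂ])] {x : K} (hx : Transcendental ℂ x)
    {κ : Point K →₀ ℤ} (hκ : HasDiv (omega K) (KaehlerDifferential.D ℂ K x) κ)
    {P : Point K} (hxP : x ∈ P.fil 1) (hxP' : P ∉ chart x⁻¹) {D : Point K →₀ ℤ} {f y : K}
    (hy : y ∈ rrSpace (κ - D)) (hf : f ∈ rrSpace (D + Finsupp.single P 1)) (hfD : f ∉ rrSpace D) :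
    y ∈ rrSpace (κ - (D + Finsupp.single P 1)) := by
  have hx0 := ne_zero_of_transcendental hx
  rw [mem_rrSpace_sub_iff hx rfl hκ] at hy ⊢
  rw [boundedOn_add_single_of_notMem hxP']
  refine ⟨?_, hy.2⟩
  have hfb := (mem_rrSpace_iff (x := x)).1 hf
  set k := IntermediateField.adjoin ℂ {x}
  have htr : (Algebra.trace k K (y * f) : K) = 0 := by
    obtain ⟨p, hp⟩ := hy.1 (x * f) (mul_mem_boundedOn (fun Q hQ => hQ) hxP hfb.1)
    obtain ⟨q, hq⟩ := hy.2 f (by rw [← boundedOn_add_single_of_notMem hxP']; exact hfb.2)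
    have h1 : ((Algebra.trace k K (y * (x * f)) : k) : K) = x * (Algebra.trace k K (y * f) : k) := by
      have hxk : x ∈ k := IntermediateField.mem_adjoin_simple_self ℂ x
      have : y * (x * f) = (⟨x, hxk⟩ : k) • (y * f) := by
        rw [Algebra.smul_def]; change _ = x * (y * f); ring
      rw [this, map_smul]; rfl
    rw [h1] at hp
    have h2 : x * Polynomial.aeval x p = Polynomial.aeval x⁻¹ q := by rw [← hp, ← hq]; ring
    rw [eq_zero_of_mul_aeval_eq hx h2, map_zero] at hp
    exact (mul_eq_zero.1 hp).resolve_left hx0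
  have hfP : f ∉ P.fil (-D P) := by
    intro hcon
    apply hfD
    rw [mem_rrSpace]
    intro Q
    by_cases h : P = Q
    · exact h ▸ hcon
    · have := mem_rrSpace.1 hf Q
      simpa [Finsupp.single_apply, h] using this
  have hf0 : f ≠ 0 := by rintro rfl; exact hfP (zero_mem _)
  have hford : P.ord f = -D P - 1 := by
    have h1 := mem_rrSpace.1 hf P
    rw [P.mem_fil hf0] at h1 hfP
    simp only [Finsupp.add_apply, Finsupp.single_eq_same] at h1
    omega
  intro z hz
  obtain ⟨c, hc⟩ := P.exists_sub_smul_mem_fil hf0 (z := z) (by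
    have := hz P (P.mem_fil_zero.1 (P.fil_anti (by norm_num) hxP))
    rw [hford]
    simpa [sub_eq_add_neg, add_comm] using this)
  rw [hford] at hc
  have ha : z - c • f ∈ boundedOn (chart x) D := by
    intro Q hQ
    by_cases h : P = Q
    · subst h; simpa using hc
    · have := (sub_mem hz (Submodule.smul_mem _ c hfb.1)) Q hQ
      simpa [Finsupp.single_apply, h] using this
  obtain ⟨p, hp⟩ := hy.1 _ ha
  refine ⟨p, ?_⟩
  rw [← hp]
  have h1 : y * z = y * (z - c • f) + (algebraMap ℂ k c) • (y * f) := by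
    rw [mul_sub, Algebra.smul_def, Algebra.smul_def, ← IsScalarTower.algebraMap_apply]; ring
  rw [h1, map_add, map_smul]
  change _ + (algebraMap ℂ k c : K) * _ = _
  rw [htr]; simp

theorem exists_neg_le (D : Point K →₀ ℤ) : ∃ N : ℕ, ∀ P, -(N : ℤ) ≤ D P := by
  refine ⟨∑ P ∈ D.support, (D P).natAbs, fun P => ?_⟩
  by_cases h : P ∈ D.support
  · have := Finset.single_le_sum (f := fun P => (D P).natAbs) (fun _ _ => Nat.zero_le _) h
    omega
  · rw [Finsupp.notMem_support_iff.1 h]; omega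

theorem exists_pow_mul_mem_boundedOn {x z : K} {D : Point K →₀ ℤ} (hx : x ≠ 0)
    (hz : z ∈ boundedOn (chart x) D) :
    ∃ N : ℕ, ∀ m, N ≤ m → (x⁻¹) ^ m * z ∈ boundedOn (chart x⁻¹) D := by
  by_cases hz0 : z = 0
  · exact ⟨0, fun m _ => by simp [hz0]⟩
  obtain ⟨N, hN⟩ := exists_neg_le (divf z + D)
  refine ⟨N, fun m hm P hP => ?_⟩
  have hxi : x⁻¹ ^ m ≠ 0 := pow_ne_zero _ (inv_ne_zero hx)
  rw [P.mem_fil (mul_ne_zero hxi hz0), P.ord_mul hxi hz0, P.ord_pow]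
  have h1 := hN P
  rw [Finsupp.add_apply, divf_apply] at h1
  rw [mem_chart, P.mem_O_iff (inv_ne_zero hx)] at hP
  rcases hP.lt_or_eq with h | h
  · nlinarith
  · have h2 : x ∈ P.O := by
      rw [P.ord_inv] at h
      exact (P.mem_O_iff hx).2 (by omega)
    have h3 := hz P h2
    rw [P.mem_fil hz0] at h3
    rw [← h]; omega

theorem aeval_mul_mem_boundedOn {x z : K} {D : Point K →₀ ℤ} (hz : z ∈ boundedOn (chart x) D)
    (p : ℂ[X]) : Polynomial.aeval x p * z ∈ boundedOn (chart x) D := by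
  intro P hP
  have h : Polynomial.aeval x p ∈ P.O := by
    induction p using Polynomial.induction_on' with
    | add p q hp hq => rw [map_add]; exact add_mem hp hq
    | monomial n a =>
      rw [Polynomial.aeval_monomial]
      exact mul_mem (P.algebraMap_mem a) (pow_mem hP n)
  have := P.mul_mem_fil (P.mem_fil_zero.2 h) (hz P hP)
  simpa using this

theorem exists_mem_rrSpace_sub [Nontrivial (Ω[K⁄ℂ])] {x : K} (hx : Transcendental ℂ x)
    {κ : Point K →₀ ℤ} (hκ : HasDiv (omega K) (KaehlerDifferential.D ℂ K x) κ)
    {P : Point K} (hxP : x ∈ P.fil 1) (hxP' : P ∉ chart x⁻¹) {D : Point K →₀ ℤ}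
    (hD : rrSpace (D + Finsupp.single P 1) ≤ rrSpace D) :
    ∃ y ∈ rrSpace (κ - D), y ∉ rrSpace (κ - (D + Finsupp.single P 1)) := by
  have hx0 := ne_zero_of_transcendental hx
  have hinj := transcendental_iff_injective.1 hx
  have hPx : P ∈ chart x := P.mem_fil_zero.1 (P.fil_anti (by norm_num) hxP)
  let k := IntermediateField.adjoin ℂ {x}
  have hfd : FiniteDimensional k K := finiteDimensional_adjoin hK.out hx
  obtain ⟨g, hg, hgD⟩ := exists_mem_boundedOn_add_single hx D hPx
  have hg' : g ∉ boundedOn (chart x) D ⊔ boundedOn (chart x⁻¹) D := by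
    intro hcon
    obtain ⟨a, ha, b, hb, rfl⟩ := Submodule.mem_sup.1 hcon
    apply hgD
    refine add_mem ha ?_
    refine ((mem_rrSpace_iff (x := x)).1 (hD ((mem_rrSpace_iff (x := x)).2 ⟨?_, ?_⟩))).1
    · have := sub_mem hg (boundedOn_mono (D' := D + Finsupp.single P 1) (by simp) ha)
      simpa using this
    · rw [boundedOn_add_single_of_notMem hxP']; exact hb
  obtain ⟨l, hlg, hl⟩ := Submodule.exists_dual_map_eq_bot_of_notMem hg' inferInstance
  have hl' : ∀ z ∈ boundedOn (chart x) D ⊔ boundedOn (chart x⁻¹) D, l z = 0 := by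
    intro z hz
    have := Submodule.mem_map_of_mem (f := l) hz
    rwa [hl, Submodule.mem_bot] at this
  have hl0 : ∀ z ∈ boundedOn (chart x) D, l z = 0 := fun z hz => hl' z (Submodule.mem_sup_left hz)
  have hl1 : ∀ z ∈ boundedOn (chart x⁻¹) D, l z = 0 := fun z hz => hl' z (Submodule.mem_sup_right hz)
  obtain ⟨n, v, hv⟩ := exists_basis_boundedOn hx (k := k) rfl D
  have hvi : ∀ i, v i ∈ boundedOn (chart x) D := fun i => (hv _).2 ⟨fun j => if j = i then 1 else 0, by
    rw [Finset.sum_eq_single i] <;> simp +contextual⟩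
  choose N hN using fun i => exists_pow_mul_mem_boundedOn hx0 (hvi i)
  let Y : Fin n → ℂ[X] := fun i => ∑ j ∈ Finset.range (N i), Polynomial.monomial j (l (x⁻¹ ^ (j + 1) * v i))
  have hY : ∀ i j, (Y i).coeff j = l (x⁻¹ ^ (j + 1) * v i) := by
    intro i j
    simp only [Y, Polynomial.finsetSum_coeff, Polynomial.coeff_monomial]
    by_cases hj : j < N i
    · simp [hj]
    · rw [Finset.sum_eq_zero]
      · exact (hl1 _ (hN i _ (by omega))).symm
      · intro a ha
        rw [Finset.mem_range] at ha
        rw [if_neg (by omega)]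
  have hYp : ∀ i (p : ℂ[X]) m, l (x⁻¹ ^ (m + 1) * (Polynomial.aeval x p * v i)) = (p * Y i).coeff m := by
    intro i p m
    induction p using Polynomial.induction_on' with
    | add p q hp hq => rw [map_add, add_mul, mul_add, map_add, hp, hq, add_mul, Polynomial.coeff_add]
    | monomial r a =>
      rw [Polynomial.aeval_monomial, ← Polynomial.C_mul_X_pow_eq_monomial, mul_assoc, mul_assoc,
        Polynomial.coeff_C_mul, mul_left_comm, ← Algebra.smul_def, map_smul, smul_eq_mul,
        Polynomial.coeff_X_pow_mul']
      congr 1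
      split_ifs with h
      · rw [hY]
        congr 1
        obtain ⟨t, rfl⟩ := Nat.exists_eq_add_of_le h
        rw [← mul_assoc, Nat.add_sub_cancel_left, show r + t + 1 = (t + 1) + r by ring, pow_add,
          mul_assoc (x⁻¹ ^ (t + 1)), ← mul_pow, inv_mul_cancel₀ hx0, one_pow, mul_one]
      · apply hl0
        obtain ⟨t, rfl⟩ := Nat.exists_eq_add_of_lt (not_le.1 h)
        rw [← mul_assoc, show m + t + 1 = (m + 1) + t by ring, pow_add x (m + 1) t, ← mul_assoc,
          ← mul_pow, inv_mul_cancel₀ hx0, one_pow, one_mul]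
        simpa using aeval_mul_mem_boundedOn (hvi i) (Polynomial.X ^ t)
  have hxk : x ∈ k := IntermediateField.mem_adjoin_simple_self ℂ x
  have hpk : ∀ p : ℂ[X], Polynomial.aeval x p = algebraMap k K (Polynomial.aeval (⟨x, hxk⟩ : k) p) := by
    intro p; rw [← Polynomial.aeval_algebraMap_apply]; rfl
  have htrk : ∀ (p : ℂ[X]) z, ((Algebra.trace k K (Polynomial.aeval x p * z) : k) : K) =
      Polynomial.aeval x p * (Algebra.trace k K z : k) := by
    intro p z
    rw [hpk p, ← Algebra.smul_def, map_smul, smul_eq_mul]; rfl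
  let y : K := ∑ i, Polynomial.aeval x (Y i) * v.traceDual i
  have hyv : ∀ j, ((Algebra.trace k K (y * v j) : k) : K) = Polynomial.aeval x (Y j) := by
    intro j
    simp only [y, Finset.sum_mul, map_sum, AddSubmonoidClass.coe_finsetSum, mul_assoc, htrk,
      Module.Basis.trace_traceDual_mul]
    rw [Finset.sum_eq_single j] <;> simp +contextual [eq_comm]
  have key : ∀ z ∈ boundedOn (chart x) D, ∃ p : ℂ[X],
      ((Algebra.trace k K (y * z) : k) : K) = Polynomial.aeval x p ∧
      ∀ m, l (x⁻¹ ^ (m + 1) * z) = p.coeff m := by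
    intro z hz
    obtain ⟨p, rfl⟩ := (hv z).1 hz
    refine ⟨∑ i, p i * Y i, ?_, fun m => ?_⟩
    · simp only [Finset.mul_sum, map_sum, AddSubmonoidClass.coe_finsetSum, map_mul]
      refine Finset.sum_congr rfl fun i _ => ?_
      rw [mul_left_comm, htrk, hyv]
    · simp only [Finset.mul_sum, map_sum, Polynomial.finsetSum_coeff, hYp]
  refine ⟨y, (mem_rrSpace_sub_iff hx rfl hκ D y).2 ⟨fun z hz => (key z hz).imp fun _ h => h.1, ?_⟩, ?_⟩
  · intro b hb
    obtain ⟨n, hn⟩ := exists_pow_mul_mem_boundedOn (inv_ne_zero hx0) hb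
    rw [inv_inv] at hn
    obtain ⟨p, hp, hpl⟩ := key _ (hn (n + 2) (by omega))
    have hdeg : p.natDegree ≤ n := by
      rw [Polynomial.natDegree_le_iff_coeff_eq_zero]
      intro m hm
      rw [← hpl]
      apply hl1
      obtain ⟨t, rfl⟩ := Nat.exists_eq_add_of_lt hm
      rw [← mul_assoc, show n + t + 1 + 1 = t + (n + 2) by ring, pow_add, mul_assoc (x⁻¹ ^ t),
        ← mul_pow, inv_mul_cancel₀ hx0, one_pow, mul_one]
      simpa using aeval_mul_mem_boundedOn hb (Polynomial.X ^ t)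
    refine ⟨p.reflect n, ?_⟩
    have h1 := htrk (Polynomial.X ^ (n + 2)) (y * b)
    simp only [map_pow, Polynomial.aeval_X] at h1
    rw [mul_left_comm, h1] at hp
    have h2 := aeval_inv_mul_pow (inv_ne_zero hx0) p hdeg
    rw [inv_inv, ← hp] at h2
    rw [← h2, inv_pow]
    have h3 : ∀ T : K, x ^ 2 * T = x ^ (n + 2) * T * (x ^ n)⁻¹ := fun T => by field_simp; ring
    exact h3 _
  · intro hcon
    obtain ⟨q, hq⟩ := ((mem_rrSpace_sub_iff hx rfl hκ _ y).1 hcon).1 g hg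
    obtain ⟨p, hp, hpl⟩ := key _ (mul_mem_boundedOn (fun Q hQ => hQ) hxP hg)
    have h1 := htrk Polynomial.X (y * g)
    simp only [Polynomial.aeval_X] at h1
    have hpq : p = Polynomial.X * q := by
      apply hinj
      rw [← hp, mul_left_comm, h1, hq]; simp
    have h2 := hpl 0
    rw [zero_add, pow_one, inv_mul_cancel_left₀ hx0, hpq] at h2
    exact hlg (by simpa using h2)

end Jump

section RiemannRoch

variable {K : Type*} [Field K] [Algebra ℂ K] [hK : Fact (IsCurveFunctionField K)]

theorem rrSpace_mono {D D' : Point K →₀ ℤ} (h : D ≤ D') : rrSpace D ≤ rrSpace D' := boundedOn_mono h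

theorem mem_rrSpace_add_divf {D : Point K →₀ ℤ} {h z : K} (hh : h ≠ 0) :
    z ∈ rrSpace (D + divf h) ↔ z * h ∈ rrSpace D := by
  rw [mem_rrSpace, mem_rrSpace]
  refine forall_congr' fun P => ?_
  rw [P.mul_mem_fil_iff hh, Finsupp.add_apply, divf_apply]
  congr! 1; ring_nf

theorem mem_rrSpace_of_ne_zero {D : Point K →₀ ℤ} {z : K} (hz : z ≠ 0) :
    z ∈ rrSpace D ↔ 0 ≤ D + divf z := by
  rw [mem_rrSpace]
  refine forall_congr' fun P => ?_
  rw [P.mem_fil hz, Finsupp.add_apply, divf_apply, Finsupp.zero_apply]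
  omega

theorem deg_nonneg_of_mem_rrSpace {D : Point K →₀ ℤ} {z : K} (hz : z ∈ rrSpace D) (hz0 : z ≠ 0) :
    0 ≤ deg D := by
  have := deg_nonneg ((mem_rrSpace_of_ne_zero hz0).1 hz)
  rwa [deg_add, deg_divf, add_zero] at this

theorem rrSpace_eq_bot {D : Point K →₀ ℤ} (hD : deg D < 0) : rrSpace D = ⊥ := by
  rw [eq_bot_iff]
  intro z hz
  by_contra hz0
  exact absurd (deg_nonneg_of_mem_rrSpace hz hz0) (not_le.2 hD)

theorem rrSpace_jump [Nontrivial (Ω[K⁄ℂ])] {η : Ω[K⁄ℂ]} {κ : Point K →₀ ℤ}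
    (hκ : HasDiv (omega K) η κ) (D : Point K →₀ ℤ) (P : Point K) :
    rrSpace (D + Finsupp.single P 1) = rrSpace D ↔
      rrSpace (κ - (D + Finsupp.single P 1)) ≠ rrSpace (κ - D) := by
  obtain ⟨x, hx, hxO, hxO'⟩ := P.exists_transcendental
  have hx0 := ne_zero_of_transcendental hx
  have hxP : x ∈ P.fil 1 := by
    rw [P.mem_O_iff (inv_ne_zero hx0), P.ord_inv] at hxO'
    rw [P.mem_fil hx0]; omega
  obtain ⟨h, hh⟩ := hκ.exists_smul (KaehlerDifferential.D ℂ K x)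
  have hh0 : h ≠ 0 := by rintro rfl; exact D_ne_zero hx (by simpa using hh)
  have hκx := hκ.smul hh0
  rw [← hh] at hκx
  have htr : ∀ (D' : Point K →₀ ℤ) z, z ∈ rrSpace (κ + divf h - D') ↔ z * h ∈ rrSpace (κ - D') := by
    intro D' z
    rw [← mem_rrSpace_add_divf hh0, sub_add_eq_add_sub]
  have hle : rrSpace D ≤ rrSpace (D + Finsupp.single P 1) := rrSpace_mono (by simp)
  have hle' : rrSpace (κ - (D + Finsupp.single P 1)) ≤ rrSpace (κ - D) := rrSpace_mono (sub_le_sub_left (by simp) κ)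
  constructor
  · intro h1 h2
    obtain ⟨y, hy, hy'⟩ := exists_mem_rrSpace_sub hx hκx hxP hxO' h1.le
    rw [htr] at hy hy'
    exact hy' (h2 ▸ hy)
  · intro h1
    by_contra h2
    apply h1
    refine le_antisymm hle' fun y hy => ?_
    obtain ⟨f, hf, hf'⟩ := SetLike.exists_of_lt (lt_of_le_of_ne hle (Ne.symm h2))
    have := mem_rrSpace_of_mem_add_single hx hκx hxP hxO' (y := y / h) (f := f) (D := D)
      ((htr _ _).2 (by rwa [div_mul_cancel₀ _ hh0])) hf hf'
    rwa [htr, div_mul_cancel₀ _ hh0] at this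

theorem rrSpace_add_single (D : Point K →₀ ℤ) (P : Point K) :
    rrSpace (D + Finsupp.single P 1) = rrSpace D ∨
      ∃ f ∉ rrSpace D, rrSpace (D + Finsupp.single P 1) = rrSpace D ⊔ Submodule.span ℂ {f} := by
  have hle : rrSpace D ≤ rrSpace (D + Finsupp.single P 1) := rrSpace_mono (by simp)
  by_cases h : rrSpace (D + Finsupp.single P 1) = rrSpace D
  · exact Or.inl h
  obtain ⟨f, hf, hf'⟩ := SetLike.exists_of_lt (lt_of_le_of_ne hle (Ne.symm h))
  refine Or.inr ⟨f, hf', le_antisymm (fun z hz => ?_) (sup_le hle (by simpa using hf))⟩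
  have hmem : ∀ z, z ∈ rrSpace (D + Finsupp.single P 1) → z ∈ P.fil (-D P) → z ∈ rrSpace D := by
    intro z hz hzP
    rw [mem_rrSpace]
    intro Q
    by_cases hQ : P = Q
    · exact hQ ▸ hzP
    · have := mem_rrSpace.1 hz Q
      simpa [Finsupp.single_apply, hQ] using this
  have hf0 : f ≠ 0 := by rintro rfl; exact hf' (zero_mem _)
  have hford : P.ord f = -D P - 1 := by
    have h1 := mem_rrSpace.1 hf P
    have h2 : f ∉ P.fil (-D P) := fun h => hf' (hmem f hf h)
    rw [P.mem_fil hf0] at h1 h2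
    simp only [Finsupp.add_apply, Finsupp.single_eq_same] at h1
    omega
  obtain ⟨c, hc⟩ := P.exists_sub_smul_mem_fil hf0 (z := z) (by
    have := mem_rrSpace.1 hz P
    rw [hford]
    simpa [sub_eq_add_neg, add_comm] using this)
  rw [hford, sub_add_cancel] at hc
  rw [← sub_add_cancel z (c • f)]
  exact Submodule.add_mem_sup (hmem _ (sub_mem hz (Submodule.smul_mem _ c hf)) hc)
    (Submodule.smul_mem _ c (Submodule.mem_span_singleton_self f))

theorem exists_transcendental : ∃ x : K, Transcendental ℂ x := by
  by_contra! h
  have : Algebra.IsAlgebraic ℂ K := ⟨fun x => by simpa [Transcendental] using h x⟩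
  have h1 := hK.out.trdeg_eq_one
  rw [trdeg_eq_zero] at h1
  exact zero_ne_one h1

instance nonempty_point : Nonempty (Point K) := by
  by_contra hcon
  obtain ⟨x, hx⟩ := exists_transcendental (K := K)
  obtain ⟨c, rfl⟩ := exists_const_of_forall_mem (z := x) fun P => (hcon ⟨P⟩).elim
  exact hx (isAlgebraic_algebraMap c)

instance finiteDimensional_rrSpace (D : Point K →₀ ℤ) : FiniteDimensional ℂ (rrSpace D) := by
  have key : ∀ (n : ℕ) (D : Point K →₀ ℤ), deg D < n → FiniteDimensional ℂ (rrSpace D) := by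
    intro n
    induction n with
    | zero => intro D hD; rw [rrSpace_eq_bot (by simpa using hD)]; infer_instance
    | succ n ih =>
      intro D hD
      obtain ⟨P⟩ := nonempty_point (K := K)
      have h1 : D = (D - Finsupp.single P 1) + Finsupp.single P 1 := by simp
      have h2 := ih (D - Finsupp.single P 1) (by rw [deg_sub, deg_single]; push_cast at hD; omega)
      rw [h1]
      rcases rrSpace_add_single (D - Finsupp.single P 1) P with h | ⟨f, -, h⟩ <;> rw [h]
      · exact h2
      · infer_instance
  exact key (deg D + 1).toNat D (by omega)

theorem finrank_sup_span_singleton_of_notMem {M : Type*} [AddCommGroup M] [Module ℂ M]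
    (S : Submodule ℂ M) [FiniteDimensional ℂ S] {f : M} (hf : f ∉ S) :
    Module.finrank ℂ (S ⊔ Submodule.span ℂ {f} : Submodule ℂ M) = Module.finrank ℂ S + 1 := by
  have h1 := Submodule.finrank_sup_add_finrank_inf_eq S (Submodule.span ℂ {f})
  have hf0 : f ≠ 0 := by rintro rfl; exact hf (zero_mem _)
  have h2 : S ⊓ Submodule.span ℂ {f} = ⊥ := by
    rw [← disjoint_iff, Submodule.disjoint_span_singleton' hf0]; exact hf
  rw [h2, finrank_bot, finrank_span_singleton hf0] at h1
  simpa using h1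

theorem euler_add_single [Nontrivial (Ω[K⁄ℂ])] {η : Ω[K⁄ℂ]} {κ : Point K →₀ ℤ}
    (hκ : HasDiv (omega K) η κ) (D : Point K →₀ ℤ) (P : Point K) :
    (Module.finrank ℂ (rrSpace (D + Finsupp.single P 1)) : ℤ) -
      Module.finrank ℂ (rrSpace (κ - (D + Finsupp.single P 1))) =
    Module.finrank ℂ (rrSpace D) - Module.finrank ℂ (rrSpace (κ - D)) + 1 := by
  have hj := rrSpace_jump hκ D P
  have hD : κ - D = κ - (D + Finsupp.single P 1) + Finsupp.single P 1 := by abel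
  have h2 := rrSpace_add_single (κ - (D + Finsupp.single P 1)) P
  rw [← hD] at h2
  rcases rrSpace_add_single D P with h | ⟨f, hf, h⟩
  · rcases h2 with h' | ⟨g, hg, h'⟩
    · exact absurd h'.symm (hj.1 h)
    · rw [h, h', finrank_sup_span_singleton_of_notMem _ hg]; push_cast; ring
  · rcases h2 with h' | ⟨g, hg, h'⟩
    · rw [h, ← h', finrank_sup_span_singleton_of_notMem _ hf]; push_cast; ring
    · exfalso
      have h3 : rrSpace (D + Finsupp.single P 1) = rrSpace D := hj.2 fun h4 => by
        rw [← h4] at h'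
        exact hg (h' ▸ (Submodule.mem_sup_right (Submodule.mem_span_singleton_self g)))
      rw [h3] at h
      exact hf (h ▸ (Submodule.mem_sup_right (Submodule.mem_span_singleton_self f)))

theorem riemannRoch [Nontrivial (Ω[K⁄ℂ])] {η : Ω[K⁄ℂ]} {κ : Point K →₀ ℤ}
    (hκ : HasDiv (omega K) η κ) (D : Point K →₀ ℤ) :
    (Module.finrank ℂ (rrSpace D) : ℤ) - Module.finrank ℂ (rrSpace (κ - D)) =
      deg D + (Module.finrank ℂ (rrSpace (0 : Point K →₀ ℤ)) - Module.finrank ℂ (rrSpace κ)) := by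
  let χ : (Point K →₀ ℤ) → ℤ := fun D =>
    (Module.finrank ℂ (rrSpace D) : ℤ) - Module.finrank ℂ (rrSpace (κ - D))
  have key : ∀ D D', χ (D' + D) = χ D' + deg D := by
    intro D
    induction D using Finsupp.induction_linear with
    | zero => simp
    | add D₁ D₂ h₁ h₂ => intro D'; rw [← add_assoc, h₂, h₁, deg_add]; ring
    | single P n =>
      induction n with
      | zero => simp
      | succ n ih =>
        intro D'
        rw [Finsupp.single_add, ← add_assoc, deg_add, deg_single P 1]
        have h1 : χ _ = χ _ + 1 := euler_add_single hκ (D' + Finsupp.single P (n : ℤ)) P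
        rw [h1, ih]; ring
      | pred n ih =>
        intro D'
        have h1 : χ _ = χ _ + 1 := euler_add_single hκ (D' + Finsupp.single P (-(n : ℤ) - 1)) P
        rw [add_assoc, ← Finsupp.single_add, sub_add_cancel, ih, deg_single] at h1
        rw [deg_single]; omega
  have h := key D 0
  simp only [χ, zero_add] at h
  rw [h, sub_zero κ]; ring

theorem finrank_rrSpace_zero : Module.finrank ℂ (rrSpace (0 : Point K →₀ ℤ)) = 1 := by
  have h : rrSpace (0 : Point K →₀ ℤ) = Submodule.span ℂ {1} := by
    ext z
    rw [Submodule.mem_span_singleton, mem_rrSpace]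
    simp only [Finsupp.zero_apply, neg_zero, Point.mem_fil_zero]
    constructor
    · intro h
      obtain ⟨c, rfl⟩ := exists_const_of_forall_mem h
      exact ⟨c, by rw [Algebra.smul_def, mul_one]⟩
    · rintro ⟨c, rfl⟩ P
      rw [Algebra.smul_def, mul_one]; exact P.algebraMap_mem c
  rw [h, finrank_span_singleton one_ne_zero]

variable {V : Type*} [AddCommGroup V] [Module K V] [Module ℂ V] [IsScalarTower ℂ K V]

/-- The sections of a line bundle as rational functions. -/
def HasDiv.sectionEquiv {L : Family K V} {s : V} {D : Point K →₀ ℤ} (h : HasDiv L s D) :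
    rrSpace D ≃ₗ[ℂ] L.H0 :=
  LinearEquiv.ofBijective
    { toFun := fun f : rrSpace D => (⟨(f : K) • s, fun P => (h.mem_iff P f).2 (mem_rrSpace.1 f.2 P)⟩ : L.H0)
      map_add' := fun f g => Subtype.ext (add_smul _ _ _)
      map_smul' := fun c f => Subtype.ext (smul_assoc c (f : K) s) }
    ⟨fun f g hfg => Subtype.ext (smul_left_injective K h.ne_zero (congrArg Subtype.val hfg)),
      fun v => by
        obtain ⟨f, hf⟩ := h.exists_smul v
        refine ⟨⟨f, mem_rrSpace.2 fun P => (h.mem_iff P f).1 (hf ▸ v.2 P)⟩, Subtype.ext hf.symm⟩⟩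

@[simp] theorem HasDiv.coe_sectionEquiv {L : Family K V} {s : V} {D : Point K →₀ ℤ}
    (h : HasDiv L s D) (f : rrSpace D) : (h.sectionEquiv f : V) = (f : K) • s := rfl

/-- The curve has genus three. -/
theorem nontrivial_omega_of_genus (hg : genus K = 3) : Nontrivial (Ω[K⁄ℂ]) := by
  by_contra hcon
  rw [not_nontrivial_iff_subsingleton] at hcon
  have : genus K = 0 := Module.finrank_zero_of_subsingleton
  omega

theorem exists_hasDiv_omega' [Nontrivial (Ω[K⁄ℂ])] : ∃ (η : Ω[K⁄ℂ]) (κ : Point K →₀ ℤ), HasDiv (omega K) η κ := by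
  obtain ⟨x, hx⟩ := exists_transcendental (K := K)
  obtain ⟨κ, h, -⟩ := exists_hasDiv_omega hx
  exact ⟨_, κ, h⟩

theorem finrank_rrSpace_canonical (hg : genus K = 3) {η : Ω[K⁄ℂ]} {κ : Point K →₀ ℤ}
    (hκ : HasDiv (omega K) η κ) : Module.finrank ℂ (rrSpace κ) = 3 := by
  rw [← hg, genus, hκ.sectionEquiv.finrank_eq]

theorem riemannRoch_genus_three (hg : genus K = 3) {η : Ω[K⁄ℂ]} {κ : Point K →₀ ℤ}
    (hκ : HasDiv (omega K) η κ) (D : Point K →₀ ℤ) :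
    (Module.finrank ℂ (rrSpace D) : ℤ) = Module.finrank ℂ (rrSpace (κ - D)) + deg D - 2 := by
  have := nontrivial_omega_of_genus hg
  have h := riemannRoch hκ D
  rw [finrank_rrSpace_canonical hg hκ, finrank_rrSpace_zero] at h
  push_cast at h
  omega

theorem deg_canonical (hg : genus K = 3) {η : Ω[K⁄ℂ]} {κ : Point K →₀ ℤ}
    (hκ : HasDiv (omega K) η κ) : deg κ = 4 := by
  have h := riemannRoch_genus_three hg hκ κ
  rw [finrank_rrSpace_canonical hg hκ, sub_self, finrank_rrSpace_zero] at h
  push_cast at h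
  omega

theorem finrank_rrSpace_of_deg (hg : genus K = 3) {D : Point K →₀ ℤ} (hD : 4 < deg D) :
    (Module.finrank ℂ (rrSpace D) : ℤ) = deg D - 2 := by
  have := nontrivial_omega_of_genus hg
  obtain ⟨η, κ, hκ⟩ := exists_hasDiv_omega' (K := K)
  rw [riemannRoch_genus_three hg hκ D, rrSpace_eq_bot (D := κ - D), finrank_bot]
  · push_cast; ring
  · rw [deg_sub, deg_canonical hg hκ]; omega

end RiemannRoch

/-! ### Degrees of functions -/

section FunctionDegree

variable {K : Type*} [Field K] [Algebra ℂ K] [hK : Fact (IsCurveFunctionField K)]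

theorem finite_support_max_ord (z : K) :
    (Function.support fun P : Point K => max (P.ord z) 0).Finite :=
  (finite_ord_ne_zero z).subset fun P hP hcon => hP (by simp [hcon])

theorem finsum_poles {x : K} (hx : Transcendental ℂ x) :
    ∑ᶠ P : Point K, max (-P.ord x) 0 = Module.finrank (IntermediateField.adjoin ℂ {x}) K := by
  rw [← adjoin_inv x, ← finsum_zeros (Transcendental.inv' hx)]
  simp only [Point.ord_inv]

theorem transcendental_pow_two {x : K} (hx : Transcendental ℂ x) : Transcendental ℂ (x ^ 2) :=
  hx.pow two_pos

theorem finrank_adjoin_sq {x : K} (hx : Transcendental ℂ x) :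
    Module.finrank (IntermediateField.adjoin ℂ {x ^ 2}) K =
      2 * Module.finrank (IntermediateField.adjoin ℂ {x}) K := by
  zify
  rw [← finsum_zeros hx, ← finsum_zeros (transcendental_pow_two hx), ← smul_eq_mul, smul_finsum]
  refine finsum_congr fun P => ?_
  rw [P.ord_pow, smul_eq_mul]; push_cast; omega

theorem three_le_finrank_adjoin (hnh : ¬ IsHyperelliptic K) {x : K} (hx : Transcendental ℂ x) :
    3 ≤ Module.finrank (IntermediateField.adjoin ℂ {x}) K := by
  have := finiteDimensional_adjoin hK.out hx
  have h0 : 0 < Module.finrank (IntermediateField.adjoin ℂ {x}) K := Module.finrank_pos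
  have h2 : Module.finrank (IntermediateField.adjoin ℂ {x}) K ≠ 2 := fun h => hnh ⟨x, hx, h⟩
  have h1 : Module.finrank (IntermediateField.adjoin ℂ {x}) K ≠ 1 := fun h =>
    hnh ⟨x ^ 2, transcendental_pow_two hx, by rw [finrank_adjoin_sq hx, h]⟩
  omega

theorem finsum_mono_of_finite {f g : Point K → ℤ} (hf : f.support.Finite) (hg : g.support.Finite)
    (h : ∀ P, f P ≤ g P) : ∑ᶠ P, f P ≤ ∑ᶠ P, g P := by
  have h1 : 0 ≤ ∑ᶠ P, (g P - f P) := finsum_nonneg fun P => sub_nonneg.2 (h P)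
  rw [finsum_sub_distrib hg hf] at h1
  omega

theorem finrank_adjoin_div_le {D : Point K →₀ ℤ} {u v : K} (hu : u ∈ rrSpace D)
    (hv : v ∈ rrSpace D) (huv : Transcendental ℂ (u / v)) :
    (Module.finrank (IntermediateField.adjoin ℂ {u / v}) K : ℤ) ≤ deg D := by
  have h0 := ne_zero_of_transcendental huv
  have hu0 : u ≠ 0 := by rintro rfl; simp at h0
  have hv0 : v ≠ 0 := by rintro rfl; simp at h0
  have h1 : deg D = deg (D + divf v) := by rw [deg_add, deg_divf, add_zero]
  rw [h1, deg_eq_finsum, ← finsum_poles huv]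
  refine finsum_mono_of_finite ?_ ?_ fun P => ?_
  · have := finite_support_max_ord (u / v)⁻¹
    simpa only [Point.ord_inv] using this
  · exact (D + divf v).hasFiniteSupport
  · have hu' := mem_rrSpace.1 hu P
    have hv' := mem_rrSpace.1 hv P
    rw [P.mem_fil hu0] at hu'
    rw [P.mem_fil hv0] at hv'
    rw [P.ord_div hu0 hv0, Finsupp.add_apply, divf_apply]
    omega

theorem Point.ord_add_of_lt (P : Point K) {a b : K} (ha : a ≠ 0) (hb : b ∈ P.fil (P.ord a + 1)) :
    a + b ≠ 0 ∧ P.ord (a + b) = P.ord a := by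
  have hmem : a + b ∈ P.fil (P.ord a) :=
    add_mem ((P.mem_fil ha).2 le_rfl) (P.fil_anti (by omega) hb)
  have hnot : a + b ∉ P.fil (P.ord a + 1) := fun h => by
    have := sub_mem h hb
    rw [add_sub_cancel_right, P.mem_fil ha] at this
    omega
  have h0 : a + b ≠ 0 := fun h => hnot (h ▸ zero_mem _)
  rw [P.mem_fil h0] at hmem hnot
  exact ⟨h0, by omega⟩

theorem Point.aeval_mem (P : Point K) {y : K} (hy : y ∈ P.O) (p : ℂ[X]) :
    Polynomial.aeval y p ∈ P.O := by
  induction p using Polynomial.induction_on' with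
  | add p q hp hq => rw [map_add]; exact add_mem hp hq
  | monomial n a =>
    rw [Polynomial.aeval_monomial]
    exact mul_mem (P.algebraMap_mem a) (pow_mem hy n)

theorem Point.ord_aeval_of_pole (P : Point K) {y : K} (hy : P.ord y < 0) {p : ℂ[X]} (hp : p ≠ 0) :
    Polynomial.aeval y p ≠ 0 ∧ P.ord (Polynomial.aeval y p) = p.natDegree * P.ord y := by
  have hy0 : y ≠ 0 := by rintro rfl; simp at hy
  induction h : p.natDegree using Nat.strong_induction_on generalizing p with
  | _ n ih =>
    subst h
    have hlc : algebraMap ℂ K p.leadingCoeff ≠ 0 := by simpa using hp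
    have hA0 : algebraMap ℂ K p.leadingCoeff * y ^ p.natDegree ≠ 0 := mul_ne_zero hlc (pow_ne_zero _ hy0)
    have hA : P.ord (algebraMap ℂ K p.leadingCoeff * y ^ p.natDegree) = p.natDegree * P.ord y := by
      rw [P.ord_mul hlc (pow_ne_zero _ hy0), P.ord_algebraMap, zero_add, P.ord_pow]
    have hsum : Polynomial.aeval y p = algebraMap ℂ K p.leadingCoeff * y ^ p.natDegree +
        Polynomial.aeval y p.eraseLead := by
      have := congrArg (Polynomial.aeval y) p.eraseLead_add_C_mul_X_pow
      rw [← this, map_add, map_mul, Polynomial.aeval_C, map_pow, Polynomial.aeval_X, add_comm]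
    rw [hsum, ← hA]
    refine P.ord_add_of_lt hA0 ?_
    by_cases he : p.eraseLead = 0
    · rw [he, map_zero]; exact zero_mem _
    have hlt : p.eraseLead.natDegree < p.natDegree := by
      refine (p.eraseLead_natDegree_lt_or_eraseLead_eq_zero).resolve_right he
    obtain ⟨h0, h1⟩ := ih _ hlt he rfl
    rw [P.mem_fil h0, h1, hA]
    nlinarith

theorem finrank_adjoin_aeval {y : K} (hy : Transcendental ℂ y) {p : ℂ[X]}
    (hp : 0 < p.natDegree) : Module.finrank (IntermediateField.adjoin ℂ {Polynomial.aeval y p}) K =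
      p.natDegree * Module.finrank (IntermediateField.adjoin ℂ {y}) K := by
  have hp0 : p ≠ 0 := by rintro rfl; simp at hp
  have ht : Transcendental ℂ (Polynomial.aeval y p) :=
    hy.aeval p hp.ne' (mem_nonZeroDivisors_of_ne_zero (by simpa using hp0))
  zify
  rw [← finsum_poles hy, ← finsum_poles ht, ← smul_eq_mul, smul_finsum]
  refine finsum_congr fun P => ?_
  by_cases h : P.ord y < 0
  · rw [(P.ord_aeval_of_pole h hp0).2, max_eq_left (by nlinarith), max_eq_left (by omega), smul_eq_mul]; ring
  · rw [max_eq_right (b := (0 : ℤ)) (a := -P.ord y) (by omega), smul_zero, max_eq_right]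
    have h1 := P.aeval_mem ((P.mem_O_iff (ne_zero_of_transcendental hy)).2 (by omega)) p
    rw [P.mem_O_iff (ne_zero_of_transcendental ht)] at h1
    omega

theorem adjoin_sub_algebraMap (z : K) (c : ℂ) :
    IntermediateField.adjoin ℂ {z - algebraMap ℂ K c} = IntermediateField.adjoin ℂ {z} := by
  apply le_antisymm <;> rw [IntermediateField.adjoin_simple_le_iff]
  · exact sub_mem (IntermediateField.mem_adjoin_simple_self ℂ z) (IntermediateField.algebraMap_mem _ c)
  · have := add_mem (IntermediateField.mem_adjoin_simple_self ℂ (z - algebraMap ℂ K c))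
      (IntermediateField.algebraMap_mem (IntermediateField.adjoin ℂ {z - algebraMap ℂ K c}) c)
    rwa [sub_add_cancel] at this

theorem exists_natDegree_sub_C_mul (p q : ℂ[X]) :
    ∃ c : ℂ, (p - Polynomial.C c * q).natDegree = max p.natDegree q.natDegree := by
  rcases lt_or_ge q.natDegree p.natDegree with h | h
  · exact ⟨0, by simp [h.le]⟩
  by_cases hc : q.leadingCoeff = p.coeff q.natDegree
  · refine ⟨0, ?_⟩
    by_cases hq : q = 0
    · simp_all
    have : q.natDegree ≤ p.natDegree := by
      apply Polynomial.le_natDegree_of_ne_zero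
      rw [← hc]; simpa using hq
    simp [this]
  · refine ⟨1, ?_⟩
    rw [max_eq_right h]
    apply le_antisymm
    · exact (Polynomial.natDegree_sub_le _ _).trans (by simp [h])
    · apply Polynomial.le_natDegree_of_ne_zero
      simp only [map_one, one_mul, Polynomial.coeff_sub]
      exact sub_ne_zero.2 (Ne.symm hc)

theorem mul_finrank_adjoin_le {y z : K} (hy : Transcendental ℂ y) (hz : Transcendental ℂ z)
    {p q : ℂ[X]} (hpq : IsCoprime p q) (hq : Polynomial.aeval y q ≠ 0)
    (h : z * Polynomial.aeval y q = Polynomial.aeval y p) :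
    max p.natDegree q.natDegree * Module.finrank (IntermediateField.adjoin ℂ {y}) K ≤
      Module.finrank (IntermediateField.adjoin ℂ {z}) K := by
  have hp : p ≠ 0 := by
    rintro rfl
    rw [map_zero, mul_eq_zero] at h
    exact h.elim (ne_zero_of_transcendental hz) hq
  obtain ⟨c, hc⟩ := exists_natDegree_sub_C_mul p q
  set g := p - Polynomial.C c * q with hg
  rcases Nat.eq_zero_or_pos (max p.natDegree q.natDegree) with h0 | h0
  · rw [h0, zero_mul]; exact Nat.zero_le _
  have hzc : (z - algebraMap ℂ K c) * Polynomial.aeval y q = Polynomial.aeval y g := by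
    rw [hg, sub_mul, h]; simp
  have ht : Transcendental ℂ (z - algebraMap ℂ K c) := by
    apply transcendental_of_forall_ne
    intro a ha
    apply hz
    rw [← sub_add_cancel z (algebraMap ℂ K c), ← ha, ← map_add]
    exact isAlgebraic_algebraMap _
  have hg0 : Polynomial.aeval y g ≠ 0 := by
    rw [← hzc]; exact mul_ne_zero (ne_zero_of_transcendental ht) hq
  have hcop : IsCoprime g q := by
    rw [hg, sub_eq_add_neg, ← neg_mul]; exact hpq.add_mul_right_left _
  have htg : Transcendental ℂ (Polynomial.aeval y g) :=
    hy.aeval g (by omega) (mem_nonZeroDivisors_of_ne_zero (by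
      rw [Polynomial.leadingCoeff_ne_zero]; rintro h; simp [h] at hg0))
  rw [← hc, ← finrank_adjoin_aeval hy (by omega), ← adjoin_sub_algebraMap z c]
  zify
  rw [← finsum_zeros ht, ← finsum_zeros htg]
  refine finsum_mono_of_finite (finite_support_max_ord _) (finite_support_max_ord _) fun P => ?_
  have hord : P.ord (Polynomial.aeval y g) = P.ord (z - algebraMap ℂ K c) + P.ord (Polynomial.aeval y q) := by
    rw [← hzc, P.ord_mul (ne_zero_of_transcendental ht) hq]
  by_cases hP : P.ord y < 0
  · have := (P.ord_aeval_of_pole hP (p := g) (by rintro h; simp [h] at hg0)).2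
    rw [this, max_eq_right]
    · exact le_max_right _ _
    · nlinarith
  · have hyO := (P.mem_O_iff (ne_zero_of_transcendental hy)).2 (by omega)
    have hqO := P.aeval_mem hyO q
    rw [P.mem_O_iff hq] at hqO
    rcases le_or_gt (P.ord (Polynomial.aeval y g)) 0 with h1 | h1
    · rw [max_eq_right h1]; exact le_max_right _ _
    have hq0 : P.ord (Polynomial.aeval y q) = 0 := by
      by_contra hne
      obtain ⟨a, b, hab⟩ := hcop
      have h2 := congrArg (Polynomial.aeval y) hab
      rw [map_add, map_mul, map_mul, map_one] at h2
      have h3 : (1 : K) ∈ P.fil 1 := by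
        rw [← h2]
        refine add_mem ?_ ?_
        · have := P.mul_mem_fil (P.mem_fil_zero.2 (P.aeval_mem hyO a)) ((P.mem_fil (n := 1) hg0).2 (by omega))
          simpa using this
        · have := P.mul_mem_fil (P.mem_fil_zero.2 (P.aeval_mem hyO b)) ((P.mem_fil (n := 1) hq).2 (by omega))
          simpa using this
      rw [P.mem_fil one_ne_zero, P.ord_one] at h3
      omega
    rw [hord, hq0, add_zero]

/-- A function in `ℂ(y)` is a quotient of coprime polynomials in `y`. -/
theorem exists_coprime_of_mem_adjoin {y z : K}
    (hz : z ∈ IntermediateField.adjoin ℂ {y}) : ∃ p q : ℂ[X], IsCoprime p q ∧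
      Polynomial.aeval y q ≠ 0 ∧ z * Polynomial.aeval y q = Polynomial.aeval y p := by
  classical
  obtain ⟨r, s, rfl⟩ := (IntermediateField.mem_adjoin_simple_iff ℂ z).1 hz
  by_cases hs : Polynomial.aeval y s = 0
  · exact ⟨0, 1, isCoprime_zero_left.2 isUnit_one, by simp, by simp [hs]⟩
  have hs0 : s ≠ 0 := by rintro rfl; simp at hs
  refine ⟨r / gcd r s, s / gcd r s, isCoprime_div_gcd_div_gcd hs0, ?_, ?_⟩
  · intro h
    apply hs
    rw [← EuclideanDomain.mul_div_cancel' (fun h => hs0 ((gcd_eq_zero_iff r s).1 h).2) (gcd_dvd_right r s), map_mul, h, mul_zero]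
  · have hg : gcd r s ≠ 0 := fun h => hs0 ((gcd_eq_zero_iff r s).1 h).2
    have hr := congrArg (Polynomial.aeval y) (EuclideanDomain.mul_div_cancel' hg (gcd_dvd_left r s))
    have hs' := congrArg (Polynomial.aeval y) (EuclideanDomain.mul_div_cancel' hg (gcd_dvd_right r s))
    rw [map_mul] at hr hs'
    have hgy : Polynomial.aeval y (gcd r s) ≠ 0 := fun h => by rw [h, zero_mul] at hs'; exact hs hs'.symm
    rw [div_mul_eq_mul_div, div_eq_iff hs]
    apply mul_left_cancel₀ hgy
    linear_combination Polynomial.aeval y r * hs' - Polynomial.aeval y s * hr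

end FunctionDegree

/-! ### Relations between canonical sections -/

section Canonical

variable {K : Type*} [Field K] [Algebra ℂ K] [hK : Fact (IsCurveFunctionField K)]

theorem finrank_rrSpace_single (hnh : ¬ IsHyperelliptic K) (P : Point K) :
    Module.finrank ℂ (rrSpace (Finsupp.single P 1)) = 1 := by
  have h0 : rrSpace (0 : Point K →₀ ℤ) ≤ rrSpace (Finsupp.single P 1) := rrSpace_mono (by simp)
  have h1 : rrSpace (Finsupp.single P 1) = rrSpace (0 : Point K →₀ ℤ) := by
    refine le_antisymm (fun z hz => ?_) h0
    by_cases hc : ∃ c : ℂ, algebraMap ℂ K c = z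
    · obtain ⟨c, rfl⟩ := hc
      rw [mem_rrSpace]; intro Q; simpa using Q.algebraMap_mem c
    · push Not at hc
      have hz' := transcendental_of_forall_ne hc
      have h1 : (1 : K) ∈ rrSpace (Finsupp.single P 1) := h0 (by
        rw [mem_rrSpace]; intro Q; simp [one_mem])
      have h2 := finrank_adjoin_div_le hz h1 (by simpa using hz')
      rw [div_one, deg_single] at h2
      have := three_le_finrank_adjoin hnh hz'
      omega
  rw [h1, finrank_rrSpace_zero]

variable {η : Ω[K⁄ℂ]} {κ : Point K →₀ ℤ}

theorem finrank_rrSpace_sub_single (hg : genus K = 3) (hnh : ¬ IsHyperelliptic K)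
    (hκ : HasDiv (omega K) η κ) (P : Point K) :
    Module.finrank ℂ (rrSpace (κ - Finsupp.single P 1)) = 2 := by
  have h := riemannRoch_genus_three hg hκ (κ - Finsupp.single P 1)
  rw [sub_sub_cancel, finrank_rrSpace_single hnh, deg_sub, deg_canonical hg hκ, deg_single] at h
  omega

theorem exists_adapted_basis (hg : genus K = 3) (hnh : ¬ IsHyperelliptic K)
    (hκ : HasDiv (omega K) η κ) (P : Point K) : ∃ e : Fin 3 → K, LinearIndependent ℂ e ∧
      (∀ i, e i ∈ rrSpace κ) ∧ e 0 ∈ rrSpace (κ - Finsupp.single P 1) ∧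
      e 1 ∈ rrSpace (κ - Finsupp.single P 1) ∧ P.ord (e 2) = -κ P := by
  have hle : rrSpace (κ - Finsupp.single P 1) ≤ rrSpace κ := rrSpace_mono (by simp)
  obtain ⟨b⟩ : Nonempty (Module.Basis (Fin 2) ℂ (rrSpace (κ - Finsupp.single P 1))) :=
    ⟨Module.finBasisOfFinrankEq ℂ _ (finrank_rrSpace_sub_single hg hnh hκ P)⟩
  have hne : rrSpace (κ - Finsupp.single P 1) ≠ rrSpace κ := fun h => by
    have h1 := finrank_rrSpace_sub_single hg hnh hκ P
    rw [h, finrank_rrSpace_canonical hg hκ] at h1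
    omega
  obtain ⟨f, hf, hf'⟩ := SetLike.exists_of_lt (lt_of_le_of_ne hle hne)
  have hli : LinearIndependent ℂ (fun i => (b i : K)) :=
    b.linearIndependent.map' _ (Submodule.ker_subtype _)
  have hf0 : f ≠ 0 := by rintro rfl; exact hf' (zero_mem _)
  refine ⟨![b 0, b 1, f], ?_, ?_, (b 0).2, (b 1).2, ?_⟩
  · have h1 : LinearIndependent ℂ (Fin.snoc (fun i => (b i : K)) f : Fin 3 → K) := by
      rw [linearIndependent_finSnoc]
      refine ⟨hli, fun h => hf' ?_⟩
      refine Submodule.span_le.2 ?_ h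
      rintro _ ⟨i, rfl⟩
      exact (b i).2
    convert h1 using 1
    funext i
    match i with
    | 0 => rfl
    | 1 => rfl
    | 2 => rfl
  · intro i
    fin_cases i
    · exact hle (b 0).2
    · exact hle (b 1).2
    · exact hf
  · change P.ord f = _
    have h1 := mem_rrSpace.1 hf P
    have h2 : f ∉ P.fil (-κ P + 1) := fun h => hf' (by
      rw [mem_rrSpace]
      intro Q
      by_cases hQ : P = Q
      · subst hQ; simpa [add_comm, sub_eq_add_neg] using h
      · simpa [hQ] using mem_rrSpace.1 hf Q)
    rw [P.mem_fil hf0] at h1 h2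
    omega

end Canonical

section Relations

variable {K : Type*} [Field K] [Algebra ℂ K] [hK : Fact (IsCurveFunctionField K)]
variable {η : Ω[K⁄ℂ]} {κ : Point K →₀ ℤ}

theorem transcendental_div {u v : K} (h : LinearIndependent ℂ ![u, v]) : Transcendental ℂ (v / u) := by
  have hu : u ≠ 0 := by simpa using h.ne_zero 0
  apply transcendental_of_forall_ne
  intro c hc
  rw [LinearIndependent.pair_iff] at h
  have h1 := (h c (-1) (by rw [Algebra.smul_def, hc, div_mul_cancel₀ _ hu]; simp)).2
  norm_num at h1

theorem notMem_adjoin_div (hg : genus K = 3) (hnh : ¬ IsHyperelliptic K)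
    (hκ : HasDiv (omega K) η κ) {e : Fin 3 → K} (he : LinearIndependent ℂ e)
    (heκ : ∀ i, e i ∈ rrSpace κ) : e 2 / e 0 ∉ IntermediateField.adjoin ℂ {e 1 / e 0} := by
  intro hmem
  have he0 : e 0 ≠ 0 := he.ne_zero 0
  have hlin : ∀ a b c : ℂ, algebraMap ℂ K a * e 0 + algebraMap ℂ K b * e 1 + algebraMap ℂ K c * e 2 = 0 →
      a = 0 ∧ b = 0 ∧ c = 0 := by
    intro a b c h
    have h1 := Fintype.linearIndependent_iff.1 he ![a, b, c] (by
      simp [Fin.sum_univ_three, Algebra.smul_def, h])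
    exact ⟨h1 0, h1 1, h1 2⟩
  have hpair : ∀ {u v : K}, (∀ a b : ℂ, algebraMap ℂ K a * u + algebraMap ℂ K b * v = 0 → a = 0 ∧ b = 0) →
      Transcendental ℂ (v / u) := fun h => transcendental_div (by
    rw [LinearIndependent.pair_iff]
    intro a b hab
    rw [Algebra.smul_def, Algebra.smul_def] at hab
    exact h a b hab)
  have hy : Transcendental ℂ (e 1 / e 0) := hpair fun a b h =>
    ⟨(hlin a b 0 (by simpa using h)).1, (hlin a b 0 (by simpa using h)).2.1⟩
  have hz : Transcendental ℂ (e 2 / e 0) := hpair fun a b h =>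
    ⟨(hlin a 0 b (by simpa using h)).1, (hlin a 0 b (by simpa using h)).2.2⟩
  obtain ⟨p, q, hpq, hq, h⟩ := exists_coprime_of_mem_adjoin hmem
  have h1 := mul_finrank_adjoin_le hy hz hpq hq h
  have h2 := three_le_finrank_adjoin hnh hy
  have h3 := finrank_adjoin_div_le (heκ 2) (heκ 0) hz
  rw [deg_canonical hg hκ] at h3
  have hmax : max p.natDegree q.natDegree ≤ 1 := by
    by_contra hcon
    have : 2 * 3 ≤ max p.natDegree q.natDegree * Module.finrank (IntermediateField.adjoin ℂ {e 1 / e 0}) K :=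
      Nat.mul_le_mul (by omega) h2
    omega
  rw [Polynomial.eq_X_add_C_of_natDegree_le_one ((le_max_left _ _).trans hmax),
    Polynomial.eq_X_add_C_of_natDegree_le_one ((le_max_right _ _).trans hmax)] at h
  simp only [map_add, map_mul, Polynomial.aeval_C, Polynomial.aeval_X] at h
  set b := p.coeff 1
  set a := p.coeff 0
  set d := q.coeff 1 with hd
  set c := q.coeff 0 with hc
  have hrel : e 2 * (algebraMap ℂ K c * e 0 + algebraMap ℂ K d * e 1) =
      e 0 * (algebraMap ℂ K a * e 0 + algebraMap ℂ K b * e 1) := by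
    field_simp at h
    linear_combination h
  by_cases hd0 : d = 0
  · rw [hd0, map_zero, zero_mul, add_zero] at hrel
    have h4 : algebraMap ℂ K (-a) * e 0 + algebraMap ℂ K (-b) * e 1 + algebraMap ℂ K c * e 2 = 0 := by
      apply mul_left_cancel₀ he0
      rw [map_neg, map_neg]
      linear_combination hrel
    have h5 := (hlin _ _ _ h4).2.2
    apply hq
    rw [Polynomial.eq_X_add_C_of_natDegree_le_one ((le_max_right _ _).trans hmax), ← hd, ← hc, hd0, h5]
    simp
  · set v := algebraMap ℂ K c * e 0 + algebraMap ℂ K d * e 1 with hv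
    set β := b / d
    set α := a - β * c
    have hdK : algebraMap ℂ K d ≠ 0 := by simpa using hd0
    have hrel' : (e 2 - algebraMap ℂ K β * e 0) * v = algebraMap ℂ K α * e 0 ^ 2 := by
      simp only [α, β, map_sub, map_mul, map_div₀]
      rw [hv] at hrel ⊢
      field_simp
      linear_combination algebraMap ℂ K d * hrel
    have hv0 : v ≠ 0 := fun h0 => hd0 (hlin c d 0 (by rw [map_zero, zero_mul, add_zero, ← hv, h0])).2.1
    have hu0 : e 2 - algebraMap ℂ K β * e 0 ≠ 0 := fun h0 => by
      have := (hlin (-β) 0 1 (by rw [map_neg, map_zero, map_one]; linear_combination h0)).2.2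
      exact one_ne_zero this
    have hα : algebraMap ℂ K α ≠ 0 := fun h0 => by
      rw [h0, zero_mul] at hrel'
      exact (mul_ne_zero hu0 hv0) hrel'
    have ht : Transcendental ℂ (e 0 / v) := hpair fun s t h0 => by
      have h6 := hlin (s * c + t) (s * d) 0 (by
        rw [map_zero, zero_mul, add_zero, map_add, map_mul, map_mul]
        rw [hv] at h0
        linear_combination h0)
      have h7 : s = 0 := (mul_eq_zero.1 h6.2.1).resolve_right hd0
      exact ⟨h7, by simpa [h7] using h6.1⟩
    have hsq : (e 0 / v) ^ 2 = ((algebraMap ℂ K α)⁻¹ * (e 2 - algebraMap ℂ K β * e 0)) / v := by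
      field_simp
      linear_combination -hrel'
    have hvκ : v ∈ rrSpace κ := by
      rw [hv, ← Algebra.smul_def, ← Algebra.smul_def]
      exact add_mem (Submodule.smul_mem _ _ (heκ 0)) (Submodule.smul_mem _ _ (heκ 1))
    have huκ : (algebraMap ℂ K α)⁻¹ * (e 2 - algebraMap ℂ K β * e 0) ∈ rrSpace κ := by
      rw [← map_inv₀, ← Algebra.smul_def, ← Algebra.smul_def]
      exact Submodule.smul_mem _ _ (sub_mem (heκ 2) (Submodule.smul_mem _ _ (heκ 0)))
    have h8 := finrank_adjoin_div_le huκ hvκ (hsq ▸ transcendental_pow_two ht)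
    rw [← hsq, finrank_adjoin_sq ht, deg_canonical hg hκ] at h8
    have h9 := three_le_finrank_adjoin hnh ht
    push_cast at h8
    omega

theorem Point.pow_mem_fil (P : Point K) {n : ℤ} {z : K} (hz : z ∈ P.fil n) (k : ℕ) :
    z ^ k ∈ P.fil (k * n) := by
  induction k with
  | zero => simp
  | succ k ih =>
    rw [pow_succ]
    have := P.mul_mem_fil ih hz
    convert this using 2
    push_cast; ring

theorem aeval_fin_three {R : Type*} [CommRing R] [Algebra ℂ R] (e : Fin 3 → R) (q : MvPolynomial (Fin 3) ℂ) :
    MvPolynomial.aeval e q =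
      ∑ m ∈ q.support, algebraMap ℂ R (q.coeff m) * (e 0 ^ m 0 * e 1 ^ m 1 * e 2 ^ m 2) := by
  rw [MvPolynomial.aeval_def, MvPolynomial.eval₂_eq']
  simp only [Fin.prod_univ_three]

theorem sum_eq_of_mem_support {d : ℕ} {q : MvPolynomial (Fin 3) ℂ} (hq : q.IsHomogeneous d)
    {m : Fin 3 →₀ ℕ} (hm : m ∈ q.support) : m 0 + m 1 + m 2 = d := by
  have h := hq.degree_eq_sum_deg_support hm
  rw [h, ← Finsupp.degree_apply, Finsupp.degree_eq_sum, Fin.sum_univ_three]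

/-- The coefficient of a pure power in a relation vanishes. -/
theorem coeff_eq_zero_of_ord {P : Point K} {n : ℤ} {e : Fin 3 → K} (h0 : e 0 ∈ P.fil (n + 1))
    (h1 : e 1 ∈ P.fil (n + 1)) (h2 : e 2 ≠ 0) (h2' : P.ord (e 2) = n) {d : ℕ}
    {q : MvPolynomial (Fin 3) ℂ} (hq : q.IsHomogeneous d) (hqe : MvPolynomial.aeval e q = 0) :
    q.coeff (Finsupp.single 2 d) = 0 := by
  by_contra hne
  have hmem : Finsupp.single 2 d ∈ q.support := MvPolynomial.mem_support_iff.2 hne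
  rw [aeval_fin_three, ← Finset.add_sum_erase _ _ hmem] at hqe
  have hc : algebraMap ℂ K (q.coeff (Finsupp.single 2 d)) ≠ 0 := by simpa using hne
  have hA0 : algebraMap ℂ K (q.coeff (Finsupp.single 2 d)) *
    (e 0 ^ (Finsupp.single (2 : Fin 3) d) 0 * e 1 ^ (Finsupp.single (2 : Fin 3) d) 1 * e 2 ^ (Finsupp.single (2 : Fin 3) d) 2) ≠ 0 := by
    simp [hne, h2]
  have hA : P.ord (algebraMap ℂ K (q.coeff (Finsupp.single 2 d)) *
    (e 0 ^ (Finsupp.single (2 : Fin 3) d) 0 * e 1 ^ (Finsupp.single (2 : Fin 3) d) 1 * e 2 ^ (Finsupp.single (2 : Fin 3) d) 2)) = d * n := by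
    have : (e 0 ^ (Finsupp.single (2 : Fin 3) d) 0 * e 1 ^ (Finsupp.single (2 : Fin 3) d) 1 *
      e 2 ^ (Finsupp.single (2 : Fin 3) d) 2) = e 2 ^ d := by simp
    rw [this, P.ord_mul hc (pow_ne_zero _ h2), P.ord_algebraMap, P.ord_pow, h2', zero_add]
  refine (P.ord_add_of_lt hA0 ?_).1 hqe
  rw [hA]
  refine Submodule.sum_mem _ fun m hm => ?_
  rw [Finset.mem_erase] at hm
  have hsum := sum_eq_of_mem_support hq hm.2
  have hpos : 1 ≤ m 0 + m 1 := by
    by_contra hcon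
    apply hm.1
    ext i
    match i with
    | 0 => simp; omega
    | 1 => simp; omega
    | 2 => simp; omega
  rw [← Algebra.smul_def]
  apply P.smul_mem_fil
  have h3 := P.mul_mem_fil (P.mul_mem_fil (P.pow_mem_fil h0 (m 0)) (P.pow_mem_fil h1 (m 1)))
    (P.pow_mem_fil ((P.mem_fil h2).2 h2'.ge) (m 2))
  refine P.fil_anti ?_ h3
  zify at hsum hpos
  rw [← hsum]
  linarith

theorem eq_zero_of_isHomogeneous_adapted (hg : genus K = 3) (hnh : ¬ IsHyperelliptic K)
    (hκ : HasDiv (omega K) η κ) {P : Point K} {e : Fin 3 → K} (he : LinearIndependent ℂ e)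
    (heκ : ∀ i, e i ∈ rrSpace κ) (he0 : e 0 ∈ rrSpace (κ - Finsupp.single P 1))
    (he1 : e 1 ∈ rrSpace (κ - Finsupp.single P 1)) (he2 : P.ord (e 2) = -κ P) {d : ℕ} (hd : d ≤ 3)
    {q : MvPolynomial (Fin 3) ℂ} (hq : q.IsHomogeneous d) (hqe : MvPolynomial.aeval e q = 0) :
    q = 0 := by
  have hn0 : e 0 ≠ 0 := he.ne_zero 0
  have hfil : ∀ {u : K}, u ∈ rrSpace (κ - Finsupp.single P 1) → u ∈ P.fil (-κ P + 1) := fun h => by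
    have := mem_rrSpace.1 h P
    simpa [sub_eq_add_neg, add_comm] using this
  have htop := coeff_eq_zero_of_ord (hfil he0) (hfil he1) (he.ne_zero 2) he2 hq hqe
  have hy : Transcendental ℂ (e 1 / e 0) := transcendental_div (by
    have := he.comp ![0, 1] (by decide)
    convert this using 1
    funext i; match i with | 0 => rfl | 1 => rfl)
  have hz := notMem_adjoin_div hg hnh hκ he heκ
  set y := e 1 / e 0 with hydef
  set z := e 2 / e 0 with hzdef
  set k := IntermediateField.adjoin ℂ {y} with hk
  have hfd : FiniteDimensional k K := finiteDimensional_adjoin hK.out hy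
  have hfin : Module.finrank k K = 3 := by
    have h1 := three_le_finrank_adjoin hnh hy
    have h2 := finrank_adjoin_div_le he1 he0 hy
    rw [deg_sub, deg_canonical hg hκ, deg_single, ← hydef, ← hk] at h2
    rw [← hk] at h1
    omega
  have hzi : IsIntegral k z := Algebra.IsIntegral.isIntegral z
  have hmin : (minpoly k z).natDegree = 3 := by
    have h1 : (minpoly k z).natDegree ∣ 3 := hfin ▸ minpoly.degree_dvd hzi
    rcases (Nat.dvd_prime Nat.prime_three).1 h1 with h | h
    · exfalso
      rw [minpoly.natDegree_eq_one_iff] at h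
      obtain ⟨w, hw⟩ := h
      exact hz (hw ▸ w.2)
    · exact h
  have hyk : y ∈ k := IntermediateField.mem_adjoin_simple_self ℂ y
  let Q : k[X] := ∑ m ∈ q.support,
    Polynomial.monomial (m 2) (algebraMap ℂ k (q.coeff m) * (⟨y, hyk⟩ : k) ^ m 1)
  have hQz : Polynomial.aeval z Q = 0 := by
    have h1 : Polynomial.aeval z Q * e 0 ^ d = MvPolynomial.aeval e q := by
      rw [aeval_fin_three, map_sum, Finset.sum_mul]
      refine Finset.sum_congr rfl fun m hm => ?_
      rw [Polynomial.aeval_monomial, ← sum_eq_of_mem_support hq hm]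
      change (algebraMap ℂ K (q.coeff m) * y ^ m 1) * z ^ m 2 * _ = _
      rw [hydef, hzdef, div_pow, div_pow]
      field_simp
      ring
    rw [hqe] at h1
    exact (mul_eq_zero.1 h1).resolve_right (pow_ne_zero _ hn0)
  have hQ0 : Q = 0 := by
    by_contra hne
    have h1 := Polynomial.natDegree_le_natDegree (minpoly.degree_le_of_ne_zero k z hne hQz)
    have h2 : Q.natDegree ≤ 2 := by
      refine Polynomial.natDegree_sum_le_of_forall_le _ _ fun m hm => ?_
      refine (Polynomial.natDegree_monomial_le _).trans ?_
      by_contra hcon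
      have h3 := sum_eq_of_mem_support hq hm
      have h4 : m = Finsupp.single 2 d := by
        ext i
        match i with
        | 0 => simp; omega
        | 1 => simp; omega
        | 2 => simp; omega
      rw [h4, MvPolynomial.mem_support_iff] at hm
      exact hm htop
    omega
  by_contra hq0
  obtain ⟨m, hm⟩ := MvPolynomial.support_nonempty.2 hq0
  let R : ℂ[X] := ∑ m' ∈ q.support with m' 2 = m 2, Polynomial.monomial (m' 1) (q.coeff m')
  have hR : R = 0 := by
    apply transcendental_iff_injective.1 hy
    rw [map_zero]
    have h1 := congrArg (fun Q : k[X] => ((Q.coeff (m 2) : k) : K)) hQ0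
    simp only [Q, Polynomial.finsetSum_coeff, Polynomial.coeff_monomial, Polynomial.coeff_zero] at h1
    rw [← Finset.sum_filter, AddSubmonoidClass.coe_finsetSum] at h1
    simp only [R, map_sum, Polynomial.aeval_monomial]
    exact h1
  have h2 := congrArg (fun R : ℂ[X] => R.coeff (m 1)) hR
  simp only [R, Polynomial.finsetSum_coeff, Polynomial.coeff_monomial, Polynomial.coeff_zero] at h2
  rw [Finset.sum_eq_single m, if_pos rfl] at h2
  · exact MvPolynomial.mem_support_iff.1 hm h2
  · intro m' hm' hne
    rw [if_neg]
    rintro h3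
    rw [Finset.mem_filter] at hm'
    apply hne
    have h4 := sum_eq_of_mem_support hq hm
    have h5 := sum_eq_of_mem_support hq hm'.1
    ext i
    match i with
    | 0 => omega
    | 1 => exact h3
    | 2 => exact hm'.2
  · intro h; simp [hm] at h

/-- There are no relations of degree at most three between the canonical sections. -/
theorem eq_zero_of_isHomogeneous (hg : genus K = 3) (hnh : ¬ IsHyperelliptic K)
    (hκ : HasDiv (omega K) η κ) {e : Fin 3 → K} (he : LinearIndependent ℂ e)
    (heκ : ∀ i, e i ∈ rrSpace κ) {d : ℕ} (hd : d ≤ 3)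
    {q : MvPolynomial (Fin 3) ℂ} (hq : q.IsHomogeneous d) (hqe : MvPolynomial.aeval e q = 0) :
    q = 0 := by
  obtain ⟨P⟩ := nonempty_point (K := K)
  obtain ⟨e', he', he'κ, h0, h1, h2⟩ := exists_adapted_basis hg hnh hκ P
  have hspan : ∀ {u v : Fin 3 → K}, LinearIndependent ℂ u → (∀ i, u i ∈ rrSpace κ) →
      (∀ i, v i ∈ rrSpace κ) → ∃ M : Fin 3 → Fin 3 → ℂ, ∀ i, v i = ∑ j, M i j • u j := by
    intro u v hu huκ hvκ
    have h3 : Submodule.span ℂ (Set.range u) = rrSpace κ := by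
      apply Submodule.eq_of_le_of_finrank_eq
      · rw [Submodule.span_le]; rintro _ ⟨i, rfl⟩; exact huκ i
      · rw [finrank_span_eq_card hu, finrank_rrSpace_canonical hg hκ]; rfl
    choose M hM using fun i => (Submodule.mem_span_range_iff_exists_fun ℂ).1 (h3 ▸ hvκ i)
    exact ⟨M, fun i => (hM i).symm⟩
  obtain ⟨M, hM⟩ := hspan he' he'κ heκ
  obtain ⟨N, hN⟩ := hspan he heκ he'κ
  let lin : (Fin 3 → Fin 3 → ℂ) → Fin 3 → MvPolynomial (Fin 3) ℂ :=
    fun M i => ∑ j, M i j • MvPolynomial.X j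
  have hlin : ∀ M i, (lin M i).IsHomogeneous 1 := fun M i =>
    MvPolynomial.IsHomogeneous.sum _ _ _ fun j _ => by
      rw [MvPolynomial.smul_eq_C_mul]; exact (MvPolynomial.isHomogeneous_X ℂ j).C_mul _
  have hq' : (MvPolynomial.aeval (lin M) q).IsHomogeneous d := by
    have := hq.aeval (lin M) (n := 1) (hlin M)
    rwa [one_mul] at this
  have h3 : MvPolynomial.aeval (lin M) q = 0 := by
    refine eq_zero_of_isHomogeneous_adapted hg hnh hκ he' he'κ h0 h1 h2 hd hq' ?_
    have : (MvPolynomial.aeval e').comp (MvPolynomial.aeval (lin M)) = MvPolynomial.aeval e := by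
      ext i; simp [lin, hM i]
    rw [← hqe, ← this]; rfl
  have h4 : (MvPolynomial.aeval (lin N)).comp (MvPolynomial.aeval (lin M)) = AlgHom.id ℂ (MvPolynomial (Fin 3) ℂ) := by
    have hMN : ∀ i l, ∑ j, M i j * N j l = if i = l then 1 else 0 := by
      intro i l
      have h5 : ∑ l, (∑ j, M i j * N j l) • e l = ∑ l, (if i = l then (1 : ℂ) else 0) • e l := by
        have : e i = ∑ l, (∑ j, M i j * N j l) • e l := by
          conv_lhs => rw [hM i]
          simp only [hN, Finset.smul_sum, smul_smul, Finset.sum_smul]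
          rw [Finset.sum_comm]
        rw [← this]; simp
      have h6 := Fintype.linearIndependent_iff.1 he (fun l => (∑ j, M i j * N j l) - if i = l then 1 else 0)
        (by simp only [sub_smul, Finset.sum_sub_distrib]; rw [h5, sub_self])
      exact sub_eq_zero.1 (h6 l)
    ext1 i
    simp only [lin, AlgHom.comp_apply, MvPolynomial.aeval_X, map_sum, map_smul, AlgHom.id_apply]
    simp only [Finset.smul_sum, smul_smul]
    rw [Finset.sum_comm]
    simp only [← Finset.sum_smul, hMN]
    simp
  have h5 := congrArg (fun φ => φ q) h4
  simp only [AlgHom.comp_apply, h3, map_zero, AlgHom.id_apply] at h5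
  exact h5.symm

end Relations

/-! ### The equation of the canonical curve -/

section Homogenization

/-- The exponent of the homogenization of degree `d` of a monomial in two variables. -/
def homogExponent (d : ℕ) (m : Fin 2 →₀ ℕ) : Fin 3 →₀ ℕ :=
  Finsupp.equivFunOnFinite.symm ![d - (m 0 + m 1), m 0, m 1]

theorem degree_fin_two (m : Fin 2 →₀ ℕ) : m.degree = m 0 + m 1 := by
  rw [Finsupp.degree_eq_sum, Fin.sum_univ_two]

theorem exists_homogenization (p : MvPolynomial (Fin 2) ℂ) {d : ℕ} (hp : p.totalDegree ≤ d) :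
    ∃ q : MvPolynomial (Fin 3) ℂ, q.IsHomogeneous d ∧
      MvPolynomial.aeval ![1, MvPolynomial.X 0, MvPolynomial.X 1] q = p ∧
      ∀ (K : Type _) [Field K] [Algebra ℂ K] (e : Fin 3 → K), e 0 ≠ 0 → MvPolynomial.aeval e q =
        e 0 ^ d * MvPolynomial.aeval ![e 1 / e 0, e 2 / e 0] p := by
  have hdeg : ∀ m ∈ p.support, m 0 + m 1 ≤ d := fun m hm => by
    rw [← degree_fin_two]
    refine le_trans ?_ hp
    have := MvPolynomial.le_totalDegree hm
    rwa [Finsupp.degree_apply]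
  refine ⟨∑ m ∈ p.support, MvPolynomial.monomial (homogExponent d m) (p.coeff m), ?_, ?_, ?_⟩
  · refine MvPolynomial.IsHomogeneous.sum _ _ _ fun m hm => ?_
    apply MvPolynomial.isHomogeneous_monomial
    rw [Finsupp.degree_eq_sum, Fin.sum_univ_three]
    simp only [homogExponent, Finsupp.equivFunOnFinite_symm_apply_apply]
    have := hdeg m hm
    simp; omega
  · conv_rhs => rw [p.as_sum]
    rw [map_sum]
    refine Finset.sum_congr rfl fun m hm => ?_
    rw [MvPolynomial.aeval_monomial, Finsupp.prod_fintype _ _ (by simp), Fin.prod_univ_three,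
      MvPolynomial.monomial_eq, Finsupp.prod_fintype _ _ (by simp), Fin.prod_univ_two]
    simp [homogExponent, MvPolynomial.algebraMap_eq]
  · intro K _ _ e he
    conv_rhs => rw [p.as_sum]
    rw [map_sum, map_sum, Finset.mul_sum]
    refine Finset.sum_congr rfl fun m hm => ?_
    rw [MvPolynomial.aeval_monomial, Finsupp.prod_fintype _ _ (by simp), Fin.prod_univ_three,
      MvPolynomial.aeval_monomial, Finsupp.prod_fintype _ _ (by simp), Fin.prod_univ_two]
    simp only [homogExponent, Finsupp.equivFunOnFinite_symm_apply_apply, Matrix.cons_val_zero, Matrix.cons_val_one, Matrix.cons_val]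
    have h1 : e 0 ^ d = e 0 ^ (d - (m 0 + m 1)) * (e 0 ^ m 0 * e 0 ^ m 1) := by
      rw [← pow_add, ← pow_add]; congr 1; have := hdeg m hm; omega
    rw [h1, div_pow, div_pow]
    field_simp

theorem eq_zero_of_dehomogenization {q : MvPolynomial (Fin 3) ℂ} {d : ℕ} (hq : q.IsHomogeneous d)
    (h : MvPolynomial.aeval ![(1 : MvPolynomial (Fin 2) ℂ), MvPolynomial.X 0, MvPolynomial.X 1] q = 0) :
    q = 0 := by
  by_contra hq0
  obtain ⟨m, hm⟩ := MvPolynomial.support_nonempty.2 hq0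
  rw [aeval_fin_three] at h
  let ex : (Fin 3 →₀ ℕ) → (Fin 2 →₀ ℕ) := fun m => Finsupp.single 0 (m 1) + Finsupp.single 1 (m 2)
  have h1 : ∀ m' ∈ q.support, algebraMap ℂ (MvPolynomial (Fin 2) ℂ) (q.coeff m') *
      ((![(1 : MvPolynomial (Fin 2) ℂ), MvPolynomial.X 0, MvPolynomial.X 1]) 0 ^ m' 0 *
      (![(1 : MvPolynomial (Fin 2) ℂ), MvPolynomial.X 0, MvPolynomial.X 1]) 1 ^ m' 1 *
      (![(1 : MvPolynomial (Fin 2) ℂ), MvPolynomial.X 0, MvPolynomial.X 1]) 2 ^ m' 2) =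
      MvPolynomial.monomial (ex m') (q.coeff m') := by
    intro m' _
    rw [MvPolynomial.monomial_eq, Finsupp.prod_fintype _ _ (by simp), Fin.prod_univ_two]
    simp [ex, MvPolynomial.algebraMap_eq]
  rw [Finset.sum_congr rfl h1] at h
  have h2 := congrArg (MvPolynomial.coeff (ex m)) h
  rw [MvPolynomial.coeff_sum, Finset.sum_eq_single m] at h2
  · rw [MvPolynomial.coeff_monomial, if_pos rfl] at h2
    exact MvPolynomial.mem_support_iff.1 hm h2
  · intro m' hm' hne
    rw [MvPolynomial.coeff_monomial, if_neg]
    intro h3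
    have ha := DFunLike.congr_fun h3 0
    have hb := DFunLike.congr_fun h3 1
    simp [ex] at ha hb
    apply hne
    have h4 := sum_eq_of_mem_support hq hm
    have h5 := sum_eq_of_mem_support hq hm'
    ext i
    match i with
    | 0 => omega
    | 1 => exact ha
    | 2 => exact hb
  · intro h; exact (h hm).elim

theorem totalDegree_dehomogenization_le {q : MvPolynomial (Fin 3) ℂ} {d : ℕ} (hq : q.IsHomogeneous d) :
    (MvPolynomial.aeval ![(1 : MvPolynomial (Fin 2) ℂ), MvPolynomial.X 0, MvPolynomial.X 1] q).totalDegree ≤ d := by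
  rw [aeval_fin_three]
  refine MvPolynomial.totalDegree_finsetSum_le fun m hm => ?_
  have h := sum_eq_of_mem_support hq hm
  simp only [Matrix.cons_val_zero, Matrix.cons_val_one, Matrix.cons_val, one_pow, one_mul]
  refine (MvPolynomial.totalDegree_mul _ _).trans ?_
  rw [MvPolynomial.algebraMap_eq, MvPolynomial.totalDegree_C, zero_add]
  refine (MvPolynomial.totalDegree_mul _ _).trans ?_
  rw [MvPolynomial.totalDegree_X_pow, MvPolynomial.totalDegree_X_pow]
  omega

theorem aeval_eq_pow_mul {K : Type*} [Field K] [Algebra ℂ K] {q : MvPolynomial (Fin 3) ℂ} {d : ℕ}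
    (hq : q.IsHomogeneous d) (e : Fin 3 → K) (he : e 0 ≠ 0) : MvPolynomial.aeval e q =
      e 0 ^ d * MvPolynomial.aeval ![e 1 / e 0, e 2 / e 0]
        (MvPolynomial.aeval ![(1 : MvPolynomial (Fin 2) ℂ), MvPolynomial.X 0, MvPolynomial.X 1] q) := by
  have h1 : (MvPolynomial.aeval ![e 1 / e 0, e 2 / e 0]).comp
      (MvPolynomial.aeval ![(1 : MvPolynomial (Fin 2) ℂ), MvPolynomial.X 0, MvPolynomial.X 1]) =
      MvPolynomial.aeval (R := ℂ) ![1, e 1 / e 0, e 2 / e 0] := by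
    ext i
    match i with
    | 0 => simp
    | 1 => simp
    | 2 => simp
  rw [← AlgHom.comp_apply, h1, aeval_fin_three, aeval_fin_three, Finset.mul_sum]
  refine Finset.sum_congr rfl fun m hm => ?_
  rw [← sum_eq_of_mem_support hq hm]
  simp only [Matrix.cons_val_zero, Matrix.cons_val_one, Matrix.cons_val, div_pow, pow_add]
  field_simp
  simp

end Homogenization

section Quartic

variable {K : Type*} [Field K] [Algebra ℂ K] [hK : Fact (IsCurveFunctionField K)]
variable {η : Ω[K⁄ℂ]} {κ : Point K →₀ ℤ}

theorem mul_mem_rrSpace {D D' : Point K →₀ ℤ} {u v : K} (hu : u ∈ rrSpace D) (hv : v ∈ rrSpace D') :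
    u * v ∈ rrSpace (D + D') := by
  rw [mem_rrSpace] at *
  intro P
  have := P.mul_mem_fil (hu P) (hv P)
  rwa [Finsupp.add_apply, neg_add]

theorem pow_mem_rrSpace {D : Point K →₀ ℤ} {u : K} (hu : u ∈ rrSpace D) (n : ℕ) :
    u ^ n ∈ rrSpace (n • D) := by
  rw [mem_rrSpace] at *
  intro P
  have := P.pow_mem_fil (hu P) n
  simpa using this

theorem deg_nsmul (n : ℕ) (D : Point K →₀ ℤ) : deg (n • D) = n * deg D := by
  induction n with
  | zero => simp
  | succ n ih => rw [succ_nsmul, deg_add, ih]; push_cast; ring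

theorem exists_quartic (hg : genus K = 3) (hκ : HasDiv (omega K) η κ) {e : Fin 3 → K}
    (heκ : ∀ i, e i ∈ rrSpace κ) : ∃ f : MvPolynomial (Fin 3) ℂ, f.IsHomogeneous 4 ∧ f ≠ 0 ∧
      MvPolynomial.aeval e f = 0 := by
  have hmem : ∀ m : Finset.Nat.antidiagonalTuple 3 4,
      e 0 ^ m.1 0 * e 1 ^ m.1 1 * e 2 ^ m.1 2 ∈ rrSpace (4 • κ) := by
    rintro ⟨m, hm⟩
    rw [Finset.Nat.mem_antidiagonalTuple, Fin.sum_univ_three] at hm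
    change e 0 ^ m 0 * e 1 ^ m 1 * e 2 ^ m 2 ∈ _
    have h : 4 • κ = m 0 • κ + m 1 • κ + m 2 • κ := by rw [← add_smul, ← add_smul, hm]
    rw [h]
    exact mul_mem_rrSpace (mul_mem_rrSpace (pow_mem_rrSpace (heκ 0) _) (pow_mem_rrSpace (heκ 1) _))
      (pow_mem_rrSpace (heκ 2) _)
  have hdep : ¬ LinearIndependent ℂ (fun m : Finset.Nat.antidiagonalTuple 3 4 =>
      (⟨_, hmem m⟩ : rrSpace (4 • κ))) := by
    intro hli
    have h1 := hli.fintype_card_le_finrank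
    have h2 := finrank_rrSpace_of_deg (D := 4 • κ) hg (by rw [deg_nsmul, deg_canonical hg hκ]; norm_num)
    rw [deg_nsmul, deg_canonical hg hκ] at h2
    have h3 : Fintype.card (Finset.Nat.antidiagonalTuple 3 4) = 15 := by
      rw [Fintype.card_coe]; rfl
    push_cast at h2
    omega
  rw [Fintype.not_linearIndependent_iff] at hdep
  obtain ⟨g, hg0, m₀, hm₀⟩ := hdep
  refine ⟨∑ m, MvPolynomial.monomial (Finsupp.equivFunOnFinite.symm m.1) (g m), ?_, ?_, ?_⟩
  · refine MvPolynomial.IsHomogeneous.sum _ _ _ fun m _ => ?_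
    apply MvPolynomial.isHomogeneous_monomial
    rw [Finsupp.degree_eq_sum]
    exact Finset.Nat.mem_antidiagonalTuple.1 m.2
  · intro h
    apply hm₀
    have h1 := congrArg (MvPolynomial.coeff (Finsupp.equivFunOnFinite.symm m₀.1)) h
    rw [MvPolynomial.coeff_sum, Finset.sum_eq_single m₀] at h1
    · simpa using h1
    · intro m _ hne
      rw [MvPolynomial.coeff_monomial, if_neg]
      intro h2
      exact hne (Subtype.ext (Finsupp.equivFunOnFinite.symm.injective h2))
    · simp
  · have h1 := congrArg (Subtype.val) hg0
    rw [AddSubmonoidClass.coe_finsetSum] at h1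
    rw [map_sum]
    refine Eq.trans (Finset.sum_congr rfl fun m _ => ?_) h1
    rw [MvPolynomial.aeval_monomial, Finsupp.prod_fintype _ _ (by simp), Fin.prod_univ_three]
    change _ = g m • (e 0 ^ m.1 0 * e 1 ^ m.1 1 * e 2 ^ m.1 2)
    rw [Algebra.smul_def]; rfl

theorem eq_zero_of_totalDegree_le (hg : genus K = 3) (hnh : ¬ IsHyperelliptic K)
    (hκ : HasDiv (omega K) η κ) {e : Fin 3 → K} (he : LinearIndependent ℂ e)
    (heκ : ∀ i, e i ∈ rrSpace κ) {p : MvPolynomial (Fin 2) ℂ} (hp : p.totalDegree ≤ 3)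
    (hpe : MvPolynomial.aeval ![e 1 / e 0, e 2 / e 0] p = 0) : p = 0 := by
  obtain ⟨q, hq, hqp, hqK⟩ := exists_homogenization p hp
  have h1 := hqK K e (he.ne_zero 0)
  rw [hpe, mul_zero] at h1
  rw [← hqp, eq_zero_of_isHomogeneous hg hnh hκ he heκ le_rfl hq h1, map_zero]

theorem mem_span_of_prime {y z : K} (hy : Transcendental ℂ y) {g h : MvPolynomial (Fin 2) ℂ}
    (hg : Prime g) (hgy : MvPolynomial.aeval ![y, z] g = 0) (hhy : MvPolynomial.aeval ![y, z] h = 0) :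
    g ∣ h := by
  by_contra hcon
  let 𝔭 := RingHom.ker (MvPolynomial.aeval (R := ℂ) ![y, z])
  have h𝔭 : 𝔭.IsPrime := RingHom.ker_isPrime _
  have hgP : (Ideal.span {g}).IsPrime := (Ideal.span_singleton_prime hg.ne_zero).2 hg
  have hlt : Ideal.span {g} < 𝔭 := by
    refine lt_of_le_of_ne ?_ fun h' => hcon ?_
    · rw [Ideal.span_singleton_le_iff_mem]; exact hgy
    · rw [← Ideal.mem_span_singleton, h']; exact hhy
  have hmax : 𝔭.IsMaximal := by
    by_contra hnm
    obtain ⟨𝔪, h𝔪, hle⟩ := Ideal.exists_le_maximal 𝔭 h𝔭.ne_top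
    have hlt2 : 𝔭 < 𝔪 := lt_of_le_of_ne hle fun h => hnm (h ▸ h𝔪)
    let c : LTSeries (PrimeSpectrum (MvPolynomial (Fin 2) ℂ)) :=
      { length := 3
        toFun := ![⟨⊥, Ideal.isPrime_bot⟩, ⟨_, hgP⟩, ⟨_, h𝔭⟩, ⟨_, h𝔪.isPrime⟩]
        step := fun i => by
          match i with
          | 0 => exact (bot_lt_iff_ne_bot.2 (by simpa using hg.ne_zero) : (⊥ : Ideal _) < Ideal.span {g})
          | 1 => exact hlt
          | 2 => exact hlt2 }
    have h1 := Order.LTSeries.length_le_krullDim c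
    have h2 : ringKrullDim (MvPolynomial (Fin 2) ℂ) = 2 := by
      rw [MvPolynomial.ringKrullDim_of_isNoetherianRing]
      simp
    rw [ringKrullDim] at h2
    rw [h2] at h1
    change ((3 : ℕ) : WithBot ℕ∞) ≤ ((2 : ℕ) : WithBot ℕ∞) at h1
    norm_cast at h1
  obtain ⟨a, ha⟩ := MvPolynomial.isMaximal_iff_eq_vanishingIdeal_singleton.1 hmax
  have h1 : MvPolynomial.X 0 - MvPolynomial.C (a 0) ∈ 𝔭 := by
    rw [ha, MvPolynomial.mem_vanishingIdeal_singleton_iff]; simp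
  rw [RingHom.mem_ker] at h1
  simp only [map_sub, MvPolynomial.aeval_X, MvPolynomial.algHom_C, Matrix.cons_val_zero] at h1
  rw [sub_eq_zero] at h1
  exact hy (h1 ▸ isAlgebraic_algebraMap _)

theorem dvd_of_aeval_eq_zero (hg : genus K = 3) (hnh : ¬ IsHyperelliptic K)
    (hκ : HasDiv (omega K) η κ) {e : Fin 3 → K} (he : LinearIndependent ℂ e)
    (heκ : ∀ i, e i ∈ rrSpace κ) {f : MvPolynomial (Fin 3) ℂ} (hf : f.IsHomogeneous 4)
    (hf0 : f ≠ 0) (hfe : MvPolynomial.aeval e f = 0) {h : MvPolynomial (Fin 2) ℂ}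
    (hh : MvPolynomial.aeval ![e 1 / e 0, e 2 / e 0] h = 0) :
    MvPolynomial.aeval ![(1 : MvPolynomial (Fin 2) ℂ), MvPolynomial.X 0, MvPolynomial.X 1] f ∣ h := by
  have hy : Transcendental ℂ (e 1 / e 0) := transcendental_div (by
    have := he.comp ![0, 1] (by decide)
    convert this using 1
    funext i; match i with | 0 => rfl | 1 => rfl)
  set f₁ := MvPolynomial.aeval ![(1 : MvPolynomial (Fin 2) ℂ), MvPolynomial.X 0, MvPolynomial.X 1] f with hf₁
  have hf₁0 : f₁ ≠ 0 := fun h => hf0 (eq_zero_of_dehomogenization hf h)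
  have hf₁e : MvPolynomial.aeval ![e 1 / e 0, e 2 / e 0] f₁ = 0 := by
    have := aeval_eq_pow_mul hf e (he.ne_zero 0)
    rw [hfe] at this
    exact (mul_eq_zero.1 this.symm).resolve_left (pow_ne_zero _ (he.ne_zero 0))
  let 𝔭 := RingHom.ker (MvPolynomial.aeval (R := ℂ) ![e 1 / e 0, e 2 / e 0])
  have h𝔭 : 𝔭.IsPrime := RingHom.ker_isPrime _
  obtain ⟨g, hgm, hgp⟩ := h𝔭.exists_mem_prime_of_ne_bot
    (fun h => hf₁0 (by have : f₁ ∈ 𝔭 := hf₁e; rwa [h, Ideal.mem_bot] at this))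
  obtain ⟨u, hu⟩ := mem_span_of_prime hy hgp hgm hf₁e
  have hgdeg : 4 ≤ g.totalDegree := by
    by_contra hcon
    exact hgp.ne_zero (eq_zero_of_totalDegree_le hg hnh hκ he heκ (by omega) hgm)
  have hu0 : u ≠ 0 := by rintro rfl; rw [mul_zero] at hu; exact hf₁0 hu
  have hdeg := totalDegree_dehomogenization_le hf
  rw [← hf₁, hu, MvPolynomial.totalDegree_mul_of_isDomain hgp.ne_zero hu0] at hdeg
  have hud : u.totalDegree = 0 := by omega
  rw [MvPolynomial.totalDegree_eq_zero_iff_eq_C] at hud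
  have hunit : IsUnit u := by
    rw [hud]
    refine IsUnit.map MvPolynomial.C (isUnit_iff_ne_zero.2 fun h => hu0 ?_)
    rw [hud, h, map_zero]
  rw [hu, hunit.mul_right_dvd]
  exact mem_span_of_prime hy hgp hgm hh

end Quartic

/-! ### Lengths and degrees -/

section Length

variable {K : Type*} [Field K] [Algebra ℂ K] [hK : Fact (IsCurveFunctionField K)]
variable {V : Type*} [AddCommGroup V] [Module K V]

theorem Point.irreducible_of_ord_eq_one (P : Point K) {t : P.O} (ht : P.ord (t : K) = 1) :
    Irreducible t := by
  have ht0 : (t : K) ≠ 0 := fun h => by rw [h] at ht; simp at ht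
  rw [IsDiscreteValuationRing.irreducible_iff_uniformizer]
  ext z
  rw [P.mem_maximalIdeal, Ideal.mem_span_singleton']
  constructor
  · intro hz
    have h1 : (z : K) / t ∈ P.O := by
      rw [← P.mem_fil_zero, div_eq_mul_inv, P.mul_mem_fil_iff (inv_ne_zero ht0), P.ord_inv, ht]
      simpa using hz
    exact ⟨⟨_, h1⟩, Subtype.ext (div_mul_cancel₀ _ ht0)⟩
  · rintro ⟨a, rfl⟩
    have := P.mul_mem_fil (P.mem_fil_zero.2 a.2) ((P.mem_fil ht0).2 ht.ge)
    simpa using this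

theorem Point.length_quotient_eq (P : Point K) {I : Ideal P.O} {n : ℕ}
    (hI : ∀ z : P.O, z ∈ I ↔ (z : K) ∈ P.fil n) : Module.length P.O (P.O ⧸ I) = n := by
  obtain ⟨t, ht0, ht⟩ := P.exists_ord_eq 1
  have htO : t ∈ P.O := (P.mem_O_iff ht0).2 (by omega)
  have hirr := P.irreducible_of_ord_eq_one (t := ⟨t, htO⟩) ht
  have h1 : I = Ideal.span {(⟨t, htO⟩ : P.O) ^ n} := by
    ext z
    rw [hI, Ideal.mem_span_singleton']
    have htn : t ^ n ≠ 0 := pow_ne_zero _ ht0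
    constructor
    · intro hz
      have h1 : (z : K) / t ^ n ∈ P.O := by
        rw [← P.mem_fil_zero, div_eq_mul_inv, P.mul_mem_fil_iff (inv_ne_zero htn), P.ord_inv, P.ord_pow, ht]
        simpa using hz
      exact ⟨⟨_, h1⟩, Subtype.ext (div_mul_cancel₀ _ htn)⟩
    · rintro ⟨a, rfl⟩
      have := P.mul_mem_fil (P.mem_fil_zero.2 a.2) ((P.mem_fil (n := n) htn).2 (by rw [P.ord_pow, ht, mul_one]))
      simpa using this
  have h2 := Ring.ord_pow (mem_nonZeroDivisors_of_ne_zero hirr.ne_zero) n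
  rw [Ring.ord_of_irreducible hirr] at h2
  rw [h1]
  simpa [Ring.ord] using h2

theorem colength_eq (P : Point K) {M N : Submodule P.O V} (g : V →ₗ[K] K) {n : ℕ}
    (h1 : ∀ m ∈ M, g m ∈ P.O) (h2 : ∃ m ∈ M, g m = 1) (h3 : ∀ m ∈ M, m ∈ N ↔ g m ∈ P.fil n) :
    colength M N = n := by
  let I : Ideal P.O := (P.fil n).comap (Algebra.linearMap P.O K)
  rw [← P.length_quotient_eq (I := I) fun z => Iff.rfl]
  let f : M →ₗ[P.O] P.O :=
    { toFun := fun m => ⟨g m, h1 m m.2⟩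
      map_add' := fun a b => Subtype.ext (by simp)
      map_smul' := fun c a => Subtype.ext (by
        change g ((c : K) • (a : V)) = c * g a
        rw [map_smul, smul_eq_mul]) }
  have hsurj : Function.Surjective (I.mkQ.comp f) := by
    refine (Submodule.mkQ_surjective I).comp ?_
    intro z
    obtain ⟨m, hm, hm1⟩ := h2
    refine ⟨z • ⟨m, hm⟩, ?_⟩
    rw [map_smul]
    have : f ⟨m, hm⟩ = 1 := Subtype.ext hm1
    rw [this, smul_eq_mul, mul_one]
  have hker : LinearMap.ker (I.mkQ.comp f) = N.submoduleOf M := by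
    ext m
    rw [LinearMap.mem_ker, LinearMap.comp_apply, Submodule.mkQ_apply, Submodule.Quotient.mk_eq_zero]
    exact (h3 m m.2).symm
  rw [colength, ← hker]
  exact (LinearMap.quotKerEquivOfSurjective _ hsurj).length_eq

variable {L : Family K V} {s : V} {D : Point K →₀ ℤ}

/-- The coordinate with respect to a rational section of a line bundle. -/
def HasDiv.equiv (h : HasDiv L s D) : K ≃ₗ[K] V :=
  LinearEquiv.ofBijective (LinearMap.toSpanSingleton K V s)
    ⟨fun _ _ hab => smul_left_injective K h.ne_zero hab, fun v => (h.exists_smul v).imp fun _ h => h.symm⟩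

@[simp] theorem HasDiv.equiv_apply (h : HasDiv L s D) (f : K) : h.equiv f = f • s := rfl

@[simp] theorem HasDiv.equiv_symm_smul (h : HasDiv L s D) (f : K) : h.equiv.symm (f • s) = f :=
  h.equiv.symm_apply_apply f

theorem HasDiv.mem_stalk (h : HasDiv L s D) (P : Point K) (v : V) :
    v ∈ L.stalk P ↔ h.equiv.symm v ∈ P.fil (-D P) := by
  rw [← h.mem_iff, ← h.equiv_apply, LinearEquiv.apply_symm_apply]

theorem HasDiv.mem_span (h : HasDiv L s D) (P : Point K) (v : V) :
    v ∈ Submodule.span P.O {s} ↔ h.equiv.symm v ∈ P.O := by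
  have := mem_span_O_singleton (P := P) h.ne_zero (f := h.equiv.symm v) one_ne_zero P.ord_one
  rw [one_smul, ← h.equiv_apply, LinearEquiv.apply_symm_apply, P.mem_fil_zero] at this
  exact this

theorem HasDiv.colength_stalk_span (h : HasDiv L s D) (P : Point K) :
    colength (L.stalk P) (Submodule.span P.O {s}) = ((D P).toNat : ℕ∞) := by
  obtain ⟨t, ht0, ht⟩ := P.exists_ord_eq (D P)
  refine colength_eq P (LinearMap.mulLeft K t ∘ₗ h.equiv.symm.toLinearMap) ?_ ?_ ?_
  · intro m hm
    rw [h.mem_stalk] at hm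
    have := P.mul_mem_fil ((P.mem_fil ht0).2 ht.ge) hm
    simpa using this
  · refine ⟨t⁻¹ • s, (h.mem_iff P _).2 ?_, ?_⟩
    · rw [P.mem_fil (inv_ne_zero ht0), P.ord_inv, ht]
    · rw [LinearMap.comp_apply, LinearEquiv.coe_coe, h.equiv_symm_smul, LinearMap.mulLeft_apply,
        mul_inv_cancel₀ ht0]
  · intro m hm
    rw [h.mem_span]
    rw [h.mem_stalk] at hm
    simp only [LinearMap.comp_apply, LinearEquiv.coe_coe, LinearMap.mulLeft_apply]
    rw [mul_comm, P.mul_mem_fil_iff ht0, ht, ← P.mem_fil_zero]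
    rcases le_total 0 (D P) with h0 | h0
    · rw [Int.toNat_of_nonneg h0, sub_self]
    · exact iff_of_true (P.fil_anti (by omega) hm) (P.fil_anti (by omega) hm)

theorem HasDiv.colength_span_stalk (h : HasDiv L s D) (P : Point K) :
    colength (Submodule.span P.O {s}) (L.stalk P) = ((-D P).toNat : ℕ∞) := by
  refine colength_eq P h.equiv.symm.toLinearMap ?_ ?_ ?_
  · intro m hm; exact (h.mem_span P m).1 hm
  · refine ⟨s, Submodule.mem_span_singleton_self s, ?_⟩
    have := h.equiv_symm_smul 1
    rwa [one_smul] at this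
  · intro m hm
    rw [h.mem_span] at hm
    rw [h.mem_stalk]
    rcases le_total 0 (-D P) with h0 | h0
    · rw [Int.toNat_of_nonneg h0]; rfl
    · rw [← P.mem_fil_zero] at hm
      exact iff_of_true (P.fil_anti (by omega) hm) (P.fil_anti (by omega) hm)

theorem HasDiv.ord_eq (h : HasDiv L s D) (P : Point K) : L.ord s P = D P := by
  rw [Family.ord, h.colength_stalk_span, h.colength_span_stalk]
  simp only [ENat.toNat_natCast]
  omega

theorem HasDiv.lineDegree_eq (h : HasDiv L s D) : L.lineDegree = deg D := by
  have hex : ∃ s : V, s ≠ 0 := ⟨s, h.ne_zero⟩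
  rw [Family.lineDegree, dif_pos hex]
  obtain ⟨f, hf⟩ := h.exists_smul hex.choose
  have hf0 : f ≠ 0 := by rintro rfl; exact hex.choose_spec (by simpa using hf)
  have h' := h.smul hf0
  rw [← hf] at h'
  rw [finsum_congr h'.ord_eq, ← deg_eq_finsum, deg_add, deg_divf, add_zero]

end Length

section LineBundles

variable {K : Type*} [Field K] [Algebra ℂ K] [hK : Fact (IsCurveFunctionField K)]
variable {V : Type*} [AddCommGroup V] [Module K V]
variable {W : Type*} [AddCommGroup W] [Module K W]

/-- The divisor of a section from a coordinate function. -/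
theorem hasDiv_of_equiv {L : Family K V} {s : V} {D : Point K →₀ ℤ} (c : V ≃ₗ[K] K) (hs : c s = 1)
    (h : ∀ P v, v ∈ L.stalk P ↔ c v ∈ P.fil (-D P)) : HasDiv L s D where
  ne_zero := by rintro rfl; simp at hs
  exists_smul v := ⟨c v, c.injective (by simp [hs])⟩
  mem_iff P f := by rw [h, map_smul, hs, smul_eq_mul, mul_one]

theorem Point.exists_mul_eq (P : Point K) {m n : ℤ} {f : K} (hf : f ∈ P.fil (m + n)) :
    ∃ a ∈ P.fil m, ∃ b ∈ P.fil n, f = a * b := by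
  obtain ⟨t, ht0, ht⟩ := P.exists_ord_eq m
  refine ⟨t, (P.mem_fil ht0).2 ht.ge, f / t, ?_, (mul_div_cancel₀ f ht0).symm⟩
  rw [div_eq_mul_inv, P.mul_mem_fil_iff (inv_ne_zero ht0), P.ord_inv, ht]
  convert hf using 2; ring

theorem HasDiv.tensor {L : Family K V} {M : Family K W} {s : V} {t : W} {D D' : Point K →₀ ℤ}
    (h : HasDiv L s D) (h' : HasDiv M t D') : HasDiv (L.tensor M) (s ⊗ₜ[K] t) (D + D') := by
  let c : V ⊗[K] W ≃ₗ[K] K := TensorProduct.congr h.equiv.symm h'.equiv.symm ≪≫ₗ TensorProduct.lid K K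
  have hc : ∀ v w, c (v ⊗ₜ w) = h.equiv.symm v * h'.equiv.symm w := fun v w => by simp [c]
  have hs : h.equiv.symm s = 1 := by have := h.equiv_symm_smul 1; rwa [one_smul] at this
  have ht : h'.equiv.symm t = 1 := by have := h'.equiv_symm_smul 1; rwa [one_smul] at this
  refine hasDiv_of_equiv c (by rw [hc, hs, ht, one_mul]) fun P x => ?_
  rw [Finsupp.add_apply, neg_add]
  constructor
  · intro hx
    refine Submodule.span_induction (p := fun x _ => c x ∈ P.fil (-D P + -D' P)) ?_ ?_ ?_ ?_ hx
    · rintro _ ⟨v, hv, w, hw, rfl⟩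
      rw [hc]
      exact P.mul_mem_fil ((h.mem_stalk P v).1 hv) ((h'.mem_stalk P w).1 hw)
    · rw [map_zero]; exact zero_mem _
    · intro a b _ _ ha hb; rw [map_add]; exact add_mem ha hb
    · intro a b _ hb
      change c ((a : K) • b) ∈ _
      rw [map_smul]
      exact (P.fil _).smul_mem a hb
  · intro hx
    obtain ⟨a, ha, b, hb, hab⟩ := P.exists_mul_eq hx
    have h1 : x = (a • s) ⊗ₜ[K] (b • t) := c.injective (by
      rw [hc, hab, h.equiv_symm_smul, h'.equiv_symm_smul])
    rw [h1]
    exact Submodule.subset_span ⟨_, (h.mem_iff P a).2 ha, _, (h'.mem_iff P b).2 hb, rfl⟩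

/-- The coordinate on the exterior square of a plane. -/
theorem exists_wedge_equiv (b : Module.Basis (Fin 2) K V) : ∃ c : ⋀[K]^2 V ≃ₗ[K] K,
    ∀ v w, c (exteriorPower.ιMulti K 2 ![v, w]) = b.repr v 0 * b.repr w 1 - b.repr v 1 * b.repr w 0 := by
  let c := exteriorPower.alternatingMapLinearEquiv b.det
  have hc : ∀ v w, c (exteriorPower.ιMulti K 2 ![v, w]) = b.repr v 0 * b.repr w 1 - b.repr v 1 * b.repr w 0 := by
    intro v w
    rw [exteriorPower.alternatingMapLinearEquiv_apply_ιMulti, Module.Basis.det_apply, Matrix.det_fin_two]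
    simp [Module.Basis.toMatrix_apply]
    ring
  have hw : ∀ v w, exteriorPower.ιMulti K 2 ![v, w] =
      (b.repr v 0 * b.repr w 1 - b.repr v 1 * b.repr w 0) • exteriorPower.ιMulti K 2 ![b 0, b 1] := by
    intro v w
    have hself : ∀ v, wedge K V v v = 0 := fun v =>
      (exteriorPower.ιMulti K 2 (M := V)).map_eq_zero_of_eq ![v, v] (i := 0) (j := 1) rfl (by decide)
    have hswap : ∀ v w, wedge K V w v = -wedge K V v w := fun v w => by
      have := hself (v + w)
      simp only [map_add, LinearMap.add_apply, hself] at this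
      rw [eq_neg_iff_add_eq_zero]; simpa [add_comm] using this
    change wedge K V v w = _ • wedge K V (b 0) (b 1)
    conv_lhs => rw [← b.sum_repr v, ← b.sum_repr w]
    simp only [Fin.sum_univ_two, map_add, map_smul, LinearMap.add_apply, LinearMap.smul_apply, hself, smul_zero,
      zero_add, add_zero]
    rw [hswap (b 0) (b 1)]
    module
  have hinv : ∀ x, x = c x • exteriorPower.ιMulti K 2 ![b 0, b 1] := by
    intro x
    have hx : x ∈ Submodule.span K (Set.range (exteriorPower.ιMulti K 2 (M := V))) := by
      rw [exteriorPower.ιMulti_span]; trivial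
    induction hx using Submodule.span_induction with
    | mem x hx =>
      obtain ⟨a, rfl⟩ := hx
      have : a = ![a 0, a 1] := by ext i; fin_cases i <;> rfl
      rw [this, hc]; exact hw _ _
    | zero => simp
    | add a b _ _ ha hb => rw [map_add, add_smul, ← ha, ← hb]
    | smul r a _ ha => rw [map_smul, smul_assoc, ← ha]
  refine ⟨LinearEquiv.ofBijective c ⟨?_, ?_⟩, hc⟩
  · intro x y hxy
    rw [hinv x, hinv y, hxy]
  · intro r
    refine ⟨r • exteriorPower.ιMulti K 2 ![b 0, b 1], ?_⟩
    rw [map_smul, hc]; simp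

theorem HasDiv.det_directSum {L : Family K V} {M : Family K W} {s : V} {t : W} {D D' : Point K →₀ ℤ}
    (h : HasDiv L s D) (h' : HasDiv M t D') :
    HasDiv (L.directSum M).det (exteriorPower.ιMulti K 2 ![(s, 0), (0, t)]) (D + D') := by
  let b : Module.Basis (Fin 2) K (V × W) := Module.Basis.ofEquivFun
    ((LinearEquiv.prodCongr h.equiv.symm h'.equiv.symm) ≪≫ₗ (LinearEquiv.finTwoArrow K K).symm)
  have hb0 : ∀ x, b.repr x 0 = h.equiv.symm x.1 := fun x => rfl
  have hb1 : ∀ x, b.repr x 1 = h'.equiv.symm x.2 := fun x => rfl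
  obtain ⟨c, hc⟩ := exists_wedge_equiv b
  have hs : h.equiv.symm s = 1 := by have := h.equiv_symm_smul 1; rwa [one_smul] at this
  have ht : h'.equiv.symm t = 1 := by have := h'.equiv_symm_smul 1; rwa [one_smul] at this
  refine hasDiv_of_equiv c (by simp [hc, hb0, hb1, hs, ht]) fun P x => ?_
  rw [Finsupp.add_apply, neg_add]
  constructor
  · intro hx
    refine Submodule.span_induction (p := fun x _ => c x ∈ P.fil (-D P + -D' P)) ?_ ?_ ?_ ?_ hx
    · rintro _ ⟨v, hv, w, hw, rfl⟩
      rw [hc, hb0, hb1, hb0, hb1]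
      refine sub_mem (P.mul_mem_fil ((h.mem_stalk P _).1 hv.1) ((h'.mem_stalk P _).1 hw.2)) ?_
      rw [mul_comm]
      exact P.mul_mem_fil ((h.mem_stalk P _).1 hw.1) ((h'.mem_stalk P _).1 hv.2)
    · rw [map_zero]; exact zero_mem _
    · intro a b _ _ ha hb; rw [map_add]; exact add_mem ha hb
    · intro a b _ hb
      change c ((a : K) • b) ∈ _
      rw [map_smul]
      exact (P.fil _).smul_mem a hb
  · intro hx
    obtain ⟨a, ha, b', hb', hab⟩ := P.exists_mul_eq hx
    have h1 : x = exteriorPower.ιMulti K 2 ![(a • s, 0), (0, b' • t)] := c.injective (by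
      rw [hc, hb0, hb1, hb0, hb1, hab, h.equiv_symm_smul, h'.equiv_symm_smul]; simp)
    rw [h1]
    exact Submodule.subset_span ⟨_, ⟨(h.mem_iff P a).2 ha, zero_mem _⟩, _, ⟨zero_mem _, (h'.mem_iff P b').2 hb'⟩, rfl⟩

theorem HasDiv.of_iso {L : Family K V} {M : Family K W} {t : W} {D : Point K →₀ ℤ}
    (h : HasDiv M t D) (φ : L.Iso M) : HasDiv L (φ.toEquiv.symm t) D := by
  refine hasDiv_of_equiv (φ.toEquiv ≪≫ₗ h.equiv.symm) ?_ fun P v => ?_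
  · have := h.equiv_symm_smul 1
    rw [one_smul] at this
    simpa using this
  · rw [← φ.mem_iff, h.mem_stalk]; rfl

theorem Point.exists_eq_fil (P : Point K) (J : Submodule P.O K) {a : K} (ha : a ∈ J) (ha0 : a ≠ 0) {n : ℤ}
    (hJ : ∀ f ∈ J, f ∈ P.fil n) : ∃ m : ℤ, ∀ f, f ∈ J ↔ f ∈ P.fil m := by
  have hex : ∃ k : ℕ, ∃ f ∈ J, f ≠ 0 ∧ P.ord f = n + k := by
    have := (P.mem_fil ha0).1 (hJ a ha)
    exact ⟨(P.ord a - n).toNat, a, ha, ha0, by omega⟩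
  classical
  obtain ⟨f, hf, hf0, hord⟩ := Nat.find_spec hex
  refine ⟨P.ord f, fun g => ⟨fun hg => ?_, fun hg => ?_⟩⟩
  · rw [P.mem_fil']
    by_cases hg0 : g = 0
    · exact Or.inl hg0
    · right
      have h1 := (P.mem_fil hg0).1 (hJ g hg)
      have h2 := Nat.find_min' hex (m := (P.ord g - n).toNat) ⟨g, hg, hg0, by omega⟩
      omega
  · have h1 : g / f ∈ P.O := by
      rw [← P.mem_fil_zero, div_eq_mul_inv, P.mul_mem_fil_iff (inv_ne_zero hf0)]
      simpa using hg
    have := J.smul_mem ⟨g / f, h1⟩ hf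
    change g / f * f ∈ J at this
    rwa [div_mul_cancel₀ _ hf0] at this

theorem Point.exists_smul_mem (P : Point K) {M : Submodule P.O V}
    (hM : Submodule.span K (M : Set V) = ⊤) (v : V) : ∃ a ∈ P.O, a ≠ 0 ∧ a • v ∈ M := by
  have h1 : v ∈ Submodule.span K (M : Set V) := by rw [hM]; trivial
  induction h1 using Submodule.span_induction with
  | mem x hx => exact ⟨1, one_mem _, one_ne_zero, by simpa using hx⟩
  | zero => exact ⟨1, one_mem _, one_ne_zero, by simp⟩
  | add x y _ _ hx hy =>
    obtain ⟨a, ha, ha0, hax⟩ := hx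
    obtain ⟨c, hc, hc0, hcy⟩ := hy
    refine ⟨a * c, mul_mem ha hc, mul_ne_zero ha0 hc0, ?_⟩
    rw [smul_add, mul_comm, mul_smul, mul_comm, mul_smul]
    exact add_mem (M.smul_mem ⟨c, hc⟩ hax) (M.smul_mem ⟨a, ha⟩ hcy)
  | smul r x _ hx =>
    obtain ⟨a, ha, ha0, hax⟩ := hx
    rcases P.O.mem_or_inv_mem r with hr | hr
    · exact ⟨a, ha, ha0, by rw [smul_comm]; exact M.smul_mem ⟨r, hr⟩ hax⟩
    · by_cases hr0 : r = 0
      · exact ⟨1, one_mem _, one_ne_zero, by simp [hr0]⟩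
      · refine ⟨a * r⁻¹, mul_mem ha hr, mul_ne_zero ha0 (inv_ne_zero hr0), ?_⟩
        rwa [smul_smul, mul_assoc, inv_mul_cancel₀ hr0, mul_one]

/-- Every line in the generic fibre of a bundle of rank two is the generic fibre of a line
subbundle. -/
theorem exists_hasDiv_sub {E : Family K V} (hE : E.IsVectorBundle 2) {s : V} (hs : s ≠ 0) :
    ∃ D, HasDiv (E.sub (Submodule.span K {s})) ⟨s, Submodule.mem_span_singleton_self s⟩ D := by
  obtain ⟨b, hb⟩ := hE.generic
  have hloc : ∀ P : Point K, ∃ n : ℤ, ∀ f : K, f • s ∈ E.stalk P ↔ f ∈ P.fil n := by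
    intro P
    let J : Submodule P.O K := (E.stalk P).comap ((LinearMap.toSpanSingleton K V s).restrictScalars P.O)
    obtain ⟨a, -, ha0, ha⟩ := P.exists_smul_mem (hE.span_eq_top P) s
    obtain ⟨i, hi⟩ : ∃ i, b.repr s i ≠ 0 := by
      by_contra! h
      exact hs (b.repr.injective (by ext i; simp [h i]))
    obtain ⟨n, hn⟩ : ∃ n : ℤ, ∀ v ∈ E.stalk P, b.repr v i ∈ P.fil n := by
      obtain ⟨S, hS⟩ := hE.fg P
      obtain ⟨n, hn⟩ := Finset.exists_le (S.image fun v => -P.ord (b.repr v i))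
      refine ⟨-n, fun v hv => ?_⟩
      rw [← hS] at hv
      induction hv using Submodule.span_induction with
      | mem x hx => exact P.mem_fil'.2 (Or.inr (neg_le.1 (hn _ (Finset.mem_image_of_mem _ hx))))
      | zero => simp
      | add x y _ _ hx hy => rw [map_add]; exact add_mem hx hy
      | smul r x _ hx =>
        change b.repr ((r : K) • x) i ∈ _
        rw [map_smul]
        exact (P.fil (-n)).smul_mem r hx
    obtain ⟨m, hm⟩ := P.exists_eq_fil J (a := a) ha ha0 (n := n - P.ord (b.repr s i)) (by
      intro f hf
      have := hn _ hf
      change b.repr (f • s) i ∈ _ at this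
      rwa [map_smul, Finsupp.smul_apply, smul_eq_mul, P.mul_mem_fil_iff hi] at this)
    exact ⟨m, hm⟩
  choose n hn using hloc
  have hfin : {P | -n P ≠ 0}.Finite := by
    refine ((hb.union (finite_ord_ne_zero (b.repr s 0))).union (finite_ord_ne_zero (b.repr s 1))).subset ?_
    intro P hP
    by_contra hcon
    simp only [Set.mem_union, not_or, Set.mem_ofPred_eq, not_not] at hcon
    obtain ⟨⟨h1, h2⟩, h3⟩ := hcon
    have hord : ∀ i, P.ord (b.repr s i) = 0 := fun i => by fin_cases i <;> assumption
    apply hP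
    have : n P = 0 := P.fil_injective fun f => by
      rw [← hn, h1, Module.Basis.mem_span_iff_repr_mem]
      constructor
      · intro h
        obtain ⟨i, hi⟩ : ∃ i, b.repr s i ≠ 0 := by
          by_contra! h
          exact hs (b.repr.injective (by ext i; simp [h i]))
        obtain ⟨z, hz⟩ := h i
        have : f * b.repr s i ∈ P.fil 0 := by
          rw [P.mem_fil_zero]
          rw [map_smul, Finsupp.smul_apply, smul_eq_mul] at hz
          rw [← hz]; exact z.2
        rwa [P.mul_mem_fil_iff hi, hord, sub_zero] at this
      · intro h i
        refine ⟨⟨b.repr (f • s) i, ?_⟩, rfl⟩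
        rw [map_smul, Finsupp.smul_apply, smul_eq_mul]
        refine mul_mem (P.mem_fil_zero.1 h) ?_
        rw [← P.mem_fil_zero, P.mem_fil']
        exact Or.inr (hord i).ge
    omega
  refine ⟨Finsupp.ofSupportFinite (fun P => -n P) hfin, ?_, ?_, ?_⟩
  · simpa using hs
  · rintro ⟨v, hv⟩
    obtain ⟨f, rfl⟩ := Submodule.mem_span_singleton.1 hv
    exact ⟨f, rfl⟩
  · intro P f
    change f • s ∈ E.stalk P ↔ f ∈ P.fil (- -n P)
    rw [neg_neg, hn]

/-- A stable bundle has no line subbundle which contains a line bundle of half its degree. -/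
theorem not_forall_smul_mem_of_isStable {E : Family K V} (hE : E.IsVectorBundle 2)
    (hst : E.IsStable) {D : Point K →₀ ℤ} (hD : 2 * deg D = E.degree) {s : V} (hs : s ≠ 0) :
    ¬ ∀ (P : Point K), ∀ f ∈ P.fil (-D P), f • s ∈ E.stalk P := by
  intro h
  obtain ⟨D', hD'⟩ := exists_hasDiv_sub hE hs
  have h1 := hst (Submodule.span K {s}) (finrank_span_singleton hs)
  rw [hD'.lineDegree_eq, ← hD] at h1
  have h2 : D ≤ D' := fun P => by
    obtain ⟨t, ht0, ht⟩ := P.exists_ord_eq (-D P)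
    have h3 := (hD'.mem_iff P t).1 (h P t ((P.mem_fil ht0).2 ht.ge))
    rw [P.mem_fil ht0] at h3
    omega
  have := deg_mono h2
  omega

end LineBundles

/-! ### S-equivalence to `ω ⊕ ω` -/

section SEquivalence

variable {K : Type*} [Field K] [Algebra ℂ K] [hK : Fact (IsCurveFunctionField K)]
variable {V : Type*} [AddCommGroup V] [Module K V]
variable {W : Type*} [AddCommGroup W] [Module K W]
variable {X : Type*} [AddCommGroup X] [Module K X]
variable {Y : Type*} [AddCommGroup Y] [Module K Y]

/-- A line subbundle of the direct sum of two copies of a line bundle. -/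
theorem exists_hasDiv_of_pair {κ : Point K →₀ ℤ} {A : Family K X} {a : X} (ha : a ≠ 0)
    (hsp : ∀ x : X, ∃ f : K, x = f • a) {u v : K} (huv : u ≠ 0 ∨ v ≠ 0)
    (hA : ∀ P f, f • a ∈ A.stalk P ↔ f * u ∈ P.fil (-κ P) ∧ f * v ∈ P.fil (-κ P)) :
    ∃ D, HasDiv A a D ∧ deg D ≤ deg κ ∧ (deg D = deg κ → ∃ (g : K) (c d : ℂ), g ≠ 0 ∧
      (c ≠ 0 ∨ d ≠ 0) ∧ u = algebraMap ℂ K c * g ∧ v = algebraMap ℂ K d * g ∧ D = κ + divf g) := by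
  have hfil : ∀ {u : K} (P : Point K) (f : K), u ≠ 0 → (f * u ∈ P.fil (-κ P) ↔ f ∈ P.fil (-(κ + divf u) P)) := by
    intro u P f hu
    rw [P.mul_mem_fil_iff hu, Finsupp.add_apply, divf_apply, neg_add, sub_eq_add_neg]
  by_cases hu : u = 0
  · have hv : v ≠ 0 := huv.resolve_left (not_not.2 hu)
    refine ⟨κ + divf v, ⟨ha, hsp, fun P f => ?_⟩, ?_, fun _ => ⟨v, 0, 1, hv, Or.inr one_ne_zero, ?_, ?_, rfl⟩⟩
    · rw [hA, hu, mul_zero, hfil P f hv]; simp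
    · rw [deg_add, deg_divf, add_zero]
    · simp [hu]
    · simp
  by_cases hv : v = 0
  · refine ⟨κ + divf u, ⟨ha, hsp, fun P f => ?_⟩, ?_, fun _ => ⟨u, 1, 0, hu, Or.inl one_ne_zero, ?_, ?_, rfl⟩⟩
    · rw [hA, hv, mul_zero, hfil P f hu]; simp
    · rw [deg_add, deg_divf, add_zero]
    · simp
    · simp [hv]
  have hdeg : deg (κ + divf u) = deg κ := by rw [deg_add, deg_divf, add_zero]
  have hle : (κ + divf u) ⊓ (κ + divf v) ≤ κ + divf u := inf_le_left
  refine ⟨(κ + divf u) ⊓ (κ + divf v), ⟨ha, hsp, fun P f => ?_⟩, hdeg ▸ deg_mono hle, fun hD => ?_⟩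
  · rw [hA, hfil P f hu, hfil P f hv, Finsupp.inf_apply, P.mem_fil', P.mem_fil', P.mem_fil']
    by_cases hf : f = 0
    · simp [hf]
    · simp only [hf, false_or]; omega
  · have h1 := eq_of_le_of_deg_eq hle (hD.trans hdeg.symm)
    have h2 : ∀ P : Point K, v / u ∈ P.O := fun P => by
      rw [P.mem_O_iff (div_ne_zero hv hu), P.ord_div hv hu]
      have h3 : κ + divf u ≤ κ + divf v := inf_eq_left.1 h1
      have := h3 P
      simp only [Finsupp.add_apply, divf_apply] at this
      omega
    obtain ⟨c, hc⟩ := exists_const_of_forall_mem h2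
    refine ⟨u, 1, c, hu, Or.inl one_ne_zero, by simp, ?_, h1⟩
    rw [hc, div_mul_cancel₀ _ hu]

theorem exists_hasDiv_of_directSum {κ : Point K →₀ ℤ} {A : Family K X} {B : Family K Y}
    {L : Family K V} {M : Family K W} {s : V} {t : W} (hL : HasDiv L s κ) (hM : HasDiv M t κ)
    (hX : Module.finrank K X = 1) (φ : (X × Y) ≃ₗ[K] (V × W))
    (hφ : ∀ P (x : X × Y), x.1 ∈ A.stalk P ∧ x.2 ∈ B.stalk P ↔ (φ x).1 ∈ L.stalk P ∧ (φ x).2 ∈ M.stalk P) :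
    ∃ a, HasDiv A a κ := by
  obtain ⟨a, ha, hsp⟩ := finrank_eq_one_iff'.1 hX
  have hsp' : ∀ x : X, ∃ f : K, x = f • a := fun x => (hsp x).imp fun _ h => h.symm
  obtain ⟨u, hu⟩ := hL.exists_smul (φ (a, 0)).1
  obtain ⟨v, hv⟩ := hM.exists_smul (φ (a, 0)).2
  have huv : u ≠ 0 ∨ v ≠ 0 := by
    by_contra! h
    have h1 : φ (a, 0) = 0 := Prod.ext (by rw [hu, h.1]; simp) (by rw [hv, h.2]; simp)
    have h2 := φ.map_eq_zero_iff.1 h1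
    exact ha (congrArg Prod.fst h2)
  have hA : ∀ P f, f • a ∈ A.stalk P ↔ f * u ∈ P.fil (-κ P) ∧ f * v ∈ P.fil (-κ P) := by
    intro P f
    have h1 := hφ P (f • (a, 0))
    simp only [map_smul, Prod.smul_fst, Prod.smul_snd, hu, hv, smul_smul, hL.mem_iff, hM.mem_iff] at h1
    rw [← h1]
    simp
  obtain ⟨D, hD, hdeg, hrest⟩ := exists_hasDiv_of_pair ha hsp' huv hA
  have hge : deg κ ≤ deg D := by
    have hkey : ∀ {x : K}, x ≠ 0 → (∀ P, ∀ f ∈ P.fil (-κ P), f • x • a ∈ A.stalk P) → deg κ ≤ deg D := by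
      intro x hx h
      have h1 : κ ≤ D + divf x := fun P => by
        obtain ⟨t, ht0, ht⟩ := P.exists_ord_eq (-κ P)
        have h2 := h P t ((P.mem_fil ht0).2 ht.ge)
        rw [smul_smul, hD.mem_iff, P.mem_fil (mul_ne_zero ht0 hx), P.ord_mul ht0 hx] at h2
        rw [Finsupp.add_apply, divf_apply]
        omega
      have := deg_mono h1
      rwa [deg_add, deg_divf, add_zero] at this
    obtain ⟨x₁, hx₁⟩ := hsp' (φ.symm (s, 0)).1
    obtain ⟨x₂, hx₂⟩ := hsp' (φ.symm (0, t)).1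
    have hne : x₁ ≠ 0 ∨ x₂ ≠ 0 := by
      by_contra! h
      have h1 : ∀ z : V × W, (φ.symm z).1 = 0 := by
        intro z
        obtain ⟨f, hf⟩ := hL.exists_smul z.1
        obtain ⟨g, hg⟩ := hM.exists_smul z.2
        have : z = f • (s, 0) + g • (0, t) := Prod.ext (by simp [hf]) (by simp [hg])
        rw [this, map_add, map_smul, map_smul, Prod.fst_add, Prod.smul_fst, Prod.smul_fst, hx₁, hx₂, h.1, h.2]
        simp
      have h2 := h1 (φ (a, 0))
      rw [LinearEquiv.symm_apply_apply] at h2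
      exact ha h2
    rcases hne with h | h
    · refine hkey h fun P f hf => ?_
      have h1 := (hφ P (f • φ.symm (s, 0))).2 (by
        rw [map_smul, LinearEquiv.apply_symm_apply]
        exact ⟨(hL.mem_iff P f).2 hf, by simp⟩)
      rw [← hx₁]; exact h1.1
    · refine hkey h fun P f hf => ?_
      have h1 := (hφ P (f • φ.symm (0, t))).2 (by
        rw [map_smul, LinearEquiv.apply_symm_apply]
        exact ⟨by simp, (hM.mem_iff P f).2 hf⟩)
      rw [← hx₂]; exact h1.1
  obtain ⟨g, -, -, hg0, -, -, -, hDg⟩ := hrest (le_antisymm hdeg hge)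
  refine ⟨g⁻¹ • a, ?_⟩
  have := hD.smul (inv_ne_zero hg0)
  rwa [hDg, add_assoc, ← divf_mul hg0 (inv_ne_zero hg0), mul_inv_cancel₀ hg0,
    show divf (1 : K) = 0 by ext P; simp, add_zero] at this

theorem HasDiv.quot {E : Family K V} {L : Family K W} {t : W} {D : Point K →₀ ℤ} (hL : HasDiv L t D)
    {m : Submodule K V} {π : V →ₗ[K] W} (hm : LinearMap.ker π = m) {x : V} (hx : π x = t)
    (h1 : ∀ P, ∀ v ∈ E.stalk P, π v ∈ L.stalk P)
    (h2 : ∀ P : Point K, ∀ f ∈ P.fil (-D P), f • x ∈ E.stalk P) : HasDiv (E.quot m) (m.mkQ x) D := by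
  have hmk : ∀ v w : V, m.mkQ v = m.mkQ w ↔ π v = π w := fun v w => by
    rw [Submodule.mkQ_apply, Submodule.mkQ_apply, Submodule.Quotient.eq, ← hm, LinearMap.mem_ker, map_sub, sub_eq_zero]
  refine ⟨fun h => hL.ne_zero ?_, fun y => ?_, fun P f => ⟨?_, fun hf => ?_⟩⟩
  · rw [← hx, ← map_zero π, ← hmk, h, map_zero]
  · obtain ⟨v, rfl⟩ := m.mkQ_surjective y
    obtain ⟨f, hf⟩ := hL.exists_smul (π v)
    exact ⟨f, by rw [← map_smul, hmk, map_smul, hx, hf]⟩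
  · rintro ⟨v, hv, hvf⟩
    have h3 : m.mkQ v = m.mkQ (f • x) := by rw [map_smul]; exact hvf
    rw [← hL.mem_iff, ← hx, ← map_smul, ← (hmk _ _).1 h3]
    exact h1 P v hv
  · exact ⟨f • x, h2 P f hf, map_smul m.mkQ f x⟩

theorem hasDiv_jordanHolder {η : Ω[K⁄ℂ]} {κ : Point K →₀ ℤ} (hκ : HasDiv (omega K) η κ)
    {m : Submodule K (Ω[K⁄ℂ] × Ω[K⁄ℂ])} (hm : ((omega K).directSum (omega K)).IsJordanHolder m) :
    (∃ a, HasDiv (((omega K).directSum (omega K)).sub m) a κ) ∧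
      ∃ q, HasDiv (((omega K).directSum (omega K)).quot m) q κ := by
  obtain ⟨hm1, hm2⟩ := hm
  rw [Family.degree, (hκ.det_directSum hκ).lineDegree_eq, deg_add] at hm2
  obtain ⟨a, ha, hsp⟩ := finrank_eq_one_iff'.1 hm1
  obtain ⟨u, hu⟩ := hκ.exists_smul (a : Ω[K⁄ℂ] × Ω[K⁄ℂ]).1
  obtain ⟨v, hv⟩ := hκ.exists_smul (a : Ω[K⁄ℂ] × Ω[K⁄ℂ]).2
  have huv : u ≠ 0 ∨ v ≠ 0 := by
    by_contra! h
    exact ha (Subtype.ext (Prod.ext (by rw [hu, h.1]; simp) (by rw [hv, h.2]; simp)))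
  obtain ⟨D, hD, -, hrest⟩ := exists_hasDiv_of_pair (κ := κ) (A := ((omega K).directSum (omega K)).sub m) ha
    (fun x => (hsp x).imp fun _ h => h.symm) huv (fun P f => by
      rw [← hκ.mem_iff, ← hκ.mem_iff, mul_smul, mul_smul, ← hu, ← hv]; rfl)
  rw [hD.lineDegree_eq] at hm2
  obtain ⟨g, c, d, hg0, hcd, huc, hvd, hDg⟩ := hrest (by omega)
  constructor
  · refine ⟨g⁻¹ • a, ?_⟩
    have := hD.smul (inv_ne_zero hg0)
    rwa [hDg, add_assoc, ← divf_mul hg0 (inv_ne_zero hg0), mul_inv_cancel₀ hg0,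
      show divf (1 : K) = 0 by ext P; simp, add_zero] at this
  · let π : (Ω[K⁄ℂ] × Ω[K⁄ℂ]) →ₗ[K] Ω[K⁄ℂ] :=
      algebraMap ℂ K c • LinearMap.snd K _ _ - algebraMap ℂ K d • LinearMap.fst K _ _
    have hπ : ∀ y, π y = algebraMap ℂ K c • y.2 - algebraMap ℂ K d • y.1 := fun y => rfl
    have hconst : ∀ (z : ℂ) (P : Point K) (v : Ω[K⁄ℂ]), v ∈ (omega K).stalk P →
        algebraMap ℂ K z • v ∈ (omega K).stalk P := fun z P v hv =>
      ((omega K).stalk P).smul_mem ⟨algebraMap ℂ K z, P.algebraMap_mem z⟩ hv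
    have hne : ∀ {z : ℂ}, z ≠ 0 → algebraMap ℂ K z ≠ 0 := fun hz => (map_ne_zero (algebraMap ℂ K)).2 hz
    have ha1 : (a : Ω[K⁄ℂ] × Ω[K⁄ℂ]).1 = algebraMap ℂ K c • g • η := by rw [hu, huc, mul_smul]
    have ha2 : (a : Ω[K⁄ℂ] × Ω[K⁄ℂ]).2 = algebraMap ℂ K d • g • η := by rw [hv, hvd, mul_smul]
    have hker : LinearMap.ker π = m := by
      apply le_antisymm
      · intro y hy
        rw [LinearMap.mem_ker, hπ, sub_eq_zero] at hy
        obtain ⟨r, hr⟩ : ∃ r : K, y = r • (a : Ω[K⁄ℂ] × Ω[K⁄ℂ]) := by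
          rcases hcd with h | h
          · obtain ⟨f, hf⟩ := hκ.exists_smul y.1
            refine ⟨f * (algebraMap ℂ K c)⁻¹ * g⁻¹, Prod.ext ?_ ?_⟩
            · rw [Prod.smul_fst, ha1, hf, smul_smul, smul_smul]
              congr 1
              field_simp [hne h]
            · rw [Prod.smul_snd, ha2]
              apply smul_right_injective _ (hne h)
              change algebraMap ℂ K c • y.2 = algebraMap ℂ K c • _
              rw [hy, hf, smul_smul, smul_smul, smul_smul, smul_smul]
              congr 1
              field_simp [hne h]
          · obtain ⟨f, hf⟩ := hκ.exists_smul y.2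
            refine ⟨f * (algebraMap ℂ K d)⁻¹ * g⁻¹, Prod.ext ?_ ?_⟩
            · rw [Prod.smul_fst, ha1]
              apply smul_right_injective _ (hne h)
              change algebraMap ℂ K d • y.1 = algebraMap ℂ K d • _
              rw [← hy, hf, smul_smul, smul_smul, smul_smul, smul_smul]
              congr 1
              field_simp [hne h]
            · rw [Prod.smul_snd, ha2, hf, smul_smul, smul_smul]
              congr 1
              field_simp [hne h]
        rw [hr]
        exact m.smul_mem r a.2
      · intro y hy
        obtain ⟨r, hr⟩ := hsp ⟨y, hy⟩
        have hr' : y = r • (a : Ω[K⁄ℂ] × Ω[K⁄ℂ]) := congrArg Subtype.val hr.symm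
        rw [LinearMap.mem_ker, hr', map_smul, hπ, ha1, ha2, smul_comm (algebraMap ℂ K c), sub_self, smul_zero]
    have h1 : ∀ P, ∀ v ∈ ((omega K).directSum (omega K)).stalk P, π v ∈ (omega K).stalk P :=
      fun P v hv => sub_mem (hconst c P _ hv.2) (hconst d P _ hv.1)
    rcases hcd with h | h
    · refine ⟨_, hκ.quot (x := (0, algebraMap ℂ K c⁻¹ • η)) hker ?_ h1 fun P f hf => ⟨?_, ?_⟩⟩
      · rw [hπ, smul_zero, sub_zero, smul_smul, ← map_mul, mul_inv_cancel₀ h, map_one, one_smul]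
      · simp
      · change f • algebraMap ℂ K c⁻¹ • η ∈ _
        rw [smul_comm]
        exact hconst _ P _ ((hκ.mem_iff P f).2 hf)
    · refine ⟨_, hκ.quot (x := (-(algebraMap ℂ K d⁻¹ • η), 0)) hker ?_ h1 fun P f hf => ⟨?_, ?_⟩⟩
      · rw [hπ, smul_zero, zero_sub, smul_neg, neg_neg, smul_smul, ← map_mul, mul_inv_cancel₀ h, map_one, one_smul]
      · change f • -(algebraMap ℂ K d⁻¹ • η) ∈ _
        rw [smul_neg, smul_comm]
        exact neg_mem (hconst _ P _ ((hκ.mem_iff P f).2 hf))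
      · simp

end SEquivalence

section Extension

variable {K : Type*} [Field K] [Algebra ℂ K] [hK : Fact (IsCurveFunctionField K)]
variable {V : Type*} [AddCommGroup V] [Module K V]
variable {η : Ω[K⁄ℂ]} {κ : Point K →₀ ℤ}

theorem not_isStable_omega_directSum (hκ : HasDiv (omega K) η κ) :
    ¬ ((omega K).directSum (omega K)).IsStable := by
  intro h
  let ℓ : Submodule K (Ω[K⁄ℂ] × Ω[K⁄ℂ]) := LinearMap.range (LinearMap.inl K _ _)
  let a : ℓ := ⟨(η, 0), η, rfl⟩
  have ha : HasDiv (((omega K).directSum (omega K)).sub ℓ) a κ := by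
    refine ⟨fun h0 => hκ.ne_zero (congrArg (fun x : ℓ => x.1.1) h0), ?_, fun P f => ?_⟩
    · rintro ⟨_, y, rfl⟩
      obtain ⟨f, hf⟩ := hκ.exists_smul y
      exact ⟨f, Subtype.ext (Prod.ext hf (smul_zero f).symm)⟩
    · rw [← hκ.mem_iff]
      refine ⟨fun h1 => h1.1, fun h1 => ⟨h1, ?_⟩⟩
      change f • (0 : Ω[K⁄ℂ]) ∈ _
      rw [smul_zero]; exact zero_mem _
  have h1 := h ℓ (finrank_eq_one_iff'.2 ⟨a, ha.ne_zero, fun w => (ha.exists_smul w).imp fun _ h => h.symm⟩)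
  rw [ha.lineDegree_eq, Family.degree, (hκ.det_directSum hκ).lineDegree_eq, deg_add] at h1
  omega

theorem HasDiv.finrank_eq_one {L : Family K V} {s : V} {D : Point K →₀ ℤ} (h : HasDiv L s D) :
    Module.finrank K V = 1 :=
  finrank_eq_one_iff'.2 ⟨s, h.ne_zero, fun w => (h.exists_smul w).imp fun _ h => h.symm⟩

theorem exists_hasDiv_of_sEquiv (hκ : HasDiv (omega K) η κ) {F : Family K V}
    (hF : F.SEquiv ((omega K).directSum (omega K))) :
    ∃ (ℓ : Submodule K V) (a : ℓ) (q : V ⧸ ℓ), HasDiv (F.sub ℓ) a κ ∧ HasDiv (F.quot ℓ) q κ := by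
  obtain ⟨-, -, ⟨-, h, -⟩ | ⟨ℓ, m, hℓ, hm, ⟨φ⟩⟩⟩ := hF
  · exact absurd h (not_isStable_omega_directSum hκ)
  obtain ⟨⟨s, hs⟩, t, ht⟩ := hasDiv_jordanHolder hκ hm
  have hφ : ∀ P x, x.1 ∈ (F.sub ℓ).stalk P ∧ x.2 ∈ (F.quot ℓ).stalk P ↔
      (φ.toEquiv x).1 ∈ (((omega K).directSum (omega K)).sub m).stalk P ∧
      (φ.toEquiv x).2 ∈ (((omega K).directSum (omega K)).quot m).stalk P := fun P x => (φ.mem_iff P x).symm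
  obtain ⟨a, ha⟩ := exists_hasDiv_of_directSum hs ht hℓ.1 φ.toEquiv hφ
  have h1 := hs.finrank_eq_one
  have h2 := ht.finrank_eq_one
  have := Module.finite_of_finrank_eq_succ h1
  have := Module.finite_of_finrank_eq_succ h2
  have hfin : Module.Finite K (ℓ × (V ⧸ ℓ)) := Module.Finite.equiv φ.toEquiv.symm
  have : Module.Finite K (V ⧸ ℓ) := Module.Finite.of_surjective (LinearMap.snd K ℓ (V ⧸ ℓ)) Prod.snd_surjective
  have := Module.finite_of_finrank_eq_succ hℓ.1
  have h3 := φ.toEquiv.finrank_eq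
  rw [Module.finrank_prod, Module.finrank_prod, h1, h2, hℓ.1] at h3
  obtain ⟨q, hq⟩ := exists_hasDiv_of_directSum (A := F.quot ℓ) (B := F.sub ℓ) hs ht (by omega)
    ((LinearEquiv.prodComm K (V ⧸ ℓ) ℓ).trans φ.toEquiv) (fun P x => by
      rw [LinearEquiv.trans_apply, ← hφ, and_comm]; rfl)
  exact ⟨ℓ, a, q, ha, hq⟩

theorem isExtension_of_hasDiv (hκ : HasDiv (omega K) η κ) {F : Family K V} {ℓ : Submodule K V} {a : ℓ}
    {q : V ⧸ ℓ} (ha : HasDiv (F.sub ℓ) a κ) (hq : HasDiv (F.quot ℓ) q κ) :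
    Family.IsExtension (omega K) F (omega K) := by
  refine ⟨ℓ.subtype ∘ₗ (hκ.equiv.symm.trans ha.equiv).toLinearMap,
    (hq.equiv.symm.trans hκ.equiv).toLinearMap ∘ₗ ℓ.mkQ, ?_, ?_, ?_, fun P => ⟨?_, ?_⟩⟩
  · exact ℓ.subtype_injective.comp (hκ.equiv.symm.trans ha.equiv).injective
  · rw [LinearMap.exact_iff, LinearMap.ker_comp, LinearEquiv.ker, Submodule.comap_bot, Submodule.ker_mkQ,
      LinearMap.range_comp, LinearEquiv.range, Submodule.map_top, Submodule.range_subtype]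
  · exact (hq.equiv.symm.trans hκ.equiv).surjective.comp ℓ.mkQ_surjective
  · ext x
    obtain ⟨f, rfl⟩ := hκ.exists_smul x
    rw [hκ.mem_iff, ← ha.mem_iff]
    have : (hκ.equiv.symm.trans ha.equiv) (f • η) = f • a := by
      rw [LinearEquiv.trans_apply, hκ.equiv_symm_smul, ha.equiv_apply]
    rw [← this]; rfl
  · ext x
    obtain ⟨f, rfl⟩ := hκ.exists_smul x
    rw [hκ.mem_iff, ← hq.mem_iff]
    have hiff : ∀ v : V, (hq.equiv.symm.trans hκ.equiv) (ℓ.mkQ v) = f • η ↔ ℓ.mkQ v = f • q := fun v => by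
      rw [LinearEquiv.trans_apply, ← hκ.equiv_apply, hκ.equiv.injective.eq_iff, LinearEquiv.symm_apply_eq,
        hq.equiv_apply]
    constructor
    · rintro ⟨v, hv, hvq⟩
      exact ⟨v, hv, (hiff v).2 hvq⟩
    · rintro ⟨v, hv, hvq⟩
      exact ⟨v, hv, (hiff v).1 hvq⟩

end Extension

/-! ### Generators of the kernel of the evaluation map -/

section Generators

variable {K : Type*} [Field K] [Algebra ℂ K] [hK : Fact (IsCurveFunctionField K)]
variable {V : Type*} [AddCommGroup V] [Module K V]
variable {X : Type*} [AddCommGroup X] [Module K X]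
variable {H : Type*} [AddCommGroup H] [Module ℂ H]
variable {κ : Point K →₀ ℤ}

theorem mem_trivial_stalk {ι : Type*} [Fintype ι] (b : Module.Basis ι ℂ H) (P : Point K) (x : K ⊗[ℂ] H) :
    x ∈ (Family.trivial K H).stalk P ↔ ∀ j, (Algebra.TensorProduct.basis K b).repr x j ∈ P.O := by
  constructor
  · intro hx j
    induction hx using Submodule.span_induction with
    | mem x hx =>
      obtain ⟨h, rfl⟩ := hx
      rw [Algebra.TensorProduct.basis_repr_tmul]
      simpa [Algebra.smul_def] using P.algebraMap_mem (b.repr h j)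
    | zero => simp
    | add x y _ _ hx hy => rw [map_add]; exact add_mem hx hy
    | smul c x _ hx =>
      change (Algebra.TensorProduct.basis K b).repr ((c : K) • x) j ∈ P.O
      rw [map_smul]
      exact mul_mem c.2 hx
  · intro h
    rw [← (Algebra.TensorProduct.basis K b).sum_repr x]
    refine Submodule.sum_mem _ fun j _ => ?_
    exact ((Family.trivial K H).stalk P).smul_mem ⟨_, h j⟩
      (Submodule.subset_span ⟨b j, (Algebra.TensorProduct.basis_apply b j).symm⟩)

theorem exists_generators {ι : Type*} [Fintype ι] (β : Module.Basis ι K X) {T : Family K X}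
    (hT : ∀ P x, x ∈ T.stalk P ↔ ∀ j, β.repr x j ∈ P.O) {N : Submodule K X}
    {ℓ : Submodule K (Module.Dual K N)} {a : ℓ} {q : Module.Dual K N ⧸ ℓ}
    (ha : HasDiv ((T.sub N).dual.sub ℓ) a κ) (hq : HasDiv ((T.sub N).dual.quot ℓ) q κ) :
    Module.finrank K N = 2 ∧ ∃ n n' : N,
      (∀ (P : Point K) j, β.repr n j ∈ P.fil (-κ P)) ∧
      (∀ (P : Point K) f, (∀ j, f * β.repr n j ∈ P.O) → f ∈ P.fil (κ P)) ∧
      (∀ P : Point K, ∃ g : K, ∀ j, β.repr n' j + g * β.repr n j ∈ P.fil (-κ P)) ∧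
      (∀ (P : Point K) f g, (∀ j, f * β.repr n' j + g * β.repr n j ∈ P.O) → f ∈ P.fil (κ P)) := by
  have : Module.Finite K X := Module.Finite.of_basis β
  have hN : Module.finrank K N = 2 := by
    rw [← Subspace.dual_finrank_eq, ← Submodule.finrank_quotient_add_finrank ℓ, ha.finrank_eq_one,
      hq.finrank_eq_one]
  have hfil : ∀ (P : Point K) (m : ℤ) (f : K), (∀ t : K, t ≠ 0 → P.ord t = m → f * t ∈ P.O) → f ∈ P.fil (-m) := by
    intro P m f h
    obtain ⟨t, ht0, ht⟩ := P.exists_ord_eq m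
    have := h t ht0 ht
    rw [← P.mem_fil_zero, P.mul_mem_fil_iff ht0, ht, zero_sub] at this
    exact this
  let p : Module.Dual K N →ₗ[K] K := hq.equiv.symm.toLinearMap ∘ₗ ℓ.mkQ
  obtain ⟨n, hn⟩ : ∃ n : N, ∀ φ : Module.Dual K N, p φ = φ n :=
    ⟨(Module.evalEquiv K N).symm p, fun φ => by
      conv_lhs => rw [← (Module.evalEquiv K N).apply_symm_apply p]
      rfl⟩
  have hpq : ∀ φ : Module.Dual K N, ℓ.mkQ φ = φ n • q := fun φ => by
    rw [← hn, ← hq.equiv_apply]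
    exact (hq.equiv.apply_symm_apply _).symm
  have hF : ∀ P, ∀ φ ∈ (T.sub N).dual.stalk P, φ n ∈ P.fil (-κ P) := fun P φ hφ => by
    rw [← hq.mem_iff, ← hpq]; exact ⟨φ, hφ, rfl⟩
  have hF' : ∀ P, ∀ f ∈ P.fil (-κ P), ∃ φ ∈ (T.sub N).dual.stalk P, φ n = f := fun P f hf => by
    obtain ⟨φ, hφ, h⟩ := (hq.mem_iff P f).2 hf
    refine ⟨φ, hφ, smul_left_injective K hq.ne_zero ?_⟩
    change φ n • q = f • q
    rw [← hpq]; exact h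
  have hn0 : n ≠ 0 := by
    rintro rfl
    obtain ⟨φ, hφ⟩ := ℓ.mkQ_surjective q
    rw [hpq, map_zero, zero_smul] at hφ
    exact hq.ne_zero hφ.symm
  have hlamn : a.1 n = 0 := by
    have h1 := hpq a.1
    rw [Submodule.mkQ_apply, (Submodule.Quotient.mk_eq_zero ℓ).2 a.2] at h1
    exact (smul_eq_zero.1 h1.symm).resolve_right hq.ne_zero
  have hlam0 : a.1 ≠ 0 := fun h => ha.ne_zero (Subtype.ext h)
  obtain ⟨n', hn'⟩ : ∃ n' : N, a.1 n' = 1 := LinearMap.surjective hlam0 1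
  have hker : ∀ y : N, a.1 y = 0 → ∃ g : K, y = g • n := by
    intro y hy
    have h1 : Module.finrank K (LinearMap.ker a.1) = 1 := by
      have := LinearMap.finrank_range_add_finrank_ker a.1
      rw [LinearMap.range_eq_top.2 (LinearMap.surjective hlam0), finrank_top, Module.finrank_self, hN] at this
      omega
    obtain ⟨g, hg⟩ := (finrank_eq_one_iff_of_nonzero' (⟨n, hlamn⟩ : LinearMap.ker a.1)
      (fun h => hn0 (congrArg Subtype.val h))).1 h1 ⟨y, hy⟩
    exact ⟨g, (congrArg Subtype.val hg).symm⟩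
  have hsub : ∀ (P : Point K) (y : N), y ∈ (T.sub N).stalk P ↔ ∀ j, β.repr y j ∈ P.O := fun P y => hT P y
  have hJ : ∀ P : Point K, ∀ y ∈ (T.sub N).stalk P, a.1 y ∈ P.fil (κ P) := fun P y hy => by
    have := hfil P (-κ P) (a.1 y) fun t ht0 ht => by
      have h1 : t • a.1 ∈ (T.sub N).dual.stalk P := (ha.mem_iff P t).2 ((P.mem_fil ht0).2 ht.ge)
      have h2 := h1 y hy
      rwa [LinearMap.smul_apply, smul_eq_mul, mul_comm] at h2
    rwa [neg_neg] at this
  refine ⟨hN, n, n', fun P j => ?_, fun P f h => ?_, fun P => ?_, fun P f g h => ?_⟩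
  · exact hF P ((β.coord j).domRestrict N) fun y hy => (hsub P y).1 hy j
  · have h1 : f • n ∈ (T.sub N).stalk P := (hsub P _).2 fun j => by simpa using h j
    have := hfil P (-κ P) f fun t ht0 ht => by
      obtain ⟨φ, hφ, hφt⟩ := hF' P t ((P.mem_fil ht0).2 ht.ge)
      have h2 := hφ _ h1
      rwa [map_smul, hφt] at h2
    rwa [neg_neg] at this
  · let J : Submodule P.O K := ((T.sub N).stalk P).map (a.1.restrictScalars P.O)
    have hspan : ∃ c : K, c ≠ 0 ∧ c • n' ∈ (T.sub N).stalk P := by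
      have hex : ∀ s : Finset ι, ∃ c : K, c ≠ 0 ∧ ∀ j ∈ s, c * β.repr n' j ∈ P.O := by
        classical
        intro s
        induction s using Finset.induction_on with
        | empty => exact ⟨1, one_ne_zero, by simp⟩
        | insert i s _ ih =>
          obtain ⟨c, hc0, hc⟩ := ih
          by_cases hz : β.repr n' i = 0
          · refine ⟨c, hc0, fun j hj => ?_⟩
            rcases Finset.mem_insert.1 hj with rfl | hj
            · rw [hz, mul_zero]; exact zero_mem _
            · exact hc j hj
          obtain ⟨t, ht0, ht⟩ := P.exists_ord_eq (max (- P.ord (c * β.repr n' i)) 0)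
          refine ⟨t * c, mul_ne_zero ht0 hc0, fun j hj => ?_⟩
          rw [mul_assoc]
          rcases Finset.mem_insert.1 hj with rfl | hj
          · rw [P.mem_O_iff (mul_ne_zero ht0 (mul_ne_zero hc0 hz)), P.ord_mul ht0 (mul_ne_zero hc0 hz)]
            omega
          · exact mul_mem ((P.mem_O_iff ht0).2 (by omega)) (hc j hj)
      obtain ⟨c, hc0, hc⟩ := hex Finset.univ
      exact ⟨c, hc0, (hsub P _).2 fun j => by simpa using hc j (Finset.mem_univ j)⟩
    obtain ⟨c, hc0, hc⟩ := hspan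
    have hcJ : c ∈ J := ⟨c • n', hc, by
      change a.1 (c • n') = c
      rw [map_smul, hn', smul_eq_mul, mul_one]⟩
    obtain ⟨m, hm⟩ := P.exists_eq_fil J hcJ hc0 (n := κ P) (by
      rintro _ ⟨y, hy, rfl⟩
      exact hJ P y hy)
    have hle : m ≤ κ P := by
      obtain ⟨t, ht0, ht⟩ := P.exists_ord_eq (-m)
      have h1 : t • a ∈ ((T.sub N).dual.sub ℓ).stalk P := by
        intro y hy
        have h2 : a.1 y ∈ P.fil m := (hm _).1 ⟨y, hy, rfl⟩
        change t * a.1 y ∈ P.O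
        rw [mul_comm, ← P.mem_fil_zero, P.mul_mem_fil_iff ht0, ht]
        simpa using h2
      rw [ha.mem_iff, P.mem_fil ht0] at h1
      omega
    obtain ⟨t, ht0, ht⟩ := P.exists_ord_eq (κ P)
    obtain ⟨y, hy, hyt⟩ := (hm t).2 ((P.mem_fil ht0).2 (by omega))
    replace hyt : a.1 y = t := hyt
    obtain ⟨g, hg⟩ := hker (t⁻¹ • y - n') (by
      rw [map_sub, map_smul, hyt, hn', smul_eq_mul, inv_mul_cancel₀ ht0, sub_self])
    refine ⟨g, fun j => ?_⟩
    have h1 : n' + g • n = t⁻¹ • y := by rw [← hg]; abel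
    have h2 : β.repr n' j + g * β.repr n j = β.repr y j * t⁻¹ := by
      have := congrArg (fun z : N => β.repr z j) h1
      simpa [mul_comm] using this
    rw [h2, P.mul_mem_fil_iff (inv_ne_zero ht0), P.ord_inv, ht]
    have := (hsub P y).1 hy j
    simpa [P.mem_fil_zero] using this
  · have h1 : f • n' + g • n ∈ (T.sub N).stalk P := (hsub P _).2 fun j => by simpa using h j
    have h2 := hJ P _ h1
    rwa [map_add, map_smul, map_smul, hn', hlamn, smul_zero, add_zero, smul_eq_mul, mul_one] at h2

end Generators

section Relations

variable {K : Type*} [Field K] [Algebra ℂ K] [hK : Fact (IsCurveFunctionField K)]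
variable {V : Type*} [AddCommGroup V] [Module K V] [Module ℂ V] [IsScalarTower ℂ K V]
variable {η : Ω[K⁄ℂ]} {κ : Point K →₀ ℤ} {E : Family K V}

/-- The linear map `μ : H⁰(E)* → K`, seen as an element of `K ⊗ H⁰(E)`, lies in the kernel of
the evaluation map. -/
def IsRelation (E : Family K V) (μ : Module.Dual ℂ E.H0 →ₗ[ℂ] K) : Prop :=
  ∀ b : Module.Basis (Fin 4) ℂ E.H0, ∑ j, μ (b.coord j) • (b j : V) = 0

theorem Family.IsVectorBundle.finrank_eq (hE : E.IsVectorBundle 2) : Module.finrank K V = 2 := by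
  obtain ⟨b, -⟩ := hE.generic
  rw [Module.finrank_eq_card_basis b, Fintype.card_fin]

theorem coe_eq_sum_coord {ι M : Type*} [Fintype ι] [AddCommGroup M] [Module ℂ M] {S : Submodule ℂ M}
    (b : Module.Basis ι ℂ S) (x : S) : (x : M) = ∑ j, b.coord j x • (b j : M) := by
  conv_lhs => rw [← b.sum_repr x]
  rw [AddSubmonoidClass.coe_finsetSum]
  rfl

theorem HasDiv.finite {X : Type*} [AddCommGroup X] [Module K X] {L : Family K X} {s : X} {D : Point K →₀ ℤ}
    (h : HasDiv L s D) : Module.Finite K X :=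
  Module.finite_of_finrank_eq_succ h.finrank_eq_one

theorem finrank_eq_two_of_hasDiv_dual {N : Type*} [AddCommGroup N] [Module K N] {F : Family K (Module.Dual K N)}
    {ℓ : Submodule K (Module.Dual K N)} {a : ℓ} {q : Module.Dual K N ⧸ ℓ}
    (ha : HasDiv (F.sub ℓ) a κ) (hq : HasDiv (F.quot ℓ) q κ) :
    Module.Finite K N ∧ Module.finrank K N = 2 := by
  have := ha.finite
  have := hq.finite
  have h : Module.Finite K (Module.Dual K N) := Module.Finite.of_submodule_quotient ℓ
  have : Module.Finite K N := (Module.finite_dual_iff K).1 h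
  refine ⟨this, ?_⟩
  rw [← Subspace.dual_finrank_eq, ← Submodule.finrank_quotient_add_finrank ℓ, ha.finrank_eq_one,
    hq.finrank_eq_one]

theorem isRelation_of_basis (b : Module.Basis (Fin 4) ℂ E.H0) {n : Fin 4 → K}
    (hn : ∑ i, n i • (b i : V) = 0) {μ : Module.Dual ℂ E.H0 →ₗ[ℂ] K}
    (hμ : ∀ u, μ u = ∑ i, u (b i) • n i) : IsRelation E μ := by
  have : SMulCommClass ℂ K V := IsScalarTower.to_smulCommClass
  intro b'
  rw [← hn]
  have h1 : ∀ i, (b i : V) = ∑ j, b'.coord j (b i) • (b' j : V) := fun i => coe_eq_sum_coord b' (b i)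
  conv_rhs => enter [2, i]; rw [h1 i, Finset.smul_sum]
  rw [Finset.sum_comm]
  refine Finset.sum_congr rfl fun j _ => ?_
  rw [hμ, Finset.sum_smul]
  refine Finset.sum_congr rfl fun i _ => ?_
  rw [smul_assoc, smul_comm]

theorem exists_relations (hE : E.IsVectorBundle 2) (hgg : E.IsGloballyGenerated)
    {ℓ : Submodule K (Module.Dual K (LinearMap.ker (LinearMap.liftBaseChange K E.H0.subtype)))} {a : ℓ}
    {q : Module.Dual K (LinearMap.ker (LinearMap.liftBaseChange K E.H0.subtype)) ⧸ ℓ}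
    (ha : HasDiv (E.dualSpan.sub ℓ) a κ) (hq : HasDiv (E.dualSpan.quot ℓ) q κ) :
    Module.finrank ℂ E.H0 = 4 ∧ ∃ ν ν' : Module.Dual ℂ E.H0 →ₗ[ℂ] K, IsRelation E ν ∧ IsRelation E ν' ∧
      (∀ u, ν u ∈ rrSpace κ) ∧
      (∀ (P : Point K) f, (∀ u, f * ν u ∈ P.O) → f ∈ P.fil (κ P)) ∧
      (∀ P : Point K, ∃ g : K, ∀ u, ν' u + g * ν u ∈ P.fil (-κ P)) ∧
      (∀ (P : Point K) f g, (∀ u, f * ν' u + g * ν u ∈ P.O) → f ∈ P.fil (κ P)) := by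
  have hfr : Module.finrank ℂ E.H0 = 4 := by
    obtain ⟨hfinN, hN⟩ : Module.Finite K (LinearMap.ker (LinearMap.liftBaseChange K E.H0.subtype)) ∧
        Module.finrank K (LinearMap.ker (LinearMap.liftBaseChange K E.H0.subtype)) = 2 :=
      finrank_eq_two_of_hasDiv_dual (N := LinearMap.ker (LinearMap.liftBaseChange K E.H0.subtype))
        (F := E.dualSpan) ha hq
    have hsurj : Function.Surjective (LinearMap.liftBaseChange K E.H0.subtype) := by
      obtain ⟨P⟩ := nonempty_point (K := K)
      rw [← LinearMap.range_eq_top, ← top_le_iff, ← hE.span_eq_top P, Submodule.span_le, ← hgg P]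
      intro v hv
      induction hv using Submodule.span_induction with
      | mem x hx => exact ⟨(1 : K) ⊗ₜ ⟨x, hx⟩, by simp⟩
      | zero => exact zero_mem _
      | add x y _ _ hx hy => exact add_mem hx hy
      | smul c x _ hx => exact Submodule.smul_mem _ (c : K) hx
    have hV := hE.finrank_eq
    have := Module.finite_of_finrank_eq_succ hV
    have e := LinearMap.quotKerEquivOfSurjective _ hsurj
    have : Module.Finite K ((K ⊗[ℂ] E.H0) ⧸ LinearMap.ker (LinearMap.liftBaseChange K E.H0.subtype)) := Module.Finite.equiv e.symm
    have : Module.Finite K (K ⊗[ℂ] E.H0) := Module.Finite.of_submodule_quotient (LinearMap.ker (LinearMap.liftBaseChange K E.H0.subtype))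
    have h1 := Submodule.finrank_quotient_add_finrank (LinearMap.ker (LinearMap.liftBaseChange K E.H0.subtype))
    rw [e.finrank_eq, hV, hN, Module.finrank_baseChange] at h1
    exact h1.symm
  refine ⟨hfr, ?_⟩
  have := Module.finite_of_finrank_eq_succ hfr
  obtain ⟨b⟩ : Nonempty (Module.Basis (Fin 4) ℂ E.H0) := ⟨Module.finBasisOfFinrankEq ℂ E.H0 hfr⟩
  obtain ⟨-, n, n', hb, ha', hc, hd⟩ := exists_generators (Algebra.TensorProduct.basis K b)
    (T := Family.trivial K E.H0) (fun P x => mem_trivial_stalk b P x) ha hq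
  let ν : (K ⊗[ℂ] E.H0) → Module.Dual ℂ E.H0 →ₗ[ℂ] K := fun n =>
    ∑ i, (LinearMap.toSpanSingleton ℂ K ((Algebra.TensorProduct.basis K b).repr n i)) ∘ₗ
      (Module.Dual.eval ℂ E.H0 (b i))
  have hν : ∀ n u, ν n u = ∑ i, u (b i) • (Algebra.TensorProduct.basis K b).repr n i := fun n u => by
    simp [ν]
  have hνj : ∀ n j, ν n (b.coord j) = (Algebra.TensorProduct.basis K b).repr n j := fun n j => by
    rw [hν, Finset.sum_eq_single j]
    · simp
    · intro i _ hij
      simp [hij]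
    · simp
  have hrel : ∀ n : LinearMap.ker (LinearMap.liftBaseChange K E.H0.subtype), IsRelation E (ν n) := fun n => by
    refine isRelation_of_basis b (n := fun i => (Algebra.TensorProduct.basis K b).repr n i) ?_ (hν n)
    have h1 := LinearMap.mem_ker.1 n.2
    rw [← (Algebra.TensorProduct.basis K b).sum_repr n.1, map_sum] at h1
    rw [← h1]
    refine Finset.sum_congr rfl fun i _ => ?_
    rw [map_smul, Algebra.TensorProduct.basis_apply]
    simp
  refine ⟨ν n, ν n', hrel n, hrel n', fun u => ?_, fun P f h => ha' P f fun j => ?_, fun P => ?_,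
    fun P f g h => hd P f g fun j => ?_⟩
  · rw [hν]
    exact Submodule.sum_mem _ fun i _ => Submodule.smul_mem _ _ (mem_rrSpace.2 fun P => hb P i)
  · rw [← hνj]; exact h _
  · obtain ⟨g, hg⟩ := hc P
    refine ⟨g, fun u => ?_⟩
    rw [hν, hν, Finset.mul_sum, ← Finset.sum_add_distrib]
    refine sum_mem fun i _ => ?_
    rw [mul_smul_comm, ← smul_add]
    exact P.smul_mem_fil _ (hg i)
  · rw [← hνj, ← hνj]; exact h _

/-- A relation without common zeros, regarded as a section of `Hom(E*, ω)`, is surjective on global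
sections when `E` is stable. -/
theorem range_eq_of_isStable (hκ : HasDiv (omega K) η κ) (hg : genus K = 3) (hE : E.IsVectorBundle 2)
    (δ : E.det.Iso (omega2 K)) (hst : E.IsStable) (hfr : Module.finrank ℂ E.H0 = 4)
    {μ : Module.Dual ℂ E.H0 →ₗ[ℂ] K} (hr : IsRelation E μ) (hb : ∀ u, μ u ∈ rrSpace κ)
    (ha : ∀ (P : Point K) f, (∀ u, f * μ u ∈ P.O) → f ∈ P.fil (κ P)) :
    LinearMap.range μ = rrSpace κ := by
  have hfin := Module.finite_of_finrank_eq_succ hfr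
  have hle : LinearMap.range μ ≤ rrSpace κ := by rintro _ ⟨u, rfl⟩; exact hb u
  by_contra hne
  have hlt := Submodule.finrank_lt_finrank_of_lt (lt_of_le_of_ne hle hne)
  rw [finrank_rrSpace_canonical hg hκ] at hlt
  obtain ⟨x, y, h₀, h₁, hμ⟩ : ∃ (x y : K) (h₀ h₁ : E.H0), ∀ u, μ u = u h₀ • x + u h₁ • y := by
    have hev : ∀ θ : Module.Dual ℂ E.H0 →ₗ[ℂ] ℂ, ∃ h : E.H0, ∀ u, θ u = u h := fun θ =>
      ⟨(Module.evalEquiv ℂ E.H0).symm θ, fun u => by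
        conv_lhs => rw [← (Module.evalEquiv ℂ E.H0).apply_symm_apply θ]
        rfl⟩
    obtain ⟨r, hr⟩ : ∃ r, r = Module.finrank ℂ (LinearMap.range μ) := ⟨_, rfl⟩
    obtain ⟨c⟩ : Nonempty (Module.Basis (Fin r) ℂ (LinearMap.range μ)) :=
      ⟨Module.finBasisOfFinrankEq ℂ _ hr.symm⟩
    have hc : ∀ u, μ u = ∑ i, c.coord i (μ.rangeRestrict u) • (c i : K) := fun u =>
      coe_eq_sum_coord c (μ.rangeRestrict u)
    choose h hh using fun i => hev (c.coord i ∘ₗ μ.rangeRestrict)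
    have hc' : ∀ u, μ u = ∑ i, u (h i) • (c i : K) := fun u => by
      rw [hc]
      exact Finset.sum_congr rfl fun i _ => by rw [← hh]; rfl
    rw [← hr] at hlt
    interval_cases r
    · exact ⟨0, 0, 0, 0, fun u => by simp [hc']⟩
    · exact ⟨c 0, 0, h 0, 0, fun u => by simp [hc']⟩
    · exact ⟨c 0, c 1, h 0, h 1, fun u => by simp [hc', Fin.sum_univ_two]⟩
  have hμ0 : ¬ ∀ u, μ u = 0 := fun h => by
    obtain ⟨P⟩ := nonempty_point (K := K)
    obtain ⟨t, ht0, ht⟩ := P.exists_ord_eq (κ P - 1)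
    have := ha P t fun u => by rw [h, mul_zero]; exact zero_mem _
    rw [P.mem_fil ht0] at this
    omega
  have hrel : x • (h₀ : V) + y • (h₁ : V) = 0 := by
    have : SMulCommClass ℂ K V := IsScalarTower.to_smulCommClass
    obtain ⟨b⟩ : Nonempty (Module.Basis (Fin 4) ℂ E.H0) := ⟨Module.finBasisOfFinrankEq ℂ E.H0 hfr⟩
    rw [← hr b]
    have h1 : ∀ h : E.H0, (h : V) = ∑ j, b.coord j h • (b j : V) := fun h =>
      coe_eq_sum_coord b h
    conv_lhs => rw [h1 h₀, h1 h₁, Finset.smul_sum, Finset.smul_sum, ← Finset.sum_add_distrib]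
    refine Finset.sum_congr rfl fun j _ => ?_
    rw [hμ, add_smul, smul_assoc, smul_assoc, smul_comm x, smul_comm y]
  have hcoe : ∀ h : E.H0, (h : V) = 0 → h = 0 := fun h hh => Subtype.ext hh
  have hx : x ≠ 0 := by
    rintro rfl
    rw [zero_smul, zero_add, smul_eq_zero] at hrel
    exact hμ0 fun u => by rcases hrel with h | h <;> simp [hμ, h, hcoe]
  have hy : y ≠ 0 := by
    rintro rfl
    rw [zero_smul, add_zero, smul_eq_zero] at hrel
    exact hμ0 fun u => by rcases hrel with h | h <;> simp [hμ, h, hcoe]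
  have hh₀ : (h₀ : V) ≠ 0 := by
    intro h
    rw [h, smul_zero, zero_add, smul_eq_zero] at hrel
    have h1 := hrel.resolve_left hy
    exact hμ0 fun u => by simp [hμ, hcoe _ h, hcoe _ h1]
  have hdeg : 2 * deg κ = E.degree := by
    rw [Family.degree, ((hκ.tensor hκ).of_iso δ).lineDegree_eq, deg_add]; ring
  refine not_forall_smul_mem_of_isStable hE hst hdeg (s := y⁻¹ • (h₀ : V))
    (smul_ne_zero (inv_ne_zero hy) hh₀) fun P f hf => ?_
  have hordxy : P.ord x ≤ -κ P ∨ P.ord y ≤ -κ P := by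
    by_contra! h
    obtain ⟨t, ht0, ht⟩ := P.exists_ord_eq (κ P - 1)
    have := ha P t fun u => by
      rw [← P.mem_fil_zero, hμ, mul_add, mul_smul_comm, mul_smul_comm]
      refine add_mem (P.smul_mem_fil _ ?_) (P.smul_mem_fil _ ?_)
      · rw [P.mem_fil (mul_ne_zero ht0 hx), P.ord_mul ht0 hx]; omega
      · rw [P.mem_fil (mul_ne_zero ht0 hy), P.ord_mul ht0 hy]; omega
    rw [P.mem_fil ht0] at this
    omega
  have hdiv : ∀ z : K, z ≠ 0 → P.ord z ≤ -κ P → f * z⁻¹ ∈ P.O := fun z hz hzo => by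
    rw [← P.mem_fil_zero, P.mul_mem_fil_iff (inv_ne_zero hz), P.ord_inv]
    exact P.fil_anti (by omega) hf
  rcases hordxy with h | h
  · have h1 : y⁻¹ • (h₀ : V) = -(x⁻¹ • (h₁ : V)) := by
      have h2 : (h₀ : V) = -(x⁻¹ • y • (h₁ : V)) := by
        rw [eq_neg_of_add_eq_zero_right hrel, smul_neg, neg_neg, inv_smul_smul₀ hx]
      rw [h2, smul_neg, smul_comm x⁻¹, inv_smul_smul₀ hy]
    rw [h1, smul_neg, smul_smul]
    exact neg_mem ((E.stalk P).smul_mem ⟨_, hdiv x hx h⟩ (h₁.2 P))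
  · rw [smul_smul]
    exact (E.stalk P).smul_mem ⟨_, hdiv y hy h⟩ (h₀.2 P)

end Relations

/-! ### Quadrics and cubics in the canonical forms -/

section Koszul

variable {K : Type*} [Field K] [Algebra ℂ K] [hK : Fact (IsCurveFunctionField K)]
variable {η : Ω[K⁄ℂ]} {κ : Point K →₀ ℤ} {e : Fin 3 → K}

theorem cubic_coeff_eq_zero (hg : genus K = 3) (hnh : ¬ IsHyperelliptic K) (hκ : HasDiv (omega K) η κ)
    (he : LinearIndependent ℂ e) (heκ : ∀ i, e i ∈ rrSpace κ)
    {c₀ c₁ c₂ c₃ c₄ c₅ c₆ c₇ c₈ c₉ : ℂ}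
    (h : c₀ • (e 0 * e 0 * e 0) + c₁ • (e 0 * e 0 * e 1) + c₂ • (e 0 * e 0 * e 2) + c₃ • (e 0 * e 1 * e 1) +
      c₄ • (e 0 * e 1 * e 2) + c₅ • (e 0 * e 2 * e 2) + c₆ • (e 1 * e 1 * e 1) + c₇ • (e 1 * e 1 * e 2) +
      c₈ • (e 1 * e 2 * e 2) + c₉ • (e 2 * e 2 * e 2) = 0) :
    c₀ = 0 ∧ c₁ = 0 ∧ c₂ = 0 ∧ c₃ = 0 ∧ c₄ = 0 ∧ c₅ = 0 ∧ c₆ = 0 ∧ c₇ = 0 ∧ c₈ = 0 ∧ c₉ = 0 := by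
  let m : ℂ → Fin 3 → Fin 3 → Fin 3 → MvPolynomial (Fin 3) ℂ := fun c i j k =>
    MvPolynomial.C c * (MvPolynomial.X i * MvPolynomial.X j * MvPolynomial.X k)
  have hm : ∀ c i j k, (m c i j k).IsHomogeneous 3 := fun c i j k => by
    have h1 := MvPolynomial.isHomogeneous_X ℂ (σ := Fin 3)
    simpa using (MvPolynomial.isHomogeneous_C (Fin 3) c).mul (((h1 i).mul (h1 j)).mul (h1 k))
  have hae : ∀ c i j k, MvPolynomial.aeval e (m c i j k) = c • (e i * e j * e k) := fun c i j k => by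
    simp [m, Algebra.smul_def]
  have hev : ∀ x c i j k, MvPolynomial.eval x (m c i j k) = c * (x i * x j * x k) := fun x c i j k => by
    simp [m]
  have hq := eq_zero_of_isHomogeneous (d := 3) (q := m c₀ 0 0 0 + m c₁ 0 0 1 + m c₂ 0 0 2 + m c₃ 0 1 1 + m c₄ 0 1 2 +
    m c₅ 0 2 2 + m c₆ 1 1 1 + m c₇ 1 1 2 + m c₈ 1 2 2 + m c₉ 2 2 2) hg hnh hκ he heκ le_rfl
    ((((((((((hm _ _ _ _).add (hm _ _ _ _)).add (hm _ _ _ _)).add (hm _ _ _ _)).add (hm _ _ _ _)).add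
      (hm _ _ _ _)).add (hm _ _ _ _)).add (hm _ _ _ _)).add (hm _ _ _ _)).add (hm _ _ _ _))
    (by simp only [map_add, hae]; exact h)
  have hx : ∀ x y z : ℂ, c₀ * (x * x * x) + c₁ * (x * x * y) + c₂ * (x * x * z) + c₃ * (x * y * y) +
      c₄ * (x * y * z) + c₅ * (x * z * z) + c₆ * (y * y * y) + c₇ * (y * y * z) + c₈ * (y * z * z) +
      c₉ * (z * z * z) = 0 := fun x y z => by
    have := congrArg (MvPolynomial.eval ![x, y, z]) hq
    simpa only [map_add, hev, map_zero, Matrix.cons_val_zero, Matrix.cons_val_one, Matrix.cons_val] using this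
  have h0 := hx 1 0 0
  have h1 := hx 0 1 0
  have h2 := hx 0 0 1
  have h3 := hx 1 1 0
  have h4 := hx 1 (-1) 0
  have h5 := hx 1 0 1
  have h6 := hx 1 0 (-1)
  have h7 := hx 0 1 1
  have h8 := hx 0 1 (-1)
  have h9 := hx 1 1 1
  norm_num at h0 h1 h2 h3 h4 h5 h6 h7 h8 h9
  have k3 : c₃ = 0 := by linear_combination (1 / 2) * h3 + (1 / 2) * h4 - h0
  have k1 : c₁ = 0 := by linear_combination (1 / 2) * h3 - (1 / 2) * h4 - h1
  have k5 : c₅ = 0 := by linear_combination (1 / 2) * h5 + (1 / 2) * h6 - h0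
  have k2 : c₂ = 0 := by linear_combination (1 / 2) * h5 - (1 / 2) * h6 - h2
  have k8 : c₈ = 0 := by linear_combination (1 / 2) * h7 + (1 / 2) * h8 - h1
  have k7 : c₇ = 0 := by linear_combination (1 / 2) * h7 - (1 / 2) * h8 - h2
  refine ⟨h0, k1, k2, k3, ?_, k5, h1, k7, k8, h2⟩
  linear_combination h9 - h0 - h1 - h2 - k1 - k2 - k3 - k5 - k7 - k8

theorem quadric_coeff_eq_zero (hg : genus K = 3) (hnh : ¬ IsHyperelliptic K) (hκ : HasDiv (omega K) η κ)
    (he : LinearIndependent ℂ e) (heκ : ∀ i, e i ∈ rrSpace κ) {c₀ c₁ c₂ c₃ c₄ c₅ : ℂ}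
    (h : c₀ • (e 0 * e 0) + c₁ • (e 0 * e 1) + c₂ • (e 0 * e 2) + c₃ • (e 1 * e 1) + c₄ • (e 1 * e 2) +
      c₅ • (e 2 * e 2) = 0) :
    c₀ = 0 ∧ c₁ = 0 ∧ c₂ = 0 ∧ c₃ = 0 ∧ c₄ = 0 ∧ c₅ = 0 := by
  obtain ⟨h0, h1, h2, h3, h4, h5, -⟩ := cubic_coeff_eq_zero hg hnh hκ he heκ (c₀ := c₀) (c₁ := c₁) (c₂ := c₂)
    (c₃ := c₃) (c₄ := c₄) (c₅ := c₅) (c₆ := 0) (c₇ := 0) (c₈ := 0) (c₉ := 0) (by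
      simp only [zero_smul, add_zero]
      simp only [Algebra.smul_def] at h ⊢
      linear_combination e 0 * h)
  exact ⟨h0, h1, h2, h3, h4, h5⟩

theorem exists_quadric (hg : genus K = 3) (hnh : ¬ IsHyperelliptic K) (hκ : HasDiv (omega K) η κ)
    (he : LinearIndependent ℂ e) (heκ : ∀ i, e i ∈ rrSpace κ) {z : K} (hz : z ∈ rrSpace (κ + κ)) :
    ∃ c₀ c₁ c₂ c₃ c₄ c₅ : ℂ, z = c₀ • (e 0 * e 0) + c₁ • (e 0 * e 1) + c₂ • (e 0 * e 2) + c₃ • (e 1 * e 1) +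
      c₄ • (e 1 * e 2) + c₅ • (e 2 * e 2) := by
  let p : Fin 6 → K := ![e 0 * e 0, e 0 * e 1, e 0 * e 2, e 1 * e 1, e 1 * e 2, e 2 * e 2]
  have hsum : ∀ c : Fin 6 → ℂ, ∑ i, c i • p i = c 0 • (e 0 * e 0) + c 1 • (e 0 * e 1) + c 2 • (e 0 * e 2) +
      c 3 • (e 1 * e 1) + c 4 • (e 1 * e 2) + c 5 • (e 2 * e 2) := fun c => by
    rw [Fin.sum_univ_six]; rfl
  have hp : LinearIndependent ℂ p := by
    rw [Fintype.linearIndependent_iff]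
    intro c hc
    rw [hsum] at hc
    obtain ⟨h0, h1, h2, h3, h4, h5⟩ := quadric_coeff_eq_zero hg hnh hκ he heκ hc
    intro i
    fin_cases i <;> assumption
  have hle : Submodule.span ℂ (Set.range p) ≤ rrSpace (κ + κ) := by
    rw [Submodule.span_le]
    rintro _ ⟨i, rfl⟩
    fin_cases i <;> exact mul_mem_rrSpace (heκ _) (heκ _)
  have heq : Submodule.span ℂ (Set.range p) = rrSpace (κ + κ) := by
    apply Submodule.eq_of_le_of_finrank_eq hle
    have h4 := deg_canonical hg hκ
    have h5 := finrank_rrSpace_of_deg hg (D := κ + κ) (by rw [deg_add]; omega)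
    rw [finrank_span_eq_card hp, Fintype.card_fin]
    rw [deg_add, h4] at h5
    omega
  rw [← heq, Submodule.mem_span_range_iff_exists_fun] at hz
  obtain ⟨c, hc⟩ := hz
  exact ⟨c 0, c 1, c 2, c 3, c 4, c 5, by rw [← hc, hsum]⟩

theorem exists_koszul (hg : genus K = 3) (hnh : ¬ IsHyperelliptic K) (hκ : HasDiv (omega K) η κ)
    (he : LinearIndependent ℂ e) (heκ : ∀ i, e i ∈ rrSpace κ) {x : Fin 3 → K}
    (hx : ∀ i j, e i * x j - e j * x i ∈ rrSpace (κ + κ)) :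
    ∃ h : K, ∀ i, x i - h * e i ∈ rrSpace κ := by
  obtain ⟨a₀, a₁, a₂, a₃, a₄, a₅, ha⟩ := exists_quadric hg hnh hκ he heκ (hx 1 2)
  obtain ⟨b₀, b₁, b₂, b₃, b₄, b₅, hb⟩ := exists_quadric hg hnh hκ he heκ (hx 2 0)
  obtain ⟨c₀, c₁, c₂, c₃, c₄, c₅, hc⟩ := exists_quadric hg hnh hκ he heκ (hx 0 1)
  obtain ⟨k0, k1, k2, k3, k4, k5, k6, k7, k8, k9⟩ := cubic_coeff_eq_zero hg hnh hκ he heκ (c₀ := a₀)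
    (c₁ := a₁ + b₀) (c₂ := a₂ + c₀) (c₃ := a₃ + b₁) (c₄ := a₄ + b₂ + c₁) (c₅ := a₅ + c₂)
    (c₆ := b₃) (c₇ := b₄ + c₃) (c₈ := b₅ + c₄) (c₉ := c₅) (by
      simp only [Algebra.smul_def, map_add] at ha hb hc ⊢
      linear_combination -e 0 * ha - e 1 * hb - e 2 * hc)
  have hspan : ∀ r s t : ℂ, r • e 0 + s • e 1 + t • e 2 ∈ rrSpace κ := fun r s t =>
    add_mem (add_mem (Submodule.smul_mem _ _ (heκ 0)) (Submodule.smul_mem _ _ (heκ 1)))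
      (Submodule.smul_mem _ _ (heκ 2))
  have he0 : e 0 ≠ 0 := he.ne_zero 0
  obtain ⟨l₀, hl₀⟩ : ∃ l, l = (0 : ℂ) • e 0 + b₄ • e 1 + b₅ • e 2 := ⟨_, rfl⟩
  obtain ⟨l₁, hl₁⟩ : ∃ l, l = (-a₂) • e 0 + c₁ • e 1 + (-a₅) • e 2 := ⟨_, rfl⟩
  obtain ⟨l₂, hl₂⟩ : ∃ l, l = a₁ • e 0 + a₃ • e 1 + (-b₂) • e 2 := ⟨_, rfl⟩
  have k1' : b₀ = -a₁ := by linear_combination k1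
  have k2' : c₀ = -a₂ := by linear_combination k2
  have k3' : b₁ = -a₃ := by linear_combination k3
  have k5' : c₂ = -a₅ := by linear_combination k5
  have k7' : c₃ = -b₄ := by linear_combination k7
  have k8' : c₄ = -b₅ := by linear_combination k8
  subst k0 k1' k2' k3' k5' k6 k7' k8' k9
  have hB : e 2 * x 0 - e 0 * x 2 = e 2 * l₀ - e 0 * l₂ := by
    rw [hb, hl₀, hl₂]
    simp only [Algebra.smul_def, map_neg, map_zero]
    ring
  have hC : e 0 * x 1 - e 1 * x 0 = e 0 * l₁ - e 1 * l₀ := by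
    rw [hc, hl₀, hl₁]
    simp only [Algebra.smul_def, map_neg, map_zero]
    ring
  refine ⟨(x 0 - l₀) / e 0, fun i => ?_⟩
  match i with
  | 0 =>
    rw [div_mul_cancel₀ _ he0, sub_sub_cancel, hl₀]; exact hspan _ _ _
  | 1 =>
    have : x 1 - (x 0 - l₀) / e 0 * e 1 = l₁ := by
      field_simp; linear_combination hC
    rw [this, hl₁]; exact hspan _ _ _
  | 2 =>
    have : x 2 - (x 0 - l₀) / e 0 * e 2 = l₂ := by
      field_simp; linear_combination -hB
    rw [this, hl₂]; exact hspan _ _ _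

/-- Every extension of `ω` by `ω` whose sections surject onto `H⁰(ω)` splits. -/
theorem exists_splitting (hg : genus K = 3) (hnh : ¬ IsHyperelliptic K) (hκ : HasDiv (omega K) η κ)
    {U : Type*} [AddCommGroup U] [Module ℂ U] {ν ν' : U →ₗ[ℂ] K} (hν : LinearMap.range ν = rrSpace κ)
    (hc : ∀ P : Point K, ∃ g : K, ∀ u, ν' u + g * ν u ∈ P.fil (-κ P)) :
    ∃ h : K, ∀ u, ν' u - h * ν u ∈ rrSpace κ := by
  have hmem : ∀ u, ν u ∈ rrSpace κ := fun u => by rw [← hν]; exact ⟨u, rfl⟩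
  obtain ⟨f⟩ : Nonempty (Module.Basis (Fin 3) ℂ (rrSpace κ)) :=
    ⟨Module.finBasisOfFinrankEq ℂ _ (finrank_rrSpace_canonical hg hκ)⟩
  have hex : ∀ i, ∃ u, ν u = f i := fun i => by
    have : (f i : K) ∈ LinearMap.range ν := by rw [hν]; exact (f i).2
    exact this
  choose u hu using hex
  have he : LinearIndependent ℂ (fun i => (f i : K)) := f.linearIndependent.map' (rrSpace κ).subtype (Submodule.ker_subtype _)
  have hx : ∀ v w, ν v * ν' w - ν w * ν' v ∈ rrSpace (κ + κ) := fun v w => by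
    rw [mem_rrSpace]
    intro P
    obtain ⟨g, hg⟩ := hc P
    have h1 : ν v * ν' w - ν w * ν' v = ν v * (ν' w + g * ν w) - ν w * (ν' v + g * ν v) := by ring
    have h2 : -(κ + κ) P = -κ P + -κ P := by rw [Finsupp.add_apply]; ring
    rw [h1, h2]
    exact sub_mem (P.mul_mem_fil (mem_rrSpace.1 (hmem v) P) (hg w)) (P.mul_mem_fil (mem_rrSpace.1 (hmem w) P) (hg v))
  obtain ⟨h, hh⟩ := exists_koszul hg hnh hκ he (fun i => (f i).2) (x := fun i => ν' (u i)) (fun i j => by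
    have := hx (u i) (u j)
    rwa [hu, hu] at this)
  refine ⟨h, fun v => ?_⟩
  have h1 : ν (v - ∑ i, f.coord i ⟨ν v, hmem v⟩ • u i) = 0 := by
    rw [map_sub, map_sum, sub_eq_zero]
    refine (coe_eq_sum_coord f ⟨ν v, hmem v⟩).trans (Finset.sum_congr rfl fun i _ => ?_)
    rw [map_smul, hu]
  obtain ⟨k, hk⟩ : ∃ k, k = v - ∑ i, f.coord i ⟨ν v, hmem v⟩ • u i := ⟨_, rfl⟩
  rw [← hk] at h1
  have h2 : ν' k ∈ rrSpace κ := mem_rrSpace.2 fun P => by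
    obtain ⟨g, hg⟩ := hc P
    have := hg k
    rwa [h1, mul_zero, add_zero] at this
  rw [show v = k + ∑ i, f.coord i ⟨ν v, hmem v⟩ • u i by rw [hk]; abel, map_add, map_add, h1, zero_add, map_sum,
    map_sum, Finset.mul_sum, add_sub_assoc, ← Finset.sum_sub_distrib]
  refine add_mem h2 (Submodule.sum_mem _ fun i _ => ?_)
  rw [map_smul, map_smul, mul_smul_comm, ← smul_sub, hu]
  exact Submodule.smul_mem _ _ (hh i)

end Koszul

/-! ### The normal form of the pencil -/

section Pencil

variable {U W : Type*} [AddCommGroup U] [Module ℂ U] [AddCommGroup W] [Module ℂ W]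

theorem eq_top_of_pencil [Module.Finite ℂ U] {ν ν' : U →ₗ[ℂ] W}
    (hs : ∀ s t : ℂ, s ≠ 0 ∨ t ≠ 0 → Function.Surjective (s • ν + t • ν')) {S : Submodule ℂ U}
    (hker : LinearMap.ker ν ≤ S) (hS : S.map ν' ≤ S.map ν) : S = ⊤ := by
  by_contra hne
  have hnt : Nontrivial (U ⧸ S) := Submodule.Quotient.nontrivial_iff.2 hne
  let f : (U ⧸ S) →ₗ[ℂ] (W ⧸ S.map ν) := S.mapQ (S.map ν) ν (Submodule.le_comap_map ν S)
  let g : (U ⧸ S) →ₗ[ℂ] (W ⧸ S.map ν) := S.mapQ (S.map ν) ν' (Submodule.map_le_iff_le_comap.1 hS)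
  have hsurj : ∀ s t : ℂ, s ≠ 0 ∨ t ≠ 0 → Function.Surjective (s • f + t • g) := fun s t hst y => by
    obtain ⟨w, rfl⟩ := Submodule.mkQ_surjective _ y
    obtain ⟨v, rfl⟩ := hs s t hst w
    exact ⟨S.mkQ v, by simp [f, g]⟩
  have hfi : Function.Injective f := by
    rw [← LinearMap.ker_eq_bot, eq_bot_iff]
    intro x hx
    obtain ⟨v, rfl⟩ := S.mkQ_surjective x
    have h1 : (S.map ν).mkQ (ν v) = 0 := hx
    rw [Submodule.mkQ_apply, Submodule.Quotient.mk_eq_zero] at h1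
    obtain ⟨w, hw, hwv⟩ := h1
    have h2 : v - w ∈ S := hker (by rw [LinearMap.mem_ker, map_sub, hwv, sub_self])
    rw [Submodule.mem_bot, Submodule.mkQ_apply, Submodule.Quotient.mk_eq_zero]
    simpa using add_mem h2 hw
  have hfs : Function.Surjective f := by simpa using hsurj 1 0 (Or.inl one_ne_zero)
  let F := LinearEquiv.ofBijective f ⟨hfi, hfs⟩
  obtain ⟨μ, hμ⟩ := Module.End.exists_eigenvalue (F.symm.toLinearMap ∘ₗ g)
  obtain ⟨v, hv⟩ := hμ.exists_hasEigenvector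
  have hgv : g v = μ • f v := by
    have h1 : F.symm (g v) = μ • v := hv.apply_eq_smul
    rw [LinearEquiv.symm_apply_eq, map_smul] at h1
    exact h1
  have : FiniteDimensional ℂ (W ⧸ S.map ν) := Module.Finite.equiv F
  have hinj : Function.Injective ((-μ) • f + (1 : ℂ) • g) :=
    (LinearMap.injective_iff_surjective_of_finrank_eq_finrank F.finrank_eq).2 (hsurj _ _ (Or.inr one_ne_zero))
  refine hv.2 (hinj ?_)
  rw [map_zero, LinearMap.add_apply, LinearMap.smul_apply, LinearMap.smul_apply, hgv, one_smul, neg_smul,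
    neg_add_cancel]

theorem exists_pencil_basis (hU : Module.finrank ℂ U = 4) (hW : Module.finrank ℂ W = 3) {ν ν' : U →ₗ[ℂ] W}
    (hs : ∀ s t : ℂ, s ≠ 0 ∨ t ≠ 0 → Function.Surjective (s • ν + t • ν')) :
    ∃ u : Module.Basis (Fin 4) ℂ U, ν (u 3) = 0 ∧ ν' (u 0) = 0 ∧ ν (u 0) = ν' (u 1) ∧ ν (u 1) = ν' (u 2) ∧
      ν (u 2) = ν' (u 3) := by
  have := Module.finite_of_finrank_eq_succ hU
  have := Module.finite_of_finrank_eq_succ hW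
  have hsurj : Function.Surjective ν := by simpa using hs 1 0 (Or.inl one_ne_zero)
  have hk : Module.finrank ℂ (LinearMap.ker ν) = 1 := by
    have h1 := LinearMap.finrank_range_add_finrank_ker ν
    rw [LinearMap.range_eq_top.2 hsurj, finrank_top, hU, hW] at h1
    omega
  obtain ⟨⟨k, hkm⟩, hk0, hksp⟩ := finrank_eq_one_iff'.1 hk
  choose r hr using hsurj
  have hli : ∀ a : ℕ → U, a 0 = k → (∀ i, ν (a (i + 1)) = ν' (a i)) → ∀ n ≤ 4,
      LinearIndependent ℂ (fun i : Fin n => a i) := by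
    intro a ha0 ha n
    induction n with
    | zero => intro _; exact linearIndependent_empty_type
    | succ n ih =>
      intro hn
      rw [linearIndependent_finSucc']
      have hli := ih (by omega)
      refine ⟨hli, fun hmem => ?_⟩
      rcases Nat.eq_zero_or_pos n with rfl | hpos
      · simp only [Set.range_eq_empty, Submodule.span_empty, Submodule.mem_bot] at hmem
        exact hk0 (Subtype.ext (ha0.symm.trans hmem))
      have hmem' : ∀ i ≤ n, a i ∈ Submodule.span ℂ (Set.range fun i : Fin n => a i) := by
        intro i hi
        rcases hi.lt_or_eq with h | rfl
        · exact Submodule.subset_span ⟨⟨i, h⟩, rfl⟩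
        · exact hmem
      have htop := eq_top_of_pencil hs (S := Submodule.span ℂ (Set.range fun i : Fin n => a i)) (by
        intro x hx
        obtain ⟨c, hc⟩ := hksp ⟨x, hx⟩
        have : x = c • k := congrArg Subtype.val hc.symm
        rw [this, ← ha0]
        exact Submodule.smul_mem _ _ (hmem' 0 (Nat.zero_le _))) (by
        rw [Submodule.map_span_le]
        rintro _ ⟨i, rfl⟩
        rw [← ha]
        exact Submodule.mem_map_of_mem (hmem' _ i.2))
      have h1 := finrank_span_eq_card hli
      rw [htop, finrank_top, hU, Fintype.card_fin] at h1
      omega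
  have hbasis : ∀ a₀ a₁ a₂ a₃ : U, a₀ = k → ν a₁ = ν' a₀ → ν a₂ = ν' a₁ → ν a₃ = ν' a₂ →
      LinearIndependent ℂ ![a₃, a₂, a₁, a₀] := by
    intro a₀ a₁ a₂ a₃ h0 h1 h2 h3
    let a : ℕ → U := fun n => n.rec a₀ fun i x => if i = 0 then a₁ else if i = 1 then a₂ else
      if i = 2 then a₃ else r (ν' x)
    have ha : ∀ i, ν (a (i + 1)) = ν' (a i) := fun i => by
      match i with
      | 0 => exact h1
      | 1 => exact h2
      | 2 => exact h3
      | i + 3 => exact hr _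
    have h4 := (hli a h0 ha 4 le_rfl).comp Fin.rev Fin.rev_injective
    convert h4 using 1
    funext i
    match i with
    | 0 => rfl
    | 1 => rfl
    | 2 => rfl
    | 3 => rfl
  obtain ⟨a₁, h1⟩ : ∃ a₁, ν a₁ = ν' k := ⟨r _, hr _⟩
  obtain ⟨a₂, h2⟩ : ∃ a₂, ν a₂ = ν' a₁ := ⟨r _, hr _⟩
  obtain ⟨a₃, h3⟩ : ∃ a₃, ν a₃ = ν' a₂ := ⟨r _, hr _⟩
  have hkm' : ν k = 0 := hkm
  obtain ⟨A, hA⟩ : ∃ A : Module.Basis (Fin 4) ℂ U, ⇑A = ![a₃, a₂, a₁, k] :=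
    ⟨basisOfLinearIndependentOfCardEqFinrank (hbasis k a₁ a₂ a₃ rfl h1 h2 h3) (by simp [hU]), by simp⟩
  obtain ⟨x, y, z, hxyz⟩ : ∃ x y z : ℂ, ν' a₃ = x • ν' a₂ + y • ν' a₁ + z • ν' k := by
    have h4 := A.sum_repr (r (ν' a₃))
    rw [Fin.sum_univ_four, hA] at h4
    refine ⟨A.repr (r (ν' a₃)) 0, A.repr (r (ν' a₃)) 1, A.repr (r (ν' a₃)) 2, ?_⟩
    have h5 := congrArg ν h4
    simp only [Matrix.cons_val_zero, Matrix.cons_val_one, Matrix.cons_val, map_add, map_smul, h1, h2, h3, hkm',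
      smul_zero, add_zero, hr] at h5
    exact h5.symm
  have hfin := hbasis k (a₁ - x • k) (a₂ - x • a₁ - y • k) (a₃ - x • a₂ - y • a₁ - z • k) rfl
    (by rw [map_sub, map_smul, hkm', smul_zero, sub_zero, h1])
    (by simp only [map_sub, map_smul, hkm', smul_zero, sub_zero, h1, h2])
    (by simp only [map_sub, map_smul, hkm', smul_zero, sub_zero, h1, h2, h3])
  obtain ⟨u, hu⟩ : ∃ u : Module.Basis (Fin 4) ℂ U, ⇑u =
      ![a₃ - x • a₂ - y • a₁ - z • k, a₂ - x • a₁ - y • k, a₁ - x • k, k] :=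
    ⟨basisOfLinearIndependentOfCardEqFinrank hfin (by simp [hU]), by simp⟩
  refine ⟨u, ?_⟩
  rw [hu]
  simp only [Matrix.cons_val_zero, Matrix.cons_val_one, Matrix.cons_val, map_sub, map_smul, hkm', smul_zero, sub_zero,
    h1, h2, h3, hxyz, true_and, and_self, and_true]
  abel

theorem exists_basis_coord {H : Type*} [AddCommGroup H] [Module ℂ H] [Module.Finite ℂ H]
    (u : Module.Basis (Fin 4) ℂ (Module.Dual ℂ H)) : ∃ b : Module.Basis (Fin 4) ℂ H, ∀ j, b.coord j = u j := by
  refine ⟨u.dualBasis.map (Module.evalEquiv ℂ H).symm, fun j => ?_⟩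
  refine (u.dualBasis.map (Module.evalEquiv ℂ H).symm).ext fun i => ?_
  have h1 : ∀ θ : Module.Dual ℂ (Module.Dual ℂ H), u j ((Module.evalEquiv ℂ H).symm θ) = θ (u j) := fun θ => by
    conv_rhs => rw [← (Module.evalEquiv ℂ H).apply_symm_apply θ]
    rfl
  rw [Module.Basis.coord_apply, Module.Basis.repr_self, Module.Basis.map_apply, h1, Module.Basis.dualBasis_apply_self,
    Finsupp.single_apply]
  exact if_congr eq_comm rfl rfl

end Pencil

section NormalForm

variable {K : Type*} [Field K] [Algebra ℂ K] [hK : Fact (IsCurveFunctionField K)]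
variable {V : Type*} [AddCommGroup V] [Module K V] [Module ℂ V] [IsScalarTower ℂ K V]
variable {η : Ω[K⁄ℂ]} {κ : Point K →₀ ℤ} {E : Family K V}

theorem exists_normal_form (hg : genus K = 3) (hnh : ¬ IsHyperelliptic K) (hκ : HasDiv (omega K) η κ)
    (hE : E.IsVectorBundle 2) (δ : E.det.Iso (omega2 K)) (hst : E.IsStable) (hgg : E.IsGloballyGenerated)
    (hι : E.dualSpan.SEquiv ((omega K).directSum (omega K))) :
    ∃ (b : Module.Basis (Fin 4) ℂ E.H0) (e : Fin 3 → K), LinearIndependent ℂ e ∧ (∀ i, e i ∈ rrSpace κ) ∧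
      (∀ (P : Point K) f, (∀ i, f * e i ∈ P.O) → f ∈ P.fil (κ P)) ∧
      e 0 • (b 0 : V) + e 1 • (b 1 : V) + e 2 • (b 2 : V) = 0 ∧
      e 0 • (b 1 : V) + e 1 • (b 2 : V) + e 2 • (b 3 : V) = 0 := by
  obtain ⟨ℓ, a, q, ha, hq⟩ := exists_hasDiv_of_sEquiv hκ hι
  obtain ⟨hfr, ν, ν', hr, hr', hb, hν, hc, hd⟩ := exists_relations hE hgg ha hq
  have hfin := Module.finite_of_finrank_eq_succ hfr
  have hrange := range_eq_of_isStable hκ hg hE δ hst hfr hr hb hν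
  obtain ⟨h, hh⟩ := exists_splitting hg hnh hκ hrange hc
  let ν₂ : Module.Dual ℂ E.H0 →ₗ[ℂ] K := ν' - (LinearMap.mulLeft ℂ h) ∘ₗ ν
  have hν₂ : ∀ u, ν₂ u = ν' u - h * ν u := fun u => rfl
  have hcomb : ∀ (s t : ℂ) u, (s • ν + t • ν₂) u = algebraMap ℂ K t * ν' u +
      (algebraMap ℂ K s - algebraMap ℂ K t * h) * ν u := fun s t u => by
    rw [LinearMap.add_apply, LinearMap.smul_apply, LinearMap.smul_apply, hν₂, Algebra.smul_def, Algebra.smul_def]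
    ring
  have hmem : ∀ (s t : ℂ) u, (s • ν + t • ν₂) u ∈ rrSpace κ := fun s t u =>
    add_mem (Submodule.smul_mem _ _ (hb u)) (Submodule.smul_mem _ _ (hh u))
  have hall : ∀ s t : ℂ, s ≠ 0 ∨ t ≠ 0 → LinearMap.range (s • ν + t • ν₂) = rrSpace κ := by
    intro s t hst'
    refine range_eq_of_isStable hκ hg hE δ hst hfr (fun b => ?_) (hmem s t) fun P f hf => ?_
    · simp only [hcomb, add_smul, mul_smul, Finset.sum_add_distrib, ← Finset.smul_sum, hr b, hr' b, smul_zero, add_zero]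
    · have hal : ∀ z : ℂ, z ≠ 0 → f * algebraMap ℂ K z ∈ P.fil (κ P) → f ∈ P.fil (κ P) := fun z hz hf => by
        have h1 : algebraMap ℂ K z ≠ 0 := (map_ne_zero _).2 hz
        rw [P.mul_mem_fil_iff h1, P.ord_algebraMap, sub_zero] at hf
        exact hf
      by_cases ht : t = 0
      · have hs := hst'.resolve_right (not_not.2 ht)
        refine hal s hs (hν P _ fun u => ?_)
        have := hf u
        rw [hcomb, ht] at this
        simpa [mul_assoc] using this
      · refine hal t ht (hd P _ (f * (algebraMap ℂ K s - algebraMap ℂ K t * h)) fun u => ?_)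
        have := hf u
        rwa [hcomb, mul_add, ← mul_assoc, ← mul_assoc] at this
  have hmem1 : ∀ u, ν u ∈ rrSpace κ := hb
  have hmem2 : ∀ u, ν₂ u ∈ rrSpace κ := hh
  obtain ⟨u, hu3, hu0, h01, h12, h23⟩ := exists_pencil_basis (U := Module.Dual ℂ E.H0) (W := rrSpace κ)
    (ν := ν.codRestrict _ hmem1) (ν' := ν₂.codRestrict _ hmem2)
    (by rw [Subspace.dual_finrank_eq, hfr]) (finrank_rrSpace_canonical hg hκ) (fun s t hst' y => by
      have : (y : K) ∈ LinearMap.range (s • ν + t • ν₂) := by rw [hall s t hst']; exact y.2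
      obtain ⟨u, hu⟩ := this
      exact ⟨u, Subtype.ext hu⟩)
  replace hu3 : ν (u 3) = 0 := congrArg Subtype.val hu3
  replace hu0 : ν₂ (u 0) = 0 := congrArg Subtype.val hu0
  replace h01 : ν (u 0) = ν₂ (u 1) := congrArg Subtype.val h01
  replace h12 : ν (u 1) = ν₂ (u 2) := congrArg Subtype.val h12
  replace h23 : ν (u 2) = ν₂ (u 3) := congrArg Subtype.val h23
  obtain ⟨b, hbu⟩ := exists_basis_coord u
  have hsum : ∀ v : Module.Dual ℂ E.H0, ∃ c : Fin 3 → ℂ, ν v = ∑ i, c i • ![ν (u 0), ν (u 1), ν (u 2)] i := fun v => by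
    refine ⟨fun i => u.repr v i.castSucc, ?_⟩
    conv_lhs => rw [← u.sum_repr v]
    rw [map_sum, Fin.sum_univ_four, Fin.sum_univ_three]
    simp only [map_smul, hu3, smul_zero, add_zero]
    rfl
  refine ⟨b, ![ν (u 0), ν (u 1), ν (u 2)], ?_, fun i => ?_, fun P f hf => hν P f fun v => ?_, ?_, ?_⟩
  · rw [linearIndependent_iff_card_eq_finrank_span, Fintype.card_fin, Set.finrank]
    refine (finrank_rrSpace_canonical hg hκ).symm.trans (congrArg (fun S : Submodule ℂ K => Module.finrank ℂ S) ?_)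
    apply le_antisymm
    · intro y hy
      rw [← hrange] at hy
      obtain ⟨v, rfl⟩ := hy
      obtain ⟨c, hc⟩ := hsum v
      rw [hc]
      exact Submodule.sum_mem _ fun i _ => Submodule.smul_mem _ _ (Submodule.subset_span ⟨i, rfl⟩)
    · rw [Submodule.span_le]
      rintro _ ⟨i, rfl⟩
      match i with
      | 0 => exact hb _
      | 1 => exact hb _
      | 2 => exact hb _
  · match i with
    | 0 => exact hb _
    | 1 => exact hb _
    | 2 => exact hb _
  · obtain ⟨c, hc⟩ := hsum v
    rw [hc, Finset.mul_sum]
    refine sum_mem fun i _ => ?_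
    rw [mul_smul_comm, Algebra.smul_def]
    exact mul_mem (P.algebraMap_mem _) (hf i)
  · have := hr b
    rw [Fin.sum_univ_four] at this
    simp only [hbu, hu3, zero_smul, add_zero] at this
    exact this
  · have h1 := hr b
    have h2 := hr' b
    rw [Fin.sum_univ_four] at h1 h2
    simp only [hbu] at h1 h2
    have hn : ∀ j, ν' (u j) = ν₂ (u j) + h * ν (u j) := fun j => by rw [hν₂]; ring
    simp only [hn, add_smul, mul_smul, hu0, ← h01, ← h12, ← h23, zero_add] at h2
    have h3 := congrArg (fun z => h • z) h1
    simp only [smul_add, smul_zero] at h3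
    change ν (u 0) • (b 1 : V) + ν (u 1) • (b 2 : V) + ν (u 2) • (b 3 : V) = 0
    rw [← sub_eq_zero.2 (h2.trans h3.symm)]
    abel

end NormalForm

/-! ### The determinants of the sections -/

section Determinants

/-- The Plücker coordinates of the line `y₀c₀ + y₁c₁ + y₂c₂ = y₀c₁ + y₁c₂ + y₂c₃ = 0`. -/
def plucker {R : Type*} [CommRing R] (y : Fin 3 → R) : Matrix (Fin 4) (Fin 4) R :=
  !![0, y 2 * y 2, -(y 1 * y 2), y 1 * y 1 - y 0 * y 2;
    -(y 2 * y 2), 0, y 0 * y 2, -(y 0 * y 1);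
    y 1 * y 2, -(y 0 * y 2), 0, y 0 * y 0;
    y 0 * y 2 - y 1 * y 1, y 0 * y 1, -(y 0 * y 0), 0]

variable {K : Type*} [Field K] [Algebra ℂ K] [hK : Fact (IsCurveFunctionField K)]
variable {V : Type*} [AddCommGroup V] [Module K V] [Module ℂ V] [IsScalarTower ℂ K V]
variable {η : Ω[K⁄ℂ]} {κ : Point K →₀ ℤ} {E : Family K V}

theorem wedge_self (v : V) : wedge K V v v = 0 :=
  (exteriorPower.ιMulti K 2 (M := V)).map_eq_zero_of_eq ![v, v] (i := 0) (j := 1) rfl (by decide)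

theorem wedge_comm (v w : V) : wedge K V v w = -wedge K V w v := by
  have h := wedge_self (K := K) (v + w)
  simp only [map_add, LinearMap.add_apply, wedge_self, zero_add, add_zero] at h
  exact eq_neg_of_add_eq_zero_right h

theorem exists_wedge_eq {v : Fin 4 → V} {e : Fin 3 → K} (he : e 0 ≠ 0)
    (h1 : e 0 • v 0 + e 1 • v 1 + e 2 • v 2 = 0) (h2 : e 0 • v 1 + e 1 • v 2 + e 2 • v 3 = 0) :
    ∃ θ, ∀ i j, wedge K V (v i) (v j) = plucker e i j • θ := by
  have r1 : ∀ w, e 0 • wedge K V (v 0) w + e 1 • wedge K V (v 1) w + e 2 • wedge K V (v 2) w = 0 := fun w => by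
    have := congrArg (fun z => wedge K V z w) h1
    simpa using this
  have r2 : ∀ w, e 0 • wedge K V (v 1) w + e 1 • wedge K V (v 2) w + e 2 • wedge K V (v 3) w = 0 := fun w => by
    have := congrArg (fun z => wedge K V z w) h2
    simpa using this
  obtain ⟨θ, hθ⟩ : ∃ θ, θ = (e 0 * e 0)⁻¹ • wedge K V (v 2) (v 3) := ⟨_, rfl⟩
  have hcancel : ∀ {x y : ⋀[K]^2 V}, e 0 • x = e 0 • y → x = y := fun h => smul_right_injective _ he h
  have w23 : wedge K V (v 2) (v 3) = (e 0 * e 0) • θ := by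
    rw [hθ, smul_inv_smul₀ (mul_ne_zero he he)]
  have w12 : wedge K V (v 1) (v 2) = (e 0 * e 2) • θ := by
    apply hcancel
    have h := r2 (v 2)
    rw [wedge_self, wedge_comm (v 3), w23] at h
    rw [← sub_eq_zero, ← h]; module
  have w13 : wedge K V (v 1) (v 3) = (-(e 0 * e 1)) • θ := by
    apply hcancel
    have h := r2 (v 3)
    rw [wedge_self, w23] at h
    rw [← sub_eq_zero, ← h]; module
  have w02 : wedge K V (v 0) (v 2) = (-(e 1 * e 2)) • θ := by
    apply hcancel
    have h := r1 (v 2)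
    rw [wedge_self, w12] at h
    rw [← sub_eq_zero, ← h]; module
  have w01 : wedge K V (v 0) (v 1) = (e 2 * e 2) • θ := by
    apply hcancel
    have h := r1 (v 1)
    rw [wedge_self, wedge_comm (v 2), w12] at h
    rw [← sub_eq_zero, ← h]; module
  have w03 : wedge K V (v 0) (v 3) = (e 1 * e 1 - e 0 * e 2) • θ := by
    apply hcancel
    have h := r1 (v 3)
    rw [w13, w23] at h
    rw [← sub_eq_zero, ← h]; module
  refine ⟨θ, fun i j => ?_⟩
  have hcase : ∀ {i j : Fin 4} {y z : K}, wedge K V (v i) (v j) = y • θ → y = -z →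
      wedge K V (v j) (v i) = z • θ := fun h hz => by rw [wedge_comm, h, hz]; module
  fin_cases i <;> fin_cases j
  · exact (wedge_self _).trans (zero_smul K θ).symm
  · exact w01
  · exact w02
  · exact w03
  · exact hcase w01 (neg_neg _).symm
  · exact (wedge_self _).trans (zero_smul K θ).symm
  · exact w12
  · exact w13
  · exact hcase w02 rfl
  · exact hcase w12 (neg_neg _).symm
  · exact (wedge_self _).trans (zero_smul K θ).symm
  · exact w23
  · exact hcase w03 (neg_sub _ _).symm
  · exact hcase w13 rfl
  · exact hcase w23 (neg_neg _).symm
  · exact (wedge_self _).trans (zero_smul K θ).symm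

theorem plucker_mem_fil {e : Fin 3 → K} (heκ : ∀ i, e i ∈ rrSpace κ) (P : Point K) (i j : Fin 4) :
    plucker e i j ∈ P.fil (-(κ P) + -(κ P)) := by
  have h : ∀ i j, e i * e j ∈ P.fil (-(κ P) + -(κ P)) := fun i j =>
    P.mul_mem_fil (mem_rrSpace.1 (heκ i) P) (mem_rrSpace.1 (heκ j) P)
  fin_cases i <;> fin_cases j
  · exact zero_mem _
  · exact h _ _
  · exact neg_mem (h _ _)
  · exact sub_mem (h _ _) (h _ _)
  · exact neg_mem (h _ _)
  · exact zero_mem _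
  · exact h _ _
  · exact neg_mem (h _ _)
  · exact h _ _
  · exact neg_mem (h _ _)
  · exact zero_mem _
  · exact h _ _
  · exact sub_mem (h _ _) (h _ _)
  · exact h _ _
  · exact neg_mem (h _ _)
  · exact zero_mem _

theorem exists_ord_eq_neg {e : Fin 3 → K} (he : ∀ i, e i ≠ 0) (heκ : ∀ i, e i ∈ rrSpace κ)
    (hbp : ∀ (P : Point K) f, (∀ i, f * e i ∈ P.O) → f ∈ P.fil (κ P)) (P : Point K) :
    ∃ i, P.ord (e i) = -κ P := by
  by_contra! h
  obtain ⟨t, ht0, ht⟩ := P.exists_ord_eq (κ P - 1)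
  have h1 := hbp P t fun i => by
    have h2 := (P.mem_fil (he i)).1 (mem_rrSpace.1 (heκ i) P)
    rw [P.mem_O_iff (mul_ne_zero ht0 (he i)), P.ord_mul ht0 (he i)]
    have := h i
    omega
  rw [P.mem_fil ht0] at h1
  omega

theorem exists_plucker_ord {e : Fin 3 → K} (he : ∀ i, e i ≠ 0) (heκ : ∀ i, e i ∈ rrSpace κ)
    (hbp : ∀ (P : Point K) f, (∀ i, f * e i ∈ P.O) → f ∈ P.fil (κ P)) (P : Point K) :
    ∃ i j, plucker e i j ≠ 0 ∧ P.ord (plucker e i j) = -κ P + -κ P := by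
  have hsq : ∀ i, P.ord (e i) = -κ P → e i * e i ≠ 0 ∧ P.ord (e i * e i) = -κ P + -κ P := fun i hi =>
    ⟨mul_ne_zero (he i) (he i), by rw [P.ord_mul (he i) (he i), hi]⟩
  by_cases h0 : P.ord (e 0) = -κ P
  · exact ⟨2, 3, hsq 0 h0⟩
  by_cases h2 : P.ord (e 2) = -κ P
  · exact ⟨0, 1, hsq 2 h2⟩
  have h1 : P.ord (e 1) = -κ P := by
    obtain ⟨i, hi⟩ := exists_ord_eq_neg he heκ hbp P
    match i, hi with
    | 0, hi => exact absurd hi h0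
    | 1, hi => exact hi
    | 2, hi => exact absurd hi h2
  obtain ⟨hn, ho⟩ := hsq 1 h1
  have h3 := (P.mem_fil (he 0)).1 (mem_rrSpace.1 (heκ 0) P)
  have h4 := (P.mem_fil (he 2)).1 (mem_rrSpace.1 (heκ 2) P)
  have hm : e 0 * e 2 ∈ P.fil (-κ P + -κ P + 1) := by
    rw [P.mem_fil (mul_ne_zero (he 0) (he 2)), P.ord_mul (he 0) (he 2)]; omega
  refine ⟨0, 3, ?_⟩
  change e 1 * e 1 - e 0 * e 2 ≠ 0 ∧ P.ord (e 1 * e 1 - e 0 * e 2) = _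
  have hnot : e 1 * e 1 - e 0 * e 2 ∉ P.fil (-κ P + -κ P + 1) := fun h => by
    have := add_mem h hm
    rw [sub_add_cancel, P.mem_fil hn, ho] at this
    omega
  have hz : e 1 * e 1 - e 0 * e 2 ≠ 0 := fun h => hnot (h ▸ zero_mem _)
  have hle : e 1 * e 1 - e 0 * e 2 ∈ P.fil (-κ P + -κ P) := plucker_mem_fil heκ P 0 3
  rw [P.mem_fil hz] at hnot hle
  exact ⟨hz, by omega⟩

theorem exists_det_eq (hκ : HasDiv (omega K) η κ) (hE : E.IsVectorBundle 2) (δ : E.det.Iso (omega2 K))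
    (hgg : E.IsGloballyGenerated) (b : Module.Basis (Fin 4) ℂ E.H0) {e : Fin 3 → K} (he : ∀ i, e i ≠ 0)
    (heκ : ∀ i, e i ∈ rrSpace κ) (hbp : ∀ (P : Point K) f, (∀ i, f * e i ∈ P.O) → f ∈ P.fil (κ P))
    (h1 : e 0 • (b 0 : V) + e 1 • (b 1 : V) + e 2 • (b 2 : V) = 0)
    (h2 : e 0 • (b 1 : V) + e 1 • (b 2 : V) + e 2 • (b 3 : V) = 0) :
    ∃ c : ℂ, c ≠ 0 ∧ ∀ i j, δ.toEquiv (wedge K V (b i) (b j)) =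
      (algebraMap ℂ K c * plucker e i j) • (η ⊗ₜ[K] η) := by
  obtain ⟨θ, hθ⟩ := exists_wedge_eq (v := fun i => (b i : V)) (he 0) h1 h2
  have hη2 := hκ.tensor hκ
  obtain ⟨g, hg⟩ := hη2.exists_smul (δ.toEquiv θ)
  have hgO : ∀ P : Point K, g ∈ P.O := fun P => by
    obtain ⟨i, j, hn, ho⟩ := exists_plucker_ord he heκ hbp P
    have h3 : plucker e i j • θ ∈ E.det.stalk P := by
      rw [← hθ]; exact Submodule.subset_span ⟨_, (b i).2 P, _, (b j).2 P, rfl⟩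
    rw [← δ.mem_iff, map_smul, hg, smul_smul] at h3
    have h4 := (hη2.mem_iff P _).1 h3
    rw [mul_comm, P.mul_mem_fil_iff hn, ho, Finsupp.add_apply] at h4
    rw [← P.mem_fil_zero]
    convert h4 using 2; ring
  obtain ⟨c, hc⟩ := exists_const_of_forall_mem hgO
  refine ⟨c, ?_, fun i j => ?_⟩
  · rintro rfl
    have hg0 : g = 0 := by rw [← hc, map_zero]
    rw [hg0, zero_smul, LinearEquiv.map_eq_zero_iff] at hg
    have hw : ∀ v w : V, wedge K V v w = 0 := by
      have hspan : Submodule.span K (Set.range fun i => (b i : V)) = ⊤ := by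
        obtain ⟨P⟩ := nonempty_point (K := K)
        rw [← top_le_iff, ← hE.span_eq_top P, Submodule.span_le, ← hgg P]
        intro v hv
        induction hv using Submodule.span_induction with
        | mem x hx =>
          have h5 := coe_eq_sum_coord b ⟨x, hx⟩
          change x = _ at h5
          rw [h5]
          refine Submodule.sum_mem _ fun j _ => ?_
          rw [← algebraMap_smul K]
          exact Submodule.smul_mem _ _ (Submodule.subset_span ⟨j, rfl⟩)
        | zero => exact zero_mem _
        | add x y _ _ hx hy => exact add_mem hx hy
        | smul c x _ hx => exact Submodule.smul_mem _ (c : K) hx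
      have hz : wedge K V = 0 := by
        refine LinearMap.ext_on_range hspan fun i => ?_
        refine LinearMap.ext_on_range hspan fun j => ?_
        rw [hθ, hg, smul_zero]; rfl
      intro v w; rw [hz]; rfl
    obtain ⟨bV, -⟩ := hE.generic
    obtain ⟨f, hf⟩ := exists_wedge_equiv bV
    have h5 := hf (bV 0) (bV 1)
    have h6 : exteriorPower.ιMulti K 2 ![bV 0, bV 1] = 0 := hw (bV 0) (bV 1)
    rw [h6, map_zero] at h5
    simp at h5
  · rw [hθ, map_smul, hg, smul_smul, hc, mul_comm]

end Determinants

/-! ### The Veronese surface -/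

section Veronese

variable {K : Type*} [Field K] [Algebra ℂ K] [hK : Fact (IsCurveFunctionField K)]
variable {η : Ω[K⁄ℂ]} {κ : Point K →₀ ℤ} {e : Fin 3 → K}

/-- The functions `e i` form a basis of `H⁰(ω_C)`, in terms of the rational differential `η`. -/
structure IsCanonicalBasis (η : Ω[K⁄ℂ]) (κ : Point K →₀ ℤ) (e : Fin 3 → K) : Prop where
  genus_eq : genus K = 3
  not_isHyperelliptic : ¬ IsHyperelliptic K
  hasDiv : HasDiv (omega K) η κ
  linearIndependent : LinearIndependent ℂ e
  mem : ∀ i, e i ∈ rrSpace κ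
  basePointFree : ∀ (P : Point K) f, (∀ i, f * e i ∈ P.O) → f ∈ P.fil (κ P)

/-- The product of sections of `ω_C`, as a bilinear map. -/
def mulSectionLin (K : Type*) [Field K] [Algebra ℂ K] :
    (omega K).H0 →ₗ[ℂ] (omega K).H0 →ₗ[ℂ] (omega2 K).H0 :=
  LinearMap.mk₂ ℂ mulSection (fun _ _ _ => Subtype.ext (TensorProduct.add_tmul _ _ _))
    (fun _ _ _ => Subtype.ext (TensorProduct.smul_tmul' _ _ _).symm)
    (fun _ _ _ => Subtype.ext (TensorProduct.tmul_add _ _ _))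
    (fun _ _ _ => Subtype.ext (TensorProduct.tmul_smul _ _ _))

namespace IsCanonicalBasis

theorem ne_zero (N : IsCanonicalBasis η κ e) (i : Fin 3) : e i ≠ 0 := N.linearIndependent.ne_zero i

theorem span_eq (N : IsCanonicalBasis η κ e) : Submodule.span ℂ (Set.range e) = rrSpace κ := by
  apply Submodule.eq_of_le_of_finrank_eq
  · rw [Submodule.span_le]; rintro _ ⟨i, rfl⟩; exact N.mem i
  · rw [finrank_span_eq_card N.linearIndependent, Fintype.card_fin, finrank_rrSpace_canonical N.genus_eq N.hasDiv]

/-- The basis of `H⁰(ω_C)`. -/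
def secBasis (N : IsCanonicalBasis η κ e) : Module.Basis (Fin 3) ℂ (omega K).H0 :=
  ((Module.Basis.span N.linearIndependent).map (LinearEquiv.ofEq _ _ N.span_eq)).map N.hasDiv.sectionEquiv

theorem coe_secBasis (N : IsCanonicalBasis η κ e) (i : Fin 3) : (N.secBasis i : Ω[K⁄ℂ]) = e i • η := by
  rw [secBasis, Module.Basis.map_apply, HasDiv.coe_sectionEquiv, Module.Basis.map_apply, LinearEquiv.coe_ofEq_apply,
    Module.Basis.span_apply]

theorem coe_mulSection (N : IsCanonicalBasis η κ e) (i j : Fin 3) :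
    (mulSection (N.secBasis i) (N.secBasis j) : Ω[K⁄ℂ] ⊗[K] Ω[K⁄ℂ]) = (e i * e j) • (η ⊗ₜ[K] η) := by
  change (N.secBasis i : Ω[K⁄ℂ]) ⊗ₜ[K] (N.secBasis j : Ω[K⁄ℂ]) = _
  rw [coe_secBasis, coe_secBasis, TensorProduct.smul_tmul_smul]

theorem mulSection_comm (N : IsCanonicalBasis η κ e) (i j : Fin 3) :
    mulSection (N.secBasis i) (N.secBasis j) = mulSection (N.secBasis j) (N.secBasis i) :=
  Subtype.ext (by rw [coe_mulSection, coe_mulSection, mul_comm])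

theorem finrank_omega2 (N : IsCanonicalBasis η κ e) : Module.finrank ℂ (omega2 K).H0 = 6 := by
  have h1 := (N.hasDiv.tensor N.hasDiv).sectionEquiv.finrank_eq
  have h4 := deg_canonical N.genus_eq N.hasDiv
  have h5 := finrank_rrSpace_of_deg N.genus_eq (D := κ + κ) (by rw [deg_add]; omega)
  rw [deg_add, h4, h1] at h5
  have : Module.finrank ℂ (omega2 K).H0 = Module.finrank ℂ ((omega K).tensor (omega K)).H0 := rfl
  omega

/-- The products of the elements of the basis of `H⁰(ω_C)`. -/
def prodSection (N : IsCanonicalBasis η κ e) : Sym2 (Fin 3) → (omega2 K).H0 :=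
  Sym2.lift ⟨fun i j => mulSection (N.secBasis i) (N.secBasis j), N.mulSection_comm⟩

theorem prodSection_mk (N : IsCanonicalBasis η κ e) (i j : Fin 3) : N.prodSection s(i, j) = mulSection (N.secBasis i) (N.secBasis j) := rfl

theorem top_le_span_prodSection (N : IsCanonicalBasis η κ e) : ⊤ ≤ Submodule.span ℂ (Set.range N.prodSection) := by
  rintro ⟨x, hx⟩ -
  obtain ⟨f, rfl⟩ := (N.hasDiv.tensor N.hasDiv).exists_smul x
  have hf : f ∈ rrSpace (κ + κ) := mem_rrSpace.2 fun P => ((N.hasDiv.tensor N.hasDiv).mem_iff P f).1 (hx P)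
  obtain ⟨c₀, c₁, c₂, c₃, c₄, c₅, rfl⟩ := exists_quadric N.genus_eq N.not_isHyperelliptic N.hasDiv N.linearIndependent N.mem hf
  have hmem : ∀ i j, mulSection (N.secBasis i) (N.secBasis j) ∈ Submodule.span ℂ (Set.range N.prodSection) :=
    fun i j => Submodule.subset_span ⟨s(i, j), rfl⟩
  have hsum := add_mem (add_mem (add_mem (add_mem (add_mem (Submodule.smul_mem _ c₀ (hmem 0 0))
    (Submodule.smul_mem _ c₁ (hmem 0 1))) (Submodule.smul_mem _ c₂ (hmem 0 2))) (Submodule.smul_mem _ c₃ (hmem 1 1)))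
    (Submodule.smul_mem _ c₄ (hmem 1 2))) (Submodule.smul_mem _ c₅ (hmem 2 2))
  convert hsum using 1
  refine Subtype.ext ?_
  simp only [Submodule.coe_add, Submodule.coe_smul, coe_mulSection, add_smul, smul_assoc]

/-- The basis of `H⁰(ω_C²)` consisting of products. -/
def quadBasis (N : IsCanonicalBasis η κ e) : Module.Basis (Sym2 (Fin 3)) ℂ (omega2 K).H0 :=
  basisOfTopLeSpanOfCardEqFinrank N.prodSection N.top_le_span_prodSection (by rw [N.finrank_omega2]; rfl)

theorem quadBasis_mk (N : IsCanonicalBasis η κ e) (i j : Fin 3) : N.quadBasis s(i, j) = mulSection (N.secBasis i) (N.secBasis j) := by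
  rw [quadBasis, coe_basisOfTopLeSpanOfCardEqFinrank, prodSection_mk]

/-- The linear form on `H⁰(ω_C)` with values `φ i` on the basis. -/
def form (N : IsCanonicalBasis η κ e) (φ : Fin 3 → ℂ) : Module.Dual ℂ (omega K).H0 := N.secBasis.constr ℂ φ

theorem form_secBasis (N : IsCanonicalBasis η κ e) (φ : Fin 3 → ℂ) (i : Fin 3) : N.form φ (N.secBasis i) = φ i :=
  N.secBasis.constr_basis ℂ φ i

/-- The square of a linear form on `H⁰(ω_C)`, as a linear form on `H⁰(ω_C²)`. -/
def sq (N : IsCanonicalBasis η κ e) (φ : Fin 3 → ℂ) : Module.Dual ℂ (omega2 K).H0 :=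
  ∑ p : Sym2 (Fin 3), (p.map φ).mul • N.quadBasis.dualBasis p

theorem sq_quadBasis (N : IsCanonicalBasis η κ e) (φ : Fin 3 → ℂ) (p : Sym2 (Fin 3)) : N.sq φ (N.quadBasis p) = (p.map φ).mul := by
  rw [sq, LinearMap.sum_apply, Finset.sum_eq_single p]
  · rw [LinearMap.smul_apply, Module.Basis.dualBasis_apply_self, if_pos rfl, smul_eq_mul, mul_one]
  · intro p' _ hp'
    rw [LinearMap.smul_apply, Module.Basis.dualBasis_apply_self, if_neg (Ne.symm hp'), smul_zero]
  · simp

theorem sq_mulSection_secBasis (N : IsCanonicalBasis η κ e) (φ : Fin 3 → ℂ) (i j : Fin 3) :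
    N.sq φ (mulSection (N.secBasis i) (N.secBasis j)) = φ i * φ j := by
  rw [← quadBasis_mk, sq_quadBasis]; rfl

theorem sq_mulSection (N : IsCanonicalBasis η κ e) (φ : Fin 3 → ℂ) (s t : (omega K).H0) :
    N.sq φ (mulSection s t) = N.form φ s * N.form φ t := by
  have h : (mulSectionLin K).compr₂ (N.sq φ) = (LinearMap.mul ℂ ℂ).compl₁₂ (N.form φ) (N.form φ) := by
    refine LinearMap.ext_basis N.secBasis N.secBasis fun i j => ?_
    rw [LinearMap.compr₂_apply, LinearMap.compl₁₂_apply, LinearMap.mul_apply', form_secBasis, form_secBasis]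
    exact N.sq_mulSection_secBasis φ i j
  exact LinearMap.congr_fun₂ h s t

theorem dual_ext (N : IsCanonicalBasis η κ e) {ψ ψ' : Module.Dual ℂ (omega2 K).H0}
    (h : ∀ i j, ψ (mulSection (N.secBasis i) (N.secBasis j)) = ψ' (mulSection (N.secBasis i) (N.secBasis j))) :
    ψ = ψ' := by
  refine N.quadBasis.ext fun p => ?_
  induction p with
  | h i j => rw [quadBasis_mk]; exact h i j

theorem sq_smul (N : IsCanonicalBasis η κ e) (r : ℂ) (φ : Fin 3 → ℂ) : N.sq (r • φ) = (r * r) • N.sq φ :=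
  N.dual_ext fun i j => by
    rw [LinearMap.smul_apply, sq_mulSection_secBasis, sq_mulSection_secBasis, Pi.smul_apply, Pi.smul_apply]
    simp only [smul_eq_mul]; ring

theorem sq_ne_zero (N : IsCanonicalBasis η κ e) {φ : Fin 3 → ℂ} (hφ : φ ≠ 0) : N.sq φ ≠ 0 := by
  obtain ⟨i, hi⟩ := Function.ne_iff.1 hφ
  intro h
  have := N.sq_mulSection_secBasis φ i i
  rw [h, LinearMap.zero_apply] at this
  exact mul_ne_zero hi hi this.symm

theorem mem_veronese_iff (N : IsCanonicalBasis η κ e) {z : ℙ ℂ (Module.Dual ℂ (omega2 K).H0)} :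
    z ∈ veronese K ↔ ∃ φ : Fin 3 → ℂ, φ ≠ 0 ∧ z.rep = N.sq φ := by
  constructor
  · rintro ⟨φ, hφ, h⟩
    have heq : N.form (fun i => φ (N.secBasis i)) = φ := N.secBasis.ext fun i => N.form_secBasis _ i
    refine ⟨fun i => φ (N.secBasis i), fun h0 => hφ ?_, N.dual_ext fun i j => ?_⟩
    · rw [← heq, h0]
      exact N.secBasis.ext fun i => N.form_secBasis _ i
    · rw [h, sq_mulSection_secBasis]
  · rintro ⟨φ, hφ, h⟩
    refine ⟨N.form φ, fun h0 => hφ (funext fun i => ?_), fun s t => ?_⟩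
    · rw [← N.form_secBasis φ i, h0]; rfl
    · rw [h, sq_mulSection]

theorem exists_rep_eq {M : Type*} [AddCommGroup M] [Module ℂ M] {z : ℙ ℂ M} {ψ : M}
    (h : z.submodule = Submodule.span ℂ {ψ}) : ∃ r : ℂ, r ≠ 0 ∧ z.rep = (r * r) • ψ := by
  rw [z.submodule_eq, Submodule.span_singleton_eq_span_singleton] at h
  obtain ⟨u, hu⟩ := h
  obtain ⟨r, hr⟩ := IsAlgClosed.exists_eq_mul_self ((u⁻¹ : ℂˣ) : ℂ)
  refine ⟨r, fun h0 => ?_, ?_⟩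
  · rw [h0, mul_zero] at hr
    exact (u⁻¹).ne_zero hr
  · rw [← hr, ← hu]
    exact (inv_smul_smul u _).symm

theorem mem_veronese_of_submodule (N : IsCanonicalBasis η κ e) {z : ℙ ℂ (Module.Dual ℂ (omega2 K).H0)} {φ : Fin 3 → ℂ} (hφ : φ ≠ 0)
    (h : z.submodule = Submodule.span ℂ {N.sq φ}) : z ∈ veronese K := by
  obtain ⟨r, hr, hz⟩ := exists_rep_eq h
  exact N.mem_veronese_iff.2 ⟨r • φ, smul_ne_zero hr hφ, by rw [hz, sq_smul]⟩

theorem isVeroneseSurface (N : IsCanonicalBasis η κ e) : IsVeroneseSurface (veronese K) := by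
  refine ⟨N.quadBasis.dualBasis, Set.ext fun z => ⟨fun hz => ?_, ?_⟩⟩
  · obtain ⟨φ, hφ, h⟩ := N.mem_veronese_iff.1 hz
    exact ⟨φ, hφ, by rw [z.submodule_eq, h]; rfl⟩
  · rintro ⟨φ, hφ, h⟩
    exact N.mem_veronese_of_submodule hφ h

end IsCanonicalBasis

end Veronese

/-! ### Bisecant lines -/

section Wedge

variable {H : Type*} [AddCommGroup H] [Module ℂ H]

theorem exists_apply_eq_zero {α β : Module.Dual ℂ H} (h : LinearIndependent ℂ ![α, β]) :
    ∃ x, α x = 0 ∧ β x = 1 := by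
  by_contra! hx
  have hmem : β ∈ Submodule.span ℂ (Set.range fun _ : Unit => α) := by
    apply mem_span_of_iInf_ker_le_ker
    intro x hxα
    rw [Submodule.mem_iInf] at hxα
    rw [LinearMap.mem_ker]
    by_contra hβ
    refine hx ((β x)⁻¹ • x) ?_ ?_
    · rw [map_smul, LinearMap.mem_ker.1 (hxα ()), smul_zero]
    · rw [map_smul, smul_eq_mul, inv_mul_cancel₀ hβ]
  rw [Set.range_const, Submodule.mem_span_singleton] at hmem
  obtain ⟨r, hr⟩ := hmem
  have := LinearIndependent.pair_iff.1 h r (-1) (by rw [hr, neg_one_smul, add_neg_cancel])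
  exact neg_ne_zero.2 one_ne_zero this.2

/-- The range of a non-zero multiple of the alternating form `α ∧ β`. -/
theorem range_eq_span_of_wedge {α β : Module.Dual ℂ H} (h : LinearIndependent ℂ ![α, β])
    {B : H →ₗ[ℂ] H →ₗ[ℂ] ℂ} {r : ℂ} (hr : r ≠ 0) (hB : ∀ x y, B x y = r * (α x * β y - β x * α y)) :
    LinearMap.range B = Submodule.span ℂ {α, β} := by
  have hB' : ∀ x, B x = r • (α x • β - β x • α) := fun x => by
    ext y
    rw [hB, LinearMap.smul_apply, LinearMap.sub_apply, LinearMap.smul_apply, LinearMap.smul_apply]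
    simp only [smul_eq_mul]
  have hα : α ∈ Submodule.span ℂ {α, β} := Submodule.subset_span (Set.mem_insert _ _)
  have hβ : β ∈ Submodule.span ℂ {α, β} := Submodule.subset_span (Set.mem_insert_of_mem _ rfl)
  apply le_antisymm
  · rintro _ ⟨x, rfl⟩
    rw [hB']
    exact Submodule.smul_mem _ _ (sub_mem (Submodule.smul_mem _ _ hβ) (Submodule.smul_mem _ _ hα))
  · obtain ⟨x, hx, hx'⟩ := exists_apply_eq_zero h
    obtain ⟨y, hy, hy'⟩ := exists_apply_eq_zero (LinearIndependent.pair_symm_iff.1 h)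
    rw [Submodule.span_le]
    rintro _ (rfl | rfl)
    · refine ⟨(-r⁻¹) • x, ?_⟩
      rw [map_smul, hB', hx, hx', smul_smul, neg_mul, inv_mul_cancel₀ hr]
      simp
    · refine ⟨r⁻¹ • y, ?_⟩
      rw [map_smul, hB', hy, hy', smul_smul, inv_mul_cancel₀ hr]
      simp

theorem wedge_eq_zero_of_not_linearIndependent {α β : Module.Dual ℂ H} (h : ¬ LinearIndependent ℂ ![α, β])
    (x y : H) : α x * β y - β x * α y = 0 := by
  rw [LinearIndependent.pair_iff] at h
  push Not at h
  obtain ⟨s, t, hst, h⟩ := h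
  have hx : s * α x + t * β x = 0 := by simpa using congrArg (fun γ => γ x) hst
  have hy : s * α y + t * β y = 0 := by simpa using congrArg (fun γ => γ y) hst
  by_cases hs : s = 0
  · have ht := h hs
    rw [hs, zero_mul, zero_add] at hx hy
    rw [(mul_eq_zero.1 hx).resolve_left ht, (mul_eq_zero.1 hy).resolve_left ht]; ring
  · have : s * (α x * β y - β x * α y) = 0 := by linear_combination β y * hx - β x * hy
    exact (mul_eq_zero.1 this).resolve_left hs

end Wedge

section RootForm

/-- The quadratic form with roots `a` and `a'`. -/
def rootForm (a a' : Fin 2 → ℂ) : Fin 3 → ℂ :=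
  ![a 1 * a' 1, -(a 0 * a' 1 + a 1 * a' 0), a 0 * a' 0]

theorem rootForm_smul_right (r : ℂ) (a a' : Fin 2 → ℂ) : rootForm a (r • a') = r • rootForm a a' := by
  ext i
  fin_cases i <;> simp [rootForm] <;> ring

theorem rootForm_ne_zero {a a' : Fin 2 → ℂ} (ha : a ≠ 0) (ha' : a' ≠ 0) : rootForm a a' ≠ 0 := by
  intro h
  have h0 : a 1 * a' 1 = 0 := congrFun h 0
  have h1 : -(a 0 * a' 1 + a 1 * a' 0) = 0 := congrFun h 1
  have h2 : a 0 * a' 0 = 0 := congrFun h 2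
  have hz : ∀ x : Fin 2 → ℂ, x 0 = 0 → x 1 = 0 → x = 0 := fun x h h' => by
    ext i; fin_cases i
    · exact h
    · exact h'
  rcases mul_eq_zero.1 h2 with h3 | h3
  · have h4 : a 1 ≠ 0 := fun h4 => ha (hz a h3 h4)
    have h5 := (mul_eq_zero.1 h0).resolve_left h4
    rw [h3, zero_mul, zero_add, neg_eq_zero] at h1
    exact ha' (hz a' ((mul_eq_zero.1 h1).resolve_left h4) h5)
  · have h4 : a' 1 ≠ 0 := fun h4 => ha' (hz a' h3 h4)
    have h5 := (mul_eq_zero.1 h0).resolve_right h4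
    rw [h3, mul_zero, add_zero, neg_eq_zero] at h1
    exact ha (hz a ((mul_eq_zero.1 h1).resolve_right h4) h5)

theorem exists_eq_rootForm_of_root {a : Fin 2 → ℂ} (ha : a ≠ 0) {φ : Fin 3 → ℂ}
    (h : a 0 ^ 2 * φ 0 + a 0 * a 1 * φ 1 + a 1 ^ 2 * φ 2 = 0) : ∃ a', φ = rootForm a a' := by
  by_cases h0 : a 0 = 0
  · have h1 : a 1 ≠ 0 := fun h1 => ha (by ext i; fin_cases i; exacts [h0, h1])
    have h2 : φ 2 = 0 := by
      rw [h0] at h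
      have : a 1 ^ 2 * φ 2 = 0 := by linear_combination h
      exact (mul_eq_zero.1 this).resolve_left (pow_ne_zero 2 h1)
    refine ⟨![-φ 1 / a 1, φ 0 / a 1], ?_⟩
    ext i
    fin_cases i
    · simp [rootForm]; field_simp
    · simp [rootForm, h0]; field_simp
    · simp [rootForm, h0, h2]
  · refine ⟨![φ 2 / a 0, -(φ 1 + a 1 * (φ 2 / a 0)) / a 0], ?_⟩
    ext i
    fin_cases i
    · simp [rootForm]; field_simp; linear_combination h
    · simp [rootForm]; field_simp; ring
    · simp [rootForm]; field_simp

theorem exists_root (φ : Fin 3 → ℂ) :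
    ∃ a : Fin 2 → ℂ, a ≠ 0 ∧ a 0 ^ 2 * φ 0 + a 0 * a 1 * φ 1 + a 1 ^ 2 * φ 2 = 0 := by
  by_cases h0 : φ 0 = 0
  · refine ⟨![1, 0], fun h => one_ne_zero (congrFun h 0), ?_⟩
    simp [h0]
  · obtain ⟨s, hs⟩ := IsAlgClosed.exists_eq_mul_self (discrim (φ 0) (φ 1) (φ 2))
    obtain ⟨x, hx⟩ := exists_quadratic_eq_zero h0 ⟨s, hs⟩
    refine ⟨![x, 1], fun h => one_ne_zero (congrFun h 1), ?_⟩
    simp only [Matrix.cons_val_zero, Matrix.cons_val_one]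
    linear_combination hx

theorem exists_eq_rootForm {φ : Fin 3 → ℂ} (hφ : φ ≠ 0) :
    ∃ a a' : Fin 2 → ℂ, a ≠ 0 ∧ a' ≠ 0 ∧ φ = rootForm a a' := by
  obtain ⟨a, ha, h⟩ := exists_root φ
  obtain ⟨a', rfl⟩ := exists_eq_rootForm_of_root ha h
  refine ⟨a, a', ha, fun h => hφ ?_, rfl⟩
  rw [h]; ext i; fin_cases i <;> simp [rootForm]

theorem linearIndependent_or_eq_smul {a a' : Fin 2 → ℂ} (ha : a ≠ 0) (ha' : a' ≠ 0) :
    LinearIndependent ℂ ![a, a'] ∨ ∃ r : ℂ, r ≠ 0 ∧ a' = r • a := by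
  by_cases h : LinearIndependent ℂ ![a, a']
  · exact Or.inl h
  · right
    rw [LinearIndependent.pair_iff' ha] at h
    push Not at h
    obtain ⟨r, hr⟩ := h
    exact ⟨r, fun h0 => ha' (by rw [← hr, h0, zero_smul]), hr.symm⟩

theorem det_ne_zero_of_linearIndependent {a a' : Fin 2 → ℂ} (h : LinearIndependent ℂ ![a, a']) :
    a 0 * a' 1 - a 1 * a' 0 ≠ 0 := by
  have h1 := (Matrix.linearIndependent_rows_iff_isUnit (A := Matrix.of ![a, a'])).1 h
  rw [Matrix.isUnit_iff_isUnit_det, Matrix.det_fin_two, isUnit_iff_ne_zero] at h1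
  exact h1

end RootForm

section Lines

variable {K : Type*} [Field K] [Algebra ℂ K] [hK : Fact (IsCurveFunctionField K)]
variable {V : Type*} [AddCommGroup V] [Module K V] [Module ℂ V] [IsScalarTower ℂ K V]
variable {η : Ω[K⁄ℂ]} {κ : Point K →₀ ℤ} {e : Fin 3 → K} {E : Family K V} {δ : E.det.Iso (omega2 K)}
variable {b : Module.Basis (Fin 4) ℂ E.H0} {c : ℂ}

/-- The normal form of the bundle `E`. -/
structure IsNormalForm (δ : E.det.Iso (omega2 K)) (η : Ω[K⁄ℂ]) (κ : Point K →₀ ℤ) (e : Fin 3 → K)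
    (b : Module.Basis (Fin 4) ℂ E.H0) (c : ℂ) : Prop extends IsCanonicalBasis η κ e where
  isGloballyGenerated : E.IsGloballyGenerated
  isVectorBundle : E.IsVectorBundle 2
  rel₁ : e 0 • (b 0 : V) + e 1 • (b 1 : V) + e 2 • (b 2 : V) = 0
  rel₂ : e 0 • (b 1 : V) + e 1 • (b 2 : V) + e 2 • (b 3 : V) = 0
  const_ne_zero : c ≠ 0
  det_eq : ∀ i j, δ.toEquiv (wedge K V (b i) (b j)) = (algebraMap ℂ K c * plucker e i j) • (η ⊗ₜ[K] η)

theorem exists_isNormalForm (hg : genus K = 3) (hnh : ¬ IsHyperelliptic K) (hκ : HasDiv (omega K) η κ)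
    (hE : E.IsVectorBundle 2) (δ : E.det.Iso (omega2 K)) (hst : E.IsStable) (hgg : E.IsGloballyGenerated)
    (hι : E.dualSpan.SEquiv ((omega K).directSum (omega K))) :
    ∃ e b c, IsNormalForm δ η κ e b c := by
  obtain ⟨b, e, he, heκ, hbp, h1, h2⟩ := exists_normal_form hg hnh hκ hE δ hst hgg hι
  obtain ⟨c, hc, hdet⟩ := exists_det_eq hκ hE δ hgg b he.ne_zero heκ hbp h1 h2
  exact ⟨e, b, c, ⟨hg, hnh, hκ, he, heκ, hbp⟩, hgg, hE, h1, h2, hc, hdet⟩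

namespace IsCanonicalBasis

/-- The quadratic polynomials of `plucker` in the canonical sections. -/
def pluckerSection (N : IsCanonicalBasis η κ e) : Matrix (Fin 4) (Fin 4) (omega2 K).H0 :=
  let m := fun i j => mulSection (N.secBasis i) (N.secBasis j)
  !![0, m 2 2, -m 1 2, m 1 1 - m 0 2; -m 2 2, 0, m 0 2, -m 0 1; m 1 2, -m 0 2, 0, m 0 0;
    m 0 2 - m 1 1, m 0 1, -m 0 0, 0]

theorem coe_pluckerSection (N : IsCanonicalBasis η κ e) (i j : Fin 4) :
    (N.pluckerSection i j : Ω[K⁄ℂ] ⊗[K] Ω[K⁄ℂ]) = plucker e i j • (η ⊗ₜ[K] η) := by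
  have h := N.coe_mulSection
  have hz : ((0 : (omega2 K).H0) : Ω[K⁄ℂ] ⊗[K] Ω[K⁄ℂ]) = (0 : K) • (η ⊗ₜ[K] η) := by
    rw [zero_smul]; rfl
  have hneg : ∀ i j, ((-mulSection (N.secBasis i) (N.secBasis j) : (omega2 K).H0) : Ω[K⁄ℂ] ⊗[K] Ω[K⁄ℂ]) =
      (-(e i * e j)) • (η ⊗ₜ[K] η) := fun i j => by rw [Submodule.coe_neg, h, neg_smul]
  have hsub : ∀ i j k l, ((mulSection (N.secBasis i) (N.secBasis j) - mulSection (N.secBasis k) (N.secBasis l) :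
      (omega2 K).H0) : Ω[K⁄ℂ] ⊗[K] Ω[K⁄ℂ]) = (e i * e j - e k * e l) • (η ⊗ₜ[K] η) := fun i j k l => by
    rw [Submodule.coe_sub, h, h, sub_smul]
  fin_cases i <;> fin_cases j
  · exact hz
  · exact h 2 2
  · exact hneg 1 2
  · exact hsub 1 1 0 2
  · exact hneg 2 2
  · exact hz
  · exact h 0 2
  · exact hneg 0 1
  · exact h 1 2
  · exact hneg 0 2
  · exact hz
  · exact h 0 0
  · exact hsub 0 2 1 1
  · exact h 0 1
  · exact hneg 0 0
  · exact hz

theorem sq_pluckerSection (N : IsCanonicalBasis η κ e) (φ : Fin 3 → ℂ) (i j : Fin 4) :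
    N.sq φ (N.pluckerSection i j) = plucker φ i j := by
  fin_cases i <;> fin_cases j <;>
    simp [pluckerSection, plucker, sq_mulSection_secBasis]

end IsCanonicalBasis

namespace IsNormalForm

theorem detMap_basis (N : IsNormalForm δ η κ e b c) (i j : Fin 4) :
    detMap δ (b i) (b j) = c • N.pluckerSection i j := by
  refine Subtype.ext ?_
  rw [Submodule.coe_smul, N.coe_pluckerSection, ← algebraMap_smul K c, smul_smul]
  exact N.det_eq i j

theorem sq_detMap_basis (N : IsNormalForm δ η κ e b c) (φ : Fin 3 → ℂ) (i j : Fin 4) :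
    N.sq φ (detMap δ (b i) (b j)) = c * plucker φ i j := by
  rw [N.detMap_basis, map_smul, N.sq_pluckerSection, smul_eq_mul]

theorem dual_ext_detMap (N : IsNormalForm δ η κ e b c) {ψ : Module.Dual ℂ (omega2 K).H0}
    (h : ∀ x y, ψ (detMap δ x y) = 0) : ψ = 0 := by
  have h1 : ∀ i j, ψ (N.pluckerSection i j) = 0 := fun i j => by
    have := h (b i) (b j)
    rw [N.detMap_basis, map_smul, smul_eq_mul] at this
    exact (mul_eq_zero.1 this).resolve_left N.const_ne_zero
  have h22 : ψ (mulSection (N.secBasis 2) (N.secBasis 2)) = 0 := h1 0 1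
  have h12 : ψ (mulSection (N.secBasis 1) (N.secBasis 2)) = 0 := h1 2 0
  have h02 : ψ (mulSection (N.secBasis 0) (N.secBasis 2)) = 0 := h1 1 2
  have h01 : ψ (mulSection (N.secBasis 0) (N.secBasis 1)) = 0 := h1 3 1
  have h00 : ψ (mulSection (N.secBasis 0) (N.secBasis 0)) = 0 := h1 2 3
  have h11 : ψ (mulSection (N.secBasis 1) (N.secBasis 1)) = 0 := by
    have h2 : ψ (mulSection (N.secBasis 1) (N.secBasis 1) - mulSection (N.secBasis 0) (N.secBasis 2)) = 0 := h1 0 3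
    rwa [map_sub, h02, sub_zero] at h2
  refine N.dual_ext fun i j => ?_
  rw [LinearMap.zero_apply]
  fin_cases i <;> fin_cases j
  · exact h00
  · exact h01
  · exact h02
  · rw [N.mulSection_comm]; exact h01
  · exact h11
  · exact h12
  · rw [N.mulSection_comm]; exact h02
  · rw [N.mulSection_comm]; exact h12
  · exact h22

theorem cubicPoint_apply (a : Fin 2 → ℂ) (j : Fin 4) :
    cubicPoint b.dualBasis a (b j) = ![a 0 ^ 3, a 0 ^ 2 * a 1, a 0 * a 1 ^ 2, a 1 ^ 3] j := by
  simp only [cubicPoint, LinearMap.add_apply, LinearMap.smul_apply, Module.Basis.dualBasis_apply_self, smul_eq_mul]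
  fin_cases j <;> simp

theorem sq_rootForm_detMap (N : IsNormalForm δ η κ e b c) (a a' : Fin 2 → ℂ) (x y : E.H0) :
    (a 0 * a' 1 - a 1 * a' 0) * N.sq (rootForm a a') (detMap δ x y) =
      c * (cubicPoint b.dualBasis a x * cubicPoint b.dualBasis a' y -
        cubicPoint b.dualBasis a' x * cubicPoint b.dualBasis a y) := by
  have h : (a 0 * a' 1 - a 1 * a' 0) • (detMap δ).compr₂ (N.sq (rootForm a a')) =
      c • ((LinearMap.mul ℂ ℂ).compl₁₂ (cubicPoint b.dualBasis a) (cubicPoint b.dualBasis a') -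
        (LinearMap.mul ℂ ℂ).compl₁₂ (cubicPoint b.dualBasis a') (cubicPoint b.dualBasis a)) := by
    refine LinearMap.ext_basis b b fun i j => ?_
    simp only [LinearMap.smul_apply, LinearMap.compr₂_apply, N.sq_detMap_basis, LinearMap.sub_apply,
      LinearMap.compl₁₂_apply, LinearMap.mul_apply', cubicPoint_apply, smul_eq_mul]
    fin_cases i <;> fin_cases j <;> simp [plucker, rootForm, -mul_eq_zero, -zero_eq_mul] <;> ring
  exact LinearMap.congr_fun₂ h x y

theorem sq_rootForm_self_detMap (N : IsNormalForm δ η κ e b c) (a : Fin 2 → ℂ) (x y : E.H0) :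
    3 * N.sq (rootForm a a) (detMap δ x y) =
      c * (((3 * a 0 ^ 2) • b.dualBasis 0 + (2 * a 0 * a 1) • b.dualBasis 1 + a 1 ^ 2 • b.dualBasis 2 :
          Module.Dual ℂ E.H0) x *
        (a 0 ^ 2 • b.dualBasis 1 + (2 * a 0 * a 1) • b.dualBasis 2 + (3 * a 1 ^ 2) • b.dualBasis 3 :
          Module.Dual ℂ E.H0) y -
        (a 0 ^ 2 • b.dualBasis 1 + (2 * a 0 * a 1) • b.dualBasis 2 + (3 * a 1 ^ 2) • b.dualBasis 3 :
          Module.Dual ℂ E.H0) x *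
        ((3 * a 0 ^ 2) • b.dualBasis 0 + (2 * a 0 * a 1) • b.dualBasis 1 + a 1 ^ 2 • b.dualBasis 2 :
          Module.Dual ℂ E.H0) y) := by
  obtain ⟨T, hT⟩ : ∃ T : Module.Dual ℂ E.H0,
    T = (3 * a 0 ^ 2) • b.dualBasis 0 + (2 * a 0 * a 1) • b.dualBasis 1 + a 1 ^ 2 • b.dualBasis 2 := ⟨_, rfl⟩
  obtain ⟨T', hT'⟩ : ∃ T : Module.Dual ℂ E.H0,
    T = a 0 ^ 2 • b.dualBasis 1 + (2 * a 0 * a 1) • b.dualBasis 2 + (3 * a 1 ^ 2) • b.dualBasis 3 := ⟨_, rfl⟩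
  have hTb : ∀ j, T (b j) = ![3 * a 0 ^ 2, 2 * a 0 * a 1, a 1 ^ 2, 0] j := fun j => by
    simp only [hT, LinearMap.add_apply, LinearMap.smul_apply, Module.Basis.dualBasis_apply_self, smul_eq_mul]
    fin_cases j <;> simp
  have hTb' : ∀ j, T' (b j) = ![0, a 0 ^ 2, 2 * a 0 * a 1, 3 * a 1 ^ 2] j := fun j => by
    simp only [hT', LinearMap.add_apply, LinearMap.smul_apply, Module.Basis.dualBasis_apply_self, smul_eq_mul]
    fin_cases j <;> simp
  rw [← hT, ← hT']
  have h : (3 : ℂ) • (detMap δ).compr₂ (N.sq (rootForm a a)) =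
      c • ((LinearMap.mul ℂ ℂ).compl₁₂ T T' - (LinearMap.mul ℂ ℂ).compl₁₂ T' T) := by
    refine LinearMap.ext_basis b b fun i j => ?_
    simp only [LinearMap.smul_apply, LinearMap.compr₂_apply, N.sq_detMap_basis, LinearMap.sub_apply,
      LinearMap.compl₁₂_apply, LinearMap.mul_apply', hTb, hTb', smul_eq_mul]
    fin_cases i <;> fin_cases j <;> simp [plucker, rootForm, -mul_eq_zero, -zero_eq_mul] <;> ring
  exact LinearMap.congr_fun₂ h x y

end IsNormalForm

end Lines

section Bisecants

variable {K : Type*} [Field K] [Algebra ℂ K] [hK : Fact (IsCurveFunctionField K)]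
variable {V : Type*} [AddCommGroup V] [Module K V] [Module ℂ V] [IsScalarTower ℂ K V]
variable {η : Ω[K⁄ℂ]} {κ : Point K →₀ ℤ} {e : Fin 3 → K} {E : Family K V} {δ : E.det.Iso (omega2 K)}
variable {b : Module.Basis (Fin 4) ℂ E.H0} {c : ℂ}

theorem detMap_self (x : E.H0) : detMap δ x x = 0 := by
  refine Subtype.ext ?_
  change δ.toEquiv (wedge K V x x) = 0
  rw [wedge_self, map_zero]

theorem detMap_comm (x y : E.H0) : detMap δ x y = -detMap δ y x := by
  refine Subtype.ext ?_
  change δ.toEquiv (wedge K V x y) = -δ.toEquiv (wedge K V y x)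
  rw [wedge_comm, map_neg]

namespace IsNormalForm

/-- The line parametrized by the square of `φ`. -/
def line (N : IsNormalForm δ η κ e b c) (φ : Fin 3 → ℂ) : Submodule ℂ (Module.Dual ℂ E.H0) :=
  LinearMap.range ((detMap δ).compr₂ (N.sq φ))

theorem line_smul (N : IsNormalForm δ η κ e b c) {r : ℂ} (hr : r ≠ 0) (φ : Fin 3 → ℂ) :
    N.line (r • φ) = N.line φ := by
  have h : (detMap δ).compr₂ (N.sq (r • φ)) = (r * r) • (detMap δ).compr₂ (N.sq φ) := by
    ext x y
    simp [N.sq_smul]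
  rw [line, h, LinearMap.range_smul _ _ (mul_ne_zero hr hr)]
  rfl

theorem lineOf_eq (N : IsNormalForm δ η κ e b c) {z : ℙ ℂ (Module.Dual ℂ (omega2 K).H0)} {φ : Fin 3 → ℂ}
    (h : z.submodule = Submodule.span ℂ {N.sq φ}) : lineOf δ z = N.line φ := by
  obtain ⟨r, hr, hz⟩ := IsCanonicalBasis.exists_rep_eq h
  rw [← N.line_smul hr, line, N.sq_smul, ← hz]
  rfl

theorem line_eq_span_of_wedge (N : IsNormalForm δ η κ e b c) {φ : Fin 3 → ℂ} (hφ : φ ≠ 0) {r : ℂ} (hr : r ≠ 0)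
    {α β : Module.Dual ℂ E.H0} (h : ∀ x y, r * N.sq φ (detMap δ x y) = c * (α x * β y - β x * α y)) :
    LinearIndependent ℂ ![α, β] ∧ N.line φ = Submodule.span ℂ {α, β} := by
  have hli : LinearIndependent ℂ ![α, β] := by
    by_contra hli
    refine N.sq_ne_zero hφ (N.dual_ext_detMap fun x y => ?_)
    have h1 := h x y
    rw [wedge_eq_zero_of_not_linearIndependent hli, mul_zero] at h1
    exact (mul_eq_zero.1 h1).resolve_left hr
  refine ⟨hli, range_eq_span_of_wedge hli (div_ne_zero N.const_ne_zero hr) fun x y => ?_⟩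
  rw [LinearMap.compr₂_apply, div_mul_eq_mul_div, eq_div_iff hr, ← h, mul_comm]

theorem line_rootForm (N : IsNormalForm δ η κ e b c) {a a' : Fin 2 → ℂ} (h : LinearIndependent ℂ ![a, a']) :
    N.line (rootForm a a') = Submodule.span ℂ {cubicPoint b.dualBasis a, cubicPoint b.dualBasis a'} :=
  (N.line_eq_span_of_wedge (rootForm_ne_zero (h.ne_zero 0) (h.ne_zero 1)) (det_ne_zero_of_linearIndependent h)
    (N.sq_rootForm_detMap a a')).2

theorem line_rootForm_self (N : IsNormalForm δ η κ e b c) {a : Fin 2 → ℂ} (ha : a ≠ 0) :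
    N.line (rootForm a a) = cubicTangent b.dualBasis a :=
  (N.line_eq_span_of_wedge (rootForm_ne_zero ha ha) three_ne_zero (N.sq_rootForm_self_detMap a)).2

theorem exists_wedge (N : IsNormalForm δ η κ e b c) {φ : Fin 3 → ℂ} (hφ : φ ≠ 0) :
    ∃ (r : ℂ) (α β : Module.Dual ℂ E.H0), r ≠ 0 ∧ LinearIndependent ℂ ![α, β] ∧
      N.line φ = Submodule.span ℂ {α, β} ∧ ∀ x y, N.sq φ (detMap δ x y) = r * (α x * β y - β x * α y) := by
  obtain ⟨s, α, β, hs, h⟩ : ∃ (s : ℂ) (α β : Module.Dual ℂ E.H0), s ≠ 0 ∧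
      ∀ x y, s * N.sq φ (detMap δ x y) = c * (α x * β y - β x * α y) := by
    obtain ⟨a, a', ha, ha', rfl⟩ := exists_eq_rootForm hφ
    rcases linearIndependent_or_eq_smul ha ha' with hli | ⟨r, hr, rfl⟩
    · exact ⟨_, _, _, det_ne_zero_of_linearIndependent hli, N.sq_rootForm_detMap a a'⟩
    · refine ⟨3 / (r * r), _, _, div_ne_zero three_ne_zero (mul_ne_zero hr hr), fun x y =>
        Eq.trans ?_ (N.sq_rootForm_self_detMap a x y)⟩
      rw [rootForm_smul_right, N.sq_smul, LinearMap.smul_apply, smul_eq_mul]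
      field_simp
  obtain ⟨h1, h2⟩ := N.line_eq_span_of_wedge hφ hs h
  refine ⟨c / s, α, β, div_ne_zero N.const_ne_zero hs, h1, h2, fun x y => ?_⟩
  rw [div_mul_eq_mul_div, eq_div_iff hs, ← h, mul_comm]

theorem isConeGenerator_line (N : IsNormalForm δ η κ e b c) {a a' : Fin 2 → ℂ} (ha : a ≠ 0) (ha' : a' ≠ 0)
    {o : ℙ ℂ (Module.Dual ℂ E.H0)} (ho : o.submodule = Submodule.span ℂ {cubicPoint b.dualBasis a}) :
    IsConeGenerator b.dualBasis o (N.line (rootForm a a')) := by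
  refine ⟨a, ha, ho, ?_⟩
  rcases linearIndependent_or_eq_smul ha ha' with hli | ⟨r, hr, rfl⟩
  · exact Or.inl ⟨a', hli, N.line_rootForm hli⟩
  · right
    rw [rootForm_smul_right, N.line_smul hr, N.line_rootForm_self ha]

theorem exists_of_isConeGenerator (N : IsNormalForm δ η κ e b c) {o : ℙ ℂ (Module.Dual ℂ E.H0)}
    {ℓ : Submodule ℂ (Module.Dual ℂ E.H0)} (h : IsConeGenerator b.dualBasis o ℓ) :
    ∃ a a' : Fin 2 → ℂ, a ≠ 0 ∧ a' ≠ 0 ∧ o.submodule = Submodule.span ℂ {cubicPoint b.dualBasis a} ∧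
      ℓ = N.line (rootForm a a') := by
  obtain ⟨a, ha, ho, ⟨a', hli, rfl⟩ | rfl⟩ := h
  · exact ⟨a, a', ha, hli.ne_zero 1, ho, (N.line_rootForm hli).symm⟩
  · exact ⟨a, a, ha, ha, ho, (N.line_rootForm_self ha).symm⟩

theorem cubicPoint_ne_zero {a : Fin 2 → ℂ} (ha : a ≠ 0) : cubicPoint b.dualBasis a ≠ 0 := by
  intro h
  have h0 := cubicPoint_apply (b := b) a 0
  have h3 := cubicPoint_apply (b := b) a 3
  rw [h, LinearMap.zero_apply] at h0 h3
  apply ha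
  ext i
  fin_cases i
  · exact pow_eq_zero_iff (three_ne_zero) |>.1 h0.symm
  · exact pow_eq_zero_iff (three_ne_zero) |>.1 h3.symm

theorem isBisecant_lineOf (N : IsNormalForm δ η κ e b c) {z : ℙ ℂ (Module.Dual ℂ (omega2 K).H0)}
    (hz : z ∈ veronese K) : IsBisecant b.dualBasis (lineOf δ z) := by
  obtain ⟨φ, hφ, h⟩ := N.mem_veronese_iff.1 hz
  rw [N.lineOf_eq (φ := φ) (by rw [z.submodule_eq, h])]
  obtain ⟨a, a', ha, ha', rfl⟩ := exists_eq_rootForm hφ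
  have ho := Projectivization.submodule_mk (K := ℂ) (cubicPoint b.dualBasis a) (cubicPoint_ne_zero ha)
  exact ⟨_, ⟨a, ha, ho⟩, N.isConeGenerator_line ha ha' ho⟩

theorem span_sq_eq_of_line_eq (N : IsNormalForm δ η κ e b c) {φ φ' : Fin 3 → ℂ} (hφ : φ ≠ 0) (hφ' : φ' ≠ 0)
    (h : N.line φ = N.line φ') : Submodule.span ℂ {N.sq φ} = Submodule.span ℂ {N.sq φ'} := by
  obtain ⟨r, α, β, hr, -, hl, hw⟩ := N.exists_wedge hφ
  obtain ⟨r', α', β', hr', -, hl', hw'⟩ := N.exists_wedge hφ'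
  rw [hl, hl'] at h
  have hα : α' ∈ Submodule.span ℂ {α, β} := by rw [h]; exact Submodule.subset_span (Set.mem_insert _ _)
  have hβ : β' ∈ Submodule.span ℂ {α, β} := by rw [h]; exact Submodule.subset_span (Set.mem_insert_of_mem _ rfl)
  obtain ⟨p, q, rfl⟩ := Submodule.mem_span_pair.1 hα
  obtain ⟨s, t, rfl⟩ := Submodule.mem_span_pair.1 hβ
  have heq : N.sq φ' = (r' * (p * t - q * s) / r) • N.sq φ := by
    rw [← sub_eq_zero]
    refine N.dual_ext_detMap fun x y => ?_
    rw [LinearMap.sub_apply, LinearMap.smul_apply, hw', hw]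
    simp only [LinearMap.add_apply, LinearMap.smul_apply, smul_eq_mul]
    field_simp
    ring
  have hne : r' * (p * t - q * s) / r ≠ 0 := fun h0 => N.sq_ne_zero hφ' (by rw [heq, h0, zero_smul])
  rw [heq]
  exact (Submodule.span_singleton_smul_eq (isUnit_iff_ne_zero.2 hne) _).symm

theorem existsUnique_of_isBisecant (N : IsNormalForm δ η κ e b c) {ℓ : Submodule ℂ (Module.Dual ℂ E.H0)}
    (h : IsBisecant b.dualBasis ℓ) : ∃! z, z ∈ veronese K ∧ lineOf δ z = ℓ := by
  obtain ⟨o, -, h⟩ := h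
  obtain ⟨a, a', ha, ha', -, rfl⟩ := N.exists_of_isConeGenerator h
  have hφ := rootForm_ne_zero ha ha'
  have hz := Projectivization.submodule_mk (K := ℂ) _ (N.sq_ne_zero hφ)
  refine ⟨_, ⟨N.mem_veronese_of_submodule hφ hz, N.lineOf_eq hz⟩, fun z' hz' => ?_⟩
  obtain ⟨φ, hφ', hrep⟩ := N.mem_veronese_iff.1 hz'.1
  have hsub : z'.submodule = Submodule.span ℂ {N.sq φ} := by rw [z'.submodule_eq, hrep]
  apply Projectivization.submodule_injective
  rw [hsub, hz]
  exact N.span_sq_eq_of_line_eq hφ' hφ (by rw [← N.lineOf_eq hsub, hz'.2])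

theorem pluckerQuadric_eq_zero (N : IsNormalForm δ η κ e b c) (b' : Module.Basis (Fin 4) ℂ E.H0)
    {z : ℙ ℂ (Module.Dual ℂ (omega2 K).H0)} (hz : z ∈ veronese K) : pluckerQuadric δ b' z.rep = 0 := by
  obtain ⟨φ, hφ, hrep⟩ := N.mem_veronese_iff.1 hz
  obtain ⟨r, α, β, -, -, -, hw⟩ := N.exists_wedge hφ
  have h : ∀ i j, pluckerCoord δ (b' i) (b' j) z.rep = r * (α (b' i) * β (b' j) - β (b' i) * α (b' j)) :=
    fun i j => by rw [← hw, ← hrep]; rfl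
  simp only [pluckerQuadric, add_apply, sub_apply, QuadraticMap.linMulLin_apply, h]
  ring

theorem quadricRank_pluckerQuadric (N : IsNormalForm δ η κ e b c) (b' : Module.Basis (Fin 4) ℂ E.H0) :
    quadricRank (pluckerQuadric δ b') = 6 := by
  let g : Fin 6 → (omega2 K).H0 := ![detMap δ (b' 0) (b' 1), detMap δ (b' 0) (b' 2), detMap δ (b' 0) (b' 3),
    detMap δ (b' 1) (b' 2), detMap δ (b' 1) (b' 3), detMap δ (b' 2) (b' 3)]
  have hspan : ⊤ ≤ Submodule.span ℂ (Set.range g) := by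
    rw [top_le_iff]
    by_contra hne
    obtain ⟨ψ, hψ0, hψ⟩ := Submodule.exists_le_ker_of_lt_top _ (lt_top_iff_ne_top.2 hne)
    refine hψ0 (N.dual_ext_detMap ?_)
    have hgk : ∀ k, ψ (g k) = 0 := fun k => hψ (Submodule.subset_span ⟨k, rfl⟩)
    have hcomm : ∀ {x y : E.H0}, ψ (detMap δ x y) = 0 → ψ (detMap δ y x) = 0 := fun h => by
      rw [detMap_comm, map_neg, h, neg_zero]
    have hself : ∀ x : E.H0, ψ (detMap δ x x) = 0 := fun x => by rw [detMap_self, map_zero]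
    have hzero : (detMap δ).compr₂ ψ = 0 := by
      refine LinearMap.ext_basis b' b' fun i j => ?_
      rw [LinearMap.compr₂_apply, LinearMap.zero_apply, LinearMap.zero_apply]
      fin_cases i <;> fin_cases j
      · exact hself _
      · exact hgk 0
      · exact hgk 1
      · exact hgk 2
      · exact hcomm (hgk 0)
      · exact hself _
      · exact hgk 3
      · exact hgk 4
      · exact hcomm (hgk 1)
      · exact hcomm (hgk 3)
      · exact hself _
      · exact hgk 5
      · exact hcomm (hgk 2)
      · exact hcomm (hgk 4)
      · exact hcomm (hgk 5)
      · exact hself _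
    exact fun x y => LinearMap.congr_fun₂ hzero x y
  have hfin : Module.Finite ℂ (omega2 K).H0 := Module.finite_of_finrank_eq_succ N.finrank_omega2
  obtain ⟨G, hG⟩ : ∃ G : Module.Basis (Fin 6) ℂ (omega2 K).H0, ⇑G = g :=
    ⟨basisOfTopLeSpanOfCardEqFinrank g hspan (by rw [N.finrank_omega2]; rfl), by simp⟩
  have hpolar : ∀ ψ ψ' : Module.Dual ℂ (omega2 K).H0, (pluckerQuadric δ b').polarBilin ψ ψ' =
      ψ (g 0) * ψ' (g 5) + ψ' (g 0) * ψ (g 5) - (ψ (g 1) * ψ' (g 4) + ψ' (g 1) * ψ (g 4)) +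
        (ψ (g 2) * ψ' (g 3) + ψ' (g 2) * ψ (g 3)) := fun ψ ψ' => by
    have h0 : ∀ (χ : Module.Dual ℂ (omega2 K).H0) i j, pluckerCoord δ (b' i) (b' j) χ = χ (detMap δ (b' i) (b' j)) :=
      fun χ i j => rfl
    rw [QuadraticMap.polarBilin_apply_apply, QuadraticMap.polar]
    simp only [pluckerQuadric, add_apply, sub_apply, QuadraticMap.linMulLin_apply, h0,
      LinearMap.add_apply]
    change _ = ψ (detMap δ (b' 0) (b' 1)) * ψ' (detMap δ (b' 2) (b' 3)) +
      ψ' (detMap δ (b' 0) (b' 1)) * ψ (detMap δ (b' 2) (b' 3)) -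
      (ψ (detMap δ (b' 0) (b' 2)) * ψ' (detMap δ (b' 1) (b' 3)) +
        ψ' (detMap δ (b' 0) (b' 2)) * ψ (detMap δ (b' 1) (b' 3))) +
      (ψ (detMap δ (b' 0) (b' 3)) * ψ' (detMap δ (b' 1) (b' 2)) +
        ψ' (detMap δ (b' 0) (b' 3)) * ψ (detMap δ (b' 1) (b' 2)))
    ring
  rw [quadricRank, LinearMap.finrank_range_of_inj, Subspace.dual_finrank_eq, N.finrank_omega2]
  rw [← LinearMap.ker_eq_bot, eq_bot_iff]
  intro ψ hψ
  rw [Submodule.mem_bot]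
  refine G.ext fun k => ?_
  have hc : ∀ i j, G.coord i (g j) = if j = i then 1 else 0 := fun i j => by
    rw [← hG, Module.Basis.coord_apply, Module.Basis.repr_self, Finsupp.single_apply]
  have hp : ∀ i, (pluckerQuadric δ b').polarBilin ψ (G.coord i) = 0 := fun i => by
    rw [LinearMap.mem_ker.1 hψ, LinearMap.zero_apply]
  simp only [hpolar, hc] at hp
  rw [hG, LinearMap.zero_apply]
  fin_cases k
  · simpa using hp 5
  · simpa using hp 4
  · simpa using hp 3
  · simpa using hp 2
  · simpa using hp 1
  · simpa using hp 0

end IsNormalForm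

end Bisecants

/-! ### The points of the curve -/

section Points

variable {K : Type*} [Field K] [Algebra ℂ K] [hK : Fact (IsCurveFunctionField K)]
variable {V : Type*} [AddCommGroup V] [Module K V]

theorem HasDiv.mem_maximalIdeal_smul {L : Family K V} {s : V} {D : Point K →₀ ℤ} (h : HasDiv L s D) (P : Point K)
    (f : K) : f • s ∈ IsLocalRing.maximalIdeal P.O • L.stalk P ↔ f ∈ P.fil (-D P + 1) := by
  constructor
  · intro hf
    have key : ∀ v ∈ IsLocalRing.maximalIdeal P.O • L.stalk P, ∃ g ∈ P.fil (-D P + 1), v = g • s := by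
      intro v hv
      refine Submodule.smul_induction_on hv (fun r hr n hn => ?_) (fun x y hx hy => ?_)
      · obtain ⟨g, rfl⟩ := h.exists_smul n
        refine ⟨(r : K) * g, ?_, ?_⟩
        · rw [add_comm]
          exact P.mul_mem_fil (P.mem_maximalIdeal.1 hr) ((h.mem_iff P g).1 hn)
        · rw [mul_smul]; rfl
      · obtain ⟨g, hg, rfl⟩ := hx
        obtain ⟨g', hg', rfl⟩ := hy
        exact ⟨g + g', add_mem hg hg', (add_smul _ _ _).symm⟩
    obtain ⟨g, hg, hfg⟩ := key _ hf
    rwa [smul_left_injective K h.ne_zero hfg]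
  · intro hf
    rw [add_comm] at hf
    obtain ⟨a, ha, g, hg, rfl⟩ := P.exists_mul_eq hf
    have haO : a ∈ P.O := P.mem_fil_zero.1 (P.fil_anti zero_le_one ha)
    rw [mul_smul]
    exact Submodule.smul_mem_smul (r := (⟨a, haO⟩ : P.O)) (P.mem_maximalIdeal.2 ha) ((h.mem_iff P g).2 hg)

theorem mem_span_of_ker_le {H : Type*} [AddCommGroup H] [Module ℂ H] {α γ : Module.Dual ℂ H}
    (h : ∀ x, α x = 0 → γ x = 0) : γ ∈ Submodule.span ℂ {α} := by
  have hmem : γ ∈ Submodule.span ℂ (Set.range fun _ : Unit => α) := by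
    apply mem_span_of_iInf_ker_le_ker
    intro x hx
    rw [Submodule.mem_iInf] at hx
    exact h x (hx ())
  rwa [Set.range_const] at hmem

theorem mem_span_pair_of_ker_le {H : Type*} [AddCommGroup H] [Module ℂ H] {α β γ : Module.Dual ℂ H}
    (h : ∀ x, α x = 0 → β x = 0 → γ x = 0) : γ ∈ Submodule.span ℂ {α, β} := by
  have hmem : γ ∈ Submodule.span ℂ (Set.range ![α, β]) := by
    apply mem_span_of_iInf_ker_le_ker
    intro x hx
    rw [Submodule.mem_iInf] at hx
    exact h x (hx 0) (hx 1)
  rwa [Matrix.range_cons_cons_empty] at hmem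

/-- Cramer's rule in a plane. -/
theorem cramer (hV : Module.finrank K V = 2) (g : ⋀[K]^2 V →ₗ[K] K) (u v w : V) :
    g (wedge K V u v) • w = g (wedge K V w v) • u + g (wedge K V u w) • v := by
  have := Module.finite_of_finrank_eq_succ hV
  obtain ⟨b⟩ : Nonempty (Module.Basis (Fin 2) K V) := ⟨Module.finBasisOfFinrankEq K V hV⟩
  obtain ⟨f, hf⟩ := exists_wedge_equiv b
  have hgf : ∀ x y, g (wedge K V x y) = g (f.symm 1) * (b.repr x 0 * b.repr y 1 - b.repr x 1 * b.repr y 0) := by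
    intro x y
    rw [← hf]
    have h1 : wedge K V x y = f (wedge K V x y) • f.symm 1 := by
      rw [← map_smul, smul_eq_mul, mul_one, LinearEquiv.symm_apply_apply]
    conv_lhs => rw [h1, map_smul, smul_eq_mul, mul_comm]
    rfl
  apply b.repr.injective
  ext i
  simp only [hgf, map_add, map_smul, Finsupp.add_apply, Finsupp.smul_apply, smul_eq_mul]
  fin_cases i
  · change _ * b.repr w 0 = _ * b.repr u 0 + _ * b.repr v 0
    ring
  · change _ * b.repr w 1 = _ * b.repr u 1 + _ * b.repr v 1
    ring

end Points

section Fibres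

variable {K : Type*} [Field K] [Algebra ℂ K] [hK : Fact (IsCurveFunctionField K)]
variable {V : Type*} [AddCommGroup V] [Module K V] [Module ℂ V] [IsScalarTower ℂ K V]
variable {η : Ω[K⁄ℂ]} {κ : Point K →₀ ℤ} {e : Fin 3 → K} {E : Family K V} {δ : E.det.Iso (omega2 K)}
variable {b : Module.Basis (Fin 4) ℂ E.H0} {c : ℂ}

namespace IsCanonicalBasis

theorem hasDiv_omega2 (N : IsCanonicalBasis η κ e) : HasDiv (omega2 K) (η ⊗ₜ[K] η) (κ + κ) :=
  N.hasDiv.tensor N.hasDiv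

/-- The section `s` of `ω_C²` is `N.coef s • (η ⊗ η)`. -/
def coef (N : IsCanonicalBasis η κ e) : (omega2 K).H0 →ₗ[ℂ] K :=
  (rrSpace (κ + κ)).subtype ∘ₗ N.hasDiv_omega2.sectionEquiv.symm.toLinearMap

theorem coef_smul (N : IsCanonicalBasis η κ e) (s : (omega2 K).H0) : N.coef s • (η ⊗ₜ[K] η) = s := by
  have h := N.hasDiv_omega2.coe_sectionEquiv (N.hasDiv_omega2.sectionEquiv.symm s)
  rw [LinearEquiv.apply_symm_apply] at h
  exact h.symm

theorem coef_eq (N : IsCanonicalBasis η κ e) {s : (omega2 K).H0} {f : K}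
    (h : (s : Ω[K⁄ℂ] ⊗[K] Ω[K⁄ℂ]) = f • (η ⊗ₜ[K] η)) : N.coef s = f :=
  smul_left_injective K N.hasDiv_omega2.ne_zero ((N.coef_smul s).trans h)

theorem coef_mulSection (N : IsCanonicalBasis η κ e) (i j : Fin 3) :
    N.coef (mulSection (N.secBasis i) (N.secBasis j)) = e i * e j :=
  N.coef_eq (N.coe_mulSection i j)

/-- The value of the canonical sections at a point, in terms of the function `t`. -/
structure IsValueAt (κ : Point K →₀ ℤ) (e : Fin 3 → K) (P : Point K) (t : K) (φ : Fin 3 → ℂ) : Prop where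
  ne_zero : t ≠ 0
  ord_eq : P.ord t = κ P
  sub_mem : ∀ i, e i * t - algebraMap ℂ K (φ i) ∈ P.fil 1
  value_ne_zero : φ ≠ 0

theorem mul_mem_O (N : IsCanonicalBasis η κ e) {P : Point K} {t : K} (ht0 : t ≠ 0) (ht : P.ord t = κ P) (i : Fin 3) :
    e i * t ∈ P.fil 0 := by
  rw [P.mul_mem_fil_iff ht0, ht, zero_sub]
  exact mem_rrSpace.1 (N.mem i) P

theorem exists_isValueAt (N : IsCanonicalBasis η κ e) (P : Point K) : ∃ t φ, IsValueAt κ e P t φ := by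
  obtain ⟨t, ht0, ht⟩ := P.exists_ord_eq (κ P)
  have hex : ∀ i, ∃ r : ℂ, e i * t - algebraMap ℂ K r ∈ P.fil 1 := fun i => by
    obtain ⟨r, hr⟩ := P.exists_residue (P.mem_fil_zero.1 (N.mul_mem_O ht0 ht i))
    exact ⟨r, hr⟩
  choose φ hφ using hex
  refine ⟨t, φ, ht0, ht, hφ, ?_⟩
  rintro rfl
  obtain ⟨i, hi⟩ := exists_ord_eq_neg N.ne_zero N.mem N.basePointFree P
  have := hφ i
  rw [Pi.zero_apply, map_zero, sub_zero, P.mem_fil (mul_ne_zero (N.ne_zero i) ht0), P.ord_mul (N.ne_zero i) ht0,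
    hi, ht] at this
  omega

theorem coef_sub_sq_mem (N : IsCanonicalBasis η κ e) {P : Point K} {t : K} {φ : Fin 3 → ℂ}
    (h : IsValueAt κ e P t φ) (s : (omega2 K).H0) : N.coef s * (t * t) - algebraMap ℂ K (N.sq φ s) ∈ P.fil 1 := by
  have hb : ∀ p, N.coef (N.quadBasis p) * (t * t) - algebraMap ℂ K (N.sq φ (N.quadBasis p)) ∈ P.fil 1 := by
    intro p
    induction p with
    | h i j =>
      rw [N.quadBasis_mk, N.coef_mulSection, N.sq_mulSection_secBasis, map_mul]
      have h1 : e i * e j * (t * t) - algebraMap ℂ K (φ i) * algebraMap ℂ K (φ j) =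
          (e i * t - algebraMap ℂ K (φ i)) * (e j * t) + algebraMap ℂ K (φ i) * (e j * t - algebraMap ℂ K (φ j)) := by
        ring
      rw [h1]
      refine add_mem ?_ ?_
      · have := P.mul_mem_fil (h.sub_mem i) (N.mul_mem_O h.ne_zero h.ord_eq j)
        simpa using this
      · rw [← Algebra.smul_def]
        exact P.smul_mem_fil _ (h.sub_mem j)
  rw [← N.quadBasis.sum_repr s, map_sum, map_sum, map_sum, Finset.sum_mul, ← Finset.sum_sub_distrib]
  refine sum_mem fun p _ => ?_
  rw [map_smul, map_smul, smul_mul_assoc, smul_eq_mul, map_mul, ← Algebra.smul_def, ← smul_sub]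
  exact P.smul_mem_fil _ (hb p)

theorem mem_fil_one_iff {P : Point K} {z : K} {r : ℂ} (h : z - algebraMap ℂ K r ∈ P.fil 1) : z ∈ P.fil 1 ↔ r = 0 := by
  constructor
  · intro hz
    by_contra hr
    have h1 := sub_mem hz h
    rw [sub_sub_cancel, P.mem_fil ((map_ne_zero _).2 hr), P.ord_algebraMap] at h1
    omega
  · rintro rfl
    rwa [map_zero, sub_zero] at h

theorem mem_maximalIdeal_smul_iff (N : IsCanonicalBasis η κ e) {P : Point K} {t : K} {φ : Fin 3 → ℂ}
    (h : IsValueAt κ e P t φ) (s : (omega2 K).H0) :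
    (s : Ω[K⁄ℂ] ⊗[K] Ω[K⁄ℂ]) ∈ IsLocalRing.maximalIdeal P.O • (omega2 K).stalk P ↔ N.sq φ s = 0 := by
  rw [← mem_fil_one_iff (N.coef_sub_sq_mem h s), P.mul_mem_fil_iff (mul_ne_zero h.ne_zero h.ne_zero),
    P.ord_mul h.ne_zero h.ne_zero, h.ord_eq]
  conv_lhs => rw [← N.coef_smul s]
  rw [N.hasDiv_omega2.mem_maximalIdeal_smul, Finsupp.add_apply]
  rw [show -(κ P + κ P) + 1 = 1 - (κ P + κ P) by ring]

theorem fibreDual_omega2 (N : IsCanonicalBasis η κ e) {P : Point K} {t : K} {φ : Fin 3 → ℂ}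
    (h : IsValueAt κ e P t φ) : (omega2 K).fibreDual P = Submodule.span ℂ {N.sq φ} := by
  apply le_antisymm
  · intro ψ hψ
    exact mem_span_of_ker_le fun s hs => hψ s ((N.mem_maximalIdeal_smul_iff h s).2 hs)
  · rw [Submodule.span_singleton_le_iff_mem]
    exact fun s hs => (N.mem_maximalIdeal_smul_iff h s).1 hs

end IsCanonicalBasis

namespace IsNormalForm

/-- The determinant of two vectors of the generic fibre of `E`, in terms of `η ⊗ η`. -/
def coefDet (N : IsNormalForm δ η κ e b c) : V →ₗ[K] V →ₗ[K] K :=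
  (wedge K V).compr₂ (N.hasDiv_omega2.equiv.symm.toLinearMap ∘ₗ δ.toEquiv.toLinearMap)

theorem coefDet_smul (N : IsNormalForm δ η κ e b c) (v w : V) :
    N.coefDet v w • (η ⊗ₜ[K] η) = δ.toEquiv (wedge K V v w) := by
  rw [← N.hasDiv_omega2.equiv_apply]
  exact N.hasDiv_omega2.equiv.apply_symm_apply _

theorem coefDet_coe (N : IsNormalForm δ η κ e b c) (x y : E.H0) : N.coefDet x y = N.coef (detMap δ x y) :=
  (N.coef_eq (N.coefDet_smul x y).symm).symm

theorem coefDet_basis (N : IsNormalForm δ η κ e b c) (i j : Fin 4) :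
    N.coefDet (b i) (b j) = algebraMap ℂ K c * plucker e i j :=
  smul_left_injective K N.hasDiv_omega2.ne_zero ((N.coefDet_smul _ _).trans (N.det_eq i j))

theorem cramer (N : IsNormalForm δ η κ e b c) (u v w : V) :
    N.coefDet u v • w = N.coefDet w v • u + N.coefDet u w • v :=
  OcticScroll.cramer N.isVectorBundle.finrank_eq
    (N.hasDiv_omega2.equiv.symm.toLinearMap ∘ₗ δ.toEquiv.toLinearMap) u v w

theorem exists_coefDet_ord (N : IsNormalForm δ η κ e b c) (P : Point K) :
    ∃ i j, N.coefDet (b i) (b j) ≠ 0 ∧ P.ord (N.coefDet (b i) (b j)) = -κ P + -κ P := by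
  obtain ⟨i, j, hn, ho⟩ := exists_plucker_ord N.ne_zero N.mem N.basePointFree P
  have hc : algebraMap ℂ K c ≠ 0 := (map_ne_zero _).2 N.const_ne_zero
  refine ⟨i, j, ?_, ?_⟩
  · rw [N.coefDet_basis]; exact mul_ne_zero hc hn
  · rw [N.coefDet_basis, P.ord_mul hc hn, ho, P.ord_algebraMap, zero_add]

theorem fibreDual_eq_line (N : IsNormalForm δ η κ e b c) {P : Point K} {t : K} {φ : Fin 3 → ℂ}
    (h : IsCanonicalBasis.IsValueAt κ e P t φ) : E.fibreDual P = N.line φ := by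
  apply le_antisymm
  · intro γ hγ
    obtain ⟨r, α, β, hr, -, hl, hw⟩ := N.exists_wedge h.value_ne_zero
    rw [hl]
    refine mem_span_pair_of_ker_le fun s hα hβ => hγ s ?_
    have hmem : ∀ y : E.H0, N.coefDet s y ∈ P.fil (-κ P + -κ P + 1) := fun y => by
      have h1 : N.sq φ (detMap δ s y) = 0 := by rw [hw, hα, hβ]; ring
      have h2 := (N.mem_maximalIdeal_smul_iff h _).2 h1
      rw [← N.coef_smul, N.hasDiv_omega2.mem_maximalIdeal_smul, ← N.coefDet_coe, Finsupp.add_apply, neg_add] at h2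
      exact h2
    obtain ⟨i, j, hn, ho⟩ := N.exists_coefDet_ord P
    have hdiv : ∀ z ∈ P.fil (-κ P + -κ P + 1), z * (N.coefDet (b i) (b j))⁻¹ ∈ P.fil 1 := fun z hz => by
      rw [P.mul_mem_fil_iff (inv_ne_zero hn), P.ord_inv, ho]
      exact P.fil_anti (by omega) hz
    have hms : ∀ f ∈ P.fil 1, ∀ x : E.H0, f • (x : V) ∈ IsLocalRing.maximalIdeal P.O • E.stalk P := fun f hf x =>
      Submodule.smul_mem_smul (r := (⟨f, P.mem_fil_zero.1 (P.fil_anti zero_le_one hf)⟩ : P.O))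
        (P.mem_maximalIdeal.2 hf) (x.2 P)
    have hs : (s : V) = (N.coefDet s (b j) * (N.coefDet (b i) (b j))⁻¹) • (b i : V) +
        (N.coefDet (b i) s * (N.coefDet (b i) (b j))⁻¹) • (b j : V) := by
      rw [mul_comm, mul_comm (N.coefDet (b i) s), mul_smul, mul_smul, ← smul_add, ← N.cramer, inv_smul_smul₀ hn]
    rw [hs]
    refine add_mem (hms _ (hdiv _ (hmem _)) _) (hms _ (hdiv _ ?_) _)
    have := hmem (b i)
    rw [N.coefDet_coe, detMap_comm, map_neg, neg_mem_iff, ← N.coefDet_coe] at this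
    exact this
  · rintro _ ⟨y, rfl⟩ s hs
    rw [LinearMap.compr₂_apply]
    refine (N.mem_maximalIdeal_smul_iff h _).1 ?_
    rw [← N.coef_smul, N.hasDiv_omega2.mem_maximalIdeal_smul, ← N.coefDet_coe]
    refine Submodule.smul_induction_on (p := fun v => N.coefDet y v ∈ P.fil (-(κ + κ) P + 1)) hs
      (fun r hr v hv => ?_) (fun x x' hx hx' => ?_)
    · change N.coefDet y ((r : K) • v) ∈ _
      rw [map_smul, add_comm]
      refine P.mul_mem_fil (P.mem_maximalIdeal.1 hr) ((N.hasDiv_omega2.mem_iff P _).1 ?_)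
      rw [N.coefDet_smul, δ.mem_iff]
      exact Submodule.subset_span ⟨_, y.2 P, _, hv, rfl⟩
    · rw [map_add]; exact add_mem hx hx'

theorem exists_mem_veronese (N : IsNormalForm δ η κ e b c) (P : Point K) : ∃ z ∈ veronese K,
    z.submodule = (omega2 K).fibreDual P ∧ lineOf δ z = E.fibreDual P := by
  obtain ⟨t, φ, h⟩ := N.exists_isValueAt P
  have hz := Projectivization.submodule_mk (K := ℂ) _ (N.sq_ne_zero h.value_ne_zero)
  exact ⟨_, N.mem_veronese_of_submodule h.value_ne_zero hz, hz.trans (N.fibreDual_omega2 h).symm,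
    (N.lineOf_eq hz).trans (N.fibreDual_eq_line h).symm⟩

end IsNormalForm

end Fibres

/-! ### The lines of the scroll through a point of the cubic -/

section Ruling

variable {K : Type*} [Field K] [Algebra ℂ K] [hK : Fact (IsCurveFunctionField K)]
variable {V : Type*} [AddCommGroup V] [Module K V]

theorem colength_eq_of_cyclic (P : Point K) {M N : Submodule P.O V} {h : V} (hh : h ∈ M)
    (hM : M ≤ N ⊔ Submodule.span P.O {h}) {n : ℕ} (hn : ∀ f : P.O, f • h ∈ N ↔ (f : K) ∈ P.fil n) :
    colength M N = n := by
  let g : P.O →ₗ[P.O] (M ⧸ N.submoduleOf M) :=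
    (N.submoduleOf M).mkQ ∘ₗ LinearMap.toSpanSingleton P.O M ⟨h, hh⟩
  have hg : ∀ f, f ∈ LinearMap.ker g ↔ (f : K) ∈ P.fil n := fun f => by
    rw [← hn, LinearMap.mem_ker, LinearMap.comp_apply, Submodule.mkQ_apply, Submodule.Quotient.mk_eq_zero]
    rfl
  have hsurj : Function.Surjective g := by
    intro y
    obtain ⟨⟨m, hm⟩, rfl⟩ := Submodule.mkQ_surjective _ y
    obtain ⟨x, hx, y, hy, rfl⟩ := Submodule.mem_sup.1 (hM hm)
    obtain ⟨f, rfl⟩ := Submodule.mem_span_singleton.1 hy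
    refine ⟨f, ?_⟩
    rw [LinearMap.comp_apply, Submodule.mkQ_apply, Submodule.mkQ_apply, eq_comm, Submodule.Quotient.eq]
    change (x + f • h) - f • h ∈ N
    rwa [add_sub_cancel_right]
  rw [colength, ← (LinearMap.quotKerEquivOfSurjective g hsurj).length_eq]
  exact P.length_quotient_eq (I := LinearMap.ker g) hg

end Ruling

section ConeDivisor

variable {K : Type*} [Field K] [Algebra ℂ K] [hK : Fact (IsCurveFunctionField K)]
variable {V : Type*} [AddCommGroup V] [Module K V] [Module ℂ V] [IsScalarTower ℂ K V]
variable {η : Ω[K⁄ℂ]} {κ : Point K →₀ ℤ} {e : Fin 3 → K} {E : Family K V} {δ : E.det.Iso (omega2 K)}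
variable {b : Module.Basis (Fin 4) ℂ E.H0} {c : ℂ}

/-- The canonical section which vanishes on the conic of the lines through the point of the cubic with
parameter `a`. -/
def coneSection (e : Fin 3 → K) (a : Fin 2 → ℂ) : K :=
  a 0 ^ 2 • e 0 + (a 0 * a 1) • e 1 + a 1 ^ 2 • e 2

namespace IsCanonicalBasis

theorem coneSection_ne_zero (N : IsCanonicalBasis η κ e) {a : Fin 2 → ℂ} (ha : a ≠ 0) : coneSection e a ≠ 0 := by
  intro h
  have h1 := Fintype.linearIndependent_iff.1 N.linearIndependent ![a 0 ^ 2, a 0 * a 1, a 1 ^ 2] (by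
    rw [Fin.sum_univ_three]; exact h)
  apply ha
  ext i
  fin_cases i
  · exact pow_eq_zero_iff two_ne_zero |>.1 (h1 0)
  · exact pow_eq_zero_iff two_ne_zero |>.1 (h1 2)

theorem coneSection_mem (N : IsCanonicalBasis η κ e) (a : Fin 2 → ℂ) : coneSection e a ∈ rrSpace κ :=
  add_mem (add_mem (Submodule.smul_mem _ _ (N.mem 0)) (Submodule.smul_mem _ _ (N.mem 1)))
    (Submodule.smul_mem _ _ (N.mem 2))

theorem hasDiv_coneSection (N : IsCanonicalBasis η κ e) {a : Fin 2 → ℂ} (ha : a ≠ 0) :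
    HasDiv (omega K) (coneSection e a • η) (κ + divf (coneSection e a)) :=
  N.hasDiv.smul (N.coneSection_ne_zero ha)

theorem coneDivisor_nonneg (N : IsCanonicalBasis η κ e) {a : Fin 2 → ℂ} (ha : a ≠ 0) (P : Point K) :
    0 ≤ (κ + divf (coneSection e a)) P := by
  have h := mem_rrSpace.1 (N.coneSection_mem a) P
  rw [P.mem_fil (N.coneSection_ne_zero ha)] at h
  rw [Finsupp.add_apply, divf_apply]
  omega

end IsCanonicalBasis

namespace IsNormalForm

theorem exists_of_cubicPoint_eq_zero {a : Fin 2 → ℂ} (ha : a ≠ 0) {s : E.H0}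
    (hs : cubicPoint b.dualBasis a s = 0) : ∃ x₁ x₂ x₃ : ℂ, s = x₁ • (a 1 • b 0 - a 0 • b 1) +
      x₂ • (a 1 • b 1 - a 0 • b 2) + x₃ • (a 1 • b 2 - a 0 • b 3) := by
  obtain ⟨h, hsum⟩ : ∃ h : Fin 4 → ℂ, s = h 0 • b 0 + h 1 • b 1 + h 2 • b 2 + h 3 • b 3 :=
    ⟨b.repr s, by rw [← Fin.sum_univ_four (fun i => b.repr s i • b i), b.sum_repr]⟩
  have hrel : h 0 * a 0 ^ 3 + h 1 * (a 0 ^ 2 * a 1) + h 2 * (a 0 * a 1 ^ 2) + h 3 * a 1 ^ 3 = 0 := by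
    rw [hsum] at hs
    simp only [map_add, map_smul, cubicPoint_apply, smul_eq_mul] at hs
    simpa using hs
  by_cases h0 : a 0 = 0
  · have h1 : a 1 ≠ 0 := fun h1 => ha (by ext i; fin_cases i; exacts [h0, h1])
    have h3 : h 3 = 0 := by
      rw [h0] at hrel
      have : h 3 * a 1 ^ 3 = 0 := by linear_combination hrel
      exact (mul_eq_zero.1 this).resolve_right (pow_ne_zero 3 h1)
    refine ⟨h 0 / a 1, h 1 / a 1, h 2 / a 1, ?_⟩
    rw [hsum, h3, h0]
    match_scalars <;> field_simp <;> ring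
  · refine ⟨(a 1 * ((a 1 * (-h 3 / a 0) - h 2) / a 0) - h 1) / a 0, (a 1 * (-h 3 / a 0) - h 2) / a 0, -h 3 / a 0, ?_⟩
    rw [hsum]
    match_scalars
    · field_simp; linear_combination hrel
    · field_simp; ring
    · field_simp; ring
    · field_simp

/-- The determinants of the sections vanishing at a point of the cubic. -/
theorem coefDet_mem_of_cubicPoint_eq_zero (N : IsNormalForm δ η κ e b c) {a : Fin 2 → ℂ} (ha : a ≠ 0) (P : Point K)
    {s s' : E.H0} (hs : cubicPoint b.dualBasis a s = 0) (hs' : cubicPoint b.dualBasis a s' = 0) :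
    N.coefDet s s' ∈ P.fil (-κ P + P.ord (coneSection e a)) := by
  obtain ⟨x₁, x₂, x₃, rfl⟩ := exists_of_cubicPoint_eq_zero ha hs
  obtain ⟨y₁, y₂, y₃, rfl⟩ := exists_of_cubicPoint_eq_zero ha hs'
  obtain ⟨r, hr⟩ : ∃ r : ℂ → K, r = algebraMap ℂ K := ⟨_, rfl⟩
  have key : N.coef (detMap δ (x₁ • (a 1 • b 0 - a 0 • b 1) + x₂ • (a 1 • b 1 - a 0 • b 2) +
      x₃ • (a 1 • b 2 - a 0 • b 3)) (y₁ • (a 1 • b 0 - a 0 • b 1) + y₂ • (a 1 • b 1 - a 0 • b 2) +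
      y₃ • (a 1 • b 2 - a 0 • b 3))) = ((c * (x₁ * y₂ - x₂ * y₁)) • e 2 + (-c * (x₁ * y₃ - x₃ * y₁)) • e 1 +
        (c * (x₂ * y₃ - x₃ * y₂)) • e 0) * coneSection e a := by
    have hb : ∀ i j, N.coef (detMap δ (b i) (b j)) = algebraMap ℂ K c * plucker e i j := fun i j => by
      rw [← N.coefDet_coe, N.coefDet_basis]
    simp only [map_add, map_sub, map_smul, LinearMap.add_apply, LinearMap.sub_apply, LinearMap.smul_apply, hb]
    simp only [coneSection, Algebra.smul_def, map_mul, map_sub, map_pow, map_neg]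
    simp [plucker]
    ring
  rw [N.coefDet_coe, key]
  refine P.mul_mem_fil ?_ ((P.mem_fil (N.coneSection_ne_zero ha)).2 le_rfl)
  exact mem_rrSpace.1 (add_mem (add_mem (Submodule.smul_mem _ _ (N.mem 2)) (Submodule.smul_mem _ _ (N.mem 1)))
    (Submodule.smul_mem _ _ (N.mem 0))) P

theorem rulingMult_eq (N : IsNormalForm δ η κ e b c) {a : Fin 2 → ℂ} (ha : a ≠ 0) (P : Point K)
    {γ : Module.Dual ℂ E.H0} {r : ℂ} (hr : r ≠ 0) (hγ : γ = r • cubicPoint b.dualBasis a) :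
    E.rulingMult γ P = (((κ + divf (coneSection e a)) P).toNat : ℕ∞) := by
  have hker : ∀ s, γ s = 0 ↔ cubicPoint b.dualBasis a s = 0 := fun s => by
    rw [hγ, LinearMap.smul_apply, smul_eq_zero, or_iff_right hr]
  have hq0 := N.coneSection_ne_zero ha
  have hn : (((κ + divf (coneSection e a)) P).toNat : ℤ) = κ P + P.ord (coneSection e a) := by
    rw [Int.toNat_of_nonneg (N.coneDivisor_nonneg ha P), Finsupp.add_apply, divf_apply]
  obtain ⟨h, hh⟩ : ∃ h : E.H0, cubicPoint b.dualBasis a h = 1 := LinearMap.surjective (cubicPoint_ne_zero ha) 1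
  set N₀ := Submodule.span P.O (((LinearMap.ker γ).map E.H0.subtype : Submodule ℂ V) : Set V) with hN₀
  have hmemN : ∀ s : E.H0, cubicPoint b.dualBasis a s = 0 → (s : V) ∈ N₀ := fun s hs =>
    Submodule.subset_span ⟨s, LinearMap.mem_ker.2 ((hker s).2 hs), rfl⟩
  have hdec : ∀ s : E.H0, (s - cubicPoint b.dualBasis a s • h : E.H0).1 ∈ N₀ := fun s => hmemN _ (by
    rw [map_sub, map_smul, hh, smul_eq_mul, mul_one, sub_self])
  have hsub : ∀ s : E.H0, (s : V) = (s - cubicPoint b.dualBasis a s • h : E.H0).1 +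
      algebraMap ℂ K (cubicPoint b.dualBasis a s) • (h : V) := fun s => by
    rw [algebraMap_smul, Submodule.coe_sub, Submodule.coe_smul, sub_add_cancel]
  have hM : E.stalk P ≤ N₀ ⊔ Submodule.span P.O {(h : V)} := by
    rw [← N.isGloballyGenerated P, Submodule.span_le]
    intro v hv
    have h1 := hsub ⟨v, hv⟩
    change v = _ at h1
    rw [h1]
    exact Submodule.add_mem_sup (hdec _) (Submodule.mem_span_singleton.2
      ⟨⟨_, P.algebraMap_mem (cubicPoint b.dualBasis a ⟨v, hv⟩)⟩, rfl⟩)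
  refine colength_eq_of_cyclic P (h.2 P) hM fun f => ⟨fun hf => ?_, fun hf => ?_⟩
  · have hNN : ∀ v ∈ N₀, ∀ w ∈ N₀, N.coefDet v w ∈ P.fil (-κ P + P.ord (coneSection e a)) := by
      intro v hv w hw
      induction hv using Submodule.span_induction with
      | mem x hx =>
        obtain ⟨s, hs, rfl⟩ := hx
        induction hw using Submodule.span_induction with
        | mem y hy =>
          obtain ⟨s', hs', rfl⟩ := hy
          exact N.coefDet_mem_of_cubicPoint_eq_zero ha P ((hker _).1 hs) ((hker _).1 hs')
        | zero => rw [map_zero]; exact zero_mem _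
        | add y y' _ _ hy hy' => rw [map_add]; exact add_mem hy hy'
        | smul k y _ hy =>
          change N.coefDet _ ((k : K) • y) ∈ _
          rw [map_smul]; exact (P.fil _).smul_mem k hy
      | zero => rw [map_zero, LinearMap.zero_apply]; exact zero_mem _
      | add y y' _ _ hy hy' => rw [map_add, LinearMap.add_apply]; exact add_mem hy hy'
      | smul k y _ hy =>
        change N.coefDet ((k : K) • y) _ ∈ _
        rw [map_smul, LinearMap.smul_apply]; exact (P.fil _).smul_mem k hy
    obtain ⟨i, j, hn0, ho⟩ := N.exists_coefDet_ord P
    have hfh : (f : K) • (h : V) ∈ N₀ := hf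
    obtain ⟨m₁, hm₁⟩ : ∃ m, m = (b i - cubicPoint b.dualBasis a (b i) • h : E.H0).1 := ⟨_, rfl⟩
    obtain ⟨m₂, hm₂⟩ : ∃ m, m = (b j - cubicPoint b.dualBasis a (b j) • h : E.H0).1 := ⟨_, rfl⟩
    have h1 : m₁ ∈ N₀ := hm₁ ▸ hdec _
    have h2 : m₂ ∈ N₀ := hm₂ ▸ hdec _
    have h3 : (f : K) * N.coefDet (b i) (b j) ∈ P.fil (-κ P + P.ord (coneSection e a)) := by
      rw [hsub (b i), hsub (b j), ← hm₁, ← hm₂]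
      have hhh : N.coefDet (h : V) (h : V) = 0 := by
        rw [N.coefDet_coe, detMap_self, map_zero]
      have h4 : (f : K) * N.coefDet (m₁ + algebraMap ℂ K (cubicPoint b.dualBasis a (b i)) • (h : V))
          (m₂ + algebraMap ℂ K (cubicPoint b.dualBasis a (b j)) • (h : V)) =
          (f : K) * N.coefDet m₁ m₂ + cubicPoint b.dualBasis a (b j) • N.coefDet m₁ ((f : K) • (h : V)) +
            cubicPoint b.dualBasis a (b i) • N.coefDet ((f : K) • (h : V)) m₂ := by
        simp only [map_add, map_smul, LinearMap.add_apply, LinearMap.smul_apply, hhh, smul_eq_mul]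
        simp only [Algebra.smul_def]
        ring
      rw [h4]
      exact add_mem (add_mem ((P.fil _).smul_mem f (hNN _ h1 _ h2)) (P.smul_mem_fil _ (hNN _ h1 _ hfh)))
        (P.smul_mem_fil _ (hNN _ hfh _ h2))
    rw [P.mul_mem_fil_iff hn0, ho] at h3
    rw [hn]
    convert h3 using 2; ring
  · obtain ⟨t, ht0, ht⟩ := P.exists_ord_eq (κ P)
    have hO : ∀ i, t * e i ∈ P.O := fun i => by
      rw [mul_comm, ← P.mem_fil_zero]; exact N.mul_mem_O ht0 ht i
    have hkey : ∀ v : Fin 3 → E.H0, e 0 • (v 0 : V) + e 1 • (v 1 : V) + e 2 • (v 2 : V) = 0 →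
        (t * (cubicPoint b.dualBasis a (v 0) • e 0 + cubicPoint b.dualBasis a (v 1) • e 1 +
          cubicPoint b.dualBasis a (v 2) • e 2)) • (h : V) ∈ N₀ := by
      intro v hv
      rw [hsub (v 0), hsub (v 1), hsub (v 2)] at hv
      have h1 : (t * (cubicPoint b.dualBasis a (v 0) • e 0 + cubicPoint b.dualBasis a (v 1) • e 1 +
          cubicPoint b.dualBasis a (v 2) • e 2)) • (h : V) =
          -((t * e 0) • (v 0 - cubicPoint b.dualBasis a (v 0) • h : E.H0).1 +
            (t * e 1) • (v 1 - cubicPoint b.dualBasis a (v 1) • h : E.H0).1 +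
            (t * e 2) • (v 2 - cubicPoint b.dualBasis a (v 2) • h : E.H0).1) := by
        rw [eq_neg_iff_add_eq_zero]
        refine Eq.trans ?_ ((congrArg (fun z => t • z) hv).trans (smul_zero t))
        simp only [Algebra.smul_def]
        module
      rw [h1]
      exact neg_mem (add_mem (add_mem (N₀.smul_mem ⟨_, hO 0⟩ (hdec _)) (N₀.smul_mem ⟨_, hO 1⟩ (hdec _)))
        (N₀.smul_mem ⟨_, hO 2⟩ (hdec _)))
    have hai : ∀ i, (algebraMap ℂ K (a i) * (t * coneSection e a)) • (h : V) ∈ N₀ := by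
      intro i
      match i with
      | 0 =>
        convert hkey ![b 0, b 1, b 2] N.rel₁ using 2
        simp [cubicPoint_apply, coneSection, Algebra.smul_def]
        ring
      | 1 =>
        convert hkey ![b 1, b 2, b 3] N.rel₂ using 2
        simp [cubicPoint_apply, coneSection, Algebra.smul_def]
        ring
    have htq : (t * coneSection e a) • (h : V) ∈ N₀ := by
      obtain ⟨i, hi⟩ := Function.ne_iff.1 ha
      have hi' : algebraMap ℂ K (a i) ≠ 0 := (map_ne_zero _).2 hi
      have := N₀.smul_mem ⟨_, P.algebraMap_mem (a i)⁻¹⟩ (hai i)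
      change algebraMap ℂ K (a i)⁻¹ • _ ∈ N₀ at this
      rwa [smul_smul, ← mul_assoc, map_inv₀, inv_mul_cancel₀ hi', one_mul] at this
    have htq0 := mul_ne_zero ht0 hq0
    have hfO : (f : K) * (t * coneSection e a)⁻¹ ∈ P.O := by
      rw [← P.mem_fil_zero, P.mul_mem_fil_iff (inv_ne_zero htq0), P.ord_inv, P.ord_mul ht0 hq0, ht]
      rw [hn] at hf
      simpa using hf
    have := N₀.smul_mem ⟨_, hfO⟩ htq
    change ((f : K) * (t * coneSection e a)⁻¹) • _ ∈ N₀ at this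
    rw [smul_smul, inv_mul_cancel_right₀ htq0] at this
    exact this

end IsNormalForm

end ConeDivisor

/-! ### The conic of the lines through a point of the cubic -/

section ConeConic

variable {K : Type*} [Field K] [Algebra ℂ K] [hK : Fact (IsCurveFunctionField K)]
variable {V : Type*} [AddCommGroup V] [Module K V] [Module ℂ V] [IsScalarTower ℂ K V]
variable {η : Ω[K⁄ℂ]} {κ : Point K →₀ ℤ} {e : Fin 3 → K} {E : Family K V} {δ : E.det.Iso (omega2 K)}
variable {b : Module.Basis (Fin 4) ℂ E.H0} {c : ℂ}

namespace IsCanonicalBasis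

/-- The points of the Veronese surface defined by the quadratic forms with the root `a`. -/
def coneConic (N : IsCanonicalBasis η κ e) (a : Fin 2 → ℂ) : Set (ℙ ℂ (Module.Dual ℂ (omega2 K).H0)) :=
  {z | ∃ s : Fin 2 → ℂ, s ≠ 0 ∧ z.submodule = Submodule.span ℂ {N.sq (rootForm a s)}}

theorem coneConic_subset (N : IsCanonicalBasis η κ e) {a : Fin 2 → ℂ} (ha : a ≠ 0) : N.coneConic a ⊆ veronese K := by
  rintro z ⟨s, hs, hz⟩
  exact N.mem_veronese_of_submodule (rootForm_ne_zero ha hs) hz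

theorem isConic_coneConic (N : IsCanonicalBasis η κ e) {a : Fin 2 → ℂ} (ha : a ≠ 0) : IsConic (N.coneConic a) := by
  refine ⟨![N.sq (rootForm a ![1, 0]), N.sq (rootForm a ![1, 1]) - N.sq (rootForm a ![1, 0]) -
    N.sq (rootForm a ![0, 1]), N.sq (rootForm a ![0, 1])], ?_, ?_⟩
  · rw [Fintype.linearIndependent_iff]
    intro x hx
    have h : ∀ i j, _ := fun i j => LinearMap.congr_fun hx (mulSection (N.secBasis i) (N.secBasis j))
    simp only [Fin.sum_univ_three, LinearMap.add_apply, LinearMap.smul_apply, LinearMap.zero_apply,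
      Matrix.cons_val_zero, Matrix.cons_val_one, Matrix.cons_val_two, Matrix.tail_cons, Matrix.head_cons,
      LinearMap.sub_apply, sq_mulSection_secBasis] at h
    have h00 := h 0 0
    have h01 := h 0 1
    have h11 := h 1 1
    have h12 := h 1 2
    have h22 := h 2 2
    simp [rootForm, -mul_eq_zero] at h00 h01 h11 h12 h22
    have key : x 0 = 0 ∧ x 1 = 0 ∧ x 2 = 0 := by
      by_cases h1 : a 1 = 0
      · have h0 : a 0 ≠ 0 := fun h0 => ha (by ext i; fin_cases i; exacts [h0, h1])
        simp [h1, h0] at h00 h01 h11 h12 h22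
        exact ⟨h22, h12, h11⟩
      · have e2 : x 2 = 0 := by simpa [h1] using h00
        rw [e2] at h01 h11
        have e1 : x 1 = 0 := by
          have : x 1 * (a 1 * a 1) = 0 := by linear_combination -h01
          simpa [h1] using this
        rw [e1] at h11
        exact ⟨by simpa [h1] using h11, e1, e2⟩
    intro i
    fin_cases i
    exacts [key.1, key.2.1, key.2.2]
  · have h : ∀ s : Fin 2 → ℂ, N.sq (rootForm a s) = s 0 ^ 2 • N.sq (rootForm a ![1, 0]) +
        (s 0 * s 1) • (N.sq (rootForm a ![1, 1]) - N.sq (rootForm a ![1, 0]) - N.sq (rootForm a ![0, 1])) +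
        s 1 ^ 2 • N.sq (rootForm a ![0, 1]) := by
      intro s
      refine N.dual_ext fun i j => ?_
      have hr : ∀ i, rootForm a s i = s 0 * rootForm a ![1, 0] i + s 1 * rootForm a ![0, 1] i := by
        intro i; fin_cases i <;> simp [rootForm] <;> ring
      have h1 : ∀ i, rootForm a ![1, 1] i = rootForm a ![1, 0] i + rootForm a ![0, 1] i := by
        intro i; fin_cases i <;> simp [rootForm]
      simp only [LinearMap.add_apply, LinearMap.smul_apply, LinearMap.sub_apply, sq_mulSection_secBasis, smul_eq_mul, hr, h1]
      ring
    refine Set.ext fun z => exists_congr fun s => ?_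
    rw [h s]
    rfl

theorem sum_coneDivisor (N : IsCanonicalBasis η κ e) {a : Fin 2 → ℂ} (ha : a ≠ 0) :
    (((κ + divf (coneSection e a)).mapRange Int.toNat Int.toNat_zero).sum fun _ n => n) = 4 := by
  have h : deg (κ + divf (coneSection e a)) = 4 := by
    rw [deg_add, deg_divf, deg_canonical N.genus_eq N.hasDiv, add_zero]
  rw [Finsupp.sum_mapRange_index (fun _ => rfl), ← Int.natCast_inj]
  rw [deg] at h
  refine Eq.trans ?_ h
  simp only [Finsupp.sum, Nat.cast_sum]
  exact Finset.sum_congr rfl fun P _ => Int.toNat_of_nonneg (N.coneDivisor_nonneg ha P)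

theorem isCanonicalDivisor_coneDivisor (N : IsCanonicalBasis η κ e) {a : Fin 2 → ℂ} (ha : a ≠ 0) :
    IsCanonicalDivisor ((κ + divf (coneSection e a)).mapRange Int.toNat Int.toNat_zero) := by
  have hd := N.hasDiv_coneSection ha
  refine ⟨_, ?_, hd.ne_zero, fun P => ?_⟩
  · have h := (N.hasDiv.sectionEquiv ⟨_, N.coneSection_mem a⟩).2
    rwa [N.hasDiv.coe_sectionEquiv] at h
  · rw [Finsupp.mapRange_apply]
    exact hd.colength_stalk_span P

theorem coneDivisor_ne_zero_iff (N : IsCanonicalBasis η κ e) {a : Fin 2 → ℂ} (ha : a ≠ 0) {P : Point K} {t : K}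
    {φ : Fin 3 → ℂ} (h : IsValueAt κ e P t φ) : ((κ + divf (coneSection e a)) P).toNat ≠ 0 ↔
      a 0 ^ 2 * φ 0 + a 0 * a 1 * φ 1 + a 1 ^ 2 * φ 2 = 0 := by
  have h1 : coneSection e a * t - algebraMap ℂ K (a 0 ^ 2 * φ 0 + a 0 * a 1 * φ 1 + a 1 ^ 2 * φ 2) ∈ P.fil 1 := by
    have h2 := add_mem (add_mem (P.smul_mem_fil (a 0 ^ 2) (h.sub_mem 0)) (P.smul_mem_fil (a 0 * a 1) (h.sub_mem 1)))
      (P.smul_mem_fil (a 1 ^ 2) (h.sub_mem 2))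
    convert h2 using 1
    simp only [coneSection, Algebra.smul_def, map_add, map_mul, map_pow]
    ring
  have hq := N.coneSection_ne_zero ha
  have h3 := N.coneDivisor_nonneg ha P
  rw [← mem_fil_one_iff h1, P.mem_fil (mul_ne_zero hq h.ne_zero), P.ord_mul hq h.ne_zero, h.ord_eq]
  rw [Finsupp.add_apply, divf_apply] at h3 ⊢
  omega

end IsCanonicalBasis

namespace IsNormalForm

theorem mem_line_iff (N : IsNormalForm δ η κ e b c) {φ : Fin 3 → ℂ} (hφ : φ ≠ 0) {γ : Module.Dual ℂ E.H0} :
    γ ∈ N.line φ ↔ φ 0 * γ (b 0) + φ 1 * γ (b 1) + φ 2 * γ (b 2) = 0 ∧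
      φ 0 * γ (b 1) + φ 1 * γ (b 2) + φ 2 * γ (b 3) = 0 := by
  set u := φ 0 • b 0 + φ 1 • b 1 + φ 2 • b 2 with hu
  set u' := φ 0 • b 1 + φ 1 • b 2 + φ 2 • b 3 with hu'
  have hli : LinearIndependent ℂ ![u, u'] := by
    rw [LinearIndependent.pair_iff]
    intro p q h
    have hb := Fintype.linearIndependent_iff.1 b.linearIndependent
      ![p * φ 0, p * φ 1 + q * φ 0, p * φ 2 + q * φ 1, q * φ 2] (by
        rw [← h, hu, hu', Fin.sum_univ_four]
        simp only [Matrix.cons_val]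
        module)
    have h0 : p * φ 0 = 0 := hb 0
    have h1 : p * φ 1 + q * φ 0 = 0 := hb 1
    have h2 : p * φ 2 + q * φ 1 = 0 := hb 2
    have h3 : q * φ 2 = 0 := hb 3
    by_contra hpq
    apply hφ
    by_cases hp : p = 0
    · have hq : q ≠ 0 := fun hq => hpq ⟨hp, hq⟩
      simp [hp, hq] at h1 h2 h3
      ext i; fin_cases i
      exacts [h1, h2, h3]
    · have e0 : φ 0 = 0 := (mul_eq_zero.1 h0).resolve_left hp
      rw [e0, mul_zero, add_zero] at h1
      have e1 := (mul_eq_zero.1 h1).resolve_left hp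
      rw [e1, mul_zero, add_zero] at h2
      ext i; fin_cases i
      exacts [e0, e1, (mul_eq_zero.1 h2).resolve_left hp]
  have hmem : ∀ γ : Module.Dual ℂ E.H0, γ ∈ (Submodule.span ℂ (Set.range ![u, u'])).dualAnnihilator ↔
      γ u = 0 ∧ γ u' = 0 := fun γ => by
    rw [Submodule.mem_dualAnnihilator]
    refine ⟨fun h => ⟨h u (Submodule.subset_span ⟨0, rfl⟩), h u' (Submodule.subset_span ⟨1, rfl⟩)⟩, fun h w hw => ?_⟩
    refine (Submodule.span_le.2 ?_ : _ ≤ LinearMap.ker γ) hw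
    rintro _ ⟨i, rfl⟩
    fin_cases i
    exacts [h.1, h.2]
  have hle : N.line φ ≤ (Submodule.span ℂ (Set.range ![u, u'])).dualAnnihilator := by
    rintro _ ⟨x, rfl⟩
    have hb := N.sq_detMap_basis φ
    have hk : (detMap δ).flip u ∈ LinearMap.ker (LinearMap.compRight ℂ (M := E.H0) (N.sq φ)) ∧
        (detMap δ).flip u' ∈ LinearMap.ker (LinearMap.compRight ℂ (M := E.H0) (N.sq φ)) := by
      constructor
      · refine b.ext fun j => ?_
        change N.sq φ (detMap δ (b j) u) = 0
        simp only [hu, map_add, map_smul, hb]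
        fin_cases j <;> simp [plucker, -mul_eq_zero] <;> ring
      · refine b.ext fun j => ?_
        change N.sq φ (detMap δ (b j) u') = 0
        simp only [hu', map_add, map_smul, hb]
        fin_cases j <;> simp [plucker, -mul_eq_zero] <;> ring
    exact (hmem _).2 ⟨LinearMap.congr_fun hk.1 x, LinearMap.congr_fun hk.2 x⟩
  have heq : N.line φ = (Submodule.span ℂ (Set.range ![u, u'])).dualAnnihilator := by
    have : FiniteDimensional ℂ E.H0 := b.finiteDimensional_of_finite
    refine Submodule.eq_of_le_of_finrank_eq hle ?_
    obtain ⟨r, α, β, hr, hl, h, -⟩ := N.exists_wedge hφ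
    have h1 := Subspace.finrank_add_finrank_dualAnnihilator_eq (Submodule.span ℂ (Set.range ![u, u']))
    rw [finrank_span_eq_card hli, Module.finrank_eq_card_basis b, Fintype.card_fin, Fintype.card_fin] at h1
    have h2 := finrank_span_eq_card hl
    rw [Matrix.range_cons, Matrix.range_cons, Matrix.range_empty, Set.union_empty, Set.singleton_union, ← h, Fintype.card_fin] at h2
    omega
  rw [heq, hmem]
  simp only [hu, hu', map_add, map_smul, smul_eq_mul]

theorem coneGenerator_iff (N : IsNormalForm δ η κ e b c) {a : Fin 2 → ℂ} (ha : a ≠ 0) {o : ℙ ℂ (Module.Dual ℂ E.H0)}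
    (ho : o.submodule = Submodule.span ℂ {cubicPoint b.dualBasis a}) (ℓ : Submodule ℂ (Module.Dual ℂ E.H0)) :
    IsConeGenerator b.dualBasis o ℓ ↔ ∃ z ∈ N.coneConic a, lineOf δ z = ℓ := by
  constructor
  · intro h
    obtain ⟨a₁, s, ha₁, hs, ho₁, rfl⟩ := N.exists_of_isConeGenerator h
    obtain ⟨r, hr, rfl⟩ : ∃ r : ℂ, r ≠ 0 ∧ a₁ = r • a := by
      refine (linearIndependent_or_eq_smul ha ha₁).resolve_left fun hli => ?_
      have h1 := (N.line_eq_span_of_wedge (rootForm_ne_zero ha ha₁) (det_ne_zero_of_linearIndependent hli)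
        (N.sq_rootForm_detMap a a₁)).1
      rw [LinearIndependent.pair_iff' (cubicPoint_ne_zero ha)] at h1
      have h2 : cubicPoint b.dualBasis a₁ ∈ Submodule.span ℂ {cubicPoint b.dualBasis a} := by
        rw [← ho, ho₁]
        exact Submodule.mem_span_singleton_self _
      obtain ⟨r, hr⟩ := Submodule.mem_span_singleton.1 h2
      exact h1 r hr
    have hz := Projectivization.submodule_mk (K := ℂ) _ (N.sq_ne_zero (rootForm_ne_zero ha hs))
    refine ⟨_, ⟨s, hs, hz⟩, ?_⟩
    rw [N.lineOf_eq hz, ← N.line_smul hr]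
    congr 1
    ext i
    fin_cases i <;> simp [rootForm] <;> ring
  · rintro ⟨z, ⟨s, hs, hz⟩, rfl⟩
    rw [N.lineOf_eq hz]
    exact N.isConeGenerator_line ha hs ho

theorem cubicPoint_mem_line_iff (N : IsNormalForm δ η κ e b c) {a : Fin 2 → ℂ} (ha : a ≠ 0) {φ : Fin 3 → ℂ}
    (hφ : φ ≠ 0) : cubicPoint b.dualBasis a ∈ N.line φ ↔ a 0 ^ 2 * φ 0 + a 0 * a 1 * φ 1 + a 1 ^ 2 * φ 2 = 0 := by
  rw [N.mem_line_iff hφ]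
  simp only [cubicPoint_apply, Matrix.cons_val]
  refine ⟨fun ⟨h1, h2⟩ => ?_, fun h => ⟨by linear_combination a 0 * h, by linear_combination a 1 * h⟩⟩
  have e0 : a 0 * (a 0 ^ 2 * φ 0 + a 0 * a 1 * φ 1 + a 1 ^ 2 * φ 2) = 0 := by linear_combination h1
  have e1 : a 1 * (a 0 ^ 2 * φ 0 + a 0 * a 1 * φ 1 + a 1 ^ 2 * φ 2) = 0 := by linear_combination h2
  by_contra h
  refine ha (funext fun i => ?_)
  fin_cases i
  exacts [(mul_eq_zero.1 e0).resolve_right h, (mul_eq_zero.1 e1).resolve_right h]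

theorem mem_support_coneDivisor_iff (N : IsNormalForm δ η κ e b c) {a : Fin 2 → ℂ} (ha : a ≠ 0)
    {o : ℙ ℂ (Module.Dual ℂ E.H0)} (ho : o.submodule = Submodule.span ℂ {cubicPoint b.dualBasis a}) (x : Point K) :
    x ∈ ((κ + divf (coneSection e a)).mapRange Int.toNat Int.toNat_zero).support ↔ o.submodule ≤ E.fibreDual x := by
  obtain ⟨t, φ, h⟩ := N.exists_isValueAt x
  rw [Finsupp.mem_support_iff, Finsupp.mapRange_apply, N.coneDivisor_ne_zero_iff ha h, ho,
    N.fibreDual_eq_line h, Submodule.span_singleton_le_iff_mem, N.cubicPoint_mem_line_iff ha h.value_ne_zero]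

end IsNormalForm

end ConeConic

/-! ### The intersection of the conic with the curve -/

theorem aeval_mul_of_isHomogeneous {σ R : Type*} [CommRing R] [Algebra ℂ R] {F : MvPolynomial σ ℂ} {n : ℕ}
    (hF : F.IsHomogeneous n) (r : R) (c : σ → R) :
    MvPolynomial.aeval (fun s => r * c s) F = r ^ n * MvPolynomial.aeval c F := by
  rw [MvPolynomial.aeval_def, MvPolynomial.eval₂_eq, MvPolynomial.aeval_def, MvPolynomial.eval₂_eq, Finset.mul_sum]
  refine Finset.sum_congr rfl fun m hm => ?_
  have h1 : ∑ i ∈ m.support, m i = n := by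
    have := hF (MvPolynomial.mem_support_iff.1 hm)
    rwa [Finsupp.weight_apply, Finsupp.sum, Finset.sum_congr rfl (fun i _ => by rw [Pi.one_apply, smul_eq_mul, mul_one])] at this
  simp only [mul_pow, Finset.prod_mul_distrib, Finset.prod_pow_eq_pow_sum, h1]
  ring

theorem X_dvd_of_aeval_eq_zero {H : MvPolynomial (Fin 3) ℂ}
    (h : MvPolynomial.aeval ![(MvPolynomial.X 0 : MvPolynomial (Fin 3) ℂ), MvPolynomial.X 1, 0] H = 0) :
    MvPolynomial.X 2 ∣ H := by
  have h1 : Ideal.Quotient.mkₐ ℂ (Ideal.span {(MvPolynomial.X 2 : MvPolynomial (Fin 3) ℂ)}) =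
      (Ideal.Quotient.mkₐ ℂ (Ideal.span {(MvPolynomial.X 2 : MvPolynomial (Fin 3) ℂ)})).comp
        (MvPolynomial.aeval ![MvPolynomial.X 0, MvPolynomial.X 1, 0]) := by
    refine MvPolynomial.algHom_ext fun i => ?_
    rw [AlgHom.comp_apply, MvPolynomial.aeval_X]
    fin_cases i
    · rfl
    · rfl
    · exact (Ideal.Quotient.eq_zero_iff_mem.2 (Ideal.mem_span_singleton_self _)).trans (map_zero _).symm
  rw [← Ideal.mem_span_singleton, ← Ideal.Quotient.eq_zero_iff_mem]
  have h2 := DFunLike.congr_fun h1 H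
  rwa [AlgHom.comp_apply, h, map_zero] at h2

theorem eq_zero_of_eval_eq_zero {σ : Type*} (i : σ) {G : MvPolynomial σ ℂ}
    (h : ∀ x : σ → ℂ, x i ≠ 0 → MvPolynomial.eval x G = 0) : G = 0 := by
  have h1 : MvPolynomial.X i * G = 0 := by
    refine MvPolynomial.funext fun x => ?_
    rw [map_mul, MvPolynomial.eval_X, map_zero]
    by_cases hx : x i = 0
    · rw [hx, zero_mul]
    · rw [h x hx, mul_zero]
  exact (mul_eq_zero.1 h1).resolve_left (MvPolynomial.X_ne_zero i)

theorem sum_smul_sum_smul {W : Type*} [AddCommGroup W] [Module ℂ W] {A B : Matrix (Fin 3) (Fin 3) ℂ} (h : A * B = 1)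
    (x : Fin 3 → W) (i : Fin 3) : ∑ k, A i k • ∑ j, B k j • x j = x i := by
  simp only [Finset.smul_sum, smul_smul]
  rw [Finset.sum_comm]
  simp only [← Finset.sum_smul, ← Matrix.mul_apply, h, Matrix.one_apply, ite_smul, one_smul, zero_smul,
    Finset.sum_ite_eq, Finset.mem_univ, if_true]

/-- Coordinates adapted to the forms with the root `a`. -/
theorem exists_adapted_matrix {a : Fin 2 → ℂ} (ha : a ≠ 0) : ∃ A B : Matrix (Fin 3) (Fin 3) ℂ, A * B = 1 ∧
    (∀ (s : Fin 2 → ℂ) (i : Fin 3), rootForm a s i = s 0 * A i 0 + s 1 * A i 1) ∧ B 2 = ![a 0 ^ 2, a 0 * a 1, a 1 ^ 2] := by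
  by_cases h0 : a 0 = 0
  · have h1 : a 1 ≠ 0 := fun h1 => ha (by ext i; fin_cases i; exacts [h0, h1])
    refine ⟨!![0, a 1, 0; -a 1, 0, 0; 0, 0, (a 1 ^ 2)⁻¹], !![0, -(a 1)⁻¹, 0; (a 1)⁻¹, 0, 0; 0, 0, a 1 ^ 2], ?_, ?_, ?_⟩
    · ext i j
      fin_cases i <;> fin_cases j <;> simp [Matrix.mul_apply, Fin.sum_univ_three, h1]
    · intro s i
      fin_cases i <;> simp [rootForm, h0] <;> ring
    · simp [h0]; rfl
  · refine ⟨!![0, a 1, (a 0 ^ 2)⁻¹; -a 1, -a 0, 0; a 0, 0, 0],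
      !![0, 0, (a 0)⁻¹; 0, -(a 0)⁻¹, -(a 1 / a 0 ^ 2); a 0 ^ 2, a 0 * a 1, a 1 ^ 2], ?_, ?_, rfl⟩
    · ext i j
      fin_cases i <;> fin_cases j <;> simp [Matrix.mul_apply, Fin.sum_univ_three, h0] <;> field_simp <;> ring
    · intro s i
      fin_cases i <;> simp [rootForm] <;> ring

section Intersection

variable {K : Type*} [Field K] [Algebra ℂ K] [hK : Fact (IsCurveFunctionField K)]
variable {η : Ω[K⁄ℂ]} {κ : Point K →₀ ℤ} {e : Fin 3 → K}

theorem Point.aeval_mem_O {σ : Type*} {P : Point K} {c : σ → K} (hc : ∀ s, c s ∈ P.O) (F : MvPolynomial σ ℂ) :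
    MvPolynomial.aeval c F ∈ P.O := by
  induction F using MvPolynomial.induction_on with
  | C r => rw [MvPolynomial.aeval_C]; exact P.algebraMap_mem r
  | add p q hp hq => rw [map_add]; exact add_mem hp hq
  | mul_X p i hp => rw [map_mul, MvPolynomial.aeval_X]; exact mul_mem hp (hc i)

theorem HasDiv.stalk_eq_span {V : Type*} [AddCommGroup V] [Module K V] {L : Family K V} {s : V} {D : Point K →₀ ℤ} (h : HasDiv L s D)
    {P : Point K} {v : K} (hv0 : v ≠ 0) (hv : P.ord v = -D P) : L.stalk P = Submodule.span P.O {v • s} := by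
  ext y
  obtain ⟨f, rfl⟩ := h.exists_smul y
  rw [h.mem_iff, mem_span_O_singleton h.ne_zero hv0 hv]

theorem HasDiv.exists_of_stalk_eq_span {V : Type*} [AddCommGroup V] [Module K V] {L : Family K V} {s : V} {D : Point K →₀ ℤ}
    (h : HasDiv L s D) {P : Point K} {y : V} (hy : L.stalk P = Submodule.span P.O {y}) :
    ∃ v : K, v ≠ 0 ∧ y = v • s ∧ P.ord v ≤ -D P := by
  obtain ⟨v, rfl⟩ := h.exists_smul y
  obtain ⟨w, hw0, hw⟩ := P.exists_ord_eq (-D P)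
  have hws : w • s ∈ L.stalk P := (h.mem_iff P w).2 ((P.mem_fil hw0).2 hw.ge)
  have hv0 : v ≠ 0 := by
    rintro rfl
    rw [hy, zero_smul, Submodule.span_zero_singleton, Submodule.mem_bot, smul_eq_zero] at hws
    exact hws.elim hw0 h.ne_zero
  refine ⟨v, hv0, rfl, ?_⟩
  rw [hy, mem_span_O_singleton h.ne_zero hv0 rfl, P.mem_fil hw0] at hws
  exact hws.trans hw.le

namespace IsCanonicalBasis

/-- The value of a quadratic form at a vector with entries in a `ℂ`-algebra. -/
def quadVal (N : IsCanonicalBasis η κ e) {R : Type*} [CommRing R] [Algebra ℂ R] (y : Fin 3 → R) (s : (omega2 K).H0) : R :=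
  ∑ p : Sym2 (Fin 3), N.quadBasis.repr s p • (p.map y).mul

theorem map_quadVal (N : IsCanonicalBasis η κ e) {R S : Type*} [CommRing R] [Algebra ℂ R] [CommRing S] [Algebra ℂ S]
    (f : R →ₐ[ℂ] S) (y : Fin 3 → R) (s : (omega2 K).H0) : f (N.quadVal y s) = N.quadVal (fun i => f (y i)) s := by
  rw [quadVal, map_sum]
  refine Finset.sum_congr rfl fun p _ => ?_
  rw [map_smul]
  congr 1
  induction p with
  | h i j => exact map_mul f _ _

theorem sq_eq_quadVal (N : IsCanonicalBasis η κ e) (φ : Fin 3 → ℂ) (s : (omega2 K).H0) : N.sq φ s = N.quadVal φ s := by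
  conv_lhs => rw [← N.quadBasis.sum_repr s]
  simp only [map_sum, map_smul, sq_quadBasis, quadVal]

theorem coef_mul_eq_quadVal (N : IsCanonicalBasis η κ e) (t : K) (s : (omega2 K).H0) :
    t * t * N.coef s = N.quadVal (fun i => e i * t) s := by
  conv_lhs => rw [← N.quadBasis.sum_repr s]
  rw [map_sum, Finset.mul_sum]
  refine Finset.sum_congr rfl fun p _ => ?_
  rw [map_smul, mul_smul_comm]
  congr 1
  induction p with
  | h i j =>
    rw [quadBasis_mk, coef_mulSection, Sym2.map_mk, Sym2.mul_mk]
    ring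

theorem aeval_aeval_quadVal (N : IsCanonicalBasis η κ e) {R : Type*} [CommRing R] [Algebra ℂ R] (x : Fin 3 → R)
    (y : Fin 3 → MvPolynomial (Fin 3) ℂ) (F : MvPolynomial (omega2 K).H0 ℂ) :
    MvPolynomial.aeval x (MvPolynomial.aeval (N.quadVal y) F) =
      MvPolynomial.aeval (N.quadVal fun i => MvPolynomial.aeval x (y i)) F := by
  rw [MvPolynomial.comp_aeval_apply]
  simp only [map_quadVal]

theorem aeval_mem_fil (N : IsCanonicalBasis η κ e) {a : Fin 2 → ℂ} (ha : a ≠ 0) {P : Point K} {t : K} (ht0 : t ≠ 0)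
    (ht : P.ord t = κ P) {F : MvPolynomial (omega2 K).H0 ℂ} {n : ℕ} (hF : F.IsHomogeneous n)
    (hv : ∀ z ∈ N.coneConic a, MvPolynomial.eval (fun s => z.rep s) F = 0) :
    MvPolynomial.aeval (fun s => t * t * N.coef s) F ∈ P.fil (P.ord (coneSection e a) + κ P) := by
  have he : ∀ i, e i * t ∈ P.O := fun i => P.mem_fil_zero.1 (N.mul_mem_O ht0 ht i)
  obtain ⟨A, B, hAB, hA, hB⟩ := exists_adapted_matrix ha
  set y : Fin 3 → MvPolynomial (Fin 3) ℂ := fun i => ∑ k, A i k • MvPolynomial.X k with hy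
  set S : Fin 3 → K := fun k => ∑ j, B k j • (e j * t) with hS
  have hzero : ∀ x : Fin 2 → ℂ, x ≠ 0 → MvPolynomial.aeval (N.quadVal (rootForm a x)) F = 0 := fun x hx => by
    have hz := Projectivization.submodule_mk (K := ℂ) _ (N.sq_ne_zero (rootForm_ne_zero ha hx))
    obtain ⟨r, hr, hrep⟩ := exists_rep_eq hz
    have h1 := hv _ ⟨x, hx, hz⟩
    rw [hrep] at h1
    have h2 := aeval_mul_of_isHomogeneous hF (r * r) (N.quadVal (rootForm a x))
    have h3 : MvPolynomial.aeval (fun s => r * r * N.quadVal (rootForm a x) s) F = 0 := by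
      simp only [← N.sq_eq_quadVal]
      exact h1
    exact (mul_eq_zero.1 (h2.symm.trans h3)).resolve_left (pow_ne_zero n (mul_ne_zero hr hr))
  obtain ⟨G, hG⟩ : MvPolynomial.X 2 ∣ MvPolynomial.aeval (N.quadVal y) F := by
    refine X_dvd_of_aeval_eq_zero (eq_zero_of_eval_eq_zero 0 fun x hx => ?_)
    rw [← MvPolynomial.aeval_eq_eval, MvPolynomial.comp_aeval_apply, N.aeval_aeval_quadVal]
    refine Eq.trans ?_ (hzero ![x 0, x 1] fun h => hx (congrFun h 0))
    have hr : (fun i => MvPolynomial.aeval (fun j => MvPolynomial.aeval x (![(MvPolynomial.X 0 : MvPolynomial (Fin 3) ℂ),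
        MvPolynomial.X 1, 0] j)) (y i)) = rootForm a ![x 0, x 1] := by
      ext i
      simp [hy, Fin.sum_univ_three, hA, mul_comm]
    rw [hr]
  have h1 : MvPolynomial.aeval (fun s => t * t * N.coef s) F =
      MvPolynomial.aeval S (MvPolynomial.aeval (N.quadVal y) F) := by
    rw [N.aeval_aeval_quadVal]
    congr 2
    ext s
    rw [N.coef_mul_eq_quadVal]
    congr 1
    ext i
    simp only [hy, map_sum, map_smul, MvPolynomial.aeval_X, hS, sum_smul_sum_smul hAB (fun j => e j * t)]
  have hS2 : S 2 = coneSection e a * t := by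
    simp [hS, hB, Fin.sum_univ_three, coneSection, add_mul]
  have hq := N.coneSection_ne_zero ha
  have h2 : coneSection e a * t ∈ P.fil (P.ord (coneSection e a) + κ P) := by
    rw [P.mem_fil (mul_ne_zero hq ht0), P.ord_mul hq ht0, ht]
  rw [h1, hG, map_mul, MvPolynomial.aeval_X, hS2, ← add_zero (P.ord _ + κ P)]
  refine P.mul_mem_fil h2 (P.mem_fil_zero.2 (P.aeval_mem_O (fun k => sum_mem fun j _ => ?_) G))
  rw [Algebra.smul_def]
  exact mul_mem (P.algebraMap_mem _) (he j)

theorem interMult_coneConic (N : IsCanonicalBasis η κ e) {a : Fin 2 → ℂ} (ha : a ≠ 0) (P : Point K) :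
    (omega2 K).interMult (N.coneConic a) P = (((κ + divf (coneSection e a)) P).toNat : ℕ∞) := by
  refine P.length_quotient_eq fun z => ?_
  obtain ⟨t, ht0, ht⟩ := P.exists_ord_eq (κ P)
  have hq := N.coneSection_ne_zero ha
  rw [Int.toNat_of_nonneg (N.coneDivisor_nonneg ha P), Finsupp.add_apply, divf_apply, add_comm]
  constructor
  · intro hz
    refine Submodule.span_induction (R := P.O) (p := fun (z : P.O) _ => (z : K) ∈ P.fil (P.ord (coneSection e a) + κ P))
      ?_ ?_ ?_ ?_ hz
    · rintro g ⟨y, c, n, F, hy, hc, hF, hv, hg⟩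
      obtain ⟨v, hv0, rfl, hord⟩ := N.hasDiv_omega2.exists_of_stalk_eq_span hy
      have htt := inv_ne_zero (mul_ne_zero ht0 ht0)
      have hcs : c = fun s => v⁻¹ * (t * t)⁻¹ * (t * t * N.coef s) := by
        ext s
        have := N.coef_eq ((hc s).trans (smul_smul _ _ _))
        rw [this]
        field_simp
      have hv' : v⁻¹ * (t * t)⁻¹ ∈ P.O := by
        rw [P.mem_O_iff (mul_ne_zero (inv_ne_zero hv0) htt), P.ord_mul (inv_ne_zero hv0) htt, P.ord_inv, P.ord_inv, P.ord_mul ht0 ht0, ht]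
        rw [Finsupp.add_apply] at hord
        omega
      rw [hg, hcs, aeval_mul_of_isHomogeneous hF]
      exact (P.fil _).smul_mem (⟨_, pow_mem hv' n⟩ : P.O) (N.aeval_mem_fil ha ht0 ht hF hv)
    · exact zero_mem _
    · intro x y _ _ hx hy
      exact add_mem hx hy
    · intro x y _ hy
      exact (P.fil _).smul_mem x hy
  · intro hz
    obtain ⟨k, hk⟩ := exists_ord_eq_neg N.ne_zero N.mem N.basePointFree P
    have hk0 := N.ne_zero k
    let q : (omega K).H0 := a 0 ^ 2 • N.secBasis 0 + (a 0 * a 1) • N.secBasis 1 + a 1 ^ 2 • N.secBasis 2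
    have hqs : (q : Ω[K⁄ℂ]) = coneSection e a • η := by
      change a 0 ^ 2 • (N.secBasis 0 : Ω[K⁄ℂ]) + (a 0 * a 1) • (N.secBasis 1 : Ω[K⁄ℂ]) + a 1 ^ 2 • (N.secBasis 2 : Ω[K⁄ℂ]) = _
      simp only [coe_secBasis, coneSection, add_smul, smul_assoc]
    have hcoef : N.coef (mulSection q (N.secBasis k)) = coneSection e a * e k := by
      refine N.coef_eq ?_
      change (q : Ω[K⁄ℂ]) ⊗ₜ[K] (N.secBasis k : Ω[K⁄ℂ]) = _
      rw [hqs, coe_secBasis, TensorProduct.smul_tmul_smul]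
    have hg0 : t * t * (coneSection e a * e k) ≠ 0 := mul_ne_zero (mul_ne_zero ht0 ht0) (mul_ne_zero hq hk0)
    have hgord : P.ord (t * t * (coneSection e a * e k)) = P.ord (coneSection e a) + κ P := by
      rw [P.ord_mul (mul_ne_zero ht0 ht0) (mul_ne_zero hq hk0), P.ord_mul ht0 ht0, P.ord_mul hq hk0, ht, hk]
      omega
    have hgO : t * t * (coneSection e a * e k) ∈ P.O := by
      rw [P.mem_O_iff hg0, hgord, add_comm]
      have := N.coneDivisor_nonneg ha P
      rwa [Finsupp.add_apply, divf_apply] at this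
    have hgen : (⟨_, hgO⟩ : P.O) ∈ (omega2 K).interIdeal (N.coneConic a) P := by
      refine Ideal.subset_span ⟨(t * t)⁻¹ • (η ⊗ₜ[K] η), fun s => t * t * N.coef s, 1,
        MvPolynomial.X (mulSection q (N.secBasis k)), ?_, fun s => ?_, MvPolynomial.isHomogeneous_X _ _, ?_, ?_⟩
      · refine N.hasDiv_omega2.stalk_eq_span (inv_ne_zero (mul_ne_zero ht0 ht0)) ?_
        rw [P.ord_inv, P.ord_mul ht0 ht0, ht, Finsupp.add_apply]
      · rw [smul_smul, mul_comm, inv_mul_cancel_left₀ (mul_ne_zero ht0 ht0), N.coef_smul]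
      · rintro z ⟨s, hs, hz⟩
        obtain ⟨r, -, hrep⟩ := exists_rep_eq hz
        rw [MvPolynomial.eval_X, hrep, LinearMap.smul_apply, sq_mulSection]
        have : N.form (rootForm a s) q = 0 := by
          simp only [q, map_add, map_smul, form_secBasis, smul_eq_mul]
          simp [rootForm]
          ring
        rw [this, zero_mul, smul_zero]
      · rw [MvPolynomial.aeval_X, hcoef]
    have hy : (z : K) / (t * t * (coneSection e a * e k)) ∈ P.O := by
      rw [div_eq_mul_inv, ← P.mem_fil_zero, P.mul_mem_fil_iff (inv_ne_zero hg0), P.ord_inv, hgord]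
      exact P.fil_anti (by omega) hz
    have hzy : z = (⟨_, hy⟩ : P.O) * ⟨_, hgO⟩ := Subtype.ext (div_mul_cancel₀ _ hg0).symm
    rw [hzy]
    exact Ideal.mul_mem_left _ _ hgen

end IsCanonicalBasis

end Intersection

/-! ### The plane quartic -/

section Quartic

variable {K : Type*} [Field K] [Algebra ℂ K] [hK : Fact (IsCurveFunctionField K)]
variable {η : Ω[K⁄ℂ]} {κ : Point K →₀ ℤ} {e : Fin 3 → K}

theorem Point.aeval_sub_eval_mem {σ : Type*} {P : Point K} {c : σ → K} {φ : σ → ℂ}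
    (h : ∀ s, c s - algebraMap ℂ K (φ s) ∈ P.fil 1) (F : MvPolynomial σ ℂ) :
    MvPolynomial.aeval c F - algebraMap ℂ K (MvPolynomial.eval φ F) ∈ P.fil 1 := by
  induction F using MvPolynomial.induction_on with
  | C r => rw [MvPolynomial.aeval_C, MvPolynomial.eval_C, sub_self]; exact zero_mem _
  | add p q hp hq =>
    rw [map_add, map_add, map_add, add_sub_add_comm]
    exact add_mem hp hq
  | mul_X p i hp =>
    have hc : ∀ s, c s ∈ P.O := fun s => by
      have := add_mem (P.mem_fil_zero.1 (P.fil_anti (by norm_num) (h s))) (P.algebraMap_mem (φ s))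
      rwa [sub_add_cancel] at this
    rw [map_mul, map_mul, map_mul, MvPolynomial.aeval_X, MvPolynomial.eval_X]
    have h1 : MvPolynomial.aeval c p * c i - algebraMap ℂ K (MvPolynomial.eval φ p) * algebraMap ℂ K (φ i) =
        c i * (MvPolynomial.aeval c p - algebraMap ℂ K (MvPolynomial.eval φ p)) +
          algebraMap ℂ K (MvPolynomial.eval φ p) * (c i - algebraMap ℂ K (φ i)) := by ring
    rw [h1]
    exact add_mem ((P.fil 1).smul_mem (⟨_, hc i⟩ : P.O) hp) ((P.fil 1).smul_mem ⟨_, P.algebraMap_mem _⟩ (h i))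

theorem infinite_point {y : K} (hy : ∀ r : ℂ, algebraMap ℂ K r ≠ y) : Infinite (Point K) := by
  have h : ∀ r : ℂ, ∃ P : Point K, y - algebraMap ℂ K r ∈ P.fil 1 := fun r => by
    by_contra hP
    push Not at hP
    have h0 : y - algebraMap ℂ K r ≠ 0 := sub_ne_zero.2 (hy r).symm
    have hle : divf (y - algebraMap ℂ K r) ≤ 0 := fun P => by
      have := hP P
      rw [P.mem_fil h0] at this
      rw [divf_apply, Finsupp.zero_apply]
      omega
    have h1 := eq_of_le_of_deg_eq hle (by rw [deg_divf, deg_zero])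
    obtain ⟨s, hs⟩ := exists_const_of_forall_mem (z := y - algebraMap ℂ K r) fun P => by
      rw [P.mem_O_iff h0, ← divf_apply, h1, Finsupp.zero_apply]
    exact hy (s + r) (by rw [map_add, hs, sub_add_cancel])
  choose P hP using h
  refine Infinite.of_injective P fun r s hrs => ?_
  have h1 := hP r
  rw [hrs] at h1
  have h2 := sub_mem (hP s) h1
  rw [sub_sub_sub_cancel_left, ← map_sub] at h2
  refine sub_eq_zero.1 ((IsCanonicalBasis.mem_fil_one_iff (P := P s) (r := r - s) ?_).1 h2)
  rw [sub_self]
  exact zero_mem _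

namespace IsCanonicalBasis

theorem IsValueAt.eval_eq_zero {f : MvPolynomial (Fin 3) ℂ} {n : ℕ} (hf : f.IsHomogeneous n)
    (hfe : MvPolynomial.aeval e f = 0) {P : Point K} {t : K} {φ : Fin 3 → ℂ} (h : IsValueAt κ e P t φ) :
    MvPolynomial.eval φ f = 0 := by
  have h1 := P.aeval_sub_eval_mem h.sub_mem f
  refine (mem_fil_one_iff h1).1 ?_
  have h2 := aeval_mul_of_isHomogeneous hf t e
  rw [hfe, mul_zero] at h2
  simp only [mul_comm _ t]
  rw [h2]
  exact zero_mem _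

/-- A polynomial which vanishes at the points of the affine part of the curve is zero on the curve. -/
theorem aeval_div_eq_zero (N : IsCanonicalBasis η κ e) {g : MvPolynomial (Fin 2) ℂ}
    (hg : ∀ (P : Point K) (t : K) (φ : Fin 3 → ℂ), IsValueAt κ e P t φ → φ 0 ≠ 0 →
      MvPolynomial.eval ![φ 1 / φ 0, φ 2 / φ 0] g = 0) : MvPolynomial.aeval ![e 1 / e 0, e 2 / e 0] g = 0 := by
  classical
  by_contra hz
  have he0 := N.ne_zero 0
  have : Infinite (Point K) := infinite_point (y := e 1 / e 0) fun r hr => by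
    have h := Fintype.linearIndependent_iff.1 N.linearIndependent ![r, -1, 0] (by
      simp [Fin.sum_univ_three, Algebra.smul_def, hr, he0]) 1
    norm_num at h
  obtain ⟨P, hP⟩ := Infinite.exists_notMem_finset
    ((divf (MvPolynomial.aeval ![e 1 / e 0, e 2 / e 0] g)).support ∪ (κ + divf (e 0)).support)
  rw [Finset.mem_union, not_or, Finsupp.notMem_support_iff, Finsupp.notMem_support_iff, divf_apply, Finsupp.add_apply,
    divf_apply] at hP
  obtain ⟨t, φ, h⟩ := N.exists_isValueAt P
  have hord : P.ord (e 0 * t) = 0 := by rw [P.ord_mul he0 h.ne_zero, h.ord_eq]; omega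
  have het := mul_ne_zero he0 h.ne_zero
  have hφ : φ 0 ≠ 0 := fun h0 => by
    have := (mem_fil_one_iff (h.sub_mem 0)).2 h0
    rw [P.mem_fil het] at this
    omega
  have hφ' : algebraMap ℂ K (φ 0) ≠ 0 := (map_ne_zero _).2 hφ
  have hq : ∀ i, e i / e 0 - algebraMap ℂ K (φ i / φ 0) ∈ P.fil 1 := fun i => by
    have h1 : e i / e 0 - algebraMap ℂ K (φ i / φ 0) = ((φ 0)⁻¹ • (φ 0 • (e i * t - algebraMap ℂ K (φ i)) -
        φ i • (e 0 * t - algebraMap ℂ K (φ 0)))) * (e 0 * t)⁻¹ := by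
      have := h.ne_zero
      simp only [Algebra.smul_def, map_div₀, map_inv₀]
      field_simp
      ring
    rw [h1, P.mul_mem_fil_iff (inv_ne_zero het), P.ord_inv, hord, neg_zero, sub_zero]
    exact P.smul_mem_fil _ (sub_mem (P.smul_mem_fil _ (h.sub_mem i)) (P.smul_mem_fil _ (h.sub_mem 0)))
  have h1 := P.aeval_sub_eval_mem (c := ![e 1 / e 0, e 2 / e 0]) (φ := ![φ 1 / φ 0, φ 2 / φ 0]) (fun i => by
    fin_cases i
    exacts [hq 1, hq 2]) g
  rw [hg P t φ h hφ, map_zero, sub_zero, P.mem_fil hz] at h1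
  omega

/-- The quartic contains no line. -/
theorem exists_eval_rootForm_ne_zero (N : IsCanonicalBasis η κ e) {a : Fin 2 → ℂ} (ha : a ≠ 0)
    {f : MvPolynomial (Fin 3) ℂ} (hf : f.IsHomogeneous 4) (hf0 : f ≠ 0) (hfe : MvPolynomial.aeval e f = 0) :
    ∃ s, MvPolynomial.eval (rootForm a s) f ≠ 0 := by
  by_contra hs
  push Not at hs
  obtain ⟨A, B, hAB, hA, hB⟩ := exists_adapted_matrix ha
  set y : Fin 3 → MvPolynomial (Fin 3) ℂ := fun i => ∑ k, A i k • MvPolynomial.X k with hy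
  have hH : (MvPolynomial.aeval y f).IsHomogeneous 4 := by
    have := hf.aeval y (n := 1) (fun i => MvPolynomial.IsHomogeneous.sum _ _ _ fun k _ => by
      rw [MvPolynomial.smul_eq_C_mul]
      exact MvPolynomial.isHomogeneous_C_mul_X _ _)
    rwa [one_mul] at this
  obtain ⟨G, hG⟩ : MvPolynomial.X 2 ∣ MvPolynomial.aeval y f := by
    refine X_dvd_of_aeval_eq_zero (eq_zero_of_eval_eq_zero 0 fun x hx => ?_)
    rw [← MvPolynomial.aeval_eq_eval, MvPolynomial.comp_aeval_apply, MvPolynomial.comp_aeval_apply, ← hs ![x 0, x 1],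
      ← MvPolynomial.aeval_eq_eval]
    congr 2
    ext i
    simp [hy, Fin.sum_univ_three, hA, mul_comm]
  have hG3 : G.IsHomogeneous 3 := fun m hm => by
    rw [← MvPolynomial.coeff_X_mul m 2, ← hG] at hm
    have := hH hm
    rw [map_add, Finsupp.weight_single] at this
    simp only [Pi.one_apply, smul_eq_mul, mul_one] at this
    omega
  have hq : ∑ j, B 2 j • e j ≠ 0 := by
    have := N.coneSection_ne_zero ha
    simpa [hB, Fin.sum_univ_three, coneSection] using this
  have hG0 : G = 0 := by
    refine eq_zero_of_isHomogeneous N.genus_eq N.not_isHyperelliptic N.hasDiv (e := fun k => ∑ j, B k j • e j) ?_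
      (fun k => sum_mem fun j _ => Submodule.smul_mem _ _ (N.mem j)) le_rfl hG3 ?_
    · rw [Fintype.linearIndependent_iff]
      intro x hx
      have h1 : Matrix.vecMul x B = 0 := funext (Fintype.linearIndependent_iff.1 N.linearIndependent _ (by
        simp only [Finset.smul_sum, smul_smul] at hx
        rw [Finset.sum_comm] at hx
        simpa only [Matrix.vecMul, dotProduct, Finset.sum_smul] using hx))
      have h2 : Matrix.vecMul x (B * A) = 0 := by rw [← Matrix.vecMul_vecMul, h1, Matrix.zero_vecMul]
      rw [mul_eq_one_comm.1 hAB, Matrix.vecMul_one] at h2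
      exact congrFun h2
    · have h1 := MvPolynomial.comp_aeval_apply (MvPolynomial.aeval (R := ℂ) fun k => ∑ j, B k j • e j) (f := y) f
      simp only [hy, map_sum, map_smul, MvPolynomial.aeval_X, sum_smul_sum_smul hAB e] at h1
      rw [← hy, hG, map_mul, MvPolynomial.aeval_X] at h1
      exact (mul_eq_zero.1 (h1.trans hfe)).resolve_left hq
  refine hf0 (MvPolynomial.funext fun φ => ?_)
  have h1 := MvPolynomial.comp_aeval_apply (MvPolynomial.aeval (R := ℂ) fun k => ∑ j, B k j • φ j) (f := y) f
  simp only [hy, map_sum, map_smul, MvPolynomial.aeval_X, sum_smul_sum_smul hAB φ] at h1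
  rw [← hy, hG, hG0, mul_zero, map_zero] at h1
  exact h1.symm

end IsCanonicalBasis

end Quartic

/-! ### The equation of the scroll -/

/-- The minors of the matrix which defines the rational normal cubic. -/
def minors {R : Type*} [CommRing R] (x : Fin 4 → R) : Fin 3 → R :=
  ![x 1 * x 3 - x 2 * x 2, x 1 * x 2 - x 0 * x 3, x 0 * x 2 - x 1 * x 1]

theorem exists_minors_eq {x : Fin 4 → ℂ} {φ : Fin 3 → ℂ} (hφ : φ ≠ 0)
    (h₁ : φ 0 * x 0 + φ 1 * x 1 + φ 2 * x 2 = 0) (h₂ : φ 0 * x 1 + φ 1 * x 2 + φ 2 * x 3 = 0) :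
    ∃ r : ℂ, minors x = fun i => r * φ i := by
  obtain ⟨i, hi⟩ := Function.ne_iff.1 hφ
  rw [Pi.zero_apply] at hi
  have h : ∀ j, minors x j * φ i = minors x i * φ j := by
    have h01 : (x 1 * x 3 - x 2 * x 2) * φ 1 = (x 1 * x 2 - x 0 * x 3) * φ 0 := by linear_combination x 3 * h₁ - x 2 * h₂
    have h02 : (x 1 * x 3 - x 2 * x 2) * φ 2 = (x 0 * x 2 - x 1 * x 1) * φ 0 := by linear_combination x 1 * h₂ - x 2 * h₁
    have h12 : (x 1 * x 2 - x 0 * x 3) * φ 2 = (x 0 * x 2 - x 1 * x 1) * φ 1 := by linear_combination x 1 * h₁ - x 0 * h₂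
    intro j
    fin_cases i <;> fin_cases j
    exacts [rfl, h01.symm, h02.symm, h01, rfl, h12.symm, h02, h12, rfl]
  exact ⟨minors x i / φ i, funext fun j => by rw [div_mul_eq_mul_div, eq_div_iff hi, h]⟩

/-- The form of degree eight in `ℙ³` defined by a plane quartic. -/
def scrollForm (f : MvPolynomial (Fin 3) ℂ) : MvPolynomial (Fin 4) ℂ := MvPolynomial.aeval (minors MvPolynomial.X) f

theorem map_minors {R S : Type*} [CommRing R] [Algebra ℂ R] [CommRing S] [Algebra ℂ S] (g : R →ₐ[ℂ] S) (x : Fin 4 → R)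
    (i : Fin 3) : g (minors x i) = minors (fun j => g (x j)) i := by
  fin_cases i <;> simp [minors]

theorem aeval_scrollForm {R : Type*} [CommRing R] [Algebra ℂ R] (x : Fin 4 → R) (f : MvPolynomial (Fin 3) ℂ) :
    MvPolynomial.aeval x (scrollForm f) = MvPolynomial.aeval (minors x) f := by
  rw [scrollForm, MvPolynomial.comp_aeval_apply]
  simp only [map_minors, MvPolynomial.aeval_X]

theorem prime_minor : Prime (minors (MvPolynomial.X : Fin 4 → MvPolynomial (Fin 4) ℂ) 0) := by
  rw [← irreducible_iff_prime]
  have h := MvPolynomial.irreducible_mul_X_add (R := ℂ) (MvPolynomial.X 1) (-(MvPolynomial.X 2 ^ 2)) (3 : Fin 4)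
    (MvPolynomial.X_ne_zero 1) (by simp [MvPolynomial.vars_X]) (by
      rw [MvPolynomial.vars_neg]
      intro h
      simpa [MvPolynomial.vars_X] using MvPolynomial.vars_pow _ 2 h) (by
      have hp : Prime (MvPolynomial.X 1 : MvPolynomial (Fin 4) ℂ) := MvPolynomial.X_prime
      rw [IsRelPrime.neg_right_iff]
      refine IsRelPrime.pow_right ?_
      rw [hp.irreducible.isRelPrime_iff_not_dvd, MvPolynomial.X_dvd_X]
      simp)
  rw [pow_two, ← sub_eq_add_neg] at h
  exact h

theorem coeff_aeval_X_mul {σ : Type*} (p : MvPolynomial σ ℂ) (i : ℕ) :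
    (MvPolynomial.aeval (fun j => (Polynomial.X : (MvPolynomial σ ℂ)[X]) * Polynomial.C (MvPolynomial.X j)) p).coeff i =
      MvPolynomial.homogeneousComponent i p := by
  have hC : ∀ q : MvPolynomial σ ℂ, MvPolynomial.aeval (fun j => Polynomial.C (MvPolynomial.X (R := ℂ) (σ := σ) j)) q =
      Polynomial.C q := fun q => by
    have := MvPolynomial.comp_aeval_apply (Polynomial.CAlgHom (R := ℂ) (A := MvPolynomial σ ℂ)) (f := MvPolynomial.X) q
    rw [MvPolynomial.aeval_X_left_apply] at this
    exact this.symm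
  conv_lhs => rw [← MvPolynomial.sum_homogeneousComponent p]
  simp only [map_sum, Polynomial.finsetSum_coeff,
    aeval_mul_of_isHomogeneous (MvPolynomial.homogeneousComponent_isHomogeneous _ p), hC]
  simp only [Polynomial.coeff_X_pow_mul', Polynomial.coeff_C]
  rw [Finset.sum_eq_single i]
  · simp
  · intro k _ hk
    split_ifs
    · omega
    · rfl
    · rfl
  · intro hi
    rw [if_pos le_rfl, if_pos (by omega)]
    exact MvPolynomial.homogeneousComponent_eq_zero _ _ (by simpa using hi)

/-- The expansion of the form at a point where the minors vanish. -/
theorem homogeneousComponent_scrollForm {f : MvPolynomial (Fin 3) ℂ} {n : ℕ} (hf : f.IsHomogeneous n) {v : Fin 4 → ℂ}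
    (hv : minors v = 0) :
    (∀ i < n, MvPolynomial.homogeneousComponent i (MvPolynomial.bind₁
      (fun j => MvPolynomial.X j + MvPolynomial.C (v j)) (scrollForm f)) = 0) ∧
    ∀ x : Fin 4 → ℂ, MvPolynomial.eval x (MvPolynomial.homogeneousComponent n (MvPolynomial.bind₁
      (fun j => MvPolynomial.X j + MvPolynomial.C (v j)) (scrollForm f))) =
        MvPolynomial.eval ![v 1 * x 3 + v 3 * x 1 - 2 * v 2 * x 2, v 1 * x 2 + v 2 * x 1 - v 0 * x 3 - v 3 * x 0,
          v 0 * x 2 + v 2 * x 0 - 2 * v 1 * x 1] f := by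
  set L : Fin 3 → (MvPolynomial (Fin 4) ℂ) := ![MvPolynomial.C (v 1) * MvPolynomial.X 3 +
    MvPolynomial.C (v 3) * MvPolynomial.X 1 - 2 * MvPolynomial.C (v 2) * MvPolynomial.X 2,
    MvPolynomial.C (v 1) * MvPolynomial.X 2 + MvPolynomial.C (v 2) * MvPolynomial.X 1 -
      MvPolynomial.C (v 0) * MvPolynomial.X 3 - MvPolynomial.C (v 3) * MvPolynomial.X 0,
    MvPolynomial.C (v 0) * MvPolynomial.X 2 + MvPolynomial.C (v 2) * MvPolynomial.X 0 -
      2 * MvPolynomial.C (v 1) * MvPolynomial.X 1] with hL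
  have key : MvPolynomial.aeval (fun j => (Polynomial.X : (MvPolynomial (Fin 4) ℂ)[X]) * Polynomial.C (MvPolynomial.X j))
      (MvPolynomial.bind₁ (fun j => MvPolynomial.X j + MvPolynomial.C (v j)) (scrollForm f)) =
      Polynomial.X ^ n * MvPolynomial.aeval (fun k => Polynomial.C (L k) +
        Polynomial.X * Polynomial.C (minors MvPolynomial.X k)) f := by
    rw [← aeval_mul_of_isHomogeneous hf, MvPolynomial.bind₁, MvPolynomial.comp_aeval_apply, aeval_scrollForm]
    congr 2
    ext1 k
    simp only [map_add, MvPolynomial.aeval_X, ← MvPolynomial.algebraMap_eq, AlgHom.commutes]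
    have h0 : v 1 * v 3 - v 2 * v 2 = 0 := congrFun hv 0
    have h1 : v 1 * v 2 - v 0 * v 3 = 0 := congrFun hv 1
    have h2 : v 0 * v 2 - v 1 * v 1 = 0 := congrFun hv 2
    have hc : ∀ r : ℂ, algebraMap ℂ (MvPolynomial (Fin 4) ℂ)[X] r = Polynomial.C (MvPolynomial.C r) := fun r => rfl
    replace h0 := congrArg (algebraMap ℂ (MvPolynomial (Fin 4) ℂ)[X]) h0
    replace h1 := congrArg (algebraMap ℂ (MvPolynomial (Fin 4) ℂ)[X]) h1
    replace h2 := congrArg (algebraMap ℂ (MvPolynomial (Fin 4) ℂ)[X]) h2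
    simp only [map_sub, map_mul, map_zero, hc] at h0 h1 h2
    have h2C : Polynomial.C (2 : MvPolynomial (Fin 4) ℂ) = 2 := map_ofNat Polynomial.C 2
    fin_cases k
    · simp [minors, L, hc, h2C]
      linear_combination h0
    · simp [minors, L, hc]
      linear_combination h1
    · simp [minors, L, hc, h2C]
      linear_combination h2
  refine ⟨fun i hi => ?_, fun x => ?_⟩
  · rw [← coeff_aeval_X_mul, key, Polynomial.coeff_X_pow_mul', if_neg (by omega)]
  · rw [← coeff_aeval_X_mul, key, Polynomial.coeff_X_pow_mul', if_pos le_rfl, Nat.sub_self, Polynomial.coeff_zero_eq_eval_zero]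
    have h1 := MvPolynomial.comp_aeval_apply ((MvPolynomial.aeval x).comp ((Polynomial.aeval (R := MvPolynomial (Fin 4) ℂ)
      (0 : MvPolynomial (Fin 4) ℂ)).restrictScalars ℂ)) (f := fun k => Polynomial.C (L k) +
        Polynomial.X * Polynomial.C (minors MvPolynomial.X k)) f
    refine Eq.trans ?_ (h1.trans ?_)
    · rw [AlgHom.comp_apply, AlgHom.restrictScalars_apply, Polynomial.coe_aeval_eq_eval, MvPolynomial.aeval_eq_eval]
    · rw [← MvPolynomial.aeval_eq_eval]
      congr 2
      ext k
      fin_cases k <;> simp [L]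

section Multiplicity

variable {K : Type*} [Field K] [Algebra ℂ K] [hK : Fact (IsCurveFunctionField K)]
variable {V : Type*} [AddCommGroup V] [Module K V] [Module ℂ V] [IsScalarTower ℂ K V]
variable {η : Ω[K⁄ℂ]} {κ : Point K →₀ ℤ} {e : Fin 3 → K} {E : Family K V} {δ : E.det.Iso (omega2 K)}
variable {b : Module.Basis (Fin 4) ℂ E.H0} {c : ℂ}

namespace IsCanonicalBasis

theorem not_minor_dvd_scrollForm (N : IsCanonicalBasis η κ e) {f : MvPolynomial (Fin 3) ℂ} (hf : f.IsHomogeneous 4)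
    (hf0 : f ≠ 0) (hfe : MvPolynomial.aeval e f = 0) :
    ¬ minors (MvPolynomial.X : Fin 4 → MvPolynomial (Fin 4) ℂ) 0 ∣ scrollForm f := by
  rintro ⟨G, hG⟩
  obtain ⟨s, hs⟩ := N.exists_eval_rootForm_ne_zero (a := ![1, 0]) (fun h => one_ne_zero (congrFun h 0)) hf hf0 hfe
  obtain ⟨x, hx⟩ : ∃ x : Fin 4 → ℂ, minors x = rootForm ![1, 0] s := by
    by_cases h1 : s 1 = 0
    · obtain ⟨p, hp⟩ := IsAlgClosed.exists_pow_nat_eq (-s 0) (n := 4) (by norm_num)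
      refine ⟨![0, p ^ 2, 0, 0], ?_⟩
      ext i
      fin_cases i <;> simp [minors, rootForm, h1]
      linear_combination -hp
    · refine ⟨![(s 0 ^ 3 + 1) / s 1, s 0 ^ 2, s 0 * s 1, s 1 ^ 2], ?_⟩
      ext i
      fin_cases i <;> simp [minors, rootForm] <;> field_simp <;> ring
  have h1 := aeval_scrollForm x f
  have h2 := map_minors (MvPolynomial.aeval (R := ℂ) x) MvPolynomial.X 0
  simp only [MvPolynomial.aeval_X, hx] at h2
  rw [hG, map_mul, h2, hx] at h1
  refine hs (h1.symm.trans ?_)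
  simp [rootForm]

theorem scrollForm_dvd (N : IsCanonicalBasis η κ e) {f : MvPolynomial (Fin 3) ℂ} (hf : f.IsHomogeneous 4)
    (hf0 : f ≠ 0) (hfe : MvPolynomial.aeval e f = 0) {H : MvPolynomial (Fin 4) ℂ}
    (hH : ∀ (x : Fin 4 → ℂ) (P : Point K) (t : K) (φ : Fin 3 → ℂ), x ≠ 0 → IsValueAt κ e P t φ →
      φ 0 * x 0 + φ 1 * x 1 + φ 2 * x 2 = 0 → φ 0 * x 1 + φ 1 * x 2 + φ 2 * x 3 = 0 → MvPolynomial.eval x H = 0) :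
    scrollForm f ∣ H := by
  let Y : MvPolynomial (Fin 2) (MvPolynomial (Fin 2) ℂ) := MvPolynomial.C (MvPolynomial.X 0)
  let Z : MvPolynomial (Fin 2) (MvPolynomial (Fin 2) ℂ) := MvPolynomial.C (MvPolynomial.X 1)
  let S : MvPolynomial (Fin 2) (MvPolynomial (Fin 2) ℂ) := MvPolynomial.X 0
  let T : MvPolynomial (Fin 2) (MvPolynomial (Fin 2) ℂ) := MvPolynomial.X 1
  let y : Fin 4 → MvPolynomial (Fin 2) (MvPolynomial (Fin 2) ℂ) := ![(Y ^ 2 - Z) * S + Y * Z * T, -Y * S - Z * T, S, T]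
  have hdvd : MvPolynomial.C (MvPolynomial.aeval ![(1 : MvPolynomial (Fin 2) ℂ), MvPolynomial.X 0, MvPolynomial.X 1] f) ∣
      MvPolynomial.aeval y H := by
    rw [MvPolynomial.C_dvd_iff_dvd_coeff]
    intro m
    refine dvd_of_aeval_eq_zero N.genus_eq N.not_isHyperelliptic N.hasDiv N.linearIndependent N.mem hf hf0 hfe
      (N.aeval_div_eq_zero fun P t φ h hφ => ?_)
    set g : MvPolynomial (Fin 2) ℂ →ₐ[ℂ] ℂ := MvPolynomial.aeval ![φ 1 / φ 0, φ 2 / φ 0] with hg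
    have h0 : MvPolynomial.map (g : MvPolynomial (Fin 2) ℂ →+* ℂ) (MvPolynomial.aeval y H) = 0 := by
      refine eq_zero_of_eval_eq_zero 0 fun x hx => ?_
      rw [MvPolynomial.eval_map]
      refine (MvPolynomial.comp_aeval_apply (f := y) (MvPolynomial.aevalTower g x) H).trans ?_
      refine hH _ P t φ (fun h0 => hx ?_) h ?_ ?_
      · have := congrFun h0 2
        simpa [y, S] using this
      · simp [y, Y, Z, S, T, hg]
        field_simp
        ring
      · simp [y, Y, Z, S, T, hg]
        field_simp
        ring
    have h1 := congrArg (MvPolynomial.coeff m) h0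
    rwa [MvPolynomial.coeff_map, MvPolynomial.coeff_zero] at h1
  obtain ⟨Q, hQ⟩ := hdvd
  set k := minors (MvPolynomial.X : Fin 4 → MvPolynomial (Fin 4) ℂ) 0 with hk
  let A := Localization.Away k
  have hinj : Function.Injective (algebraMap (MvPolynomial (Fin 4) ℂ) A) :=
    IsLocalization.injective A (powers_le_nonZeroDivisors_of_noZeroDivisors prime_minor.ne_zero)
  let u : A := IsLocalization.Away.invSelf k
  let ι : MvPolynomial (Fin 4) ℂ →ₐ[ℂ] A := IsScalarTower.toAlgHom ℂ _ A
  have hu : ι k * u = 1 := IsLocalization.Away.mul_invSelf k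
  let M : Fin 3 → A := fun i => ι (minors MvPolynomial.X i)
  let x : Fin 4 → A := fun j => ι (MvPolynomial.X j)
  have hM : ∀ i, M i = minors x i := fun i => map_minors ι _ i
  let Φ : MvPolynomial (Fin 2) (MvPolynomial (Fin 2) ℂ) →ₐ[ℂ] A := MvPolynomial.aevalTower (MvPolynomial.aeval ![u * M 1, u * M 2]) ![x 2, x 3]
  have hk0 : u * M 0 = 1 := (mul_comm _ _).trans hu
  have h1 : Φ (MvPolynomial.aeval y H) = ι H := by
    rw [MvPolynomial.comp_aeval_apply, ← MvPolynomial.aeval_X_left_apply H, MvPolynomial.comp_aeval_apply,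
      MvPolynomial.aeval_X_left_apply]
    congr 2
    have e0 : u * (x 1 * x 3 - x 2 * x 2) = 1 := by rw [← hk0, hM]; rfl
    have e1 : M 1 = x 1 * x 2 - x 0 * x 3 := hM 1
    have e2 : M 2 = x 0 * x 2 - x 1 * x 1 := hM 2
    have hx1 : -(u * M 1) * x 2 - u * M 2 * x 3 = x 1 := by rw [e1, e2]; linear_combination x 1 * e0
    ext j
    fin_cases j
    · have : ((u * M 1) ^ 2 - u * M 2) * x 2 + u * M 1 * (u * M 2) * x 3 = x 0 := by
        have : ((u * M 1) ^ 2 - u * M 2) * x 2 + u * M 1 * (u * M 2) * x 3 = -(u * M 1) * x 1 - u * M 2 * x 2 := by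
          linear_combination -(u * M 1) * hx1
        rw [this, e1, e2]
        linear_combination x 0 * e0
      simpa [Φ, y, Y, Z, S, T] using this
    · simpa [Φ, y, Y, Z, S, T, -neg_mul] using hx1
    · simp [Φ, y, S, x]
    · simp [Φ, y, T, x]
  have h2 : Φ (MvPolynomial.C (MvPolynomial.aeval ![(1 : MvPolynomial (Fin 2) ℂ), MvPolynomial.X 0, MvPolynomial.X 1] f)) =
      u ^ 4 * ι (scrollForm f) := by
    rw [scrollForm, MvPolynomial.comp_aeval_apply, ← aeval_mul_of_isHomogeneous hf, MvPolynomial.aevalTower_C,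
      MvPolynomial.comp_aeval_apply]
    congr 2
    ext j
    fin_cases j
    · simpa using hk0.symm
    · simp [M]
    · simp [M]
  obtain ⟨n, p, hp⟩ := IsLocalization.Away.surj k (Φ Q)
  have h3 : k ^ (n + 4) * H = scrollForm f * p := by
    refine hinj ?_
    change ι _ = ι _
    change Φ Q * ι k ^ n = ι p at hp
    rw [map_mul, map_mul, ← hp, map_pow, ← h1, hQ, map_mul, h2]
    have : ι k ^ 4 * u ^ 4 = 1 := by rw [← mul_pow, hu, one_pow]
    linear_combination ι k ^ n * ι (scrollForm f) * Φ Q * this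
  obtain ⟨q, rfl⟩ := prime_minor.pow_dvd_of_dvd_mul_left (n + 4) (N.not_minor_dvd_scrollForm hf hf0 hfe) ⟨H, h3.symm⟩
  refine ⟨q, mul_left_cancel₀ (pow_ne_zero (n + 4) prime_minor.ne_zero) (h3.trans ?_)⟩
  rw [mul_left_comm]

end IsCanonicalBasis

namespace IsNormalForm

theorem mk_mem_scroll_iff (N : IsNormalForm δ η κ e b c) (x : Fin 4 → ℂ) (hx : b.dualBasis.equivFun.symm x ≠ 0) :
    Projectivization.mk ℂ (b.dualBasis.equivFun.symm x) hx ∈ E.scroll ↔ ∃ P t φ, IsCanonicalBasis.IsValueAt κ e P t φ ∧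
      φ 0 * x 0 + φ 1 * x 1 + φ 2 * x 2 = 0 ∧ φ 0 * x 1 + φ 1 * x 2 + φ 2 * x 3 = 0 := by
  have hb : ∀ j, b.dualBasis.equivFun.symm x (b j) = x j := fun j => by
    rw [Module.Basis.equivFun_symm_apply, LinearMap.sum_apply, Finset.sum_eq_single j]
    · rw [LinearMap.smul_apply, Module.Basis.dualBasis_apply_self, if_pos rfl, smul_eq_mul, mul_one]
    · intro i _ hi
      rw [LinearMap.smul_apply, Module.Basis.dualBasis_apply_self, if_neg (Ne.symm hi), smul_zero]
    · simp
  constructor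
  · rintro ⟨P, hP⟩
    obtain ⟨t, φ, h⟩ := N.exists_isValueAt P
    rw [N.fibreDual_eq_line h, Projectivization.submodule_mk, Submodule.span_singleton_le_iff_mem,
      N.mem_line_iff h.value_ne_zero] at hP
    simp only [hb] at hP
    exact ⟨P, t, φ, h, hP⟩
  · rintro ⟨P, t, φ, h, hP⟩
    refine ⟨P, ?_⟩
    rw [N.fibreDual_eq_line h, Projectivization.submodule_mk, Submodule.span_singleton_le_iff_mem,
      N.mem_line_iff h.value_ne_zero]
    simpa only [hb] using hP

theorem hasMultiplicity_scroll (N : IsNormalForm δ η κ e b c) {o : ℙ ℂ (Module.Dual ℂ E.H0)}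
    (ho : o ∈ ratNormalCubic b.dualBasis) : HasMultiplicity b.dualBasis E.scroll o 4 := by
  obtain ⟨a, ha, ho⟩ := ho
  obtain ⟨f, hf, hf0, hfe⟩ := exists_quartic N.genus_eq N.hasDiv N.mem
  obtain ⟨r, hr, hrep⟩ := IsCanonicalBasis.exists_rep_eq ho
  have hv : ∀ j, b.dualBasis.equivFun o.rep j = r * r * ![a 0 ^ 3, a 0 ^ 2 * a 1, a 0 * a 1 ^ 2, a 1 ^ 3] j := fun j => by
    rw [hrep, cubicPoint]
    fin_cases j <;> simp
  have hm : minors (b.dualBasis.equivFun o.rep) = 0 := by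
    ext i
    fin_cases i <;> simp [minors, hv, -mul_eq_zero] <;> ring
  obtain ⟨hlow, htop⟩ := homogeneousComponent_scrollForm hf hm
  refine ⟨scrollForm f, le_antisymm (fun H hH => ?_) ?_, hlow, fun h0 => ?_⟩
  · rw [Ideal.mem_span_singleton]
    refine N.scrollForm_dvd hf hf0 hfe fun x P t φ hx h h₁ h₂ => ?_
    have hx' : b.dualBasis.equivFun.symm x ≠ 0 := (LinearEquiv.map_ne_zero_iff _).2 hx
    exact hH x ⟨hx', (N.mk_mem_scroll_iff x hx').2 ⟨P, t, φ, h, h₁, h₂⟩⟩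
  · rw [Ideal.span_singleton_le_iff_mem]
    rintro x ⟨hx', hx⟩
    obtain ⟨P, t, φ, h, h₁, h₂⟩ := (N.mk_mem_scroll_iff x hx').1 hx
    obtain ⟨s, hs⟩ := exists_minors_eq h.value_ne_zero h₁ h₂
    rw [aeval_scrollForm, hs, aeval_mul_of_isHomogeneous hf]
    have := h.eval_eq_zero hf hfe
    rw [← MvPolynomial.aeval_eq_eval] at this
    rw [this, mul_zero]
  · obtain ⟨s, hs⟩ := N.exists_eval_rootForm_ne_zero ha hf hf0 hfe
    obtain ⟨x, hx₀, hx₁⟩ : ∃ x : Fin 4 → ℂ, a 0 ^ 2 * x 2 + a 1 ^ 2 * x 0 - 2 * a 0 * a 1 * x 1 = s 0 ∧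
        a 0 ^ 2 * x 3 + a 1 ^ 2 * x 1 - 2 * a 0 * a 1 * x 2 = s 1 := by
      by_cases h0 : a 0 = 0
      · have h1 : a 1 ≠ 0 := fun h1 => ha (by ext i; fin_cases i; exacts [h0, h1])
        refine ⟨![s 0 / a 1 ^ 2, s 1 / a 1 ^ 2, 0, 0], ?_, ?_⟩ <;> simp [h0] <;> field_simp
      · refine ⟨![0, 0, s 0 / a 0 ^ 2, (s 1 + 2 * a 1 * s 0 / a 0) / a 0 ^ 2], ?_, ?_⟩ <;> simp <;> field_simp
        ring
    have h1 := htop x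
    rw [h0, map_zero] at h1
    have h2 := aeval_mul_of_isHomogeneous hf (r * r) (rootForm a s)
    refine mul_ne_zero (pow_ne_zero 4 (mul_ne_zero hr hr)) hs (h2.symm.trans (Eq.trans ?_ h1.symm))
    rw [← MvPolynomial.aeval_eq_eval]
    congr 2
    ext i
    fin_cases i <;> simp [rootForm, hv, ← hx₀, ← hx₁] <;> ring

end IsNormalForm

end Multiplicity

end OcticScroll

end

theorem case_b_rational_normal_cubic
    {K : Type*} [Field K] [Algebra ℂ K]
    (hK : IsCurveFunctionField K) (hgenus : genus K = 3) (hnonhyp : ¬ IsHyperelliptic K)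
    {V : Type*} [AddCommGroup V] [Module K V] [Module ℂ V] [IsScalarTower ℂ K V]
    (E : Family K V) (hE : E.IsVectorBundle 2) (δ : E.det.Iso (omega2 K))
    (hstable : E.IsStable) (hgg : E.IsGloballyGenerated)
    (hι : E.dualSpan.SEquiv ((omega K).directSum (omega K))) :
    -- the dual span is an extension of `ω_C` by `ω_C`
    Family.IsExtension (omega K) E.dualSpan (omega K) ∧
    -- `ℙH⁰(E)*` is three-dimensional, and the Plücker quadric has rank six and contains `V`
    Module.finrank ℂ E.H0 = 4 ∧
    (∀ b : Module.Basis (Fin 4) ℂ E.H0,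
      quadricRank (pluckerQuadric δ b) = 6 ∧
      ∀ z ∈ veronese K, pluckerQuadric δ b z.rep = 0) ∧
    -- `V` is a Veronese surface through the bicanonical curve, whose points parametrize the
    -- lines of the scroll
    IsVeroneseSurface (veronese K) ∧
    (∀ x : Point K, ∃ z ∈ veronese K,
      z.submodule = (omega2 K).fibreDual x ∧ lineOf δ z = E.fibreDual x) ∧
    ∃ w : Module.Basis (Fin 4) ℂ (Module.Dual ℂ E.H0),
      -- the points of `V` parametrize the bisecant lines of the rational normal cubic
      (∀ z ∈ veronese K, IsBisecant w (lineOf δ z)) ∧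
      (∀ ℓ, IsBisecant w ℓ → ∃! z, z ∈ veronese K ∧ lineOf δ z = ℓ) ∧
      -- the conic of `V` and the canonical divisor defined by a point `o` of the cubic
      (∀ o ∈ ratNormalCubic w,
        ∃ B : Set (ℙ ℂ (Module.Dual ℂ (omega2 K).H0)), IsConic B ∧ B ⊆ veronese K ∧
          (∀ ℓ, IsConeGenerator w o ℓ ↔ ∃ z ∈ B, lineOf δ z = ℓ) ∧
          ∃ D : Point K →₀ ℕ,
            (∀ x, (omega2 K).interMult B x = (D x : ℕ∞)) ∧
            IsCanonicalDivisor D ∧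
            (D.sum fun _ n => n) = 4 ∧
            (∀ x, x ∈ D.support ↔ o.submodule ≤ E.fibreDual x) ∧
            (∀ x, E.rulingMult o.rep x = (D x : ℕ∞))) ∧
      -- the scroll has multiplicity four along the cubic
      (∀ o ∈ ratNormalCubic w, HasMultiplicity w E.scroll o 4) := by
  have : Fact (IsCurveFunctionField K) := ⟨hK⟩
  have := nontrivial_omega_of_genus hgenus
  obtain ⟨η, κ, hκ⟩ := exists_hasDiv_omega' (K := K)
  obtain ⟨ℓ, s, q, hs, hq⟩ := exists_hasDiv_of_sEquiv hκ hι
  obtain ⟨e, b, c, N⟩ := exists_isNormalForm hgenus hnonhyp hκ hE δ hstable hgg hι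
  refine ⟨isExtension_of_hasDiv hκ hs hq, ?_, fun b' => ⟨N.quadricRank_pluckerQuadric b', fun z hz =>
    N.pluckerQuadric_eq_zero b' hz⟩, N.isVeroneseSurface, N.exists_mem_veronese, b.dualBasis,
    fun z hz => N.isBisecant_lineOf hz, fun ℓ h => N.existsUnique_of_isBisecant h, ?_,
    fun o ho => N.hasMultiplicity_scroll ho⟩
  · rw [Module.finrank_eq_card_basis b, Fintype.card_fin]
  · rintro o ⟨a, ha, ho⟩
    obtain ⟨r, hr, hrep⟩ := IsCanonicalBasis.exists_rep_eq ho
    refine ⟨N.coneConic a, N.isConic_coneConic ha, N.coneConic_subset ha, N.coneGenerator_iff ha ho,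
      (κ + divf (coneSection e a)).mapRange Int.toNat Int.toNat_zero, fun x => ?_,
      N.isCanonicalDivisor_coneDivisor ha, N.sum_coneDivisor ha, N.mem_support_coneDivisor_iff ha ho, fun x => ?_⟩
    · rw [Finsupp.mapRange_apply]
      exact N.interMult_coneConic ha x
    · rw [Finsupp.mapRange_apply]
      exact N.rulingMult_eq ha x (mul_ne_zero hr hr) hrep
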